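/- For every positive integer A there exists a real number u_A > 0 such that for all real u ≥ u_A the following holds: there exists a finite set 𝑃_u of prime numbers, all lying in the interval [u, 2u], with #(𝑃_u) ≤ u/(log u)^A, such that every odd integer m with 4u ≤ m ≤ 5u can be written as m = p₁ + p₂ + p₃ with p₁, p₂, p₃ ∈ 𝑃_u. -/

import Mathlib

section P1
open Complex

lemma vt_cpow_mvt {a b : ℝ} (ha : 0 < a) (hab : a ≤ b) {w : ℂ} (hw : w.re ≤ 1) :
    ‖(b : ℂ) ^ w - (a : ℂ) ^ w‖ ≤ ‖w‖ * a ^ (w.re - 1) * (b - a) := by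
  by_cases hw0 : w = 0
  · simp [hw0]
  have h := (convex_Icc a b).norm_image_sub_le_of_norm_hasDerivWithin_le
    (f := fun y : ℝ => (y : ℂ) ^ w) (f' := fun y : ℝ => w * (y : ℂ) ^ (w - 1))
    (C := ‖w‖ * a ^ (w.re - 1)) (x := a) (y := b) ?_ ?_
    (Set.left_mem_Icc.2 hab) (Set.right_mem_Icc.2 hab)
  · rwa [Real.norm_eq_abs, abs_of_nonneg (sub_nonneg.2 hab)] at h
  · intro x hx
    exact (hasDerivAt_ofReal_cpow_const (by linarith [hx.1]) hw0).hasDerivWithinAt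
  · intro x hx
    have hx0 : 0 < x := lt_of_lt_of_le ha hx.1
    rw [norm_mul, Complex.norm_cpow_eq_rpow_re_of_pos hx0]
    simp only [sub_re, one_re]
    gcongr ‖w‖ * ?_
    exact Real.rpow_le_rpow_of_nonpos ha hx.1 (by linarith)

lemma vt_second_diff {a : ℝ} (ha : 0 < a) {s : ℂ} (hs : 0 < s.re) :
    ‖(s - 1) * (a : ℂ) ^ (-s) + (((a + 1 : ℝ) : ℂ) ^ (1 - s) - (a : ℂ) ^ (1 - s))‖
      ≤ ‖s - 1‖ * ‖s‖ * a ^ (-s.re - 1) := by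
  by_cases hs1 : s = 1
  · simp [hs1]
  have h1s : (1 - s) ≠ 0 := sub_ne_zero.2 (Ne.symm hs1)
  have h := (convex_Icc a (a + 1)).norm_image_sub_le_of_norm_hasDerivWithin_le
    (f := fun y : ℝ => (y : ℂ) ^ (1 - s) + (y : ℂ) * ((s - 1) * (a : ℂ) ^ (-s)))
    (f' := fun y : ℝ => (1 - s) * (y : ℂ) ^ (1 - s - 1) + 1 * ((s - 1) * (a : ℂ) ^ (-s)))
    (C := ‖s - 1‖ * ‖s‖ * a ^ (-s.re - 1)) (x := a) (y := a + 1) ?_ ?_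
    (Set.left_mem_Icc.2 (by linarith)) (Set.right_mem_Icc.2 (by linarith))
  · have e : ‖a + 1 - a‖ = 1 := by simp
    rw [e, mul_one] at h
    refine le_trans (le_of_eq ?_) h
    congr 1
    push_cast
    ring
  · intro x hx
    have h1 := (hasDerivAt_ofReal_cpow_const (x := x) (by linarith [hx.1]) h1s)
    have h2 : HasDerivAt (fun y : ℝ => (y : ℂ)) 1 x := Complex.ofRealCLM.hasDerivAt
    exact (h1.add (h2.mul_const _)).hasDerivWithinAt
  · intro x hx
    have e : (1 - s) * (x : ℂ) ^ (1 - s - 1) + 1 * ((s - 1) * (a : ℂ) ^ (-s))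
        = (1 - s) * ((x : ℂ) ^ (-s) - (a : ℂ) ^ (-s)) := by
      have : (1 - s - 1) = -s := by ring
      rw [this]; ring
    rw [e, norm_mul, mul_assoc, norm_sub_rev 1 s]
    gcongr
    have := vt_cpow_mvt ha hx.1 (w := -s) (by simp; linarith)
    rw [norm_neg] at this
    refine this.trans ?_
    have h1 : x - a ≤ 1 := by linarith [hx.2]
    have : 0 ≤ ‖s‖ * a ^ ((-s).re - 1) := by positivity
    simpa using mul_le_mul_of_nonneg_left h1 this

lemma vt_tail_term {σ : ℝ} (hσ : 0 < σ) {x : ℝ} (hx : 0 < x) :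
    (x + 1) ^ (-σ - 1) ≤ (x ^ (-σ) - (x + 1) ^ (-σ)) / σ := by
  obtain ⟨c, hc, h⟩ := exists_hasDerivAt_eq_slope (fun y : ℝ => y ^ (-σ)) (fun y => -σ * y ^ (-σ - 1))
    (show x < x + 1 by linarith)
    (fun y hy => (Real.continuousAt_rpow_const _ _ (Or.inl (by linarith [hy.1]))).continuousWithinAt)
    (fun y hy => Real.hasDerivAt_rpow_const (Or.inl (by linarith [hy.1])))
  simp only [add_sub_cancel_left, div_one] at h
  rw [le_div_iff₀ hσ]
  have : (x + 1) ^ (-σ - 1) ≤ c ^ (-σ - 1) :=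
    Real.rpow_le_rpow_of_nonpos (by linarith [hc.1]) hc.2.le (by linarith)
  nlinarith

lemma vt_head_term {ε : ℝ} (hε : 0 < ε) (hε1 : ε ≤ 1) {x : ℝ} (hx : 0 ≤ x) :
    (x + 1) ^ (ε - 1) ≤ ((x + 1) ^ ε - x ^ ε) / ε := by
  obtain ⟨c, hc, h⟩ := exists_hasDerivAt_eq_slope (fun y : ℝ => y ^ ε) (fun y => ε * y ^ (ε - 1))
    (show x < x + 1 by linarith)
    (fun y hy => (Real.continuousAt_rpow_const _ _ (Or.inr hε.le)).continuousWithinAt)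
    (fun y hy => Real.hasDerivAt_rpow_const (Or.inl (by linarith [hy.1])))
  simp only [add_sub_cancel_left, div_one] at h
  rw [le_div_iff₀ hε]
  have : (x + 1) ^ (ε - 1) ≤ c ^ (ε - 1) :=
    Real.rpow_le_rpow_of_nonpos (by linarith [hc.1]) hc.2.le (by linarith)
  nlinarith

lemma vt_head_sum {ε : ℝ} (hε : 0 < ε) (hε1 : ε ≤ 1) (M : ℕ) :
    ∑ k ∈ Finset.range M, ((k : ℝ) + 1) ^ (ε - 1) ≤ (M : ℝ) ^ ε / ε := by
  calc _ ≤ ∑ k ∈ Finset.range M, (((k + 1 : ℕ) : ℝ) ^ ε / ε - (k : ℝ) ^ ε / ε) := by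
        refine Finset.sum_le_sum fun k _ => ?_
        have := vt_head_term hε hε1 (x := k) (by positivity)
        push_cast
        rw [← sub_div]; exact this
    _ = _ := by
        rw [Finset.sum_range_sub (fun k : ℕ => (k : ℝ) ^ ε / ε)]
        simp [Real.zero_rpow hε.ne']

lemma vt_tail_summable {σ : ℝ} (hσ : 0 < σ) :
    Summable (fun k : ℕ => ((k : ℝ) + 1) ^ (-σ - 1)) := by
  have := (Real.summable_nat_rpow (p := -σ - 1)).2 (by linarith)
  exact_mod_cast (summable_nat_add_iff 1).2 this

lemma vt_tail_sum {σ : ℝ} (hσ : 0 < σ) (M : ℕ) (hM : 0 < M) :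
    ∑' k : ℕ, (((k + M : ℕ) : ℝ) + 1) ^ (-σ - 1) ≤ (M : ℝ) ^ (-σ) / σ := by
  have hs := (summable_nat_add_iff M).2 (vt_tail_summable hσ)
  refine hs.tsum_le_of_sum_range_le fun n => ?_
  calc _ ≤ ∑ k ∈ Finset.range n, (((k + M : ℕ) : ℝ) ^ (-σ) / σ - ((k + 1 + M : ℕ) : ℝ) ^ (-σ) / σ) := by
        refine Finset.sum_le_sum fun k _ => ?_
        have := vt_tail_term hσ (x := (k + M : ℕ)) (by positivity)
        rw [← sub_div]
        have e : ((k + 1 + M : ℕ) : ℝ) = ((k + M : ℕ) : ℝ) + 1 := by push_cast; ring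
        rw [e]; exact this
    _ = (M : ℝ) ^ (-σ) / σ - ((n + M : ℕ) : ℝ) ^ (-σ) / σ := by
        rw [Finset.sum_range_sub' (fun k : ℕ => ((k + M : ℕ) : ℝ) ^ (-σ) / σ)]
        simp
    _ ≤ _ := by
        have : 0 ≤ ((n + M : ℕ) : ℝ) ^ (-σ) / σ := by positivity
        linarith

lemma vt_cont_tsum {F : ℂ → ℂ} {h : ℕ → ℂ → ℂ} {A : ℝ} (hA : 0 ≤ A) (hF : Differentiable ℂ F)
    (hh : ∀ k, Differentiable ℂ (h k))
    (hb : ∀ k s, 0 < s.re → ‖h k s‖ ≤ A * (1 + ‖s‖) ^ 2 * ((k : ℝ) + 1) ^ (-s.re - 1))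
    (hsum : ∀ s, 1 < s.re → HasSum (fun k => h k s) (F s)) {s : ℂ} (hs : 0 < s.re) :
    HasSum (fun k => h k s) (F s) := by
  have hsumm : ∀ s, 0 < s.re → Summable (fun k => h k s) := fun s hs =>
    Summable.of_norm_bounded ((vt_tail_summable hs).mul_left _) (fun k => hb k s hs)
  have hU : IsOpen {s : ℂ | 0 < s.re} := isOpen_lt continuous_const Complex.continuous_re
  have hd : DifferentiableOn ℂ (fun w => ∑' k, h k w) {s : ℂ | 0 < s.re} := by
    intro z hz
    have hz' : 0 < z.re := hz
    set V : Set ℂ := {w | z.re / 2 < w.re} ∩ Metric.ball 0 (‖z‖ + 1) with hV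
    have hVo : IsOpen V := (isOpen_lt continuous_const Complex.continuous_re).inter Metric.isOpen_ball
    have hzV : z ∈ V := ⟨by simp only [Set.mem_ofPred_eq]; linarith, by simp⟩
    have := differentiableOn_tsum_of_summable_norm (F := h) (U := V)
      (u := fun k => A * (2 + ‖z‖) ^ 2 * ((k : ℝ) + 1) ^ (-(z.re / 2) - 1))
      ((vt_tail_summable (by linarith)).mul_left _) (fun k => (hh k).differentiableOn) hVo ?_
    · exact (this.differentiableAt (hVo.mem_nhds hzV)).differentiableWithinAt
    · intro k w hw
      have hw1 : z.re / 2 < w.re := hw.1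
      have hw2 : ‖w‖ < ‖z‖ + 1 := by simpa using hw.2
      refine (hb k w (by linarith)).trans ?_
      have h1 : (1 : ℝ) ≤ (k : ℝ) + 1 := by linarith [(Nat.cast_nonneg k : (0:ℝ) ≤ k)]
      gcongr ?_ * ?_ ^ 2 * ?_
      · linarith
      · exact Real.rpow_le_rpow_of_exponent_le h1 (by linarith)
  have heq : Set.EqOn F (fun w => ∑' k, h k w) {s : ℂ | 0 < s.re} := by
    refine AnalyticOnNhd.eqOn_of_preconnected_of_eventuallyEq (z₀ := 2)
      (hF.differentiableOn.analyticOnNhd hU) (hd.analyticOnNhd hU)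
      (convex_halfSpace_re_gt 0).isPreconnected (by simp) ?_
    have : {s : ℂ | 1 < s.re} ∈ nhds (2 : ℂ) :=
      (isOpen_lt continuous_const Complex.continuous_re).mem_nhds (by simp)
    filter_upwards [this] with w hw
    exact (hsum w hw).tsum_eq.symm
  have := heq hs
  rw [this]
  exact (hsumm s hs).hasSum

end P1


section P1b
open Complex

lemma vt_sum_blocks {E : Type*} [AddCommMonoid E] (f : ℕ → E) (q M : ℕ) :
    ∑ k ∈ Finset.range M, ∑ r ∈ Finset.range q, f (k * q + r) = ∑ n ∈ Finset.range (M * q), f n := by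
  induction M with
  | zero => simp
  | succ M ih => rw [Finset.sum_range_succ, ih, Nat.succ_mul, Finset.sum_range_add]

lemma vt_hasSum_blocks {f : ℕ → ℂ} {a : ℂ} (q : ℕ) [NeZero q] (h : HasSum f a) :
    HasSum (fun k => ∑ r ∈ Finset.range q, f (k * q + r)) a := by
  have h1 := (Equiv.hasSum_iff (Nat.divModEquiv q).symm).2 h
  have h2 := h1.prod_fiberwise (g := fun k => ∑ r ∈ Finset.range q, f (k * q + r)) ?_
  · exact h2
  · intro k
    rw [Finset.sum_range]
    convert hasSum_fintype _ using 2
    simp [Nat.divModEquiv]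

/-- block of the Dirichlet series -/
noncomputable def vtBlock {q : ℕ} (Φ : ZMod q → ℂ) (k : ℕ) (s : ℂ) : ℂ :=
  ∑ r ∈ Finset.range q, Φ ((k * q + r + 1 : ℕ) : ZMod q) * (((k * q + r + 1 : ℕ) : ℝ) : ℂ) ^ (-s)

lemma vtBlock_differentiable {q : ℕ} (Φ : ZMod q → ℂ) (k : ℕ) : Differentiable ℂ (vtBlock Φ k) := by
  unfold vtBlock
  refine Differentiable.fun_sum fun r _ => ?_
  refine Differentiable.const_mul ?_ _
  refine Differentiable.const_cpow (by fun_prop) (Or.inl ?_)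
  exact Complex.ofReal_ne_zero.2 (Nat.cast_ne_zero.2 (Nat.succ_ne_zero _))

lemma vt_sum_period {q : ℕ} [NeZero q] (Φ : ZMod q → ℂ) (k : ℕ) :
    ∑ r ∈ Finset.range q, Φ ((k * q + r + 1 : ℕ) : ZMod q) = ∑ j, Φ j := by
  have : ∀ r : ℕ, ((k * q + r + 1 : ℕ) : ZMod q) = (r : ZMod q) + 1 := by intro r; simp
  simp_rw [this]
  rw [← Equiv.sum_comp (Equiv.addRight (1 : ZMod q)) Φ]
  simp only [Equiv.coe_addRight]
  refine Finset.sum_bij (fun r _ => (r : ZMod q)) (by simp) ?_ ?_ (by simp)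
  · intro a ha b hb hab
    have := (ZMod.natCast_eq_natCast_iff' a b q).1 hab
    rwa [Nat.mod_eq_of_lt (Finset.mem_range.1 ha), Nat.mod_eq_of_lt (Finset.mem_range.1 hb)] at this
  · intro b _
    exact ⟨b.val, Finset.mem_range.2 (ZMod.val_lt b), by simp⟩

lemma vtBlock_bound {q : ℕ} [NeZero q] {Φ : ZMod q → ℂ} (hΦ0 : ∑ j, Φ j = 0) (hΦ : ∀ j, ‖Φ j‖ ≤ 1)
    {k : ℕ} (hk : 0 < k) {s : ℂ} (hs : 0 < s.re) :
    ‖vtBlock Φ k s‖ ≤ (q : ℝ) ^ (1 - s.re) * ‖s‖ * (k : ℝ) ^ (-s.re - 1) := by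
  have hq : 0 < q := Nat.pos_of_ne_zero (NeZero.ne q)
  have hkq : (0 : ℝ) < (k * q : ℕ) := by positivity
  have e : vtBlock Φ k s = ∑ r ∈ Finset.range q, Φ ((k * q + r + 1 : ℕ) : ZMod q) *
      ((((k * q + r + 1 : ℕ) : ℝ) : ℂ) ^ (-s) - (((k * q : ℕ) : ℝ) : ℂ) ^ (-s)) := by
    simp_rw [mul_sub, Finset.sum_sub_distrib, ← Finset.sum_mul]
    rw [vt_sum_period, hΦ0]; simp [vtBlock]
  rw [e]
  calc _ ≤ ∑ r ∈ Finset.range q, (‖s‖ * ((k * q : ℕ) : ℝ) ^ (-s.re - 1) * q) := by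
        refine (norm_sum_le _ _).trans (Finset.sum_le_sum fun r hr => ?_)
        rw [norm_mul]
        have h1 := vt_cpow_mvt hkq (b := ((k * q + r + 1 : ℕ) : ℝ)) (by push_cast; linarith [(Nat.cast_nonneg r : (0:ℝ) ≤ r)])
          (w := -s) (by simp; linarith)
        have h2 : (((k * q + r + 1 : ℕ) : ℝ) - ((k * q : ℕ) : ℝ)) ≤ q := by
          have : (r : ℝ) + 1 ≤ q := by exact_mod_cast Finset.mem_range.1 hr
          push_cast; linarith
        rw [norm_neg, neg_re] at h1
        calc _ ≤ 1 * (‖s‖ * ((k * q : ℕ) : ℝ) ^ (-s.re - 1) * (((k * q + r + 1 : ℕ) : ℝ) - ((k * q : ℕ) : ℝ))) := by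
              gcongr
              exact hΦ _
          _ ≤ _ := by rw [one_mul]; gcongr
    _ = _ := by
        have hq' : (0:ℝ) < q := by positivity
        rw [Finset.sum_const, Finset.card_range, nsmul_eq_mul, Nat.cast_mul,
          Real.mul_rpow (by positivity) (by positivity)]
        have : (q : ℝ) ^ (1 - s.re) = q * q * (q : ℝ) ^ (-s.re - 1) := by
          rw [show (1 - s.re) = 1 + 1 + (-s.re - 1) by ring, Real.rpow_add hq', Real.rpow_add hq', Real.rpow_one]
        rw [this]; ring

lemma vtBlock_hasSum {q : ℕ} [NeZero q] {Φ : ZMod q → ℂ} (hΦ0 : ∑ j, Φ j = 0) (hΦ : ∀ j, ‖Φ j‖ ≤ 1)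
    {s : ℂ} (hs : 0 < s.re) :
    HasSum (fun k => vtBlock Φ (k + 1) s) (ZMod.LFunction Φ s - vtBlock Φ 0 s) := by
  have hq : 0 < q := Nat.pos_of_ne_zero (NeZero.ne q)
  have hq1 : (1:ℝ) ≤ q := by exact_mod_cast hq
  refine vt_cont_tsum (A := q) (F := fun s => ZMod.LFunction Φ s - vtBlock Φ 0 s)
    (h := fun k => vtBlock Φ (k + 1)) (by positivity)
    ((ZMod.differentiable_LFunction_of_sum_zero hΦ0).sub (vtBlock_differentiable Φ 0))
    (fun k => vtBlock_differentiable Φ _) ?_ ?_ hs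
  · intro k s hs
    refine (vtBlock_bound hΦ0 hΦ (Nat.succ_pos k) hs).trans ?_
    push_cast
    gcongr
    · calc (q:ℝ) ^ (1 - s.re) ≤ (q:ℝ) ^ (1:ℝ) := Real.rpow_le_rpow_of_exponent_le hq1 (by linarith)
        _ = q := Real.rpow_one _
    · nlinarith [norm_nonneg s]
  · intro s hs
    have hL : HasSum (LSeries.term (fun x => Φ ↑x) s) (ZMod.LFunction Φ s) := by
      rw [ZMod.LFunction_eq_LSeries Φ hs]
      exact (ZMod.LSeriesSummable_of_one_lt_re Φ hs).hasSum
    rw [← hasSum_nat_add_iff' 1] at hL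
    simp only [Finset.range_one, Finset.sum_singleton, LSeries.term_zero, sub_zero] at hL
    have h2 := vt_hasSum_blocks q hL
    rw [← hasSum_nat_add_iff' 1] at h2
    simp only [Finset.range_one, Finset.sum_singleton] at h2
    have key : ∀ k, ∑ r ∈ Finset.range q, LSeries.term (fun x => Φ ↑x) s (k * q + r + 1) = vtBlock Φ k s := by
      intro k
      unfold vtBlock
      refine Finset.sum_congr rfl fun r _ => ?_
      rw [LSeries.term_of_ne_zero (Nat.succ_ne_zero _), Complex.cpow_neg, div_eq_mul_inv, Complex.ofReal_natCast]
    simpa only [key] using h2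

/-- UB for periodic mean zero functions -/
lemma vt_LFunction_bound {ε : ℝ} (hε : 0 < ε) (hε2 : ε ≤ 1 / 2) :
    ∃ C : ℝ, 0 < C ∧ ∀ (q : ℕ) [NeZero q] (Φ : ZMod q → ℂ), ∑ j, Φ j = 0 → (∀ j, ‖Φ j‖ ≤ 1) →
      ∀ s : ℂ, 1 - ε ≤ s.re → s.re ≤ 4 →
        ‖ZMod.LFunction Φ s‖ ≤ C * ((q : ℝ) * (|s.im| + 2)) ^ ε := by
  refine ⟨2 / ε + 8, by positivity, fun q _ Φ hΦ0 hΦ s hs1 hs2 => ?_⟩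
  have hq : 0 < q := Nat.pos_of_ne_zero (NeZero.ne q)
  have hq1 : (1:ℝ) ≤ q := by exact_mod_cast hq
  set σ := s.re with hσ
  set τ := |s.im| + 2 with hτ
  have hσ0 : 0 < σ := by linarith
  have hτ2 : 2 ≤ τ := by have := abs_nonneg s.im; linarith
  obtain ⟨M, hM⟩ : ∃ M : ℕ, M = ⌈τ⌉₊ := ⟨_, rfl⟩
  have hM1 : τ ≤ M := hM ▸ Nat.le_ceil τ
  have hM2 : (M : ℝ) < τ + 1 := hM ▸ Nat.ceil_lt_add_one (by linarith)
  have hM0 : 0 < M := by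
    have : (0:ℝ) < M := by linarith
    exact_mod_cast this
  have hsn : ‖s‖ ≤ 3 * τ := by
    have := Complex.norm_le_abs_re_add_abs_im s
    have h3 : |s.re| ≤ 4 := by rw [abs_of_pos hσ0]; exact hs2
    linarith
  have hS := vtBlock_hasSum hΦ0 hΦ (s := s) hσ0
  have hsumm := hS.summable
  have e1 : ZMod.LFunction Φ s = (∑ k ∈ Finset.range (M + 1), vtBlock Φ k s)
      + ∑' k : ℕ, vtBlock Φ (k + M + 1) s := by
    have := hsumm.sum_add_tsum_nat_add M
    rw [hS.tsum_eq] at this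
    rw [Finset.sum_range_succ']
    linear_combination -this
  have hhead : ‖∑ k ∈ Finset.range (M + 1), vtBlock Φ k s‖ ≤ (((M + 1) * q : ℕ) : ℝ) ^ ε / ε := by
    refine le_trans ?_ (vt_head_sum hε (by linarith) ((M + 1) * q))
    rw [← vt_sum_blocks (fun n : ℕ => ((n : ℝ) + 1) ^ (ε - 1))]
    refine (norm_sum_le _ _).trans (Finset.sum_le_sum fun k _ => ?_)
    unfold vtBlock
    refine (norm_sum_le _ _).trans (Finset.sum_le_sum fun r _ => ?_)
    have hpos : (0:ℝ) < ((k * q + r + 1 : ℕ) : ℝ) := by exact_mod_cast Nat.succ_pos _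
    rw [norm_mul, Complex.norm_cpow_eq_rpow_re_of_pos hpos, ← Nat.cast_add_one]
    have h1 : ((k * q + r + 1 : ℕ) : ℝ) ^ (-s).re ≤ ((k * q + r + 1 : ℕ) : ℝ) ^ (ε - 1) := by
      refine Real.rpow_le_rpow_of_exponent_le ?_ (by simp; linarith)
      exact_mod_cast Nat.succ_le_of_lt (Nat.succ_pos _)
    calc _ ≤ 1 * ((k * q + r + 1 : ℕ) : ℝ) ^ (ε - 1) := by gcongr; exact hΦ _
      _ = _ := one_mul _
  have htail : ‖∑' k : ℕ, vtBlock Φ (k + M + 1) s‖ ≤ (q : ℝ) ^ (1 - σ) * ‖s‖ * ((M : ℝ) ^ (-σ) / σ) := by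
    have hb : ∀ k : ℕ, ‖vtBlock Φ (k + M + 1) s‖ ≤
        (q : ℝ) ^ (1 - σ) * ‖s‖ * (((k + M : ℕ) : ℝ) + 1) ^ (-σ - 1) := by
      intro k
      have := vtBlock_bound hΦ0 hΦ (Nat.succ_pos (k + M)) hσ0
      simpa using this
    have hs3 := ((summable_nat_add_iff M).2 (vt_tail_summable hσ0)).mul_left ((q : ℝ) ^ (1 - σ) * ‖s‖)
    refine (tsum_of_norm_bounded hs3.hasSum hb).trans ?_
    rw [tsum_mul_left]
    gcongr
    exact vt_tail_sum hσ0 M hM0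
  have hT : 0 < τ := by linarith
  have htail2 : (q : ℝ) ^ (1 - σ) * ‖s‖ * ((M : ℝ) ^ (-σ) / σ) ≤ 6 * (q * τ) ^ ε := by
    have h1 : (M : ℝ) ^ (-σ) ≤ τ ^ (-σ) := Real.rpow_le_rpow_of_nonpos hT hM1 (by linarith)
    have h2 : (q : ℝ) ^ (1 - σ) * (3 * τ) * (τ ^ (-σ) / σ) ≤ 6 * ((q : ℝ) * τ) ^ (1 - σ) := by
      have e2 : τ * τ ^ (-σ) = τ ^ (1 - σ) := by
        rw [show 1 - σ = 1 + -σ by ring, Real.rpow_add hT, Real.rpow_one]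
      have e3 : (q : ℝ) ^ (1 - σ) * (3 * τ) * (τ ^ (-σ) / σ) = (3 / σ) * ((q:ℝ) * τ) ^ (1 - σ) := by
        rw [Real.mul_rpow (by positivity) hT.le, ← e2]; field_simp
      rw [e3]
      gcongr
      rw [div_le_iff₀ hσ0]; linarith
    have h3 : ((q:ℝ) * τ) ^ (1 - σ) ≤ (q * τ) ^ ε :=
      Real.rpow_le_rpow_of_exponent_le (by nlinarith) (by linarith)
    calc _ ≤ (q : ℝ) ^ (1 - σ) * (3 * τ) * (τ ^ (-σ) / σ) := by gcongr
      _ ≤ _ := h2.trans (by linarith)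
  have hhead2 : (((M + 1) * q : ℕ) : ℝ) ^ ε / ε ≤ (2 / ε) * (q * τ) ^ ε := by
    have h1 : (((M + 1) * q : ℕ) : ℝ) ≤ 2 ^ 2 * (q * τ) := by
      push_cast; nlinarith
    have h2 : (((M + 1) * q : ℕ) : ℝ) ^ ε ≤ 2 * (q * τ) ^ ε := by
      calc _ ≤ (2 ^ 2 * ((q:ℝ) * τ)) ^ ε := by gcongr
        _ = (2 ^ 2) ^ ε * ((q:ℝ) * τ) ^ ε := Real.mul_rpow (by positivity) (by positivity)
        _ ≤ (2 ^ 2) ^ (1 / 2 : ℝ) * ((q:ℝ) * τ) ^ ε := by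
            gcongr
            norm_num
        _ = _ := by
            congr 1
            rw [← Real.sqrt_eq_rpow]; norm_num
    rw [div_mul_eq_mul_div]
    gcongr
  rw [e1]
  refine (norm_add_le _ _).trans ?_
  have : 0 < (q * τ) ^ ε := by positivity
  nlinarith [hhead, htail, htail2, hhead2]

end P1b


section P1c
open Complex

noncomputable def vtZ (k : ℕ) (s : ℂ) : ℂ :=
  (s - 1) * (((k : ℝ) + 1 : ℝ) : ℂ) ^ (-s) +
    ((((k : ℝ) + 1 + 1 : ℝ) : ℂ) ^ (1 - s) - (((k : ℝ) + 1 : ℝ) : ℂ) ^ (1 - s))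

lemma vtZ_differentiable (k : ℕ) : Differentiable ℂ (vtZ k) := by
  have h1 : (((k : ℝ) + 1 : ℝ) : ℂ) ≠ 0 := Complex.ofReal_ne_zero.2 (by positivity)
  have h2 : (((k : ℝ) + 1 + 1 : ℝ) : ℂ) ≠ 0 := Complex.ofReal_ne_zero.2 (by positivity)
  unfold vtZ
  refine Differentiable.add (Differentiable.mul (by fun_prop) ?_) (Differentiable.sub ?_ ?_)
  · exact Differentiable.const_cpow (by fun_prop) (Or.inl h1)
  · exact Differentiable.const_cpow (by fun_prop) (Or.inl h2)
  · exact Differentiable.const_cpow (by fun_prop) (Or.inl h1)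

lemma vtZ_hasSum {s : ℂ} (hs : 0 < s.re) : HasSum (fun k => vtZ k s) (riemannZeta₁ s - 1) := by
  refine vt_cont_tsum (A := 1) (F := fun s => riemannZeta₁ s - 1) (by positivity)
    (differentiable_riemannZeta₁.sub_const 1) vtZ_differentiable ?_ ?_ hs
  · intro k s hs
    refine (vt_second_diff (by positivity) hs).trans ?_
    have : ‖s - 1‖ ≤ 1 + ‖s‖ := by
      have := norm_sub_le s 1
      rw [norm_one] at this; linarith
    refine mul_le_mul_of_nonneg_right ?_ (by positivity)
    nlinarith [norm_nonneg s, norm_nonneg (s - 1)]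
  · intro s hs
    have hs1 : s ≠ 1 := by rintro rfl; simp at hs
    have h1 : HasSum (fun k : ℕ => (((k : ℝ) + 1 : ℝ) : ℂ) ^ (-s)) (riemannZeta s) := by
      rw [zeta_eq_tsum_one_div_nat_add_one_cpow hs]
      have hsm : Summable (fun k : ℕ => 1 / ((k : ℂ) + 1) ^ s) := by
        have := (summable_nat_add_iff 1).2 (Complex.summable_one_div_nat_cpow.2 hs)
        simpa using this
      convert hsm.hasSum using 2 with k
      rw [Complex.cpow_neg]; simp
    have h2 : HasSum (fun k : ℕ => (((k : ℝ) + 1 + 1 : ℝ) : ℂ) ^ (1 - s) - (((k : ℝ) + 1 : ℝ) : ℂ) ^ (1 - s)) (-1) := by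
      have hsm : Summable (fun k : ℕ => (((k : ℝ) + 1 + 1 : ℝ) : ℂ) ^ (1 - s) - (((k : ℝ) + 1 : ℝ) : ℂ) ^ (1 - s)) := by
        have hb := (vt_tail_summable (σ := s.re - 1) (by linarith)).mul_left ‖1 - s‖
        refine Summable.of_norm_bounded hb fun k => ?_
        have := vt_cpow_mvt (a := (k:ℝ) + 1) (b := (k:ℝ) + 1 + 1) (by positivity) (by linarith) (w := 1 - s)
          (by simp; linarith)
        refine this.trans (le_of_eq ?_)
        simp
      rw [hsm.hasSum_iff_tendsto_nat]
      have e : ∀ n : ℕ, ∑ k ∈ Finset.range n, ((((k : ℝ) + 1 + 1 : ℝ) : ℂ) ^ (1 - s) - (((k : ℝ) + 1 : ℝ) : ℂ) ^ (1 - s))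
          = (((n : ℝ) + 1 : ℝ) : ℂ) ^ (1 - s) - 1 := by
        intro n
        have := Finset.sum_range_sub (fun k : ℕ => (((k : ℝ) + 1 : ℝ) : ℂ) ^ (1 - s)) n
        simp only [Nat.cast_add, Nat.cast_one] at this
        rw [this]; simp
      simp_rw [e]
      have : Filter.Tendsto (fun n : ℕ => (((n : ℝ) + 1 : ℝ) : ℂ) ^ (1 - s)) Filter.atTop (nhds 0) := by
        rw [tendsto_zero_iff_norm_tendsto_zero]
        have h3 : ∀ n : ℕ, ‖(((n : ℝ) + 1 : ℝ) : ℂ) ^ (1 - s)‖ = ((n : ℝ) + 1) ^ (-(s.re - 1)) := by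
          intro n
          rw [Complex.norm_cpow_eq_rpow_re_of_pos (by positivity)]; simp
        simp_rw [h3]
        exact (tendsto_rpow_neg_atTop (by linarith)).comp
          (Filter.tendsto_atTop_add_const_right _ _ tendsto_natCast_atTop_atTop)
      simpa using this.sub_const 1
    have h3 := (h1.mul_left (s - 1)).add h2
    have e : riemannZeta₁ s - 1 = (s - 1) * riemannZeta s + -1 := by
      rw [riemannZeta_eq_inv_sub_mul hs1]
      have : s - 1 ≠ 0 := sub_ne_zero.2 hs1
      field_simp; ring
    simp only [e]
    exact h3

lemma vt_zeta_bound {ε : ℝ} (hε : 0 < ε) (hε2 : ε ≤ 1 / 2) :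
    ∃ C : ℝ, 0 < C ∧ ∀ s : ℂ, 1 - ε ≤ s.re → s.re ≤ 4 →
        ‖riemannZeta₁ s - 1‖ ≤ C * ‖s - 1‖ * (|s.im| + 2) ^ ε := by
  refine ⟨4 / ε + 6, by positivity, fun s hs1 hs2 => ?_⟩
  set σ := s.re with hσ
  set τ := |s.im| + 2 with hτ
  have hσ0 : 0 < σ := by linarith
  have hτ2 : 2 ≤ τ := by have := abs_nonneg s.im; linarith
  obtain ⟨M, hM⟩ : ∃ M : ℕ, M = ⌈τ⌉₊ := ⟨_, rfl⟩
  have hM1 : τ ≤ M := hM ▸ Nat.le_ceil τ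
  have hM2 : (M : ℝ) < τ + 1 := hM ▸ Nat.ceil_lt_add_one (by linarith)
  have hM0 : 0 < M := by
    have : (0:ℝ) < M := by linarith
    exact_mod_cast this
  have hsn : ‖s‖ ≤ 3 * τ := by
    have := Complex.norm_le_abs_re_add_abs_im s
    have h3 : |s.re| ≤ 4 := by rw [abs_of_pos hσ0]; exact hs2
    linarith
  have hS := vtZ_hasSum hσ0
  have hsumm := hS.summable
  have e1 : riemannZeta₁ s - 1 = (∑ k ∈ Finset.range M, vtZ k s) + ∑' k : ℕ, vtZ (k + M) s := by
    have := hsumm.sum_add_tsum_nat_add M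
    rw [hS.tsum_eq] at this
    exact this.symm
  have hhead : ‖∑ k ∈ Finset.range M, vtZ k s‖ ≤ (2 * ‖s - 1‖) * ((M : ℝ) ^ ε / ε) := by
    refine le_trans ?_ (mul_le_mul_of_nonneg_left (vt_head_sum hε (by linarith) M) (by positivity))
    rw [Finset.mul_sum]
    refine (norm_sum_le _ _).trans (Finset.sum_le_sum fun k _ => ?_)
    have hk : (0:ℝ) < (k:ℝ) + 1 := by positivity
    have h1 : ((k:ℝ) + 1) ^ (-σ) ≤ ((k:ℝ) + 1) ^ (ε - 1) :=
      Real.rpow_le_rpow_of_exponent_le (by linarith [(Nat.cast_nonneg k : (0:ℝ) ≤ k)]) (by linarith)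
    have h2 := vt_cpow_mvt (a := (k:ℝ) + 1) (b := (k:ℝ) + 1 + 1) hk (by linarith) (w := 1 - s)
          (by simp; linarith)
    have h3 : ‖(s - 1) * (((k : ℝ) + 1 : ℝ) : ℂ) ^ (-s)‖ = ‖s - 1‖ * ((k:ℝ) + 1) ^ (-σ) := by
      rw [norm_mul, Complex.norm_cpow_eq_rpow_re_of_pos hk]; simp [hσ]
    have h4 : (1 - s).re - 1 = -σ := by simp [hσ]
    rw [h4, add_sub_cancel_left, mul_one, norm_sub_rev 1 s] at h2
    unfold vtZ
    refine (norm_add_le _ _).trans ?_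
    rw [h3]
    have := mul_le_mul_of_nonneg_left h1 (norm_nonneg (s - 1))
    nlinarith
  have htail : ‖∑' k : ℕ, vtZ (k + M) s‖ ≤ ‖s - 1‖ * ‖s‖ * ((M : ℝ) ^ (-σ) / σ) := by
    have hb : ∀ k : ℕ, ‖vtZ (k + M) s‖ ≤
        ‖s - 1‖ * ‖s‖ * (((k + M : ℕ) : ℝ) + 1) ^ (-σ - 1) := by
      intro k
      exact vt_second_diff (by positivity) hσ0
    have hs3 := ((summable_nat_add_iff M).2 (vt_tail_summable hσ0)).mul_left (‖s - 1‖ * ‖s‖)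
    refine (tsum_of_norm_bounded hs3.hasSum hb).trans ?_
    rw [tsum_mul_left]
    gcongr
    exact vt_tail_sum hσ0 M hM0
  have hT : 0 < τ := by linarith
  have htail2 : ‖s‖ * ((M : ℝ) ^ (-σ) / σ) ≤ 6 * τ ^ ε := by
    have h1 : (M : ℝ) ^ (-σ) ≤ τ ^ (-σ) := Real.rpow_le_rpow_of_nonpos hT hM1 (by linarith)
    have h2 : (3 * τ) * (τ ^ (-σ) / σ) ≤ 6 * τ ^ (1 - σ) := by
      have e2 : τ * τ ^ (-σ) = τ ^ (1 - σ) := by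
        rw [show 1 - σ = 1 + -σ by ring, Real.rpow_add hT, Real.rpow_one]
      have e3 : (3 * τ) * (τ ^ (-σ) / σ) = (3 / σ) * τ ^ (1 - σ) := by
        rw [← e2]; field_simp
      rw [e3]
      gcongr
      rw [div_le_iff₀ hσ0]; linarith
    have h3 : τ ^ (1 - σ) ≤ τ ^ ε :=
      Real.rpow_le_rpow_of_exponent_le (by linarith) (by linarith)
    calc _ ≤ (3 * τ) * (τ ^ (-σ) / σ) := by gcongr
      _ ≤ _ := h2.trans (by linarith)
  have hhead2 : (M : ℝ) ^ ε / ε ≤ (2 / ε) * τ ^ ε := by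
    have h2 : (M : ℝ) ^ ε ≤ 2 * τ ^ ε := by
      calc _ ≤ (2 ^ 2 * τ) ^ ε := by gcongr; linarith
        _ = (2 ^ 2) ^ ε * τ ^ ε := Real.mul_rpow (by positivity) (by positivity)
        _ ≤ (2 ^ 2) ^ (1 / 2 : ℝ) * τ ^ ε := by
            gcongr
            norm_num
        _ = _ := by
            congr 1
            rw [← Real.sqrt_eq_rpow]; norm_num
    rw [div_mul_eq_mul_div]
    gcongr
  rw [e1]
  refine (norm_add_le _ _).trans ?_
  have h5 := mul_le_mul_of_nonneg_left htail2 (norm_nonneg (s - 1))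
  have h6 := mul_le_mul_of_nonneg_left hhead2 (show 0 ≤ 2 * ‖s - 1‖ by positivity)
  have e7 : (4 / ε + 6) * ‖s - 1‖ * τ ^ ε = 2 * ‖s - 1‖ * (2 / ε * τ ^ ε) + ‖s - 1‖ * (6 * τ ^ ε) := by
    ring
  rw [e7]
  rw [mul_assoc] at htail
  linarith

end P1c


section P2a
open Complex
open scoped ComplexOrder

/-- Lemma of Estermann. -/
lemma vt_estermann {f : ℕ → ℂ} (hf : 0 ≤ f) (hf1 : f 1 = 1) {F : ℂ → ℂ} (hF : Differentiable ℂ F)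
    (hsum : ∀ s : ℂ, 1 < s.re → LSeriesSummable f s)
    (hFf : ∀ s : ℂ, 1 < s.re → F s = (s - 1) * LSeries f s) {K : ℝ} (hK : 1 ≤ K)
    (hFK : ∀ s : ℂ, ‖s - 2‖ ≤ 3 / 2 → ‖F s‖ ≤ K) {l : ℝ} (hl : F 1 = l)
    {β : ℝ} (hβ : 7 / 8 ≤ β) (hβ1 : β < 1) (hFβ : 0 ≤ (F β).re) :
    (1 - β) / 2 ≤ l * (Real.exp 1 * (32 * K) ^ (4 * (1 - β))) := by
  set G : ℂ → ℂ := dslope F 1 with hG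
  have hGd : Differentiable ℂ G := by
    rw [← differentiableOn_univ]
    exact (Complex.differentiableOn_dslope Filter.univ_mem).2 hF.differentiableOn
  have hlK : |l| ≤ K := by
    have := hFK 1 (by norm_num)
    rwa [hl, Complex.norm_real, Real.norm_eq_abs] at this
  have hGs : ∀ s : ℂ, s ≠ 1 → G s = (s - 1)⁻¹ * (F s - l) := by
    intro s hs
    rw [hG, dslope_of_ne _ hs, slope_def_field, hl]
    rw [div_eq_inv_mul]
  have hGbd : ∀ s ∈ Metric.sphere (2 : ℂ) (3 / 2), ‖G s‖ ≤ 4 * K := by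
    intro s hs
    rw [mem_sphere_iff_norm] at hs
    have h1 : 1 / 2 ≤ ‖s - 1‖ := by
      have := norm_sub_le (s - 1) (1 : ℂ)
      rw [show s - 1 - 1 = s - 2 by ring, hs] at this
      norm_num at this
      linarith
    have hs1 : s ≠ 1 := by
      rintro rfl
      norm_num at h1
    rw [hGs s hs1, norm_mul, norm_inv]
    have h2 : ‖F s - l‖ ≤ 2 * K := by
      refine (norm_sub_le _ _).trans ?_
      rw [Complex.norm_real, Real.norm_eq_abs]
      linarith [hFK s hs.le]
    have h3 : ‖s - 1‖⁻¹ ≤ 2 := by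
      rw [inv_le_comm₀ (by linarith) (by norm_num)]
      linarith
    calc _ ≤ 2 * (2 * K) := by gcongr
      _ = _ := by ring
  have habs : LSeries.abscissaOfAbsConv f ≤ (1 : ℝ) :=
    LSeries.abscissaOfAbsConv_le_of_forall_lt_LSeriesSummable fun y hy => hsum y (by simpa using hy)
  have habs2 : LSeries.abscissaOfAbsConv f < ((2 : ℝ) : EReal) :=
    lt_of_le_of_lt habs (by exact_mod_cast one_lt_two)
  -- identify the derivatives at 2
  have hev : G =ᶠ[nhds (2 : ℂ)] fun s => LSeries f s - l * (s - 1)⁻¹ := by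
    have : {s : ℂ | 1 < s.re} ∈ nhds (2 : ℂ) :=
      (isOpen_lt continuous_const Complex.continuous_re).mem_nhds (by simp)
    filter_upwards [this] with s hs
    have hs' : 1 < s.re := hs
    have hs1 : s - 1 ≠ 0 := by
      intro h
      rw [sub_eq_zero] at h
      simp [h] at hs'
    rw [hGs s (sub_ne_zero.1 hs1), hFf s hs']
    field_simp
  have hLan : AnalyticAt ℂ (LSeries f) 2 :=
    LSeries_analyticOnNhd f 2 (by simpa using habs2)
  have hder : ∀ n : ℕ, iteratedDeriv n G 2 =
      iteratedDeriv n (LSeries f) 2 - l * ((-1) ^ n * n.factorial) := by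
    intro n
    have hia : AnalyticAt ℂ (fun s : ℂ => (l : ℂ) * (s - 1)⁻¹) 2 := by
      have : (2 : ℂ) - 1 ≠ 0 := by norm_num
      fun_prop (disch := assumption)
    rw [hev.iteratedDeriv_eq, iteratedDeriv_fun_sub hLan.contDiffAt hia.contDiffAt,
      iteratedDeriv_const_mul_field]
    have := congrFun (iter_deriv_inv_linear_sub n (1 : ℂ) 1) 2
    rw [← iteratedDeriv_eq_iterate] at this
    simp only [one_mul] at this
    rw [this]
    norm_num
  set c : ℕ → ℝ := fun n => ((n.factorial : ℂ)⁻¹ * ((-1) ^ n * iteratedDeriv n G 2)).re with hc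
  have hpow : ∀ n : ℕ, ((-1 : ℂ)) ^ n * (-1) ^ n = 1 := fun n => by
    rw [← mul_pow]; norm_num
  have hc1 : ∀ n, c n = (((n.factorial : ℝ)⁻¹ : ℝ) * ((-1) ^ n * iteratedDeriv n (LSeries f) 2)).re - l := by
    intro n
    have hn : (n.factorial : ℂ) ≠ 0 := by exact_mod_cast n.factorial_ne_zero
    simp only [hc, hder]
    rw [mul_sub, mul_sub, Complex.sub_re]
    congr 1
    · push_cast; rfl
    · rw [show (n.factorial : ℂ)⁻¹ * ((-1) ^ n * (l * ((-1) ^ n * n.factorial))) =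
        ((n.factorial : ℂ)⁻¹ * n.factorial) * ((-1 : ℂ) ^ n * (-1) ^ n) * l by ring, hpow,
        inv_mul_cancel₀ hn]
      simp
  have hc2 : ∀ n, -l ≤ c n := by
    intro n
    rw [hc1, Complex.re_ofReal_mul]
    have h1 := LSeries.iteratedDeriv_alternating hf habs2 n
    have h2 := (Complex.le_def.1 h1).1
    have : 0 ≤ (n.factorial : ℝ)⁻¹ * ((-1) ^ n * iteratedDeriv n (LSeries f) 2).re :=
      mul_nonneg (by positivity) (by simpa using h2)
    linarith
  have hc0 : 1 - l ≤ c 0 := by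
    rw [hc1]
    simp only [Nat.factorial_zero, Nat.cast_one, inv_one, ofReal_one, pow_zero, one_mul, iteratedDeriv_zero]
    have hs2 := hsum 2 (by simp)
    have h1 : (LSeries f 2).re = ∑' n, (LSeries.term f 2 n).re := Complex.re_tsum hs2
    have hnn : ∀ n, 0 ≤ (LSeries.term f 2 n).re := by
      intro n
      have := LSeries.term_nonneg (hf n) (2 : ℝ)
      have h := (Complex.le_def.1 this).1
      simpa using h
    have h2 := (Complex.hasSum_re hs2.hasSum).summable.le_tsum 1 (fun n _ => hnn n)
    have h3 : (LSeries.term f 2 1).re = 1 := by simp [hf1]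
    simp only [h3] at h2
    linarith
  have hc3 : ∀ n, |c n| ≤ 4 * K * (2 / 3) ^ n := by
    intro n
    refine (Complex.abs_re_le_norm _).trans ?_
    have := Complex.norm_iteratedDeriv_le_of_forall_mem_sphere_norm_le n (by norm_num)
      hGd.diffContOnCl hGbd
    rw [norm_mul, norm_mul, norm_inv, norm_pow, norm_neg, norm_one, one_pow, one_mul, Complex.norm_natCast]
    have hn : (0 : ℝ) < n.factorial := by exact_mod_cast n.factorial_pos
    calc _ ≤ (n.factorial : ℝ)⁻¹ * (n.factorial * (4 * K) / (3 / 2) ^ n) := by gcongr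
      _ = _ := by
        rw [show (2 / 3 : ℝ) = (3 / 2)⁻¹ by norm_num, inv_pow]
        field_simp
  have hsumG : HasSum (fun n => (2 - β) ^ n * c n) (G β).re := by
    have h1 := Complex.hasSum_taylorSeries_on_ball (f := G) (c := 2) (r := 3 / 2)
      hGd.differentiableOn (z := β) (by
        rw [mem_ball_iff_norm]
        rw [show (β : ℂ) - 2 = ((β - 2 : ℝ) : ℂ) by push_cast; ring, Complex.norm_real,
          Real.norm_eq_abs, abs_lt]
        constructor <;> linarith)
    have h2 := Complex.hasSum_re h1
    convert h2 using 2 with n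
    simp only [hc, smul_eq_mul]
    rw [← Complex.re_ofReal_mul]
    congr 1
    push_cast
    rw [show (β : ℂ) - 2 = (-1) * (2 - β) by ring, mul_pow]
    ring
  set M : ℕ := ⌈4 * Real.log (32 * K)⌉₊ with hM
  have hMlog : 0 ≤ 4 * Real.log (32 * K) := by
    have := Real.log_nonneg (show 1 ≤ 32 * K by linarith)
    linarith
  have hM1 : 4 * Real.log (32 * K) ≤ M := Nat.le_ceil _
  have hM2 : (M : ℝ) < 4 * Real.log (32 * K) + 1 := Nat.ceil_lt_add_one hMlog
  have h34 : 16 * K * (3 / 4 : ℝ) ^ M ≤ 1 / 2 := by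
    have h1 : (3 / 4 : ℝ) ^ M ≤ Real.exp (-(1 / 4) * M) := by
      rw [mul_comm, Real.exp_nat_mul]
      gcongr
      linarith [Real.add_one_le_exp (-(1 / 4) : ℝ)]
    have h2 : Real.exp (-(1 / 4) * M) ≤ (32 * K)⁻¹ := by
      rw [← Real.exp_log (show 0 < (32 * K)⁻¹ by positivity), Real.log_inv]
      apply Real.exp_le_exp.2
      linarith
    calc _ ≤ 16 * K * (32 * K)⁻¹ := by gcongr; exact h1.trans h2
      _ = 1 / 2 := by field_simp; norm_num
  have hb2 : 1 ≤ 2 - β := by linarith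
  -- tail
  have htail : -(16 * K * (3 / 4 : ℝ) ^ M) ≤ ∑' n, (2 - β) ^ (n + M) * c (n + M) := by
    have hg : HasSum (fun n : ℕ => -(4 * K * (3 / 4 : ℝ) ^ M * (3 / 4) ^ n)) (-(16 * K * (3 / 4 : ℝ) ^ M)) := by
      have := (hasSum_geometric_of_lt_one (r := (3 / 4 : ℝ)) (by norm_num) (by norm_num)).mul_left
        (-(4 * K * (3 / 4 : ℝ) ^ M))
      rw [show (-(4 * K * (3 / 4 : ℝ) ^ M)) * (1 - 3 / 4)⁻¹ = -(16 * K * (3 / 4 : ℝ) ^ M) by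
        rw [show (1 - 3 / 4 : ℝ)⁻¹ = 4 by norm_num]; ring] at this
      simpa only [neg_mul] using this
    have hs' := (summable_nat_add_iff M).2 hsumG.summable
    refine hasSum_le (fun n => ?_) hg hs'.hasSum
    have h1 := hc3 (n + M)
    have h2 : (2 - β) ^ (n + M) ≤ (9 / 8 : ℝ) ^ (n + M) := by gcongr; linarith
    have h3 : |(2 - β) ^ (n + M) * c (n + M)| ≤ (9 / 8 : ℝ) ^ (n + M) * (4 * K * (2 / 3) ^ (n + M)) := by
      rw [abs_mul, abs_of_nonneg (by positivity)]
      gcongr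
    have h4 : (9 / 8 : ℝ) ^ (n + M) * (4 * K * (2 / 3) ^ (n + M)) = 4 * K * (3 / 4 : ℝ) ^ M * (3 / 4) ^ n := by
      rw [mul_left_comm, ← mul_pow]
      norm_num [pow_add]
      ring
    rw [← h4]
    linarith [neg_abs_le ((2 - β) ^ (n + M) * c (n + M))]
  have hM0 : 0 < M := by
    rw [hM, Nat.ceil_pos]
    have := Real.log_pos (show 1 < 32 * K by linarith)
    linarith
  have hhead : 1 - l * ∑ n ∈ Finset.range M, (2 - β) ^ n ≤ ∑ n ∈ Finset.range M, (2 - β) ^ n * c n := by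
    obtain ⟨M', hM'⟩ : ∃ M', M = M' + 1 := ⟨M - 1, by omega⟩
    rw [hM', Finset.sum_range_succ', Finset.sum_range_succ']
    have : ∑ n ∈ Finset.range M', (2 - β) ^ (n + 1) * (-l) ≤
        ∑ n ∈ Finset.range M', (2 - β) ^ (n + 1) * c (n + 1) := by
      apply Finset.sum_le_sum
      intro n _
      exact mul_le_mul_of_nonneg_left (hc2 _) (by positivity)
    rw [← Finset.sum_mul] at this
    simp only [pow_zero, one_mul, mul_add]
    linarith
  have hGre : 1 - l * ∑ n ∈ Finset.range M, (2 - β) ^ n - 1 / 2 ≤ (G β).re := by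
    rw [← hsumG.tsum_eq, ← hsumG.summable.sum_add_tsum_nat_add M]
    linarith
  have hgeom : (1 - β) * ∑ n ∈ Finset.range M, (2 - β) ^ n = (2 - β) ^ M - 1 := by
    have := geom_sum_mul (2 - β) M
    rw [← this]; ring
  have hFre : (F β).re = l - (1 - β) * (G β).re := by
    have hne : (β : ℂ) - 1 ≠ 0 := by
      rw [sub_ne_zero]
      exact_mod_cast hβ1.ne
    have h1 := hGs β (sub_ne_zero.1 hne)
    have h2 : F β = l - ((1 - β : ℝ) : ℂ) * G β := by
      rw [h1]
      push_cast
      field_simp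
      ring
    rw [h2, Complex.sub_re, Complex.re_ofReal_mul, Complex.ofReal_re]
  have hfin : (1 - β) / 2 ≤ l * (2 - β) ^ M := by
    have h1 : (1 - β) * (1 - l * ∑ n ∈ Finset.range M, (2 - β) ^ n - 1 / 2) ≤ (1 - β) * (G β).re :=
      mul_le_mul_of_nonneg_left hGre (by linarith)
    have h2 : (1 - β) * (1 - l * ∑ n ∈ Finset.range M, (2 - β) ^ n - 1 / 2) =
        (1 - β) / 2 - l * ((2 - β) ^ M - 1) := by
      rw [← hgeom]; ring
    rw [hFre] at hFβ
    linarith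
  have hl0 : 0 < l := by
    by_contra h
    have : l * (2 - β) ^ M ≤ 0 := mul_nonpos_of_nonpos_of_nonneg (not_lt.1 h) (by positivity)
    linarith
  refine hfin.trans (mul_le_mul_of_nonneg_left ?_ hl0.le)
  calc (2 - β) ^ M ≤ Real.exp (1 - β) ^ M := by
        gcongr
        linarith [Real.add_one_le_exp (1 - β)]
    _ = Real.exp (M * (1 - β)) := by rw [Real.exp_nat_mul]
    _ ≤ Real.exp (1 + Real.log (32 * K) * (4 * (1 - β))) := by
        apply Real.exp_le_exp.2
        nlinarith
    _ = _ := by rw [Real.exp_add, Real.rpow_def_of_pos (by linarith)]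
end P2a


section P2b
open Complex
open scoped ComplexOrder

noncomputable def vtA {q : ℕ} (χ : DirichletCharacter ℂ q) : ArithmeticFunction ℂ :=
  toArithmeticFunction (fun n => χ n)

noncomputable def vtLam {q : ℕ} (χ : DirichletCharacter ℂ q) : ArithmeticFunction ℂ :=
  toArithmeticFunction (fun n => χ n * ArithmeticFunction.vonMangoldt n)

lemma vtA_apply {q : ℕ} (χ : DirichletCharacter ℂ q) {n : ℕ} (hn : n ≠ 0) : vtA χ n = χ n := by
  simp [vtA, toArithmeticFunction, hn]

lemma vtLam_apply {q : ℕ} (χ : DirichletCharacter ℂ q) (n : ℕ) :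
    vtLam χ n = χ n * ArithmeticFunction.vonMangoldt n := by
  by_cases hn : n = 0
  · subst hn; simp
  · simp [vtLam, toArithmeticFunction, hn]

def vtIsD (f h : ArithmeticFunction ℂ) : Prop := ∀ n : ℕ, f n * Complex.log n = (f * h) n

lemma vtIsD_A {q : ℕ} (χ : DirichletCharacter ℂ q) : vtIsD (vtA χ) (vtLam χ) := by
  intro n
  have h := congrFun (DirichletCharacter.convolution_twist_vonMangoldt χ) n
  by_cases hn : n = 0
  · subst hn; simp
  rw [vtA_apply χ hn, mul_comm (vtA χ)]
  exact h.symm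

lemma vtIsD_mul {f g h k : ArithmeticFunction ℂ} (hf : vtIsD f h) (hg : vtIsD g k) :
    vtIsD (f * g) (h + k) := by
  set Df : ArithmeticFunction ℂ := ⟨fun n => f n * Complex.log n, by simp⟩ with hDf
  set Dg : ArithmeticFunction ℂ := ⟨fun n => g n * Complex.log n, by simp⟩ with hDg
  have h1 : Df = f * h := by ext n; exact hf n
  have h2 : Dg = g * k := by ext n; exact hg n
  have h3 : f * g * (h + k) = Df * g + f * Dg := by rw [h1, h2]; ring
  intro n
  rw [h3, ArithmeticFunction.add_apply, ArithmeticFunction.mul_apply, ArithmeticFunction.mul_apply,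
    ArithmeticFunction.mul_apply, Finset.sum_mul, ← Finset.sum_add_distrib]
  apply Finset.sum_congr rfl
  intro p hp
  rw [Nat.mem_divisorsAntidiagonal] at hp
  obtain ⟨hp, hn⟩ := hp
  have hp1 : p.1 ≠ 0 := by rintro h; simp [h] at hp; exact hn hp.symm
  have hp2 : p.2 ≠ 0 := by rintro h; simp [h] at hp; exact hn hp.symm
  have hlog : Complex.log (n : ℂ) = Complex.log p.1 + Complex.log p.2 := by
    rw [← hp, ← Complex.natCast_log, ← Complex.natCast_log, ← Complex.natCast_log, Nat.cast_mul]
    rw [Real.log_mul (by exact_mod_cast hp1) (by exact_mod_cast hp2)]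
    push_cast; rfl
  show f p.1 * g p.2 * Complex.log n = (f p.1 * Complex.log p.1) * g p.2 + f p.1 * (g p.2 * Complex.log p.2)
  rw [hlog]; ring

lemma vtIsD_nonneg {f h : ArithmeticFunction ℂ} (hf : vtIsD f h) (hf1 : f 1 = 1)
    (h1 : h 1 = 0) (hh : ∀ n, 0 ≤ h n) : (0 : ℕ → ℂ) ≤ fun n => f n := by
  intro n
  show 0 ≤ f n
  induction n using Nat.strong_induction_on with
  | _ n ih =>
    rcases Nat.lt_or_ge n 2 with hn | hn
    · interval_cases n
      · simp
      · rw [hf1]; exact zero_le_one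
    · have hlog : 0 < Real.log n := Real.log_pos (by exact_mod_cast hn)
      have key := hf n
      have hs : 0 ≤ (f * h) n := by
        rw [ArithmeticFunction.mul_apply]
        apply Finset.sum_nonneg
        intro p hp
        have hp' := Nat.mem_divisorsAntidiagonal.1 hp
        by_cases hp1 : p.1 = n
        · have : p.2 = 1 := by
            have h3 := hp'.1
            rw [hp1] at h3
            exact Nat.eq_of_mul_eq_mul_left (by omega : 0 < n) (by rw [h3, mul_one])
          rw [this, h1, mul_zero]
        · refine mul_nonneg (ih _ ?_) (hh _)
          have : p.1 ≤ n := Nat.le_of_dvd (by omega) ⟨_, hp'.1.symm⟩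
          omega
      have h2 : f n = (f * h) n * ((Real.log n)⁻¹ : ℝ) := by
        rw [← key, ← Complex.natCast_log]
        push_cast
        rw [mul_assoc, mul_inv_cancel₀, mul_one]
        rw [← Complex.natCast_log]
        exact_mod_cast hlog.ne'
      rw [h2]
      exact mul_nonneg hs (by exact_mod_cast (inv_pos.2 hlog).le)

lemma vt_real_of_real {F : ℂ → ℂ} (hF : Differentiable ℂ F)
    (h : ∀ x : ℝ, 1 < x → (F x).im = 0) (x : ℝ) : (F x).im = 0 := by
  have hG : Differentiable ℂ (⇑(starRingEnd ℂ) ∘ F ∘ ⇑(starRingEnd ℂ)) := by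
    intro z
    have := (hF ((starRingEnd ℂ) z)).conj_conj
    simpa using this
  have key := AnalyticOnNhd.eq_of_frequently_eq (z₀ := (2 : ℂ)) (f := F)
    (g := ⇑(starRingEnd ℂ) ∘ F ∘ ⇑(starRingEnd ℂ))
    (Complex.analyticOnNhd_univ_iff_differentiable.2 hF)
    (Complex.analyticOnNhd_univ_iff_differentiable.2 hG) (by
      have ht : Filter.Tendsto (fun n : ℕ => (2 : ℂ) + (((n : ℝ) + 1)⁻¹ : ℝ)) Filter.atTop
          (nhdsWithin 2 {2}ᶜ) := by
        rw [tendsto_nhdsWithin_iff]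
        constructor
        · have h1 : Filter.Tendsto (fun n : ℕ => ((n : ℝ) + 1)⁻¹) Filter.atTop (nhds 0) := by
            simpa [one_div] using tendsto_one_div_add_atTop_nhds_zero_nat (𝕜 := ℝ)
          have h2 := (Complex.continuous_ofReal.tendsto 0).comp h1
          simpa using h2.const_add (2 : ℂ)
        · refine Filter.Eventually.of_forall fun n => ?_
          have : ((n : ℝ) + 1)⁻¹ ≠ 0 := by positivity
          simp only [Set.mem_compl_iff, Set.mem_singleton_iff, add_eq_left]
          exact_mod_cast this
      apply ht.frequently
      apply Filter.Frequently.of_forall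
      intro n
      have h1 : (2 : ℂ) + (((n : ℝ) + 1)⁻¹ : ℝ) = ((2 + ((n : ℝ) + 1)⁻¹ : ℝ) : ℂ) := by push_cast; rfl
      rw [h1]
      simp only [Function.comp, Complex.conj_ofReal]
      refine (Complex.conj_eq_iff_im.2 (h _ ?_)).symm
      have : 0 < ((n : ℝ) + 1)⁻¹ := by positivity
      linarith)
  have h2 := congrFun key (x : ℂ)
  simp only [Function.comp, Complex.conj_ofReal] at h2
  exact Complex.conj_eq_iff_im.1 h2.symm

lemma vtA_summable {q : ℕ} (χ : DirichletCharacter ℂ q) {s : ℂ} (hs : 1 < s.re) :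
    LSeriesSummable (fun n => vtA χ n) s := by
  refine (LSeriesSummable_congr s ?_).1 (DirichletCharacter.LSeriesSummable_of_one_lt_re χ hs)
  intro n hn
  rw [vtA_apply χ hn]

lemma vtA_LSeries {q : ℕ} [NeZero q] (χ : DirichletCharacter ℂ q) {s : ℂ} (hs : 1 < s.re) :
    LSeries (fun n => vtA χ n) s = DirichletCharacter.LFunction χ s := by
  rw [DirichletCharacter.LFunction_eq_LSeries χ hs]
  refine LSeries_congr ?_ s
  intro n hn
  rw [vtA_apply χ hn]

lemma vtA_one {q : ℕ} (χ : DirichletCharacter ℂ q) : vtA χ 1 = 1 := by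
  rw [vtA_apply χ one_ne_zero]; simp

lemma vtLam_one {q : ℕ} (χ : DirichletCharacter ℂ q) : vtLam χ 1 = 0 := by
  rw [vtLam_apply]; simp

lemma vt_mul_one {f g : ArithmeticFunction ℂ} (hf : f 1 = 1) (hg : g 1 = 1) : (f * g) 1 = 1 := by
  simp [ArithmeticFunction.mul_apply, hf, hg]

lemma vt_LSeries_im {f : ℕ → ℂ} (hf : 0 ≤ f) {x : ℝ} :
    (LSeries f x).im = 0 := by
  have h : 0 ≤ LSeries f x := tsum_nonneg fun n => LSeries.term_nonneg (hf n) x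
  exact (Complex.le_def.1 h).2.symm

lemma vt_LSeries_re {f : ℕ → ℂ} (hf : 0 ≤ f) (hf1 : f 1 = 1) {x : ℝ} (h : LSeriesSummable f x) :
    1 ≤ (LSeries f x).re := by
  have h1 : (LSeries f x).re = ∑' n, (LSeries.term f x n).re := Complex.re_tsum h
  have hnn : ∀ n, 0 ≤ (LSeries.term f x n).re := by
    intro n
    exact (Complex.le_def.1 (LSeries.term_nonneg (hf n) x)).1
  have h2 := (Complex.hasSum_re h.hasSum).summable.le_tsum 1 (fun n _ => hnn n)
  have h3 : (LSeries.term f x 1).re = 1 := by simp [hf1]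
  simp only [h3] at h2
  linarith

/-- nonnegativity of 1 * χ -/
lemma vt_pos_one {q : ℕ} {χ : DirichletCharacter ℂ q} (hχ : χ ^ 2 = 1) :
    (0 : ℕ → ℂ) ≤ fun n => (vtA (1 : DirichletCharacter ℂ 1) * vtA χ) n := by
  refine vtIsD_nonneg (vtIsD_mul (vtIsD_A _) (vtIsD_A _)) (vt_mul_one (vtA_one _) (vtA_one _)) ?_ ?_
  · simp [vtLam_one]
  · intro n
    rw [ArithmeticFunction.add_apply, vtLam_apply, vtLam_apply]
    have h0 : (0 : ℂ) ≤ ((ArithmeticFunction.vonMangoldt n : ℝ) : ℂ) := by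
      exact_mod_cast ArithmeticFunction.vonMangoldt_nonneg
    have h1 : (1 : DirichletCharacter ℂ 1) (n : ZMod 1) = 1 := by
      rw [Subsingleton.elim (n : ZMod 1) 1]; simp
    rw [h1, ← add_mul]
    refine mul_nonneg ?_ h0
    rcases MulChar.isQuadratic_iff_sq_eq_one.2 hχ (n : ZMod q) with h | h | h <;> rw [h] <;> norm_num

/-- the product character -/
noncomputable def vtProd {q r : ℕ} (χ : DirichletCharacter ℂ q) (ψ : DirichletCharacter ℂ r) :
    DirichletCharacter ℂ (q * r) :=
  DirichletCharacter.changeLevel (Dvd.intro _ rfl) χ * DirichletCharacter.changeLevel (Dvd.intro_left _ rfl) ψ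

lemma vt_changeLevel_nat {q r : ℕ} (h : q ∣ r) (χ : DirichletCharacter ℂ q) {n : ℕ} (hn : n.Coprime r) :
    DirichletCharacter.changeLevel h χ (n : ZMod r) = χ (n : ZMod q) := by
  have := DirichletCharacter.changeLevel_eq_cast_of_dvd χ h (ZMod.unitOfCoprime n hn)
  rw [ZMod.coe_unitOfCoprime] at this
  rw [this, ZMod.cast_natCast h]

lemma vtProd_apply {q r : ℕ} (χ : DirichletCharacter ℂ q) (ψ : DirichletCharacter ℂ r) (n : ℕ) :
    vtProd χ ψ n = χ n * ψ n := by
  by_cases hn : n.Coprime (q * r)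
  · rw [vtProd, MulChar.mul_apply, vt_changeLevel_nat _ _ hn, vt_changeLevel_nat _ _ hn]
  · rw [MulChar.map_nonunit]
    · rw [Nat.coprime_mul_iff_right, not_and_or] at hn
      rcases hn with hn | hn
      · rw [MulChar.map_nonunit χ, zero_mul]
        rwa [ZMod.isUnit_iff_coprime]
      · rw [MulChar.map_nonunit ψ, mul_zero]
        rwa [ZMod.isUnit_iff_coprime]
    · rwa [ZMod.isUnit_iff_coprime]

lemma vt_pos_two {q r : ℕ} {χ : DirichletCharacter ℂ q} {ψ : DirichletCharacter ℂ r} (hχ : χ ^ 2 = 1)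
    (hψ : ψ ^ 2 = 1) :
    (0 : ℕ → ℂ) ≤ fun n => (vtA (1 : DirichletCharacter ℂ 1) * vtA χ * vtA ψ * vtA (vtProd χ ψ)) n := by
  refine vtIsD_nonneg (vtIsD_mul (vtIsD_mul (vtIsD_mul (vtIsD_A _) (vtIsD_A _)) (vtIsD_A _)) (vtIsD_A _))
    (vt_mul_one (vt_mul_one (vt_mul_one (vtA_one _) (vtA_one _)) (vtA_one _)) (vtA_one _)) ?_ ?_
  · simp [vtLam_one]
  · intro n
    simp only [ArithmeticFunction.add_apply, vtLam_apply]
    have h0 : (0 : ℂ) ≤ ((ArithmeticFunction.vonMangoldt n : ℝ) : ℂ) := by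
      exact_mod_cast ArithmeticFunction.vonMangoldt_nonneg
    have h1 : (1 : DirichletCharacter ℂ 1) (n : ZMod 1) = 1 := by
      rw [Subsingleton.elim (n : ZMod 1) 1]; simp
    rw [h1, ← add_mul, ← add_mul, ← add_mul, vtProd_apply]
    refine mul_nonneg ?_ h0
    rcases MulChar.isQuadratic_iff_sq_eq_one.2 hχ (n : ZMod q) with h | h | h <;> rw [h] <;>
    rcases MulChar.isQuadratic_iff_sq_eq_one.2 hψ (n : ZMod r) with h' | h' | h' <;> rw [h'] <;> norm_num

end P2b


section P2c
open Complex
open scoped ComplexOrder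

lemma vt_one_mod (n : ℕ) : (1 : DirichletCharacter ℂ 1) (n : ZMod 1) = 1 := by
  rw [Subsingleton.elim (n : ZMod 1) 1]; simp

lemma vtA_one_nonneg : (0 : ℕ → ℂ) ≤ fun n => vtA (1 : DirichletCharacter ℂ 1) n := by
  intro n
  show 0 ≤ vtA (1 : DirichletCharacter ℂ 1) n
  by_cases hn : n = 0
  · simp [hn]
  · rw [vtA_apply _ hn, vt_one_mod]; exact zero_le_one

lemma vt_lift {f : ℕ → ℂ} (hf : 0 ≤ f) (hf1 : f 1 = 1) {x : ℝ} (h : LSeriesSummable f x) :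
    ∃ r : ℝ, 1 ≤ r ∧ LSeries f x = r :=
  ⟨_, vt_LSeries_re hf hf1 h, by
    apply Complex.ext
    · simp
    · simpa using vt_LSeries_im hf⟩

lemma vt_L_real_pos {q : ℕ} [NeZero q] {χ : DirichletCharacter ℂ q} (hχ : χ ^ 2 = 1) {x : ℝ} (hx : 1 < x) :
    ∃ r : ℝ, 0 < r ∧ DirichletCharacter.LFunction χ x = r := by
  have hx' : 1 < (x : ℂ).re := by simpa using hx
  have s1 := vtA_summable (1 : DirichletCharacter ℂ 1) hx'
  have s2 := vtA_summable χ hx'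
  obtain ⟨a, ha, ha'⟩ := vt_lift vtA_one_nonneg (vtA_one _) s1
  obtain ⟨b, hb, hb'⟩ := vt_lift (vt_pos_one hχ) (vt_mul_one (vtA_one _) (vtA_one _))
    (ArithmeticFunction.LSeriesSummable_mul s1 s2)
  rw [ArithmeticFunction.LSeries_mul' s1 s2, ha', vtA_LSeries χ hx'] at hb'
  refine ⟨b / a, by positivity, ?_⟩
  have : (a : ℂ) ≠ 0 := by exact_mod_cast (by linarith : a ≠ 0)
  push_cast
  rw [← hb']
  field_simp

lemma vt_L_im {q : ℕ} [NeZero q] {χ : DirichletCharacter ℂ q} (hχ : χ ^ 2 = 1) (h1 : χ ≠ 1) (x : ℝ) :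
    (DirichletCharacter.LFunction χ x).im = 0 := by
  apply vt_real_of_real (DirichletCharacter.differentiable_LFunction h1)
  intro y hy
  obtain ⟨r, _, hr⟩ := vt_L_real_pos hχ hy
  simp [hr]

lemma vt_L_pos_of_ne {q : ℕ} [NeZero q] {χ : DirichletCharacter ℂ q} (hχ : χ ^ 2 = 1) (h1 : χ ≠ 1) {β : ℝ}
    (hβ : β ≤ 1) (hne : ∀ x : ℝ, β ≤ x → x < 1 → DirichletCharacter.LFunction χ x ≠ 0) :
    0 < (DirichletCharacter.LFunction χ β).re := by
  by_contra hcon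
  rw [not_lt] at hcon
  have hc : ContinuousOn (fun x : ℝ => (DirichletCharacter.LFunction χ x).re) (Set.Icc β 2) := by
    apply Continuous.continuousOn
    exact Complex.continuous_re.comp
      ((DirichletCharacter.differentiable_LFunction h1).continuous.comp Complex.continuous_ofReal)
  obtain ⟨r, hr, hr'⟩ := vt_L_real_pos hχ (show (1 : ℝ) < 2 by norm_num)
  have h2 : 0 ≤ (DirichletCharacter.LFunction χ ((2 : ℝ) : ℂ)).re := by
    rw [hr']; simpa using hr.le
  obtain ⟨x, hx, hx'⟩ := intermediate_value_Icc (by linarith : β ≤ 2) hc ⟨hcon, h2⟩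
  have hz : DirichletCharacter.LFunction χ x = 0 := by
    apply Complex.ext
    · simpa using hx'
    · simpa using vt_L_im hχ h1 x
  by_cases hx1 : x < 1
  · exact hne x hx.1 hx1 hz
  · exact DirichletCharacter.LFunction_ne_zero_of_one_le_re χ (Or.inl h1) (by simpa using not_lt.1 hx1) hz

lemma vt_L_one_pos {q : ℕ} [NeZero q] {χ : DirichletCharacter ℂ q} (hχ : χ ^ 2 = 1) (h1 : χ ≠ 1) :
    0 < (DirichletCharacter.LFunction χ 1).re := by
  have := vt_L_pos_of_ne hχ h1 (le_refl (1 : ℝ)) (fun x h1 h2 => absurd h1 (not_le.2 h2))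
  simpa using this

lemma vt_L_one_eq {q : ℕ} [NeZero q] {χ : DirichletCharacter ℂ q} (hχ : χ ^ 2 = 1) (h1 : χ ≠ 1) (x : ℝ) :
    DirichletCharacter.LFunction χ x = ((DirichletCharacter.LFunction χ x).re : ℝ) := by
  apply Complex.ext
  · simp
  · simpa using vt_L_im hχ h1 x

lemma vt_ball {s : ℂ} (h : ‖s - 2‖ ≤ 3 / 2) : 1 / 2 ≤ s.re ∧ s.re ≤ 4 ∧ |s.im| ≤ 2 := by
  have h1 := (Complex.abs_re_le_norm (s - 2)).trans h
  have h2 := (Complex.abs_im_le_norm (s - 2)).trans h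
  simp only [sub_re, re_ofNat, sub_im, im_ofNat, sub_zero] at h1 h2
  rw [abs_le] at h1
  refine ⟨by linarith, by linarith, by linarith⟩

lemma vt_chi_bound {ε : ℝ} (hε : 0 < ε) (hε2 : ε ≤ 1 / 2) : ∃ C : ℝ, 1 ≤ C ∧
    ∀ (q : ℕ) [NeZero q] (χ : DirichletCharacter ℂ q), χ ≠ 1 → ∀ s : ℂ, 1 - ε ≤ s.re → s.re ≤ 4 →
      ‖DirichletCharacter.LFunction χ s‖ ≤ C * ((q : ℝ) * (|s.im| + 2)) ^ ε := by
  obtain ⟨C, hC, h⟩ := vt_LFunction_bound hε hε2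
  refine ⟨max C 1, le_max_right _ _, fun q _ χ hχ s h1 h2 => ?_⟩
  refine (h q (fun j => χ j) (MulChar.sum_eq_zero_of_ne_one hχ) (fun j => χ.norm_le_one j) s h1 h2).trans ?_
  gcongr
  exact le_max_left _ _

lemma vt_L_ball : ∃ C : ℝ, 1 ≤ C ∧ ∀ (q : ℕ) [NeZero q] (χ : DirichletCharacter ℂ q), χ ≠ 1 → ∀ s : ℂ,
    ‖s - 2‖ ≤ 3 / 2 → ‖DirichletCharacter.LFunction χ s‖ ≤ C * q := by
  obtain ⟨C, hC, h⟩ := vt_chi_bound (show (0 : ℝ) < 1 / 2 by norm_num) le_rfl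
  refine ⟨C * 4, by linarith, fun q _ χ hχ s hs => ?_⟩
  obtain ⟨h1, h2, h3⟩ := vt_ball hs
  refine (h q χ hχ s (by linarith) h2).trans ?_
  have hq : (1 : ℝ) ≤ q := by exact_mod_cast NeZero.one_le
  rw [mul_assoc]
  gcongr
  calc ((q : ℝ) * (|s.im| + 2)) ^ (1 / 2 : ℝ) ≤ (4 * (q : ℝ)) ^ (1 / 2 : ℝ) := by
        apply Real.rpow_le_rpow (by positivity) _ (by norm_num)
        nlinarith
    _ ≤ (4 * (q : ℝ)) ^ (1 : ℝ) := by
        apply Real.rpow_le_rpow_of_exponent_le <;> linarith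
    _ = _ := Real.rpow_one _

lemma vt_zeta1_ball : ∃ C : ℝ, 1 ≤ C ∧ ∀ s : ℂ, ‖s - 2‖ ≤ 3 / 2 → ‖riemannZeta₁ s‖ ≤ C := by
  obtain ⟨C, hC⟩ := (isCompact_closedBall (2 : ℂ) (3 / 2)).exists_bound_of_continuousOn
    differentiable_riemannZeta₁.continuous.continuousOn
  refine ⟨max C 1, le_max_right _ _, fun s hs => (hC s ?_).trans (le_max_left _ _)⟩
  rwa [mem_closedBall_iff_norm]

lemma vtA_zeta {s : ℂ} (hs : 1 < s.re) :
    (s - 1) * LSeries (fun n => vtA (1 : DirichletCharacter ℂ 1) n) s = riemannZeta₁ s := by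
  rw [vtA_LSeries _ hs, DirichletCharacter.LFunction_modOne_eq]
  have h1 : s ≠ 1 := by rintro rfl; simp at hs
  rw [riemannZeta_eq_inv_sub_mul h1]
  have := sub_ne_zero.2 h1
  field_simp

lemma vt_core_one : ∃ C : ℝ, 1 ≤ C ∧ ∀ β : ℝ, 7 / 8 ≤ β → β < 1 → ∀ (q : ℕ) [NeZero q]
    (χ : DirichletCharacter ℂ q), χ ^ 2 = 1 → χ ≠ 1 →
    0 ≤ (riemannZeta₁ β * DirichletCharacter.LFunction χ β).re →
    (1 - β) / 2 ≤ (DirichletCharacter.LFunction χ 1).re * (Real.exp 1 * (C * q) ^ (4 * (1 - β))) := by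
  obtain ⟨C1, hC1, h1⟩ := vt_zeta1_ball
  obtain ⟨C2, hC2, h2⟩ := vt_L_ball
  refine ⟨32 * (C1 * C2), by nlinarith, fun β hβ hβ1 q _ χ hχ hχ1 hF => ?_⟩
  have hq : (1 : ℝ) ≤ q := by exact_mod_cast NeZero.one_le
  have := vt_estermann (f := fun n => (vtA (1 : DirichletCharacter ℂ 1) * vtA χ) n)
    (F := fun s => riemannZeta₁ s * DirichletCharacter.LFunction χ s) (K := C1 * (C2 * q))
    (l := (DirichletCharacter.LFunction χ 1).re) (β := β)
    (vt_pos_one hχ) (vt_mul_one (vtA_one _) (vtA_one _))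
    (differentiable_riemannZeta₁.mul (DirichletCharacter.differentiable_LFunction hχ1))
    (fun s hs => ArithmeticFunction.LSeriesSummable_mul (vtA_summable _ hs) (vtA_summable _ hs))
    (fun s hs => by
      rw [ArithmeticFunction.LSeries_mul' (vtA_summable _ hs) (vtA_summable _ hs), ← mul_assoc,
        vtA_zeta hs, vtA_LSeries _ hs])
    (by nlinarith [mul_le_mul hC2 hq (by norm_num) (by linarith)])
    (fun s hs => by
      rw [norm_mul]
      exact mul_le_mul (h1 s hs) (h2 q χ hχ1 s hs) (norm_nonneg _) (by linarith))
    (by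
      have := vt_L_one_eq hχ hχ1 1
      rw [ofReal_one] at this
      show riemannZeta₁ 1 * DirichletCharacter.LFunction χ 1 = _
      rw [riemannZeta₁_one, one_mul, ← this])
    hβ hβ1 hF
  rw [show 32 * (C1 * C2) * (q : ℝ) = 32 * (C1 * (C2 * q)) by ring]
  exact this

lemma vtProd_sq {q r : ℕ} {χ : DirichletCharacter ℂ q} {ψ : DirichletCharacter ℂ r} (hχ : χ ^ 2 = 1)
    (hψ : ψ ^ 2 = 1) : vtProd χ ψ ^ 2 = 1 := by
  rw [vtProd, mul_pow, ← map_pow, ← map_pow, hχ, hψ, map_one, map_one, one_mul]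

lemma vt_core_two : ∃ C : ℝ, 1 ≤ C ∧ ∀ β : ℝ, 7 / 8 ≤ β → β < 1 → ∀ (q r : ℕ) [NeZero q] [NeZero r]
    (χ : DirichletCharacter ℂ q) (ψ : DirichletCharacter ℂ r), χ ^ 2 = 1 → χ ≠ 1 → ψ ^ 2 = 1 → ψ ≠ 1 →
    vtProd χ ψ ≠ 1 → DirichletCharacter.LFunction χ β = 0 →
    (1 - β) / 2 ≤ ((DirichletCharacter.LFunction χ 1).re * (DirichletCharacter.LFunction ψ 1).re *
      (DirichletCharacter.LFunction (vtProd χ ψ) 1).re) *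
      (Real.exp 1 * (C * (q * r) ^ 2) ^ (4 * (1 - β))) := by
  obtain ⟨C1, hC1, h1⟩ := vt_zeta1_ball
  obtain ⟨C2, hC2, h2⟩ := vt_L_ball
  have hC23 : 1 ≤ C2 ^ 3 := one_le_pow₀ hC2
  refine ⟨32 * (C1 * C2 ^ 3), by nlinarith, fun β hβ hβ1 q r _ _ χ ψ hχ hχ1 hψ hψ1 hp hF => ?_⟩
  have hq : (1 : ℝ) ≤ q := by exact_mod_cast NeZero.one_le
  have hr : (1 : ℝ) ≤ r := by exact_mod_cast NeZero.one_le
  have hp2 := vtProd_sq hχ hψ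
  have sm1 : ∀ {s : ℂ}, 1 < s.re → LSeriesSummable (fun n => (vtA (1 : DirichletCharacter ℂ 1) * vtA χ) n) s :=
    fun hs => ArithmeticFunction.LSeriesSummable_mul (vtA_summable _ hs) (vtA_summable _ hs)
  have sm2 : ∀ {s : ℂ}, 1 < s.re → LSeriesSummable (fun n => (vtA (1 : DirichletCharacter ℂ 1) * vtA χ * vtA ψ) n) s :=
    fun hs => ArithmeticFunction.LSeriesSummable_mul (sm1 hs) (vtA_summable _ hs)
  have := vt_estermann (f := fun n => (vtA (1 : DirichletCharacter ℂ 1) * vtA χ * vtA ψ * vtA (vtProd χ ψ)) n)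
    (F := fun s => riemannZeta₁ s * DirichletCharacter.LFunction χ s * DirichletCharacter.LFunction ψ s *
      DirichletCharacter.LFunction (vtProd χ ψ) s) (K := C1 * (C2 * q) * (C2 * r) * (C2 * (q * r : ℕ)))
    (l := (DirichletCharacter.LFunction χ 1).re * (DirichletCharacter.LFunction ψ 1).re *
      (DirichletCharacter.LFunction (vtProd χ ψ) 1).re) (β := β)
    (vt_pos_two hχ hψ) (vt_mul_one (vt_mul_one (vt_mul_one (vtA_one _) (vtA_one _)) (vtA_one _)) (vtA_one _))
    (((differentiable_riemannZeta₁.mul (DirichletCharacter.differentiable_LFunction hχ1)).mul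
      (DirichletCharacter.differentiable_LFunction hψ1)).mul (DirichletCharacter.differentiable_LFunction hp))
    (fun s hs => ArithmeticFunction.LSeriesSummable_mul (sm2 hs) (vtA_summable _ hs))
    (fun s hs => by
      rw [ArithmeticFunction.LSeries_mul' (sm2 hs) (vtA_summable _ hs),
        ArithmeticFunction.LSeries_mul' (sm1 hs) (vtA_summable _ hs),
        ArithmeticFunction.LSeries_mul' (vtA_summable _ hs) (vtA_summable _ hs), ← mul_assoc, ← mul_assoc,
        ← mul_assoc, vtA_zeta hs, vtA_LSeries _ hs, vtA_LSeries _ hs, vtA_LSeries _ hs])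
    (by
      have a1 : 1 ≤ C2 * q := one_le_mul_of_one_le_of_one_le hC2 hq
      have a2 : 1 ≤ C2 * r := one_le_mul_of_one_le_of_one_le hC2 hr
      have a3 : 1 ≤ C2 * (q * r : ℕ) := by
        push_cast
        exact one_le_mul_of_one_le_of_one_le hC2 (one_le_mul_of_one_le_of_one_le hq hr)
      exact one_le_mul_of_one_le_of_one_le (one_le_mul_of_one_le_of_one_le
        (one_le_mul_of_one_le_of_one_le hC1 a1) a2) a3)
    (fun s hs => by
      rw [norm_mul, norm_mul, norm_mul]
      have b1 := h1 s hs
      have b2 := h2 q χ hχ1 s hs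
      have b3 := h2 r ψ hψ1 s hs
      have b4 := h2 (q * r) (vtProd χ ψ) hp s hs
      gcongr)
    (by
      have e1 := vt_L_one_eq hχ hχ1 1
      have e2 := vt_L_one_eq hψ hψ1 1
      have e3 := vt_L_one_eq hp2 hp 1
      rw [ofReal_one] at e1 e2 e3
      show riemannZeta₁ 1 * DirichletCharacter.LFunction χ 1 * DirichletCharacter.LFunction ψ 1 *
        DirichletCharacter.LFunction (vtProd χ ψ) 1 = _
      push_cast
      rw [riemannZeta₁_one, one_mul, ← e1, ← e2, ← e3])
    hβ hβ1 (by
      show 0 ≤ (riemannZeta₁ β * DirichletCharacter.LFunction χ β * DirichletCharacter.LFunction ψ β *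
        DirichletCharacter.LFunction (vtProd χ ψ) β).re
      rw [hF]; simp)
  rw [show 32 * (C1 * C2 ^ 3) * ((q : ℝ) * r) ^ 2 = 32 * (C1 * (C2 * q) * (C2 * r) * (C2 * (q * r : ℕ))) by
    push_cast; ring]
  exact this

lemma vt_zero_transfer {q r : ℕ} [NeZero q] [NeZero r] {χ : DirichletCharacter ℂ q} {ψ : DirichletCharacter ℂ r}
    (hψ : ψ ^ 2 = 1) (hp : vtProd χ ψ = 1) {β : ℝ} (hβ : 0 < β) (hβ1 : β < 1)
    (hz : DirichletCharacter.LFunction χ β = 0) : DirichletCharacter.LFunction ψ β = 0 := by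
  have hb : (β : ℂ) ≠ 1 := by exact_mod_cast hβ1.ne
  have h1 : DirichletCharacter.changeLevel (Dvd.intro r rfl) χ =
      DirichletCharacter.changeLevel (Dvd.intro_left q rfl) ψ := by
    have h2 : DirichletCharacter.changeLevel (Dvd.intro_left q rfl) ψ *
      DirichletCharacter.changeLevel (Dvd.intro_left q rfl) ψ = 1 := by
      rw [← map_mul, ← pow_two, hψ, map_one]
    rw [vtProd] at hp
    calc _ = DirichletCharacter.changeLevel (Dvd.intro r rfl) χ *
          (DirichletCharacter.changeLevel (Dvd.intro_left q rfl) ψ *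
          DirichletCharacter.changeLevel (Dvd.intro_left q rfl) ψ) := by rw [h2, mul_one]
      _ = _ := by rw [← mul_assoc, hp, one_mul]
  have h3 := DirichletCharacter.LFunction_changeLevel (Dvd.intro r rfl : q ∣ q * r) χ (s := β) (Or.inr hb)
  have h4 := DirichletCharacter.LFunction_changeLevel (Dvd.intro_left q rfl : r ∣ q * r) ψ (s := β) (Or.inr hb)
  rw [h1, h4, hz, zero_mul] at h3
  rcases mul_eq_zero.1 h3 with h | h
  · exact h
  · exfalso
    rw [Finset.prod_eq_zero_iff] at h
    obtain ⟨p, hp, h⟩ := h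
    have hpp := Nat.prime_of_mem_primeFactors hp
    have h5 : ‖ψ p * (p : ℂ) ^ (-(β : ℂ))‖ < 1 := by
      rw [norm_mul, Complex.norm_natCast_cpow_of_pos hpp.pos]
      have h6 : (p : ℝ) ^ (-(β : ℂ)).re < 1 := by
        apply Real.rpow_lt_one_of_one_lt_of_neg
        · exact_mod_cast hpp.one_lt
        · simpa using hβ
      have h7 := ψ.norm_le_one (p : ZMod r)
      have h8 : 0 ≤ (p : ℝ) ^ (-(β : ℂ)).re := by positivity
      nlinarith
    rw [← sub_eq_zero.1 h] at h5
    simp at h5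

end P2c


section P2d
open Complex

lemma vt_rpow_aux {a b x e : ℝ} (ha : 1 ≤ a) (hb : 1 ≤ b) (hx : x ≤ 1) (hxe : x ≤ e) (hx0 : 0 ≤ x) :
    (a * b) ^ x ≤ a * b ^ e := by
  rw [Real.mul_rpow (by linarith) (by linarith)]
  gcongr
  · exact (Real.rpow_le_rpow_of_exponent_le ha hx).trans_eq (Real.rpow_one a)

lemma vt_siegel {ε : ℝ} (hε : 0 < ε) : ∃ c : ℝ, 0 < c ∧ ∀ (q : ℕ) [NeZero q] (χ : DirichletCharacter ℂ q),
    χ ^ 2 = 1 → χ ≠ 1 → c * (q : ℝ) ^ (-ε) ≤ (DirichletCharacter.LFunction χ 1).re := by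
  set e := min ε (1 / 2) with he
  have he0 : 0 < e := lt_min hε (by norm_num)
  have he2 : e ≤ 1 / 2 := min_le_right _ _
  have hee : e ≤ ε := min_le_left _ _
  obtain ⟨C1, hC1, h1⟩ := vt_core_one
  obtain ⟨C2, hC2, h2⟩ := vt_core_two
  obtain ⟨C3, hC3, h3⟩ := vt_chi_bound (show 0 < e / 2 by linarith) (by linarith)
  -- reduce to finding c with c ≤ L(1) q^e
  suffices hmain : ∃ D : ℝ, 0 < D ∧ ∀ (q : ℕ) [NeZero q] (χ : DirichletCharacter ℂ q),
    χ ^ 2 = 1 → χ ≠ 1 → D ≤ (DirichletCharacter.LFunction χ 1).re * (q : ℝ) ^ e by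
    obtain ⟨D, hD, h⟩ := hmain
    refine ⟨D, hD, fun q _ χ hχ hχ1 => ?_⟩
    have hq : (1 : ℝ) ≤ q := by exact_mod_cast NeZero.one_le
    have hL := vt_L_one_pos hχ hχ1
    have h4 := h q χ hχ hχ1
    rw [Real.rpow_neg (by linarith), ← div_eq_mul_inv, div_le_iff₀ (by positivity)]
    refine h4.trans ?_
    gcongr
  have hζ : ∃ d : ℝ, 0 < d ∧ ∀ β : ℝ, 1 - d < β → β < 1 → 0 ≤ (riemannZeta₁ β).re := by
    have hc : ContinuousAt (fun s : ℂ => (riemannZeta₁ s).re) 1 :=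
      (Complex.continuous_re.comp differentiable_riemannZeta₁.continuous).continuousAt
    have hev : ∀ᶠ s : ℂ in nhds 1, 0 < (riemannZeta₁ s).re := by
      apply hc.eventually (lt_mem_nhds _)
      simp [riemannZeta₁_one]
    obtain ⟨d, hd, h⟩ := Metric.eventually_nhds_iff.1 hev
    refine ⟨d, hd, fun β hb hb1 => (h ?_).le⟩
    rw [dist_eq_norm, show (β : ℂ) - 1 = ((β - 1 : ℝ) : ℂ) by push_cast; ring, Complex.norm_real,
      Real.norm_eq_abs, abs_lt]
    constructor <;> linarith
  obtain ⟨d, hd, hζ⟩ := hζ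
  set δ := min (e / 32) (d / 2) with hδ
  have hδ0 : 0 < δ := lt_min (by linarith) (by linarith)
  have hδe : δ ≤ e / 32 := min_le_left _ _
  have hδd : δ ≤ d / 2 := min_le_right _ _
  have hE : 0 < Real.exp 1 := Real.exp_pos 1
  by_cases hA : ∃ (q1 : ℕ) (_ : NeZero q1) (χ1 : DirichletCharacter ℂ q1) (β : ℝ), χ1 ^ 2 = 1 ∧ χ1 ≠ 1 ∧
      1 - δ ≤ β ∧ β < 1 ∧ DirichletCharacter.LFunction χ1 β = 0
  · obtain ⟨q1, _, χ1, β, hχ1, hχ1', hβ, hβ1, hz⟩ := hA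
    have hq1 : (1 : ℝ) ≤ q1 := by exact_mod_cast NeZero.one_le
    have hL1 := vt_L_one_pos hχ1 hχ1'
    set L1 := (DirichletCharacter.LFunction χ1 1).re with hL1def
    set D2 := L1 * (C3 * (2 * q1)) * (Real.exp 1 * (C2 * q1 ^ 2)) with hD2
    have hD2pos : 0 < D2 := by positivity
    refine ⟨min ((1 - β) / 2 / (Real.exp 1 * C1)) ((1 - β) / 2 / D2), lt_min ?_ ?_, ?_⟩
    · exact div_pos (by linarith) (by positivity)
    · exact div_pos (by linarith) (by positivity)
    intro r _ ψ hψ hψ1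
    have hr : (1 : ℝ) ≤ r := by exact_mod_cast NeZero.one_le
    have hLψ := vt_L_one_pos hψ hψ1
    by_cases hp : vtProd χ1 ψ = 1
    · have hz2 := vt_zero_transfer hψ hp (by linarith) hβ1 hz
      have h4 := h1 β (by linarith) hβ1 r ψ hψ hψ1 (by rw [hz2]; simp)
      have h5 : (C1 * r) ^ (4 * (1 - β)) ≤ C1 * (r : ℝ) ^ e :=
        vt_rpow_aux hC1 hr (by linarith) (by linarith) (by linarith)
      refine (min_le_left _ _).trans ?_
      rw [div_le_iff₀ (by positivity)]
      calc _ ≤ _ := h4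
        _ ≤ (DirichletCharacter.LFunction ψ 1).re * (Real.exp 1 * (C1 * (r : ℝ) ^ e)) := by gcongr
        _ = _ := by ring
    · have h4 := h2 β (by linarith) hβ1 q1 r χ1 ψ hχ1 hχ1' hψ hψ1 hp hz
      have h5 : (C2 * ((q1 : ℝ) * r) ^ 2) ^ (4 * (1 - β)) ≤ (C2 * q1 ^ 2) * (r : ℝ) ^ (e / 2) := by
        rw [mul_pow, ← mul_assoc]
        rw [Real.mul_rpow (by positivity) (by positivity)]
        gcongr
        · exact (Real.rpow_le_rpow_of_exponent_le (by nlinarith [one_le_pow₀ (n := 2) hq1])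
            (show 4 * (1 - β) ≤ 1 by linarith)).trans_eq (Real.rpow_one _)
        · rw [← Real.rpow_natCast, ← Real.rpow_mul (by linarith)]
          apply Real.rpow_le_rpow_of_exponent_le hr
          push_cast
          linarith
      have h6 : (DirichletCharacter.LFunction (vtProd χ1 ψ) 1).re ≤ C3 * (2 * q1) * (r : ℝ) ^ (e / 2) := by
        refine (Complex.re_le_norm _).trans ?_
        refine (h3 (q1 * r) _ hp 1 (by simp; linarith) (by norm_num)).trans ?_
        rw [mul_assoc]
        gcongr
        simp only [Complex.one_im, abs_zero, zero_add]
        push_cast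
        rw [show (q1 : ℝ) * r * 2 = (2 * q1) * r by ring]
        exact vt_rpow_aux (by linarith) hr (by linarith) le_rfl (by linarith)
      have hLp := vt_L_one_pos (vtProd_sq hχ1 hψ) hp
      refine (min_le_right _ _).trans ?_
      rw [div_le_iff₀ (by positivity)]
      calc _ ≤ _ := h4
        _ ≤ (L1 * (DirichletCharacter.LFunction ψ 1).re * (C3 * (2 * q1) * (r : ℝ) ^ (e / 2))) *
            (Real.exp 1 * ((C2 * q1 ^ 2) * (r : ℝ) ^ (e / 2))) := by gcongr
        _ = (DirichletCharacter.LFunction ψ 1).re * ((r : ℝ) ^ (e / 2) * (r : ℝ) ^ (e / 2)) * D2 := by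
            rw [hD2]; ring
        _ = _ := by rw [← Real.rpow_add (by linarith)]; norm_num
  · push Not at hA
    refine ⟨δ / 2 / (Real.exp 1 * C1), by positivity, ?_⟩
    intro r _ ψ hψ hψ1
    have hr : (1 : ℝ) ≤ r := by exact_mod_cast NeZero.one_le
    have hLψ := vt_L_one_pos hψ hψ1
    have hpos : 0 < (DirichletCharacter.LFunction ψ ((1 - δ : ℝ) : ℂ)).re :=
      vt_L_pos_of_ne hψ hψ1 (by linarith) (fun x hx hx1 => hA r ‹_› ψ x hψ hψ1 hx hx1)
    have h4 := h1 (1 - δ) (by linarith) (by linarith) r ψ hψ hψ1 (by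
      rw [Complex.mul_re, vt_L_im hψ hψ1, mul_zero, sub_zero]
      exact mul_nonneg (hζ _ (by linarith) (by linarith)) hpos.le)
    have h5 : (C1 * r) ^ (4 * (1 - (1 - δ))) ≤ C1 * (r : ℝ) ^ e :=
      vt_rpow_aux hC1 hr (by linarith) (by linarith) (by linarith)
    rw [div_le_iff₀ (by positivity)]
    rw [show (1 - (1 - δ)) / 2 = δ / 2 by ring] at h4
    calc _ ≤ _ := h4
      _ ≤ (DirichletCharacter.LFunction ψ 1).re * (Real.exp 1 * (C1 * (r : ℝ) ^ e)) := by gcongr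
      _ = _ := by ring
end P2d


section P3a
open Complex

lemma vt_zeta_bound' {ε : ℝ} (hε : 0 < ε) (hε2 : ε ≤ 1 / 2) : ∃ C : ℝ, 1 ≤ C ∧ ∀ s : ℂ, 1 - ε ≤ s.re →
    s.re ≤ 4 → s ≠ 1 → ‖riemannZeta s‖ ≤ 1 / ‖s - 1‖ + C * (|s.im| + 2) ^ ε := by
  obtain ⟨C, hC, h⟩ := vt_zeta_bound hε hε2
  refine ⟨max C 1, le_max_right _ _, fun s h1 h2 hs => ?_⟩
  have hs' : 0 < ‖s - 1‖ := norm_pos_iff.2 (sub_ne_zero.2 hs)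
  rw [riemannZeta_eq_inv_sub_mul hs, norm_mul, norm_inv]
  have h3 : ‖riemannZeta₁ s‖ ≤ 1 + C * ‖s - 1‖ * (|s.im| + 2) ^ ε := by
    have := norm_add_le (1 : ℂ) (riemannZeta₁ s - 1)
    rw [add_sub_cancel, norm_one] at this
    linarith [h s h1 h2]
  calc _ ≤ ‖s - 1‖⁻¹ * (1 + C * ‖s - 1‖ * (|s.im| + 2) ^ ε) := by gcongr
    _ = 1 / ‖s - 1‖ + C * (|s.im| + 2) ^ ε := by field_simp
    _ ≤ _ := by gcongr; exact le_max_left _ _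

lemma vt_dir_bound : ∃ C : ℝ, 1 ≤ C ∧ ∀ a : ℕ → ℂ, (∀ n, ‖a n‖ ≤ 1) → ∀ s : ℂ, 1 < s.re → s.re ≤ 3 →
    ‖LSeries a s‖ ≤ C / (s.re - 1) := by
  obtain ⟨C, hC, h⟩ := vt_zeta_bound' (show (0 : ℝ) < 1 / 2 by norm_num) le_rfl
  refine ⟨1 + 2 * (C * 2 ^ (1 / 2 : ℝ)), by
    have : (0 : ℝ) < 2 ^ (1 / 2 : ℝ) := by positivity
    nlinarith, fun a ha s hs hs3 => ?_⟩
  have hsr : 1 < ((s.re : ℝ) : ℂ).re := by simpa using hs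
  have hsum1 : LSeriesSummable 1 ((s.re : ℝ) : ℂ) := LSeriesSummable_one_iff.2 hsr
  have hle : ∀ n, ‖LSeries.term a s n‖ ≤ ‖LSeries.term 1 ((s.re : ℝ) : ℂ) n‖ := by
    intro n
    rw [LSeries.norm_term_eq, LSeries.norm_term_eq]
    split_ifs
    · exact le_rfl
    · simp only [Pi.one_apply, norm_one, ofReal_re]
      gcongr
      exact ha n
  have h1 : ‖LSeries a s‖ ≤ ∑' n, ‖LSeries.term 1 ((s.re : ℝ) : ℂ) n‖ :=
    tsum_of_norm_bounded hsum1.norm.hasSum hle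
  have h2 : ∑' n, ‖LSeries.term 1 ((s.re : ℝ) : ℂ) n‖ = (riemannZeta ((s.re : ℝ) : ℂ)).re := by
    rw [← LSeries_one_eq_riemannZeta hsr, LSeries, Complex.re_tsum hsum1]
    apply tsum_congr
    intro n
    open scoped ComplexOrder in
    have : 0 ≤ LSeries.term 1 ((s.re : ℝ) : ℂ) n := LSeries.term_nonneg (by simp) s.re
    rw [Complex.eq_coe_norm_of_nonneg this]
    simp
  have hne : ((s.re : ℝ) : ℂ) ≠ 1 := by intro h; rw [h] at hsr; simp at hsr
  have h3 := h ((s.re : ℝ) : ℂ) (by simp; linarith) (by simp; linarith) hne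
  have h4 : ‖((s.re : ℝ) : ℂ) - 1‖ = s.re - 1 := by
    rw [show ((s.re : ℝ) : ℂ) - 1 = ((s.re - 1 : ℝ) : ℂ) by push_cast; ring, Complex.norm_real,
      Real.norm_of_nonneg (by linarith)]
  rw [h4] at h3
  simp only [ofReal_im, abs_zero, zero_add] at h3
  have h5 := Complex.re_le_norm (riemannZeta ((s.re : ℝ) : ℂ))
  have hp : 0 < s.re - 1 := by linarith
  rw [h2] at h1
  refine (h1.trans h5).trans (h3.trans ?_)
  rw [add_div, add_le_add_iff_left, le_div_iff₀ hp]
  have : 0 < C * 2 ^ (1 / 2 : ℝ) := by positivity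
  nlinarith

lemma vt_L_lower_far : ∃ c : ℝ, 0 < c ∧ ∀ (q : ℕ) [NeZero q] (χ : DirichletCharacter ℂ q) (s : ℂ), 1 < s.re →
    s.re ≤ 3 → c * (s.re - 1) ≤ ‖DirichletCharacter.LFunction χ s‖ := by
  obtain ⟨C, hC, h⟩ := vt_dir_bound
  refine ⟨1 / C, by positivity, fun q _ χ s hs hs3 => ?_⟩
  have h1 := DirichletCharacter.LSeries.mul_mu_eq_one χ hs
  rw [← DirichletCharacter.LFunction_eq_LSeries χ hs] at h1
  have h2 := congrArg norm h1
  rw [norm_mul, norm_one] at h2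
  have h3 := h ((fun n : ℕ => χ n) * fun n => (ArithmeticFunction.moebius n : ℂ)) (fun n => by
    simp only [Pi.mul_apply, norm_mul]
    refine mul_le_one₀ (χ.norm_le_one _) (norm_nonneg _) ?_
    rw [Complex.norm_intCast]
    exact_mod_cast ArithmeticFunction.abs_moebius_le_one) s hs hs3
  have hp : 0 < s.re - 1 := by linarith
  have h4 : 1 ≤ ‖DirichletCharacter.LFunction χ s‖ * (C / (s.re - 1)) :=
    h2.symm.le.trans (by gcongr)
  rw [← mul_div_assoc, le_div_iff₀ hp] at h4
  rw [div_mul_eq_mul_div, div_le_iff₀ (by linarith)]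
  exact h4

lemma vt_341 : ∃ c : ℝ, 0 < c ∧ ∀ (q : ℕ) [NeZero q] (χ : DirichletCharacter ℂ q) (x t B : ℝ), 0 < x → x ≤ 1 →
    0 < B → ‖DirichletCharacter.LFunction (χ ^ 2) (1 + x + 2 * I * t)‖ ≤ B →
    c * x ^ 3 / B ≤ ‖DirichletCharacter.LFunction χ (1 + x + I * t)‖ ^ 4 := by
  obtain ⟨C, hC, h⟩ := vt_dir_bound
  refine ⟨1 / C ^ 3, by positivity, fun q _ χ x t B hx hx1 hB hb => ?_⟩
  have h1 := DirichletCharacter.norm_LFunction_product_ge_one χ hx t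
  have hre : 1 < (1 + (x : ℂ)).re := by simpa using hx
  have h2 : ‖DirichletCharacter.LFunctionTrivChar q (1 + x)‖ ≤ C / x := by
    have := h (fun n => (1 : DirichletCharacter ℂ q) n) (fun n => DirichletCharacter.norm_le_one _ _) (1 + x) hre
      (by simp; linarith)
    rw [← DirichletCharacter.LFunction_eq_LSeries _ hre] at this
    simpa using this
  rw [norm_mul, norm_mul, norm_pow, norm_pow] at h1
  have h3 : 1 ≤ (C / x) ^ 3 * ‖DirichletCharacter.LFunction χ (1 + x + I * t)‖ ^ 4 * B :=
    h1.le.trans (by gcongr)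
  rw [div_pow] at h3
  rw [div_le_iff₀ hB, div_mul_eq_mul_div, div_le_iff₀ (by positivity), one_mul]
  have hx3 : 0 < x ^ 3 := by positivity
  calc x ^ 3 = x ^ 3 * 1 := by ring
    _ ≤ x ^ 3 * (C ^ 3 / x ^ 3 * ‖DirichletCharacter.LFunction χ (1 + x + I * t)‖ ^ 4 * B) := by gcongr
    _ = _ := by field_simp

lemma vt_lower_abs {f : ℂ → ℂ} {t a D σ : ℝ} (ha : 0 < a) (hD : 0 < D) (haD : a ≤ D)
    (hσ : 1 < σ) (hσ2 : σ ≤ 2)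
    (hf : ∀ x : ℝ, 1 < x → x ≤ 2 → DifferentiableAt ℂ f (x + I * t) ∧ ‖deriv f (x + I * t)‖ ≤ D)
    (hl : ∀ x : ℝ, 0 < x → x ≤ 1 → a ^ 4 * x ^ 3 ≤ ‖f (1 + x + I * t)‖ ^ 4) :
    a ^ 4 / (16 * D ^ 3) ≤ ‖f (σ + I * t)‖ := by
  set y := a / (2 * D) with hy
  have hy0 : 0 < y := by positivity
  have hy1 : y ≤ 1 / 2 := by rw [hy, div_le_iff₀ (by positivity)]; linarith
  have hya : y * D * 2 = a := by rw [hy]; field_simp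
  have hgoal : a ^ 4 / (16 * D ^ 3) = a * y ^ 3 / 2 := by rw [hy]; field_simp; norm_num
  have hy4 : y ^ 4 ≤ 1 := pow_le_one₀ hy0.le (by linarith)
  have key : ∀ x : ℝ, y ^ 4 ≤ x → x ≤ 1 → a * y ^ 3 ≤ ‖f (1 + x + I * t)‖ := by
    intro x hx hx1
    have hx0 : 0 < x := lt_of_lt_of_le (by positivity) hx
    have h1 := hl x hx0 hx1
    refine le_of_pow_le_pow_left₀ (n := 4) (by norm_num) (norm_nonneg _) (le_trans ?_ h1)
    rw [mul_pow]
    gcongr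
    calc (y ^ 3) ^ 4 = (y ^ 4) ^ 3 := by ring
      _ ≤ x ^ 3 := by gcongr
  rw [hgoal]
  by_cases hx : y ^ 4 ≤ σ - 1
  · have := key (σ - 1) hx (by linarith)
    rw [show (1 : ℂ) + ((σ - 1 : ℝ) : ℂ) = σ by push_cast; ring] at this
    have h3 : 0 < a * y ^ 3 := by positivity
    linarith
  · rw [not_le] at hx
    have h1 := key (y ^ 4) le_rfl hy4
    have hmv : ‖f ((1 + y ^ 4 : ℝ) + I * t) - f (σ + I * t)‖ ≤ D * ‖((1 + y ^ 4 : ℝ) : ℂ) + I * t - (σ + I * t)‖ := by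
      have hconv : Convex ℝ {z : ℂ | 1 < z.re ∧ z.re ≤ 2 ∧ z.im = t} := by
        have e : {z : ℂ | 1 < z.re ∧ z.re ≤ 2 ∧ z.im = t} =
          {z : ℂ | 1 < z.re} ∩ {z : ℂ | z.re ≤ 2} ∩ {z : ℂ | z.im = t} := by
          ext z; simp [and_assoc]
        rw [e]
        refine ((convex_halfSpace_re_gt 1).inter (convex_halfSpace_re_le 2)).inter ?_
        exact convex_hyperplane (IsLinearMap.mk Complex.add_im (fun c z => by simp)) t
      have hz : ∀ z ∈ {z : ℂ | 1 < z.re ∧ z.re ≤ 2 ∧ z.im = t}, DifferentiableAt ℂ f z ∧ ‖deriv f z‖ ≤ D := by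
        rintro z ⟨h1, h2, h3⟩
        have e : z = (z.re : ℂ) + I * t := by apply Complex.ext <;> simp [h3]
        rw [e]
        exact hf z.re h1 h2
      refine Convex.norm_image_sub_le_of_norm_deriv_le (fun z h => (hz z h).1) (fun z h => (hz z h).2) hconv ?_ ?_
      · simp [hσ, hσ2]
      · have : 0 < y ^ 4 := by positivity
        simp [-ofReal_add, -ofReal_pow]
        exact ⟨this, by linarith⟩
    have h2 : ‖((1 + y ^ 4 : ℝ) : ℂ) + I * t - (σ + I * t)‖ ≤ y ^ 4 := by
      rw [show ((1 + y ^ 4 : ℝ) : ℂ) + I * t - (σ + I * t) = ((1 + y ^ 4 - σ : ℝ) : ℂ) by push_cast; ring,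
        Complex.norm_real, Real.norm_of_nonneg (by linarith)]
      linarith
    have h3 := norm_sub_norm_le (f ((1 + y ^ 4 : ℝ) + I * t)) (f (σ + I * t))
    have h4 : D * ‖((1 + y ^ 4 : ℝ) : ℂ) + I * t - (σ + I * t)‖ ≤ a * y ^ 3 / 2 := by
      calc _ ≤ D * y ^ 4 := by gcongr
        _ = (y * D * 2) * y ^ 3 / 2 := by ring
        _ = _ := by rw [hya]
    rw [show (1 : ℂ) + ((y ^ 4 : ℝ) : ℂ) = ((1 + y ^ 4 : ℝ) : ℂ) by push_cast; ring] at h1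
    linarith

lemma vt_triv_bound {ε : ℝ} (hε : 0 < ε) (hε2 : ε ≤ 1 / 2) : ∃ C : ℝ, 1 ≤ C ∧ ∀ (q : ℕ) [NeZero q] (s : ℂ),
    1 < s.re → s.re ≤ 4 → ‖DirichletCharacter.LFunction (1 : DirichletCharacter ℂ q) s‖ ≤
      1 / ‖s - 1‖ + C * ((q : ℝ) * (|s.im| + 2)) ^ ε := by
  obtain ⟨C1, hC1, h1⟩ := vt_zeta_bound' hε hε2
  obtain ⟨C2, hC2, h2⟩ := vt_LFunction_bound hε hε2
  refine ⟨C1 + C2, by linarith, fun q _ s hs hs4 => ?_⟩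
  have hq : (1 : ℝ) ≤ q := by exact_mod_cast NeZero.one_le
  set w : ℝ := (q.totient : ℝ) / q with hw
  have hw0 : 0 ≤ w := by positivity
  have hw1 : w ≤ 1 := by
    rw [hw, div_le_one (by linarith)]
    exact_mod_cast Nat.totient_le q
  set Φ : ZMod q → ℂ := fun j => (1 : DirichletCharacter ℂ q) j - (w : ℂ) with hΦ
  have hs0 : ∑ j, Φ j = 0 := by
    classical
    have hqc : (q : ℂ) ≠ 0 := by exact_mod_cast NeZero.ne q
    simp only [hΦ, Finset.sum_sub_distrib, MulChar.sum_one_eq_card_units, ZMod.card_units_eq_totient,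
      Finset.sum_const, Finset.card_univ, ZMod.card, nsmul_eq_mul, hw]
    push_cast
    field_simp
    ring
  have hs1 : ∀ j, ‖Φ j‖ ≤ 1 := by
    intro j
    have hval : (1 : DirichletCharacter ℂ q) j = 0 ∨ (1 : DirichletCharacter ℂ q) j = 1 := by
      by_cases hj : IsUnit j
      · right; exact MulChar.one_apply hj
      · left; exact MulChar.map_nonunit _ hj
    simp only [hΦ]
    rcases hval with h | h <;> rw [h]
    · rw [zero_sub, norm_neg, Complex.norm_real, Real.norm_of_nonneg hw0]; exact hw1
    · rw [show (1 : ℂ) - w = ((1 - w : ℝ) : ℂ) by push_cast; ring, Complex.norm_real,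
        Real.norm_of_nonneg (by linarith)]; linarith
  have hdec : DirichletCharacter.LFunction (1 : DirichletCharacter ℂ q) s = ZMod.LFunction Φ s + w * riemannZeta s := by
    rw [DirichletCharacter.LFunction_eq_LSeries _ hs, ZMod.LFunction_eq_LSeries Φ hs,
      ← LSeries_one_eq_riemannZeta hs]
    have s1 : LSeriesSummable (fun n : ℕ => (1 : DirichletCharacter ℂ q) n) s :=
      DirichletCharacter.LSeriesSummable_of_one_lt_re _ hs
    have s2 : LSeriesSummable ((w : ℂ) • (1 : ℕ → ℂ)) s := (LSeriesSummable_one_iff.2 hs).smul _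
    have := LSeries_sub s1 s2
    rw [LSeries_smul] at this
    have e : (fun x : ℕ => Φ x) = (fun n : ℕ => (1 : DirichletCharacter ℂ q) n) - (w : ℂ) • (1 : ℕ → ℂ) := by
      ext n; simp [hΦ]
    rw [e, this]; simp
  have hne : s ≠ 1 := by rintro rfl; simp at hs
  have b1 := h1 s (by linarith) hs4 hne
  have b2 := h2 q Φ hs0 hs1 s (by linarith) hs4
  rw [hdec]
  refine (norm_add_le _ _).trans ?_
  rw [norm_mul, Complex.norm_real, Real.norm_of_nonneg hw0]
  have b3 : (|s.im| + 2) ^ ε ≤ ((q : ℝ) * (|s.im| + 2)) ^ ε := by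
    apply Real.rpow_le_rpow (by positivity) _ hε.le
    nlinarith [abs_nonneg s.im]
  calc _ ≤ C2 * ((q : ℝ) * (|s.im| + 2)) ^ ε + 1 * (1 / ‖s - 1‖ + C1 * ((q : ℝ) * (|s.im| + 2)) ^ ε) := by
        gcongr
        exact b1.trans (by gcongr)
    _ = _ := by ring
end P3a


section P3b
open Complex

lemma vt_rpow_two {Q e : ℝ} (hQ : 0 < Q) (he1 : e ≤ 1) {R : ℝ} (hR0 : 0 ≤ R) (hR : R ≤ 2 * Q)
    (he : 0 < e) : R ^ e ≤ 2 * Q ^ e := by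
  calc R ^ e ≤ (2 * Q) ^ e := Real.rpow_le_rpow hR0 hR he.le
    _ = 2 ^ e * Q ^ e := Real.mul_rpow (by norm_num) hQ.le
    _ ≤ 2 * Q ^ e := by
      gcongr
      exact (Real.rpow_le_rpow_of_exponent_le (by norm_num) he1).trans_eq (Real.rpow_one 2)

lemma vt_sphere {s z : ℂ} {r : ℝ} (hz : z ∈ Metric.closedBall s r) :
    s.re - r ≤ z.re ∧ z.re ≤ s.re + r ∧ |z.im| ≤ |s.im| + r := by
  rw [mem_closedBall_iff_norm] at hz
  have h1 := (Complex.abs_re_le_norm (z - s)).trans hz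
  have h2 := (Complex.abs_im_le_norm (z - s)).trans hz
  rw [Complex.sub_re, abs_le] at h1
  rw [Complex.sub_im] at h2
  have h3 := abs_sub_abs_le_abs_sub z.im s.im
  refine ⟨by linarith, by linarith, by linarith⟩

lemma vt_L_deriv {e : ℝ} (he : 0 < e) (he2 : e ≤ 1 / 2) : ∃ D : ℝ, 1 ≤ D ∧ ∀ (q : ℕ) [NeZero q]
    (χ : DirichletCharacter ℂ q), χ ≠ 1 → ∀ s : ℂ, 1 - e / 2 ≤ s.re → s.re ≤ 3 →
    ‖deriv (DirichletCharacter.LFunction χ) s‖ ≤ D * ((q : ℝ) * (|s.im| + 2)) ^ e := by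
  obtain ⟨C, hC, h⟩ := vt_chi_bound he he2
  refine ⟨2 * C / (e / 2), ?_, fun q _ χ hχ s hs hs3 => ?_⟩
  · rw [le_div_iff₀ (by linarith)]; linarith
  have hq : (1 : ℝ) ≤ q := by exact_mod_cast NeZero.one_le
  have := Complex.norm_deriv_le_of_forall_mem_sphere_norm_le (c := s) (R := e / 2)
    (C := 2 * C * ((q : ℝ) * (|s.im| + 2)) ^ e) (by linarith)
    (DirichletCharacter.differentiable_LFunction hχ).diffContOnCl (fun z hz => by
      obtain ⟨h1, h2, h3⟩ := vt_sphere (Metric.sphere_subset_closedBall hz)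
      refine (h q χ hχ z (by linarith) (by linarith)).trans ?_
      rw [mul_comm 2 C, mul_assoc]
      gcongr
      apply vt_rpow_two (by positivity) (by linarith) (by positivity) _ he
      nlinarith [abs_nonneg s.im])
  rw [div_mul_eq_mul_div]
  exact this

lemma vt_zeta_deriv {e : ℝ} (he : 0 < e) (he2 : e ≤ 1 / 2) : ∃ D : ℝ, 1 ≤ D ∧ ∀ s : ℂ, 1 - e / 2 ≤ s.re →
    s.re ≤ 3 → 1 ≤ |s.im| → ‖deriv riemannZeta s‖ ≤ D * (|s.im| + 2) ^ e := by
  obtain ⟨C, hC, h⟩ := vt_zeta_bound' he he2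
  refine ⟨(2 + 2 * C) / (e / 2), ?_, fun s hs hs3 ht => ?_⟩
  · rw [le_div_iff₀ (by linarith)]; linarith
  have hne : ∀ z ∈ Metric.closedBall s (e / 2), 1 / 2 ≤ ‖z - 1‖ := by
    intro z hz
    rw [mem_closedBall_iff_norm] at hz
    have h2 := Complex.abs_im_le_norm (z - s)
    have h3 := Complex.abs_im_le_norm (z - 1)
    simp only [sub_im, one_im, sub_zero] at h2 h3
    have h4 := abs_sub_abs_le_abs_sub s.im z.im
    rw [abs_sub_comm s.im] at h4
    linarith
  have := Complex.norm_deriv_le_of_forall_mem_sphere_norm_le (c := s) (R := e / 2) (f := riemannZeta)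
    (C := (2 + 2 * C) * (|s.im| + 2) ^ e) (by linarith)
    (by
      apply DifferentiableOn.diffContOnCl
      rw [closure_ball _ (by linarith)]
      intro z hz
      refine (differentiableAt_riemannZeta ?_).differentiableWithinAt
      rintro rfl
      have := hne 1 hz
      norm_num at this) (fun z hz => by
      have hz' := Metric.sphere_subset_closedBall hz
      obtain ⟨h1, h2, h3⟩ := vt_sphere hz'
      have h4 := hne z hz'
      have h5 : z ≠ 1 := by rintro rfl; norm_num at h4
      refine (h z (by linarith) (by linarith) h5).trans ?_
      have h6 : 1 / ‖z - 1‖ ≤ 2 := by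
        rw [div_le_iff₀ (by linarith)]; linarith
      have h7 : (|z.im| + 2) ^ e ≤ 2 * (|s.im| + 2) ^ e := by
        apply vt_rpow_two (by positivity) (by linarith) (by positivity) _ he
        nlinarith [abs_nonneg s.im]
      have h8 : 1 ≤ (|s.im| + 2) ^ e := Real.one_le_rpow (by linarith [abs_nonneg s.im]) he.le
      nlinarith)
  rw [div_mul_eq_mul_div]
  exact this

/-- 3-4-1 combined with the derivative bound -/
lemma vt_lower_B : ∃ c : ℝ, 0 < c ∧ ∀ (q : ℕ) [NeZero q] (χ : DirichletCharacter ℂ q) (t B D σ : ℝ), 1 ≤ B →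
    1 ≤ D → 1 < σ → σ ≤ 2 →
    (∀ x : ℝ, 1 < x → x ≤ 2 → DifferentiableAt ℂ (DirichletCharacter.LFunction χ) (x + I * t) ∧
      ‖deriv (DirichletCharacter.LFunction χ) (x + I * t)‖ ≤ D) →
    (∀ x : ℝ, 0 < x → x ≤ 1 → ‖DirichletCharacter.LFunction (χ ^ 2) (1 + x + 2 * I * t)‖ ≤ B) →
    c / (B * D ^ 3) ≤ ‖DirichletCharacter.LFunction χ (σ + I * t)‖ := by
  obtain ⟨c0, hc0, h⟩ := vt_341
  set c := min c0 1 with hc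
  have hcpos : 0 < c := lt_min hc0 one_pos
  refine ⟨c / 16, by positivity, fun q _ χ t B D σ hB hD hσ hσ2 hd hb => ?_⟩
  set a := (c / B) ^ (1 / 4 : ℝ) with ha
  have hapos : 0 < a := by positivity
  have ha4 : a ^ 4 = c / B := by
    rw [ha, ← Real.rpow_natCast, ← Real.rpow_mul (by positivity)]; norm_num
  have ha1 : a ≤ 1 := by
    apply Real.rpow_le_one (by positivity) _ (by norm_num)
    rw [div_le_one (by linarith)]
    exact (min_le_right _ _).trans hB
  have := vt_lower_abs (f := DirichletCharacter.LFunction χ) hapos (by linarith) (ha1.trans hD) hσ hσ2 hd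
    (fun x hx hx1 => by
      rw [ha4]
      refine le_trans ?_ (h q χ x t B hx hx1 (by linarith) (hb x hx hx1))
      rw [div_mul_eq_mul_div]
      gcongr
      exact min_le_left _ _)
  rw [ha4] at this
  convert this using 1
  field_simp

lemma vt_Q_two {q : ℕ} [NeZero q] (t : ℝ) : 2 ≤ (q : ℝ) * (|t| + 2) := by
  have hq : (1 : ℝ) ≤ q := by exact_mod_cast NeZero.one_le
  nlinarith [abs_nonneg t]

set_option maxHeartbeats 1000000 in
lemma vt_L_lower {ε : ℝ} (hε : 0 < ε) : ∃ c : ℝ, 0 < c ∧ ∀ (q : ℕ) [NeZero q] (χ : DirichletCharacter ℂ q),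
    χ ≠ 1 → ∀ s : ℂ, 1 < s.re → s.re ≤ 2 →
    c * ((q : ℝ) * (|s.im| + 2)) ^ (-ε) ≤ ‖DirichletCharacter.LFunction χ s‖ := by
  set e := min ε 1 / 5 with he
  have he0 : 0 < e := by have := lt_min hε one_pos; positivity
  have he2 : e ≤ 1 / 2 := by have := min_le_right ε 1; rw [he]; linarith
  have hee : 5 * e ≤ ε := by have := min_le_left ε 1; rw [he]; linarith
  obtain ⟨C, hC, hCb⟩ := vt_chi_bound he0 he2
  obtain ⟨D, hD, hDb⟩ := vt_L_deriv he0 he2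
  obtain ⟨C0, hC0, hCb0⟩ := vt_triv_bound he0 he2
  obtain ⟨cS, hcS, hS⟩ := vt_siegel he0
  obtain ⟨cf, hcf, hfar⟩ := vt_L_lower_far
  obtain ⟨cB, hcB, hlB⟩ := vt_lower_B
  set η := min (cS / (4 * D)) 1 with hη
  have hη0 : 0 < η := lt_min (by positivity) one_pos
  set B1 := 2 * C + 1 / η + 2 * C0 with hB1
  have hB1' : 0 < B1 := by positivity
  set c := min (min (cf * η) (cS / 2)) (cB / (B1 * D ^ 3)) with hc
  refine ⟨c, lt_min (lt_min (by positivity) (by positivity)) (by positivity), ?_⟩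
  intro q _ χ hχ s hs hs2
  have hq : (1 : ℝ) ≤ q := by exact_mod_cast NeZero.one_le
  set Q := (q : ℝ) * (|s.im| + 2) with hQ
  have hQ2 : 2 ≤ Q := vt_Q_two _
  have hQ1 : 1 ≤ Q := by linarith
  have hQ0 : 0 < Q := by linarith
  -- monotonicity of powers
  have hmono : ∀ k : ℝ, k ≤ ε → Q ^ (-ε) ≤ Q ^ (-k) := fun k hk =>
    Real.rpow_le_rpow_of_exponent_le hQ1 (by linarith)
  have hseq : s = (s.re : ℂ) + I * s.im := by rw [mul_comm]; exact (Complex.re_add_im s).symm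
  have hQe1 : 1 ≤ Q ^ e := Real.one_le_rpow hQ1 he0.le
  have hder : ∀ x : ℝ, 1 < x → x ≤ 2 → DifferentiableAt ℂ (DirichletCharacter.LFunction χ) (x + I * s.im) ∧
      ‖deriv (DirichletCharacter.LFunction χ) (x + I * s.im)‖ ≤ D * Q ^ e := by
    intro x hx hx2
    refine ⟨(DirichletCharacter.differentiable_LFunction hχ) _, ?_⟩
    have := hDb q χ hχ (x + I * s.im) (by simp; linarith) (by simp; linarith)
    simpa using this
  have hfinB : (∀ x : ℝ, 0 < x → x ≤ 1 → ‖DirichletCharacter.LFunction (χ ^ 2) (1 + x + 2 * I * s.im)‖ ≤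
      B1 * Q ^ (2 * e)) → c * Q ^ (-ε) ≤ ‖DirichletCharacter.LFunction χ s‖ := by
    intro hb
    have hQe2 : 1 ≤ Q ^ (2 * e) := Real.one_le_rpow hQ1 (by linarith)
    have hB11 : 1 ≤ B1 := by
      have : 0 < 1 / η := by positivity
      linarith
    have h1 := hlB q χ s.im (B1 * Q ^ (2 * e)) (D * Q ^ e) s.re (by nlinarith) (by nlinarith) hs hs2 hder hb
    rw [← hseq] at h1
    refine le_trans ?_ h1
    have h2 : cB / (B1 * Q ^ (2 * e) * (D * Q ^ e) ^ 3) = cB / (B1 * D ^ 3) * Q ^ (-(5 * e)) := by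
      rw [Real.rpow_neg hQ0.le, show 5 * e = 2 * e + e * (3 : ℕ) by push_cast; ring, Real.rpow_add hQ0,
        Real.rpow_mul hQ0.le e, Real.rpow_natCast]
      field_simp
    rw [h2]
    gcongr
    exact min_le_right _ _
  have hR : ∀ x : ℝ, |(1 + (x : ℂ) + 2 * I * s.im).im| = 2 * |s.im| := by
    intro x
    simp [abs_mul]
  have hQ' : (q : ℝ) * (2 * |s.im| + 2) ≤ 2 * Q := by
    rw [hQ]; nlinarith [abs_nonneg s.im]
  have hQ'' : ((q : ℝ) * (2 * |s.im| + 2)) ^ e ≤ 2 * Q ^ e :=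
    vt_rpow_two hQ0 (by linarith) (by positivity) hQ' he0
  have hQe12 : Q ^ e ≤ Q ^ (2 * e) := Real.rpow_le_rpow_of_exponent_le hQ1 (by linarith)
  by_cases hχ2 : χ ^ 2 = 1
  · set x1 := η * Q ^ (-(2 * e)) with hx1
    have hx1pos : 0 < x1 := by positivity
    by_cases h1 : x1 ≤ s.re - 1
    · refine le_trans ?_ (hfar q χ s hs (by linarith))
      calc c * Q ^ (-ε) ≤ (cf * η) * Q ^ (-(2 * e)) := by
            gcongr
            · exact (min_le_left _ _).trans (min_le_left _ _)
            · linarith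
        _ = cf * x1 := by rw [hx1]; ring
        _ ≤ _ := by gcongr
    rw [not_le] at h1
    by_cases h2 : |s.im| ≤ x1
    · have hL1 := hS q χ hχ2 hχ
      have hconv : Convex ℝ {z : ℂ | 1 ≤ z.re ∧ z.re ≤ 2 ∧ |z.im| ≤ |s.im|} := by
        have e : {z : ℂ | 1 ≤ z.re ∧ z.re ≤ 2 ∧ |z.im| ≤ |s.im|} =
          ({z : ℂ | 1 ≤ z.re} ∩ {z : ℂ | z.re ≤ 2}) ∩ ({z : ℂ | -|s.im| ≤ z.im} ∩ {z : ℂ | z.im ≤ |s.im|}) := by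
          ext z; simp [abs_le, and_assoc]
        rw [e]
        exact ((convex_halfSpace_re_ge 1).inter (convex_halfSpace_re_le 2)).inter
          ((convex_halfSpace_im_ge _).inter (convex_halfSpace_im_le _))
      have hmv := Convex.norm_image_sub_le_of_norm_deriv_le (𝕜 := ℂ) (f := DirichletCharacter.LFunction χ)
        (C := D * Q ^ e) (x := s) (y := 1) (s := {z : ℂ | 1 ≤ z.re ∧ z.re ≤ 2 ∧ |z.im| ≤ |s.im|})
        (fun z _ => (DirichletCharacter.differentiable_LFunction hχ) z)
        (fun z hz => by
          obtain ⟨a1, a2, a3⟩ := hz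
          refine (hDb q χ hχ z (by linarith) (by linarith)).trans ?_
          gcongr
          rw [hQ]
          gcongr) hconv ⟨hs.le, hs2, le_rfl⟩ ⟨by simp, by norm_num, by simp⟩
      have hn : ‖1 - s‖ ≤ 2 * x1 := by
        have := Complex.norm_le_abs_re_add_abs_im (1 - s)
        simp only [sub_re, one_re, sub_im, one_im, zero_sub, abs_neg] at this
        rw [abs_sub_comm, abs_of_pos (by linarith : 0 < s.re - 1)] at this
        linarith
      have h3 := norm_sub_norm_le (DirichletCharacter.LFunction χ 1) (DirichletCharacter.LFunction χ s)
      have h4 : D * Q ^ e * ‖1 - s‖ ≤ cS / 2 * Q ^ (-e) := by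
        have h5 : Q ^ e * Q ^ (-(2 * e)) = Q ^ (-e) := by
          rw [← Real.rpow_add hQ0]; congr 1; ring
        calc _ ≤ D * Q ^ e * (2 * x1) := by gcongr
          _ = 2 * D * η * (Q ^ e * Q ^ (-(2 * e))) := by rw [hx1]; ring
          _ = 2 * D * η * Q ^ (-e) := by rw [h5]
          _ ≤ 2 * D * (cS / (4 * D)) * Q ^ (-e) := by gcongr; exact min_le_left _ _
          _ = _ := by field_simp; norm_num
      have h6 : cS * Q ^ (-e) ≤ (DirichletCharacter.LFunction χ 1).re := by
        refine le_trans ?_ hL1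
        have : Q ^ (-e) ≤ (q : ℝ) ^ (-e) := by
          apply Real.rpow_le_rpow_of_nonpos (by linarith) _ (by linarith)
          rw [hQ]; nlinarith [abs_nonneg s.im]
        gcongr
      have h7 := Complex.re_le_norm (DirichletCharacter.LFunction χ 1)
      calc c * Q ^ (-ε) ≤ cS / 2 * Q ^ (-e) := by
            gcongr
            · exact (min_le_left _ _).trans (min_le_right _ _)
            · linarith
        _ ≤ _ := by linarith
    · rw [not_le] at h2
      apply hfinB
      intro x hx hx1'
      rw [hχ2]
      have := hCb0 q (1 + x + 2 * I * s.im) (by simp [hx]) (by simp; linarith)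
      rw [hR] at this
      refine this.trans ?_
      have h3 : 1 / ‖(1 + (x : ℂ) + 2 * I * s.im) - 1‖ ≤ 1 / x1 := by
        apply one_div_le_one_div_of_le hx1pos
        have := Complex.abs_im_le_norm ((1 + (x : ℂ) + 2 * I * s.im) - 1)
        rw [Complex.sub_im, one_im, sub_zero, hR] at this
        linarith [abs_nonneg s.im]
      have h4 : 1 / x1 = 1 / η * Q ^ (2 * e) := by
        rw [hx1, Real.rpow_neg hQ0.le]; field_simp
      rw [h4] at h3
      have h5 : 0 < Q ^ (2 * e) := by positivity
      calc _ ≤ 1 / η * Q ^ (2 * e) + C0 * (2 * Q ^ e) := by gcongr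
        _ ≤ 1 / η * Q ^ (2 * e) + C0 * (2 * Q ^ (2 * e)) := by gcongr
        _ ≤ 1 / η * Q ^ (2 * e) + C0 * (2 * Q ^ (2 * e)) + 2 * C * Q ^ (2 * e) :=
            le_add_of_nonneg_right (by positivity)
        _ = _ := by rw [hB1]; ring
  · apply hfinB
    intro x hx hx1'
    have := hCb q (χ ^ 2) hχ2 (1 + x + 2 * I * s.im) (by simp; linarith) (by simp; linarith)
    rw [hR] at this
    refine this.trans ?_
    have h5 : 0 < Q ^ (2 * e) := by positivity
    have h6 : 0 < 1 / η := by positivity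
    calc _ ≤ C * (2 * Q ^ e) := by gcongr
      _ ≤ C * (2 * Q ^ (2 * e)) := by gcongr
      _ ≤ C * (2 * Q ^ (2 * e)) + (1 / η + 2 * C0) * Q ^ (2 * e) :=
            le_add_of_nonneg_right (by positivity)
      _ = _ := by rw [hB1]; ring

lemma vt_zeta_lower {ε : ℝ} (hε : 0 < ε) : ∃ c : ℝ, 0 < c ∧ ∀ s : ℂ, 1 < s.re → s.re ≤ 2 → 1 ≤ |s.im| →
    c * (|s.im| + 2) ^ (-ε) ≤ ‖riemannZeta s‖ := by
  set e := min ε 1 / 5 with he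
  have he0 : 0 < e := by have := lt_min hε one_pos; positivity
  have he2 : e ≤ 1 / 2 := by have := min_le_right ε 1; rw [he]; linarith
  have hee : 5 * e ≤ ε := by have := min_le_left ε 1; rw [he]; linarith
  obtain ⟨C, hC, hCb⟩ := vt_zeta_bound' he0 he2
  obtain ⟨D, hD, hDb⟩ := vt_zeta_deriv he0 he2
  obtain ⟨cB, hcB, hlB⟩ := vt_lower_B
  refine ⟨cB / ((1 + 2 * C) * D ^ 3), by positivity, fun s hs hs2 ht => ?_⟩
  set Q := |s.im| + 2 with hQ
  have hQ1 : 1 ≤ Q := by linarith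
  have hQ0 : 0 < Q := by linarith
  have hQe1 : 1 ≤ Q ^ e := Real.one_le_rpow hQ1 he0.le
  have hseq : s = (s.re : ℂ) + I * s.im := by rw [mul_comm]; exact (Complex.re_add_im s).symm
  have hfun : DirichletCharacter.LFunction (1 : DirichletCharacter ℂ 1) = riemannZeta := by
    ext z; rw [DirichletCharacter.LFunction_modOne_eq]
  have hR : ∀ x : ℝ, |(1 + (x : ℂ) + 2 * I * s.im).im| = 2 * |s.im| := by
    intro x
    simp [abs_mul]
  have h1 := hlB 1 1 s.im ((1 + 2 * C) * Q ^ e) (D * Q ^ e) s.re (by nlinarith) (by nlinarith) hs hs2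
    (fun x hx hx2 => by
      rw [hfun]
      refine ⟨differentiableAt_riemannZeta ?_, ?_⟩
      · intro h
        have := congrArg Complex.re h
        simp at this
        linarith
      · have := hDb (x + I * s.im) (by simp; linarith) (by simp; linarith) (by simpa using ht)
        simpa using this)
    (fun x hx hx1 => by
      rw [one_pow, hfun]
      have hne : (1 + (x : ℂ) + 2 * I * s.im) ≠ 1 := by
        intro h
        have := congrArg Complex.re h
        simp at this
        linarith
      refine (hCb _ (by simp; linarith) (by simp; linarith) hne).trans ?_
      rw [hR]
      have h3 : 1 / ‖(1 + (x : ℂ) + 2 * I * s.im) - 1‖ ≤ 1 := by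
        have := Complex.abs_im_le_norm ((1 + (x : ℂ) + 2 * I * s.im) - 1)
        rw [Complex.sub_im, one_im, sub_zero, hR] at this
        rw [div_le_one (by linarith)]
        linarith
      have h4 : (2 * |s.im| + 2) ^ e ≤ 2 * Q ^ e :=
        vt_rpow_two hQ0 (by linarith) (by positivity) (by rw [hQ]; linarith) he0
      nlinarith)
  rw [hfun, ← hseq] at h1
  refine le_trans ?_ h1
  have h2 : cB / ((1 + 2 * C) * Q ^ e * (D * Q ^ e) ^ 3) = cB / ((1 + 2 * C) * D ^ 3) * Q ^ (-(4 * e)) := by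
    rw [Real.rpow_neg hQ0.le, show 4 * e = e + e * (3 : ℕ) by push_cast; ring, Real.rpow_add hQ0,
      Real.rpow_mul hQ0.le, Real.rpow_natCast]
    field_simp
  rw [h2]
  gcongr
  linarith
end P3b


section P4
open Complex

lemma vt_logderiv {f : ℂ → ℂ} {s : ℂ} {r m M : ℝ} (hr : 0 < r) (hm : 0 < m) (k : ℕ)
    {U : Set ℂ} (hU : IsOpen U) (hUs : Metric.closedBall s r ⊆ U)
    (hf : DifferentiableOn ℂ f U) (hM : ∀ z ∈ Metric.closedBall s r, ‖deriv f z‖ ≤ M)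
    (hfs : m ≤ ‖f s‖) (hMr : M * r ≤ m / 2) :
    (∀ z ∈ Metric.closedBall s r, f z ≠ 0) ∧
    ‖iteratedDeriv k (fun z => deriv f z / f z) s‖ ≤ k.factorial * (2 * M / m) / r ^ k := by
  have hM0 : 0 ≤ M := (norm_nonneg _).trans (hM s (Metric.mem_closedBall_self hr.le))
  have hlow : ∀ z ∈ Metric.closedBall s r, m / 2 ≤ ‖f z‖ := by
    intro z hz
    have h1 := Convex.norm_image_sub_le_of_norm_deriv_le (𝕜 := ℂ) (f := f) (C := M) (x := z) (y := s)
      (s := Metric.closedBall s r) (fun w hw => (hf w (hUs hw)).differentiableAt (hU.mem_nhds (hUs hw)))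
      hM (convex_closedBall _ _) hz (Metric.mem_closedBall_self hr.le)
    have h2 : ‖s - z‖ ≤ r := by rw [norm_sub_rev]; exact mem_closedBall_iff_norm.1 hz
    have h3 := norm_sub_norm_le (f s) (f z)
    have h4 : M * ‖s - z‖ ≤ M * r := by gcongr
    linarith
  have hne : ∀ z ∈ Metric.closedBall s r, f z ≠ 0 := by
    intro z hz h
    have := hlow z hz
    rw [h, norm_zero] at this
    linarith
  refine ⟨hne, ?_⟩
  apply Complex.norm_iteratedDeriv_le_of_forall_mem_sphere_norm_le k hr
  · apply DifferentiableOn.diffContOnCl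
    rw [closure_ball _ hr.ne']
    apply DifferentiableOn.div ((hf.deriv hU).mono hUs) (hf.mono hUs) hne
  · intro z hz
    have hz' := Metric.sphere_subset_closedBall hz
    rw [norm_div, div_le_div_iff₀ (by linarith [hlow z hz']) hm]
    have h1 := hM z hz'
    have h2 := hlow z hz'
    have h3 := norm_nonneg (deriv f z)
    calc _ ≤ M * m := by gcongr
      _ = 2 * M * (m / 2) := by ring
      _ ≤ _ := by gcongr

/-- numerics -/
lemma vt_P4_num (k : ℕ) {c D Q e r : ℝ} (hc : 0 < c) (hD : 0 < D) (hQ : 1 ≤ Q) (he : e = 1 / (4 * (k + 1)))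
    {κ : ℝ} (hκ : 0 < κ) (hr : r = κ * Q ^ (-(2 * e))) :
    k.factorial * (2 * (2 * D * Q ^ e) / (c * Q ^ (-e))) / r ^ k =
      (k.factorial * (4 * D / c) / κ ^ k) * Q ^ (1 / 2 : ℝ) := by
  have hQ0 : 0 < Q := by linarith
  have h1 : Q ^ (1 / 2 : ℝ) = Q ^ e * Q ^ e * (Q ^ (2 * e)) ^ k := by
    rw [← Real.rpow_natCast, ← Real.rpow_mul hQ0.le, ← Real.rpow_add hQ0, ← Real.rpow_add hQ0, he]
    congr 1
    have : (k : ℝ) + 1 ≠ 0 := by positivity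
    field_simp; ring
  rw [h1, hr, mul_pow, Real.rpow_neg hQ0.le, Real.rpow_neg hQ0.le]
  have : 0 < Q ^ e := by positivity
  have : 0 < Q ^ (2 * e) := by positivity
  rw [inv_pow]
  have : 0 < (Q ^ (2 * e)) ^ k := by positivity
  field_simp
  norm_num

lemma vt_logderiv_L (k : ℕ) : ∃ C : ℝ, 0 < C ∧ ∀ (q : ℕ) [NeZero q] (χ : DirichletCharacter ℂ q),
    χ ≠ 1 → ∀ s : ℂ, 1 < s.re → s.re ≤ 2 →
    ‖iteratedDeriv k (fun z => deriv (DirichletCharacter.LFunction χ) z / DirichletCharacter.LFunction χ z) s‖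
      ≤ C * ((q : ℝ) * (|s.im| + 2)) ^ (1 / 2 : ℝ) := by
  set e : ℝ := 1 / (4 * (k + 1)) with he
  have he0 : 0 < e := by positivity
  have he2 : e ≤ 1 / 4 := by
    rw [he]; apply one_div_le_one_div_of_le (by norm_num)
    have : (0 : ℝ) ≤ k := by positivity
    linarith
  obtain ⟨D, hD, hDb⟩ := vt_L_deriv he0 (by linarith)
  obtain ⟨c, hc, hcb⟩ := vt_L_lower he0
  set κ := min (e / 2) (c / (4 * D)) with hκ
  have hκ0 : 0 < κ := lt_min (by positivity) (by positivity)
  refine ⟨k.factorial * (4 * D / c) / κ ^ k, by positivity, fun q _ χ hχ s hs hs2 => ?_⟩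
  set Q := (q : ℝ) * (|s.im| + 2) with hQ
  have hq : (1 : ℝ) ≤ q := by exact_mod_cast NeZero.one_le
  have hQ2 : 2 ≤ Q := vt_Q_two _
  have hQ0 : 0 < Q := by linarith
  have hr : κ * Q ^ (-(2 * e)) ≤ κ := by
    apply mul_le_of_le_one_right hκ0.le
    apply Real.rpow_le_one_of_one_le_of_nonpos (by linarith) (by linarith)
  have hκe : κ ≤ e / 2 := min_le_left _ _
  have := (vt_logderiv (f := DirichletCharacter.LFunction χ) (s := s) (r := κ * Q ^ (-(2 * e)))
    (m := c * Q ^ (-e)) (M := 2 * D * Q ^ e) (by positivity) (by positivity) k isOpen_univ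
    (Set.subset_univ _) (DirichletCharacter.differentiable_LFunction hχ).differentiableOn
    (fun z hz => by
      obtain ⟨h1, h2, h3⟩ := vt_sphere hz
      refine (hDb q χ hχ z (by linarith) (by linarith)).trans ?_
      rw [mul_comm 2 D, mul_assoc]
      gcongr
      apply vt_rpow_two (by positivity) (by linarith) (by positivity) _ he0
      rw [hQ]
      nlinarith [abs_nonneg s.im]) (hcb q χ hχ s hs hs2) (by
      have h5 : Q ^ e * Q ^ (-(2 * e)) = Q ^ (-e) := by
        rw [← Real.rpow_add hQ0]; congr 1; ring
      calc _ = 2 * D * κ * (Q ^ e * Q ^ (-(2 * e))) := by ring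
        _ = 2 * D * κ * Q ^ (-e) := by rw [h5]
        _ ≤ 2 * D * (c / (4 * D)) * Q ^ (-e) := by gcongr; exact min_le_right _ _
        _ = _ := by field_simp; norm_num)).2
  rwa [vt_P4_num k hc (by linarith) (by linarith) he hκ0 rfl] at this

lemma vt_logderiv_zeta (k : ℕ) : ∃ C : ℝ, 0 < C ∧ ∀ s : ℂ, 1 < s.re → s.re ≤ 2 → 2 ≤ |s.im| →
    ‖iteratedDeriv k (fun z => -deriv riemannZeta z / riemannZeta z - riemannZeta z) s‖
      ≤ C * (|s.im| + 2) ^ (1 / 2 : ℝ) := by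
  set e : ℝ := 1 / (4 * (k + 1)) with he
  have he0 : 0 < e := by positivity
  have he2 : e ≤ 1 / 4 := by
    rw [he]; apply one_div_le_one_div_of_le (by norm_num)
    have : (0 : ℝ) ≤ k := by positivity
    linarith
  obtain ⟨D, hD, hDb⟩ := vt_zeta_deriv he0 (by linarith)
  obtain ⟨c, hc, hcb⟩ := vt_zeta_lower he0
  obtain ⟨C, hC, hCb⟩ := vt_zeta_bound' he0 (by linarith)
  set κ := min (e / 2) (c / (4 * D)) with hκ
  have hκ0 : 0 < κ := lt_min (by positivity) (by positivity)
  refine ⟨k.factorial * (4 * D / c) / κ ^ k + k.factorial * (2 + 2 * C) / (e / 2) ^ k, by positivity,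
    fun s hs hs2 ht => ?_⟩
  set Q := (|s.im| + 2) with hQ
  have hQ2 : 2 ≤ Q := by linarith
  have hQ0 : 0 < Q := by linarith
  have hr : κ * Q ^ (-(2 * e)) ≤ κ := by
    apply mul_le_of_le_one_right hκ0.le
    apply Real.rpow_le_one_of_one_le_of_nonpos (by linarith) (by linarith)
  have hκe : κ ≤ e / 2 := min_le_left _ _
  have hU : IsOpen {z : ℂ | z ≠ 1} := isOpen_ne
  have hfar : ∀ r ≤ e / 2, ∀ z ∈ Metric.closedBall s r, 1 ≤ |z.im| ∧ z ≠ 1 := by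
    intro r hr z hz
    rw [mem_closedBall_iff_norm] at hz
    have h2 := Complex.abs_im_le_norm (z - s)
    simp only [sub_im] at h2
    have h4 := abs_sub_abs_le_abs_sub s.im z.im
    rw [abs_sub_comm s.im] at h4
    have : 1 ≤ |z.im| := by linarith
    refine ⟨this, ?_⟩
    rintro rfl
    norm_num at this
  have hdz : DifferentiableOn ℂ riemannZeta {z : ℂ | z ≠ 1} :=
    fun z hz => (differentiableAt_riemannZeta hz).differentiableWithinAt
  obtain ⟨hne, hl⟩ := (vt_logderiv (f := riemannZeta) (s := s) (r := κ * Q ^ (-(2 * e)))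
    (m := c * Q ^ (-e)) (M := 2 * D * Q ^ e) (by positivity) (by positivity) k hU
    (fun z hz => (hfar _ (by linarith) z hz).2) hdz
    (fun z hz => by
      obtain ⟨h1, h2, h3⟩ := vt_sphere hz
      refine (hDb z (by linarith) (by linarith) (hfar _ (by linarith) z hz).1).trans ?_
      rw [mul_comm 2 D, mul_assoc]
      gcongr
      apply vt_rpow_two (by positivity) (by linarith) (by positivity) _ he0
      rw [hQ]
      nlinarith [abs_nonneg s.im]) (hcb s hs hs2 (by linarith)) (by
      have h5 : Q ^ e * Q ^ (-(2 * e)) = Q ^ (-e) := by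
        rw [← Real.rpow_add hQ0]; congr 1; ring
      calc _ = 2 * D * κ * (Q ^ e * Q ^ (-(2 * e))) := by ring
        _ = 2 * D * κ * Q ^ (-e) := by rw [h5]
        _ ≤ 2 * D * (c / (4 * D)) * Q ^ (-e) := by gcongr; exact min_le_right _ _
        _ = _ := by field_simp; norm_num))
  rw [vt_P4_num k hc (by linarith) (by linarith) he hκ0 rfl] at hl
  have hz : ‖iteratedDeriv k riemannZeta s‖ ≤ k.factorial * ((2 + 2 * C) * Q ^ e) / (e / 2) ^ k := by
    apply Complex.norm_iteratedDeriv_le_of_forall_mem_sphere_norm_le k (by positivity)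
    · apply DifferentiableOn.diffContOnCl
      rw [closure_ball _ (by positivity)]
      exact hdz.mono (fun z hz => (hfar _ le_rfl z hz).2)
    · intro z hz
      have hz' := Metric.sphere_subset_closedBall hz
      obtain ⟨h1, h2, h3⟩ := vt_sphere hz'
      obtain ⟨h4, h5⟩ := hfar _ le_rfl z hz'
      refine (hCb z (by linarith) (by linarith) h5).trans ?_
      have h6 : 1 / ‖z - 1‖ ≤ 1 := by
        have := Complex.abs_im_le_norm (z - 1)
        simp only [sub_im, one_im, sub_zero] at this
        rw [div_le_iff₀ (by linarith)]; linarith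
      have h7 : (|z.im| + 2) ^ e ≤ 2 * Q ^ e := by
        apply vt_rpow_two (by positivity) (by linarith) (by positivity) _ he0
        rw [hQ]; nlinarith [abs_nonneg s.im]
      have h8 : 1 ≤ Q ^ e := Real.one_le_rpow (by linarith) he0.le
      nlinarith
  have hrpos : 0 < κ * Q ^ (-(2 * e)) := by positivity
  have hsU : s ≠ 1 := (hfar 0 (by positivity) s (by simp)).2
  have hzan : AnalyticAt ℂ riemannZeta s := hdz.analyticAt (hU.mem_nhds hsU)
  have hlan : AnalyticAt ℂ (fun z => deriv riemannZeta z / riemannZeta z) s :=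
    hzan.deriv.div hzan (hne s (Metric.mem_closedBall_self hrpos.le))
  have heq : iteratedDeriv k (fun z => -deriv riemannZeta z / riemannZeta z - riemannZeta z) s =
      -iteratedDeriv k (fun z => deriv riemannZeta z / riemannZeta z) s - iteratedDeriv k riemannZeta s := by
    have h1 : (fun z => -deriv riemannZeta z / riemannZeta z - riemannZeta z) =
      (-(fun z => deriv riemannZeta z / riemannZeta z)) - riemannZeta := by
      ext z; simp [neg_div]
    rw [h1]
    have h2 := iteratedDeriv_sub (n := k) (ContDiffAt.neg hlan.contDiffAt) hzan.contDiffAt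
    refine h2.trans ?_
    congr 1
    exact iteratedDeriv_neg k _ s
  rw [heq]
  refine (norm_sub_le _ _).trans ?_
  rw [norm_neg]
  have h9 : Q ^ e ≤ Q ^ (1 / 2 : ℝ) := Real.rpow_le_rpow_of_exponent_le (by linarith) (by linarith)
  calc _ ≤ _ := add_le_add hl hz
    _ = k.factorial * (4 * D / c) / κ ^ k * Q ^ (1 / 2 : ℝ) +
      k.factorial * (2 + 2 * C) / (e / 2) ^ k * Q ^ e := by ring
    _ ≤ k.factorial * (4 * D / c) / κ ^ k * Q ^ (1 / 2 : ℝ) +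
      k.factorial * (2 + 2 * C) / (e / 2) ^ k * Q ^ (1 / 2 : ℝ) := by gcongr
    _ = _ := by ring

lemma vt_logderiv_zeta_small (k : ℕ) : ∃ C : ℝ, 0 < C ∧ ∀ s : ℂ, 1 < s.re → s.re ≤ 2 → |s.im| ≤ 2 →
    ‖iteratedDeriv k (fun z => -deriv riemannZeta z / riemannZeta z - riemannZeta z) s‖ ≤ C := by
  set H : ℂ → ℂ := fun z => -deriv riemannZeta₁ z / riemannZeta₁ z - riemannZeta₀ z with hH
  set K : Set ℂ := Set.Icc 1 2 ×ℂ Set.Icc (-2) 2 with hK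
  have hKc : IsCompact K := isCompact_Icc.reProdIm isCompact_Icc
  have hz1 : ∀ z : ℂ, 1 ≤ z.re → riemannZeta₁ z ≠ 0 := by
    intro z hz
    rcases eq_or_ne z 1 with rfl | h
    · simp
    · intro h0
      have := riemannZeta_eq_inv_sub_mul h
      rw [h0, mul_zero] at this
      exact riemannZeta_ne_zero_of_one_le_re hz this
  have hHan : ∀ z ∈ K, AnalyticAt ℂ H z := by
    intro z hz
    rw [hK, Complex.mem_reProdIm] at hz
    have a1 := differentiable_riemannZeta₁.analyticAt z
    exact (a1.deriv.neg.div a1 (hz1 z hz.1.1)).sub (differentiable_riemannZeta₀.analyticAt z)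
  have hcont : ContinuousOn (iteratedDeriv k H) K := by
    intro z hz
    have := (hHan z hz).iterated_deriv k
    rw [← iteratedDeriv_eq_iterate] at this
    exact this.continuousAt.continuousWithinAt
  obtain ⟨C, hC⟩ := hKc.exists_bound_of_continuousOn hcont
  refine ⟨max C 1, lt_max_of_lt_right one_pos, fun s hs hs2 ht => ?_⟩
  have hev : (fun z => -deriv riemannZeta z / riemannZeta z - riemannZeta z) =ᶠ[nhds s] H := by
    filter_upwards [(isOpen_lt continuous_const Complex.continuous_re).mem_nhds hs] with z hz
    have hz : 1 < z.re := hz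
    have hne : z ≠ 1 := by rintro rfl; simp at hz
    have hne' : z - 1 ≠ 0 := sub_ne_zero.2 hne
    have hd : deriv riemannZeta z = -(z - 1)⁻¹ ^ 2 * riemannZeta₁ z + (z - 1)⁻¹ * deriv riemannZeta₁ z := by
      have h1 : riemannZeta =ᶠ[nhds z] fun w => (w - 1)⁻¹ * riemannZeta₁ w := by
        filter_upwards [isOpen_ne.mem_nhds hne] with w hw
        exact riemannZeta_eq_inv_sub_mul hw
      rw [h1.deriv_eq]
      have h2 : HasDerivAt (fun w : ℂ => (w - 1)⁻¹) (-(1) / (z - 1) ^ 2) z :=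
        ((hasDerivAt_id z).sub_const 1).inv hne'
      refine (h2.mul (differentiable_riemannZeta₁ z).hasDerivAt).deriv.trans ?_
      field_simp
    have h3 := riemannZeta_eq_inv_sub_mul hne
    have h4 := riemannZeta_eq_inv_sub_add hne
    have h5 := hz1 z hz.le
    show -deriv riemannZeta z / riemannZeta z - riemannZeta z =
      -deriv riemannZeta₁ z / riemannZeta₁ z - riemannZeta₀ z
    have h6 : -deriv riemannZeta z / riemannZeta z = (z - 1)⁻¹ - deriv riemannZeta₁ z / riemannZeta₁ z := by
      rw [hd, h3]; field_simp; ring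
    rw [h6, h4]; ring
  rw [hev.iteratedDeriv_eq k]
  refine (hC s ?_).trans (le_max_left _ _)
  rw [hK, Complex.mem_reProdIm]
  exact ⟨⟨hs.le, hs2⟩, abs_le.1 ht⟩

noncomputable def vtC {q : ℕ} (χ : DirichletCharacter ℂ q) (n : ℕ) : ℂ := χ n * (ArithmeticFunction.vonMangoldt n : ℂ)
noncomputable def vtD (n : ℕ) : ℂ := (ArithmeticFunction.vonMangoldt n : ℂ) - 1

lemma vt_abs_le {a : ℕ → ℂ} (h : ∀ s : ℂ, 1 < s.re → LSeriesSummable a s) {s : ℂ} (hs : 1 < s.re) :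
    LSeries.abscissaOfAbsConv a < s.re := by
  have h1 : LSeries.abscissaOfAbsConv a ≤ (1 : ℝ) :=
    LSeries.abscissaOfAbsConv_le_of_forall_lt_LSeriesSummable (fun y hy => h y (by simpa using hy))
  exact h1.trans_lt (by exact_mod_cast hs)

lemma vtC_summable {q : ℕ} (χ : DirichletCharacter ℂ q) {s : ℂ} (hs : 1 < s.re) : LSeriesSummable (vtC χ) s :=
  DirichletCharacter.LSeriesSummable_twist_vonMangoldt χ hs

lemma vtD_summable {s : ℂ} (hs : 1 < s.re) : LSeriesSummable vtD s :=
  (ArithmeticFunction.LSeriesSummable_vonMangoldt hs).sub (LSeriesSummable_one_iff.2 hs)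

lemma vt_P4_chi (k : ℕ) : ∃ C : ℝ, 0 < C ∧ ∀ (q : ℕ) [NeZero q] (χ : DirichletCharacter ℂ q),
    χ ≠ 1 → ∀ s : ℂ, 1 < s.re → s.re ≤ 2 →
    ‖LSeries (LSeries.logMul^[k] (vtC χ)) s‖ ≤ C * (q : ℝ) ^ (1 / 2 : ℝ) * (|s.im| + 2) ^ (1 / 2 : ℝ) := by
  obtain ⟨C, hC, h⟩ := vt_logderiv_L k
  refine ⟨C, hC, fun q _ χ hχ s hs hs2 => ?_⟩
  have h1 := LSeries_iteratedDeriv k (vt_abs_le (fun s hs => vtC_summable χ hs) hs)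
  have h2 : ‖LSeries (LSeries.logMul^[k] (vtC χ)) s‖ = ‖iteratedDeriv k (LSeries (vtC χ)) s‖ := by
    rw [h1, norm_mul, norm_pow, norm_neg, norm_one, one_pow, one_mul]
  have hev : LSeries (vtC χ) =ᶠ[nhds s]
      -(fun z => deriv (DirichletCharacter.LFunction χ) z / DirichletCharacter.LFunction χ z) := by
    filter_upwards [(isOpen_lt continuous_const Complex.continuous_re).mem_nhds hs] with z hz
    have := DirichletCharacter.LSeries_twist_vonMangoldt_eq χ hz
    have e1 : LSeries (vtC χ) z = _ := this
    rw [e1, ← DirichletCharacter.LFunction_eq_LSeries χ hz, ← DirichletCharacter.deriv_LFunction_eq_deriv_LSeries χ hz]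
    simp [neg_div]
  rw [h2, hev.iteratedDeriv_eq, iteratedDeriv_neg, norm_neg, mul_assoc,
    ← Real.mul_rpow (by positivity) (by positivity)]
  exact h q χ hχ s hs hs2

lemma vt_P4_zeta (k : ℕ) : ∃ C : ℝ, 0 < C ∧ ∀ s : ℂ, 1 < s.re → s.re ≤ 2 →
    ‖LSeries (LSeries.logMul^[k] vtD) s‖ ≤ C * (|s.im| + 2) ^ (1 / 2 : ℝ) := by
  obtain ⟨C, hC, h⟩ := vt_logderiv_zeta k
  obtain ⟨C', hC', h'⟩ := vt_logderiv_zeta_small k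
  refine ⟨max C C', lt_max_of_lt_left hC, fun s hs hs2 => ?_⟩
  have h1 := LSeries_iteratedDeriv k (vt_abs_le (fun s hs => vtD_summable hs) hs)
  have h2 : ‖LSeries (LSeries.logMul^[k] vtD) s‖ = ‖iteratedDeriv k (LSeries vtD) s‖ := by
    rw [h1, norm_mul, norm_pow, norm_neg, norm_one, one_pow, one_mul]
  have hev : LSeries vtD =ᶠ[nhds s] (fun z => -deriv riemannZeta z / riemannZeta z - riemannZeta z) := by
    filter_upwards [(isOpen_lt continuous_const Complex.continuous_re).mem_nhds hs] with z hz
    have e1 : LSeries vtD z = _ := LSeries_sub (ArithmeticFunction.LSeriesSummable_vonMangoldt hz)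
      (LSeriesSummable_one_iff.2 hz)
    rw [e1, ArithmeticFunction.LSeries_vonMangoldt_eq_deriv_riemannZeta_div hz, ← LSeries_one_eq_riemannZeta hz]
    rfl
  rw [h2, hev.iteratedDeriv_eq]
  have h3 : 1 ≤ (|s.im| + 2) ^ (1 / 2 : ℝ) := Real.one_le_rpow (by linarith [abs_nonneg s.im]) (by norm_num)
  rcases le_total 2 |s.im| with h4 | h4
  · refine (h s hs hs2 h4).trans ?_
    gcongr
    exact le_max_left _ _
  · refine (h' s hs hs2 h4).trans ?_
    calc C' ≤ max C C' := le_max_right _ _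
      _ ≤ _ := le_mul_of_one_le_right (hC.le.trans (le_max_left _ _)) h3
end P4


section P5a
open Complex MeasureTheory

noncomputable def vtW (t : ℝ) : ℂ := (Set.Ioc (0 : ℝ) 1).indicator (fun _ => (1 : ℂ)) t -
  (Set.Ioc (0 : ℝ) 1).indicator (fun t : ℝ => (t : ℂ) ^ (1 : ℂ)) t

lemma vtW_of_le {t : ℝ} (h0 : 0 < t) (h1 : t ≤ 1) : vtW t = 1 - t := by
  simp [vtW, h0, h1]

lemma vtW_of_gt {t : ℝ} (h1 : 1 < t) : vtW t = 0 := by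
  simp [vtW, h1, not_le.2 h1]

lemma vtW_cont {t : ℝ} (h0 : 0 < t) : ContinuousAt vtW t := by
  have h : vtW =ᶠ[nhds t] fun t => ((max (1 - t) 0 : ℝ) : ℂ) := by
    filter_upwards [isOpen_Ioi.mem_nhds h0] with y hy
    rcases le_or_gt y 1 with h | h
    · rw [vtW_of_le hy h, max_eq_left (by linarith)]; simp
    · rw [vtW_of_gt h, max_eq_right (by linarith)]; simp
  rw [continuousAt_congr h]
  fun_prop

lemma vtW_mellin {s : ℂ} (hs : 0 < s.re) : HasMellin vtW s (1 / s - 1 / (s + 1)) := by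
  have h1 := hasMellin_one_Ioc hs
  have h2 := hasMellin_cpow_Ioc 1 (s := s) (by simp; linarith)
  have := hasMellin_sub h1.1 h2.1
  rw [h1.2, h2.2] at this
  exact this

noncomputable def vtG (s : ℂ) : ℂ := 1 / s - 1 / (s + 1)

lemma vtG_norm {σ t : ℝ} (hσ : 1 ≤ σ) : ‖vtG (σ + t * I)‖ ≤ (1 + t ^ 2)⁻¹ := by
  set s : ℂ := σ + t * I with hs
  have hre : s.re = σ := by simp [hs]
  have him : s.im = t := by simp [hs]
  have h1 : s ≠ 0 := by intro h; rw [h] at hre; simp at hre; linarith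
  have h2 : s + 1 ≠ 0 := by
    intro h; have := congrArg Complex.re h; simp [hre] at this; linarith
  have e : vtG s = 1 / (s * (s + 1)) := by
    rw [vtG]; field_simp; ring
  rw [e, norm_div, norm_one, norm_mul, one_div]
  have h3 : 1 + t ^ 2 ≤ ‖s‖ ^ 2 := by
    rw [← Complex.normSq_eq_norm_sq, Complex.normSq_apply, hre, him]; nlinarith
  have h4 : ‖s‖ ≤ ‖s + 1‖ := by
    rw [← sq_le_sq₀ (norm_nonneg _) (norm_nonneg _), ← Complex.normSq_eq_norm_sq, ← Complex.normSq_eq_norm_sq,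
      Complex.normSq_apply, Complex.normSq_apply]
    simp [hre, him]; nlinarith
  apply inv_anti₀ (by positivity)
  nlinarith [norm_nonneg s]

lemma vtG_cont {σ : ℝ} (hσ : 1 ≤ σ) : Continuous (fun t : ℝ => vtG (σ + t * I)) := by
  unfold vtG
  apply Continuous.sub
  · apply Continuous.div continuous_const (by fun_prop)
    intro t h; have := congrArg Complex.re h; simp at this; linarith
  · apply Continuous.div continuous_const (by fun_prop)
    intro t h; have := congrArg Complex.re h; simp at this; linarith

lemma vt_int34 : Integrable (fun t : ℝ => (1 + t ^ 2) ^ (-(3 / 4) : ℝ)) := by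
  have := integrable_rpow_neg_one_add_norm_sq (E := ℝ) (μ := volume) (r := 3 / 2) (by simp; norm_num)
  convert this using 2 with t
  rw [Real.norm_eq_abs, sq_abs]; norm_num

lemma vt_int_inv : Integrable (fun t : ℝ => (1 + t ^ 2)⁻¹) := integrable_inv_one_add_sq

lemma vtG_int {σ : ℝ} (hσ : 1 ≤ σ) : Integrable (fun t : ℝ => vtG (σ + t * I)) :=
  vt_int_inv.mono' (vtG_cont hσ).aestronglyMeasurable (ae_of_all _ fun _ => vtG_norm hσ)

lemma vt_perron_one {σ y : ℝ} (hσ : 1 ≤ σ) (hy : 0 < y) :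
    ∫ t : ℝ, (y : ℂ) ^ (-(σ + t * I : ℂ)) * vtG (σ + t * I) = 2 * Real.pi * vtW y := by
  have hm : ∀ t : ℝ, mellin vtW (σ + t * I) = vtG (σ + t * I) := fun t =>
    (vtW_mellin (by simp; linarith)).2
  have h := mellinInv_mellin_eq σ vtW hy (vtW_mellin (s := σ) (by simp; linarith)).1
    (by
      show Integrable (fun t : ℝ => mellin vtW (σ + t * I))
      simp_rw [hm]
      exact vtG_int hσ) (vtW_cont hy)
  rw [mellinInv] at h
  simp_rw [hm, smul_eq_mul] at h
  rw [← h]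
  simp only [Complex.real_smul]
  push_cast
  have h3 : (Real.pi : ℂ) ≠ 0 := by exact_mod_cast Real.pi_ne_zero
  rw [← mul_assoc, mul_one_div, div_self (mul_ne_zero two_ne_zero h3), one_mul]

lemma vt_tau_bound (t : ℝ) : (|t| + 2) ^ (1 / 2 : ℝ) * (1 + t ^ 2)⁻¹ ≤ 2 * (1 + t ^ 2) ^ (-(3 / 4) : ℝ) := by
  have h0 : (0 : ℝ) < 1 + t ^ 2 := by positivity
  have h1 : |t| + 2 ≤ 4 * (1 + t ^ 2) ^ (1 / 2 : ℝ) := by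
    rw [← Real.sqrt_eq_rpow]
    have a1 : |t| ≤ Real.sqrt (1 + t ^ 2) := Real.abs_le_sqrt (by linarith)
    have a2 : 1 ≤ Real.sqrt (1 + t ^ 2) := Real.one_le_sqrt.2 (by nlinarith)
    linarith
  have h2 : (|t| + 2) ^ (1 / 2 : ℝ) ≤ 2 * (1 + t ^ 2) ^ (1 / 4 : ℝ) := by
    calc _ ≤ (4 * (1 + t ^ 2) ^ (1 / 2 : ℝ)) ^ (1 / 2 : ℝ) := by gcongr
      _ = _ := by
        rw [Real.mul_rpow (by norm_num) (by positivity), ← Real.rpow_mul h0.le]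
        norm_num
  calc _ ≤ 2 * (1 + t ^ 2) ^ (1 / 4 : ℝ) * (1 + t ^ 2)⁻¹ := by gcongr
    _ = 2 * ((1 + t ^ 2) ^ (1 / 4 : ℝ) * (1 + t ^ 2) ^ (-1 : ℝ)) := by rw [Real.rpow_neg_one]; ring
    _ = _ := by rw [← Real.rpow_add h0]; norm_num

lemma vt_perron : ∃ C : ℝ, 0 < C ∧ ∀ (a : ℕ → ℂ) (σ x M : ℝ), 1 ≤ σ → 0 < x → LSeriesSummable a σ →
    (∀ t : ℝ, ‖LSeries a (σ + t * I)‖ ≤ M * (|t| + 2) ^ (1 / 2 : ℝ)) →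
    ‖∑ n ∈ Finset.Icc 1 ⌊x⌋₊, a n * (1 - n / x)‖ ≤ C * M * x ^ σ := by
  set J := ∫ t : ℝ, (1 + t ^ 2) ^ (-(3 / 4) : ℝ) with hJ
  have hJ0 : 0 ≤ J := integral_nonneg fun t => by positivity
  refine ⟨2 * J + 1, by positivity, fun a σ x M hσ hx hsum hb => ?_⟩
  have hM : 0 ≤ M := by
    have h1 := (norm_nonneg _).trans (hb 0)
    have h2 : (0 : ℝ) < (|0| + 2) ^ (1 / 2 : ℝ) := by positivity
    exact nonneg_of_mul_nonneg_left h1 h2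
  set F : ℕ → ℝ → ℂ := fun n t => LSeries.term a (σ + t * I) n * ((x : ℂ) ^ (σ + t * I : ℂ) * vtG (σ + t * I)) with hF
  have hxs : ∀ t : ℝ, ‖(x : ℂ) ^ (σ + t * I : ℂ)‖ = x ^ σ := by
    intro t; rw [Complex.norm_cpow_eq_rpow_re_of_pos hx]; simp
  have hterm : ∀ (n : ℕ) (t : ℝ), ‖LSeries.term a (σ + t * I) n‖ = ‖LSeries.term a σ n‖ := by
    intro n t
    rw [LSeries.norm_term_eq, LSeries.norm_term_eq]; simp
  have hcx : Continuous (fun t : ℝ => (x : ℂ) ^ (σ + t * I : ℂ)) := by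
    apply Continuous.const_cpow (by fun_prop)
    left; exact_mod_cast hx.ne'
  have hct : ∀ n, Continuous (fun t : ℝ => LSeries.term a (σ + t * I) n) := by
    intro n
    rcases eq_or_ne n 0 with rfl | hn
    · simp [continuous_const]
    · simp only [LSeries.term_of_ne_zero hn]
      apply Continuous.div continuous_const
      · apply Continuous.const_cpow (by fun_prop)
        left; exact_mod_cast hn
      · intro t
        rw [Complex.cpow_ne_zero_iff]
        left; exact_mod_cast hn
  have hFc : ∀ n, Continuous (F n) := fun n => (hct n).mul (hcx.mul (vtG_cont hσ))
  have hFn : ∀ n t, ‖F n t‖ = ‖LSeries.term a σ n‖ * x ^ σ * ‖vtG (σ + t * I)‖ := by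
    intro n t
    simp only [hF]
    rw [norm_mul, norm_mul, hterm, hxs]; ring
  have hFi : ∀ n, Integrable (F n) := by
    intro n
    refine (((vtG_int hσ).norm).const_mul (‖LSeries.term a σ n‖ * x ^ σ)).mono' (hFc n).aestronglyMeasurable
      (ae_of_all _ fun t => (hFn n t).le)
  have hS : Summable fun n => ∫ t, ‖F n t‖ := by
    simp_rw [hFn, integral_const_mul]
    exact ((Summable.norm hsum).mul_right _).mul_right _
  have H := hasSum_integral_of_summable_integral_norm hFi hS
  have hI : ∀ n, ∫ t, F n t = if n = 0 then 0 else a n * (2 * Real.pi * vtW (n / x)) := by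
    intro n
    rcases eq_or_ne n 0 with rfl | hn
    · simp [hF]
    rw [if_neg hn, ← vt_perron_one hσ (y := n / x) (by positivity), ← integral_const_mul]
    apply integral_congr_ae
    filter_upwards with t
    simp only [hF, LSeries.term_of_ne_zero hn]
    have hn' : (n : ℂ) ≠ 0 := by exact_mod_cast hn
    have hx' : (x : ℂ) ≠ 0 := by exact_mod_cast hx.ne'
    have e1 : (((n / x : ℝ)) : ℂ) ^ (-(σ + t * I : ℂ)) = (x : ℂ) ^ (σ + t * I : ℂ) / (n : ℂ) ^ (σ + t * I : ℂ) := by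
      rw [Complex.ofReal_div, div_eq_mul_inv, ← Complex.ofReal_inv, Complex.mul_cpow_ofReal_nonneg (by positivity)
        (by positivity), Complex.cpow_neg, Complex.ofReal_inv, Complex.inv_cpow, Complex.cpow_neg, inv_inv]
      · simp; ring
      · rw [Complex.arg_ofReal_of_nonneg hx.le]; exact Real.pi_pos.ne
    rw [e1]; ring
  have htot : ∫ t, ∑' n, F n t = ∑ n ∈ Finset.Icc 1 ⌊x⌋₊, a n * (2 * Real.pi * (1 - n / x)) := by
    rw [← H.tsum_eq, tsum_eq_sum (s := Finset.Icc 1 ⌊x⌋₊)]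
    · apply Finset.sum_congr rfl
      intro n hn
      rw [Finset.mem_Icc] at hn
      have h1 : (n : ℝ) ≤ x := (Nat.le_floor_iff hx.le).1 hn.2
      have h2 : (0 : ℝ) < n := by exact_mod_cast hn.1
      rw [hI, if_neg (by omega), vtW_of_le (by positivity) ((div_le_one hx).2 h1)]
      push_cast; rfl
    · intro n hn
      rw [hI]
      split_ifs with h0
      · rfl
      rw [Finset.mem_Icc, not_and, not_le] at hn
      have h1 := (Nat.floor_lt hx.le).1 (hn (by omega))
      rw [vtW_of_gt ((one_lt_div hx).2 h1)]; simp
  have hbd : ‖∫ t, ∑' n, F n t‖ ≤ ∫ t : ℝ, M * x ^ σ * 2 * (1 + t ^ 2) ^ (-(3 / 4) : ℝ) := by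
    apply norm_integral_le_of_norm_le (vt_int34.const_mul _)
    filter_upwards with t
    simp only [hF]
    rw [tsum_mul_right, norm_mul, norm_mul, hxs]
    have h1 := hb t
    have h2 := vtG_norm (t := t) hσ
    have h3 := vt_tau_bound t
    rw [LSeries] at h1
    calc _ ≤ (M * (|t| + 2) ^ (1 / 2 : ℝ)) * (x ^ σ * (1 + t ^ 2)⁻¹) := by gcongr
      _ = M * x ^ σ * ((|t| + 2) ^ (1 / 2 : ℝ) * (1 + t ^ 2)⁻¹) := by ring
      _ ≤ M * x ^ σ * (2 * (1 + t ^ 2) ^ (-(3 / 4) : ℝ)) := by gcongr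
      _ = _ := by ring
  rw [htot, integral_const_mul, ← hJ] at hbd
  have hfac : ∑ n ∈ Finset.Icc 1 ⌊x⌋₊, a n * (2 * Real.pi * (1 - n / x)) =
      ((2 * Real.pi : ℝ) : ℂ) * ∑ n ∈ Finset.Icc 1 ⌊x⌋₊, a n * (1 - n / x) := by
    rw [Finset.mul_sum]; apply Finset.sum_congr rfl; intros; push_cast; ring
  rw [hfac, norm_mul, Complex.norm_real, Real.norm_of_nonneg (by positivity)] at hbd
  have hpi : 1 ≤ 2 * Real.pi := by linarith [Real.pi_gt_three]
  calc _ ≤ 2 * Real.pi * ‖∑ n ∈ Finset.Icc 1 ⌊x⌋₊, a n * (1 - n / x)‖ := le_mul_of_one_le_left (norm_nonneg _) hpi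
    _ ≤ M * x ^ σ * 2 * J := hbd
    _ = 2 * J * M * x ^ σ := by ring
    _ ≤ _ := by gcongr; linarith
end P5a


section P5b
open Complex

lemma vt_abel (f b : ℕ → ℂ) (S : ℝ) (N : ℕ) (h : ∀ j ≤ N, ‖∑ i ∈ Finset.range j, b i‖ ≤ S) :
    ‖∑ i ∈ Finset.range N, f i * b i‖ ≤ S * (‖f N‖ + ∑ i ∈ Finset.range N, ‖f (i + 1) - f i‖) := by
  have e : ∀ N : ℕ, ∑ i ∈ Finset.range N, f i * b i = f N * (∑ i ∈ Finset.range N, b i) -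
      ∑ i ∈ Finset.range N, (f (i + 1) - f i) * ∑ j ∈ Finset.range (i + 1), b j := by
    intro N
    induction N with
    | zero => simp
    | succ n ih =>
      rw [Finset.sum_range_succ, ih, Finset.sum_range_succ
        (fun i => (f (i + 1) - f i) * ∑ j ∈ Finset.range (i + 1), b j) n, Finset.sum_range_succ b n]
      ring
  rw [e]
  refine (norm_sub_le _ _).trans ?_
  rw [mul_add, Finset.mul_sum (Finset.range N) _ S]
  apply add_le_add
  · rw [norm_mul, mul_comm]
    gcongr
    exact h N le_rfl
  · refine (norm_sum_le _ _).trans (Finset.sum_le_sum fun i hi => ?_)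
    rw [norm_mul, mul_comm]
    gcongr
    exact h _ (Finset.mem_range.1 hi)

/-- antitone nonnegative weights -/
lemma vt_abel_anti (f : ℕ → ℝ) (b : ℕ → ℂ) (S : ℝ) (N : ℕ) (hf : Antitone f) (hf0 : ∀ n, 0 ≤ f n)
    (h : ∀ j ≤ N, ‖∑ i ∈ Finset.range j, b i‖ ≤ S) :
    ‖∑ i ∈ Finset.range N, (f i : ℂ) * b i‖ ≤ S * f 0 := by
  refine (vt_abel (fun i => (f i : ℂ)) b S N h).trans_eq ?_
  congr 1
  have e : ∀ i, ‖((f (i + 1) : ℝ) : ℂ) - (f i : ℂ)‖ = f i - f (i + 1) := by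
    intro i
    rw [← Complex.ofReal_sub, Complex.norm_real, Real.norm_eq_abs, abs_sub_comm, abs_of_nonneg]
    linarith [hf (Nat.le_succ i)]
  simp_rw [e]
  rw [Finset.sum_range_sub', Complex.norm_real, Real.norm_of_nonneg (hf0 N)]
  ring

lemma vt_desmooth (b : ℕ → ℂ) (N : ℕ) (hN : 0 < N) (h R E : ℝ) (hh : 0 < h) (hE0 : 0 ≤ E)
    (hb : ∀ n, N < n → (n : ℝ) ≤ N + h → ‖b n‖ ≤ E)
    (h1 : ‖∑ n ∈ Finset.Icc 1 N, b n * (1 - n / (N : ℝ))‖ ≤ R)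
    (h2 : ‖∑ n ∈ Finset.Icc 1 ⌊(N : ℝ) + h⌋₊, b n * (1 - n / ((N : ℝ) + h : ℝ))‖ ≤ R) :
    h * ‖∑ n ∈ Finset.Icc 1 N, b n‖ ≤ (2 * N + h) * R + h * (h * E) := by
  have hN' : (0 : ℝ) < N := by exact_mod_cast hN
  have hNc : (N : ℂ) ≠ 0 := by exact_mod_cast hN.ne'
  have hNh : ((N : ℂ) + h) ≠ 0 := by
    have : (N : ℝ) + h ≠ 0 := by positivity
    exact_mod_cast this
  have hfl : ⌊(N : ℝ) + h⌋₊ = N + ⌊h⌋₊ := by rw [add_comm, Nat.floor_add_natCast hh.le, add_comm]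
  have hT1 : ∑ n ∈ Finset.Icc 1 N, b n * (N - n) = N * ∑ n ∈ Finset.Icc 1 N, b n * (1 - n / (N : ℝ)) := by
    rw [Finset.mul_sum]; apply Finset.sum_congr rfl; intro n _
    push_cast; field_simp
  have hT2 : ∑ n ∈ Finset.Icc 1 ⌊(N : ℝ) + h⌋₊, b n * (N + h - n) =
      (N + h) * ∑ n ∈ Finset.Icc 1 ⌊(N : ℝ) + h⌋₊, b n * (1 - n / ((N : ℝ) + h : ℝ)) := by
    rw [Finset.mul_sum]; apply Finset.sum_congr rfl; intro n _
    push_cast; field_simp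
  have hsplit : ∑ n ∈ Finset.Icc 1 ⌊(N : ℝ) + h⌋₊, b n * (N + h - n) =
      ∑ n ∈ Finset.Icc 1 N, b n * (N + h - n) + ∑ n ∈ Finset.Ioc N (N + ⌊h⌋₊), b n * (N + h - n) := by
    rw [hfl, ← Finset.sum_union]
    · apply Finset.sum_congr _ (fun _ _ => rfl)
      ext n; simp only [Finset.mem_Icc, Finset.mem_union, Finset.mem_Ioc]; omega
    · rw [Finset.disjoint_left]; intro n; simp only [Finset.mem_Icc, Finset.mem_Ioc]; omega
  have hdec : ∑ n ∈ Finset.Icc 1 N, b n * (N + h - n) = h * ∑ n ∈ Finset.Icc 1 N, b n +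
      ∑ n ∈ Finset.Icc 1 N, b n * (N - n) := by
    rw [Finset.mul_sum, ← Finset.sum_add_distrib]; apply Finset.sum_congr rfl; intro n _; ring
  have hkey : (h : ℂ) * ∑ n ∈ Finset.Icc 1 N, b n =
      (N + h) * ∑ n ∈ Finset.Icc 1 ⌊(N : ℝ) + h⌋₊, b n * (1 - n / ((N : ℝ) + h : ℝ)) -
      N * ∑ n ∈ Finset.Icc 1 N, b n * (1 - n / (N : ℝ)) - ∑ n ∈ Finset.Ioc N (N + ⌊h⌋₊), b n * (N + h - n) := by
    rw [← hT2, hsplit, hdec, hT1]; ring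
  have hE : ‖∑ n ∈ Finset.Ioc N (N + ⌊h⌋₊), b n * (N + h - n)‖ ≤ h * (h * E) := by
    have hterm : ∀ n ∈ Finset.Ioc N (N + ⌊h⌋₊), ‖b n * (N + h - n)‖ ≤ E * h := by
      intro n hn
      rw [Finset.mem_Ioc] at hn
      have a1 : (n : ℝ) ≤ N + h := by
        have : (n : ℝ) ≤ N + ⌊h⌋₊ := by exact_mod_cast hn.2
        linarith [Nat.floor_le hh.le]
      have a2 : (N : ℝ) < n := by exact_mod_cast hn.1
      have a3 := hb n hn.1 a1
      rw [norm_mul]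
      have a4 : ‖(N + h - n : ℂ)‖ ≤ h := by
        have : (N + h - n : ℂ) = ((N + h - n : ℝ) : ℂ) := by push_cast; rfl
        rw [this, Complex.norm_real, Real.norm_of_nonneg (by linarith)]
        linarith
      have := (norm_nonneg _).trans a3
      gcongr
    refine (norm_sum_le_of_le _ hterm).trans ?_
    rw [Finset.sum_const, Nat.card_Ioc, nsmul_eq_mul]
    have : ((N + ⌊h⌋₊ - N : ℕ) : ℝ) ≤ h := by simpa using Nat.floor_le hh.le
    calc _ ≤ h * (E * h) := by gcongr
      _ = _ := by ring
  have := congrArg norm hkey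
  rw [norm_mul, Complex.norm_real, Real.norm_of_nonneg hh.le] at this
  rw [this]
  refine (norm_sub_le _ _).trans (add_le_add ((norm_sub_le _ _).trans ?_) hE)
  rw [norm_mul, norm_mul]
  have e1 : ‖(N + h : ℂ)‖ = N + h := by
    have : (N + h : ℂ) = ((N + h : ℝ) : ℂ) := by push_cast; rfl
    rw [this, Complex.norm_real, Real.norm_of_nonneg (by positivity)]
  rw [e1, Complex.norm_natCast]
  calc _ ≤ (N + h) * R + N * R := by gcongr
    _ = _ := by ring

lemma vt_logMul_iter (a : ℕ → ℂ) (k n : ℕ) : LSeries.logMul^[k] a n = (Real.log n : ℂ) ^ k * a n := by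
  induction k generalizing a with
  | zero => simp
  | succ k ih =>
    rw [Function.iterate_succ_apply, ih, LSeries.logMul, pow_succ, mul_assoc, Complex.natCast_log]

lemma vt_logpow_sqrt (m : ℕ) (hm : 1 ≤ m) {x : ℝ} (hx : 1 ≤ x) :
    (Real.log x) ^ m ≤ (2 * m : ℝ) ^ m * Real.sqrt x := by
  have hm' : (0 : ℝ) < m := by exact_mod_cast hm
  have h1 := Real.log_le_rpow_div (x := x) (ε := 1 / (2 * m)) (by linarith) (by positivity)
  have h0 := Real.log_nonneg hx
  calc (Real.log x) ^ m ≤ (x ^ (1 / (2 * m) : ℝ) / (1 / (2 * m))) ^ m := by gcongr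
    _ = (2 * m : ℝ) ^ m * (x ^ (1 / (2 * m) : ℝ)) ^ m := by rw [← mul_pow]; congr 1; field_simp
    _ = _ := by
      rw [Real.sqrt_eq_rpow, ← Real.rpow_natCast (x ^ (1 / (2 * m) : ℝ)), ← Real.rpow_mul (by linarith)]
      congr 2; field_simp

/-- the sum with logs -/
lemma vt_tauber_one (m : ℕ) (hm : 1 ≤ m) : ∃ C : ℝ, 0 < C ∧ ∀ (a : ℕ → ℂ) (M : ℝ), 1 ≤ M →
    (∀ n : ℕ, 1 ≤ n → ‖a n‖ ≤ Real.log n + 1) → (∀ s : ℂ, 1 < s.re → LSeriesSummable a s) →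
    (∀ s : ℂ, 1 < s.re → s.re ≤ 2 → ‖LSeries (LSeries.logMul^[2 * m - 1] a) s‖ ≤ M * (|s.im| + 2) ^ (1 / 2 : ℝ)) →
    ∀ N : ℕ, 3 ≤ N → ‖∑ n ∈ Finset.Icc 1 N, (Real.log n : ℂ) ^ (2 * m - 1) * a n‖ ≤ C * M * N * (Real.log N) ^ m := by
  obtain ⟨C, hC, h⟩ := vt_perron
  refine ⟨36 * C + 3 ^ (2 * m), by positivity, fun a M hM ha hs hb N hN => ?_⟩
  set b : ℕ → ℂ := LSeries.logMul^[2 * m - 1] a with hbdef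
  have hbn : ∀ n, b n = (Real.log n : ℂ) ^ (2 * m - 1) * a n := fun n => vt_logMul_iter a _ n
  simp_rw [← hbn]
  set L := Real.log N with hL
  have hN3 : (3 : ℝ) ≤ N := by exact_mod_cast hN
  have hL1 : 1 ≤ L := by
    rw [hL, Real.le_log_iff_exp_le (by linarith)]
    linarith [Real.exp_one_lt_d9]
  have hbs : ∀ s : ℂ, 1 < s.re → LSeriesSummable b s := by
    intro s hs1
    apply LSeriesSummable_of_abscissaOfAbsConv_lt_re
    rw [hbdef, LSeries.absicssaOfAbsConv_logPowMul]
    exact vt_abs_le hs hs1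
  set σ := 1 + 1 / L with hσ
  have hLi : 1 / L ≤ 1 := by rw [div_le_one (by linarith)]; exact hL1
  have hLi0 : 0 < 1 / L := by positivity
  set R := C * M * (12 * N) with hR
  have hxσ : ∀ x : ℝ, 0 < x → x ≤ 2 * N → x ^ σ ≤ 12 * N := by
    intro x hx hx2
    calc x ^ σ ≤ (2 * N : ℝ) ^ σ := by gcongr
      _ = 2 ^ σ * (N : ℝ) ^ σ := Real.mul_rpow (by norm_num) (by positivity)
      _ ≤ 2 ^ (2 : ℝ) * (N * 3) := by
        gcongr
        · norm_num
        · linarith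
        · rw [hσ, Real.rpow_add (by linarith), Real.rpow_one, Real.rpow_def_of_pos (by linarith), ← hL,
            mul_one_div_cancel (by positivity)]
          gcongr
          linarith [Real.exp_one_lt_d9]
      _ = _ := by norm_num; ring
  have hces : ∀ x : ℝ, 0 < x → x ≤ 2 * N → ‖∑ n ∈ Finset.Icc 1 ⌊x⌋₊, b n * (1 - n / x)‖ ≤ R := by
    intro x hx hx2
    refine (h b σ x M (by linarith) hx (hbs σ (by simp; linarith)) (fun t => ?_)).trans ?_
    · have := hb (σ + t * I) (by simp; linarith) (by simp; linarith)
      simpa using this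
    · rw [hR]; gcongr; exact hxσ x hx hx2
  set hh := N / L ^ m with hhd
  have hLm : 1 ≤ L ^ m := one_le_pow₀ hL1
  have hh0 : 0 < hh := by positivity
  have hhN : hh ≤ N := div_le_self (by positivity) hLm
  have key := vt_desmooth b N (by omega) hh R ((3 * L) ^ (2 * m)) hh0 (by positivity)
    (fun n hn hn2 => by
      have hn1 : 1 ≤ n := by omega
      have hn0 : (1 : ℝ) ≤ n := by exact_mod_cast hn1
      have hl : Real.log n ≤ 2 * L := by
        calc Real.log n ≤ Real.log (2 * N) := Real.log_le_log (by linarith) (by linarith)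
          _ = Real.log 2 + L := Real.log_mul (by norm_num) (by linarith)
          _ ≤ _ := by linarith [Real.log_two_lt_d9]
      have hl0 := Real.log_nonneg hn0
      rw [hbn, norm_mul, norm_pow, Complex.norm_real, Real.norm_of_nonneg hl0]
      calc _ ≤ (3 * L) ^ (2 * m - 1) * (3 * L) := by
            gcongr
            · linarith
            · linarith [ha n hn1]
        _ = _ := by rw [← pow_succ]; congr 1; omega)
    (by simpa using hces N (by linarith) (by linarith)) (by simpa using hces (N + hh) (by positivity) (by linarith))
  have h4 : hh * ‖∑ n ∈ Finset.Icc 1 N, b n‖ ≤ hh * ((36 * C + 3 ^ (2 * m)) * M * N * L ^ m) := by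
    refine key.trans ?_
    have e1 : hh * L ^ m = N := by rw [hhd]; field_simp
    have e2 : hh * (3 * L) ^ (2 * m) = 3 ^ (2 * m) * N * L ^ m := by
      rw [← e1, mul_pow, pow_mul' L]; ring
    rw [e2]
    calc _ ≤ (3 * N) * R + hh * (3 ^ (2 * m) * N * L ^ m) := by gcongr; linarith
      _ = (hh * L ^ m) * (36 * C * M * N) + hh * (3 ^ (2 * m) * 1 * N * L ^ m) := by rw [e1, hR]; ring
      _ ≤ (hh * L ^ m) * (36 * C * M * N) + hh * (3 ^ (2 * m) * M * N * L ^ m) := by gcongr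
      _ = _ := by ring
  exact le_of_mul_le_mul_left h4 hh0

lemma vt_tauber (m : ℕ) (hm : 1 ≤ m) : ∃ C : ℝ, 0 < C ∧ ∀ (a : ℕ → ℂ) (M : ℝ), 1 ≤ M →
    (∀ n : ℕ, 1 ≤ n → ‖a n‖ ≤ Real.log n + 1) → (∀ s : ℂ, 1 < s.re → LSeriesSummable a s) →
    (∀ s : ℂ, 1 < s.re → s.re ≤ 2 → ‖LSeries (LSeries.logMul^[2 * m - 1] a) s‖ ≤ M * (|s.im| + 2) ^ (1 / 2 : ℝ)) →
    ∀ N : ℕ, 3 ≤ N → ‖∑ n ∈ Finset.Icc 1 N, a n‖ ≤ C * M * N / (Real.log N) ^ (m - 1) := by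
  obtain ⟨C, hC, h⟩ := vt_tauber_one m hm
  set k := 2 * m - 1 with hk
  set C1 : ℝ := C + 2 * 2 ^ (2 * m) with hC1
  refine ⟨2 * C1 * 2 ^ k + 2 * (2 * m) ^ m, by positivity, fun a M hM ha hs hb N hN => ?_⟩
  set L := Real.log N with hL
  have hN3 : (3 : ℝ) ≤ N := by exact_mod_cast hN
  have hL1 : 1 ≤ L := by
    rw [hL, Real.le_log_iff_exp_le (by linarith)]
    linarith [Real.exp_one_lt_d9]
  have hLm : 1 ≤ L ^ m := one_le_pow₀ hL1
  set b : ℕ → ℂ := fun n => (Real.log n : ℂ) ^ k * a n with hbdef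
  have hS : ∀ j ≤ N, ‖∑ n ∈ Finset.Icc 1 j, b n‖ ≤ C1 * M * N * L ^ m := by
    intro j hj
    rcases le_or_gt 3 j with h3 | h3
    · have hj3 : (3 : ℝ) ≤ j := by exact_mod_cast h3
      have hjN : (j : ℝ) ≤ N := by exact_mod_cast hj
      refine (h a M hM ha hs hb j h3).trans ?_
      have : Real.log j ≤ L := Real.log_le_log (by linarith) hjN
      have : 0 ≤ Real.log j := Real.log_nonneg (by linarith)
      gcongr
      rw [hC1]; linarith [show (0 : ℝ) < 2 * 2 ^ (2 * m) by positivity]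
    · have hterm : ∀ n ∈ Finset.Icc 1 j, ‖b n‖ ≤ 2 ^ (2 * m) := by
        intro n hn
        rw [Finset.mem_Icc] at hn
        have hn1 : (1 : ℝ) ≤ n := by exact_mod_cast hn.1
        have hn2 : (n : ℝ) ≤ 2 := by exact_mod_cast (by omega : n ≤ 2)
        have hl0 := Real.log_nonneg hn1
        have hl : Real.log n ≤ 1 := by
          calc _ ≤ Real.log 2 := Real.log_le_log (by linarith) hn2
            _ ≤ 1 := by linarith [Real.log_two_lt_d9]
        rw [hbdef]
        simp only []
        rw [norm_mul, norm_pow, Complex.norm_real, Real.norm_of_nonneg hl0]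
        calc _ ≤ (2 : ℝ) ^ k * 2 := by
              gcongr
              · linarith
              · linarith [ha n hn.1]
          _ = _ := by rw [← pow_succ]; congr 1; omega
      refine (norm_sum_le_of_le _ hterm).trans ?_
      rw [Finset.sum_const, Nat.card_Icc, nsmul_eq_mul]
      have hj2 : ((j + 1 - 1 : ℕ) : ℝ) ≤ 2 := by exact_mod_cast (by omega : j + 1 - 1 ≤ 2)
      calc _ ≤ 2 * (2 : ℝ) ^ (2 * m) := by gcongr
        _ ≤ C1 := by rw [hC1]; linarith
        _ ≤ C1 * (M * N * L ^ m) := by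
          apply le_mul_of_one_le_right (by positivity)
          apply one_le_mul_of_one_le_of_one_le _ hLm
          nlinarith
        _ = _ := by ring
  set R := Nat.sqrt N with hR
  have hR1 : 1 ≤ R := Nat.le_sqrt.2 (by omega)
  have hRN : R ≤ N := Nat.sqrt_le_self N
  have hRs : (R : ℝ) ≤ Real.sqrt N := Real.nat_sqrt_le_real_sqrt
  have hsplit : ∑ n ∈ Finset.Icc 1 N, a n = ∑ n ∈ Finset.Icc 1 R, a n +
      ∑ i ∈ Finset.range (N - R), a (R + 1 + i) := by
    have e1 : ∑ i ∈ Finset.range (N - R), a (R + 1 + i) = ∑ n ∈ Finset.Ico (R + 1) (N + 1), a n := by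
      rw [Finset.sum_Ico_eq_sum_range]; congr 2; omega
    rw [e1, ← Finset.sum_union]
    · apply Finset.sum_congr _ (fun _ _ => rfl)
      ext n; simp only [Finset.mem_Icc, Finset.mem_union, Finset.mem_Ico]; omega
    · rw [Finset.disjoint_left]; intro n; simp only [Finset.mem_Icc, Finset.mem_Ico]; omega
  have hps : ∀ j ≤ N - R, ‖∑ i ∈ Finset.range j, b (R + 1 + i)‖ ≤ 2 * (C1 * M * N * L ^ m) := by
    intro j hj
    have e1 : ∑ i ∈ Finset.range j, b (R + 1 + i) = ∑ n ∈ Finset.Icc 1 (R + j), b n - ∑ n ∈ Finset.Icc 1 R, b n := by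
      rw [eq_sub_iff_add_eq]
      have e2 : ∑ i ∈ Finset.range j, b (R + 1 + i) = ∑ n ∈ Finset.Ico (R + 1) (R + j + 1), b n := by
        rw [Finset.sum_Ico_eq_sum_range]; congr 2; omega
      rw [e2, ← Finset.sum_union]
      · apply Finset.sum_congr _ (fun _ _ => rfl)
        ext n; simp only [Finset.mem_Icc, Finset.mem_union, Finset.mem_Ico]; omega
      · rw [Finset.disjoint_left]; intro n; simp only [Finset.mem_Icc, Finset.mem_Ico]; omega
    rw [e1]
    refine (norm_sub_le _ _).trans ?_
    linarith [hS (R + j) (by omega), hS R hRN]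
  have hlogR : L / 2 ≤ Real.log (R + 1) := by
    have : Real.sqrt N ≤ R + 1 := Real.real_sqrt_le_nat_sqrt_succ
    calc L / 2 = Real.log (Real.sqrt N) := by rw [Real.log_sqrt (by positivity)]
      _ ≤ _ := Real.log_le_log (Real.sqrt_pos.2 (by linarith)) this
  have hlogpos : ∀ i : ℕ, 0 < Real.log ((R + 1 + i : ℕ) : ℝ) := by
    intro i
    apply Real.log_pos
    push_cast
    have : (1 : ℝ) ≤ R := by exact_mod_cast hR1
    linarith [show (0 : ℝ) ≤ i by positivity]
  have hab := vt_abel_anti (fun i => 1 / (Real.log ((R + 1 + i : ℕ) : ℝ)) ^ k) (fun i => b (R + 1 + i))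
    (2 * (C1 * M * N * L ^ m)) (N - R) (fun i j hij => by
      have h1 := hlogpos i
      have h2 : Real.log ((R + 1 + i : ℕ) : ℝ) ≤ Real.log ((R + 1 + j : ℕ) : ℝ) := by
        apply Real.log_le_log (by positivity)
        exact_mod_cast (by omega)
      simp only []
      apply one_div_le_one_div_of_le (by positivity)
      gcongr) (fun i => by have := hlogpos i; positivity) hps
  have hfac : ∀ i, ((1 / (Real.log ((R + 1 + i : ℕ) : ℝ)) ^ k : ℝ) : ℂ) * b (R + 1 + i) = a (R + 1 + i) := by
    intro i
    have h1 : (Real.log ((R + 1 + i : ℕ) : ℝ) : ℂ) ≠ 0 := by exact_mod_cast (hlogpos i).ne'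
    rw [hbdef]
    simp only []
    rw [Complex.ofReal_div, Complex.ofReal_pow, Complex.ofReal_one]
    field_simp
  simp_rw [hfac] at hab
  have hLk : L ^ k = L ^ m * L ^ (m - 1) := by rw [← pow_add]; congr 1; omega
  have hsec : ‖∑ i ∈ Finset.range (N - R), a (R + 1 + i)‖ ≤ 2 * C1 * 2 ^ k * M * N / L ^ (m - 1) := by
    refine hab.trans ?_
    have h1 : 1 / (Real.log ((R + 1 + 0 : ℕ) : ℝ)) ^ k ≤ 1 / (L / 2) ^ k := by
      apply one_div_le_one_div_of_le (by positivity)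
      gcongr
      push_cast
      simpa using hlogR
    calc _ ≤ 2 * (C1 * M * N * L ^ m) * (1 / (L / 2) ^ k) := by gcongr
      _ = _ := by rw [div_pow, hLk]; field_simp
  have hfirst : ‖∑ n ∈ Finset.Icc 1 R, a n‖ ≤ 2 * (2 * m) ^ m * M * N / L ^ (m - 1) := by
    have hterm : ∀ n ∈ Finset.Icc 1 R, ‖a n‖ ≤ 2 * L := by
      intro n hn
      rw [Finset.mem_Icc] at hn
      have hn1 : (1 : ℝ) ≤ n := by exact_mod_cast hn.1
      have hnN : (n : ℝ) ≤ N := by exact_mod_cast (by omega : n ≤ N)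
      have : Real.log n ≤ L := Real.log_le_log (by linarith) hnN
      linarith [ha n hn.1]
    refine (norm_sum_le_of_le _ hterm).trans ?_
    rw [Finset.sum_const, Nat.card_Icc, nsmul_eq_mul, le_div_iff₀ (by positivity)]
    have h1 := vt_logpow_sqrt m hm (x := N) (by linarith)
    rw [← hL] at h1
    have e1 : L * L ^ (m - 1) = L ^ m := by rw [← pow_succ']; congr 1; omega
    calc _ = 2 * R * (L * L ^ (m - 1)) := by rw [Nat.add_sub_cancel]; ring
      _ ≤ 2 * Real.sqrt N * ((2 * m : ℝ) ^ m * Real.sqrt N) := by rw [e1]; gcongr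
      _ = 2 * (2 * m : ℝ) ^ m * 1 * (Real.sqrt N * Real.sqrt N) := by ring
      _ ≤ 2 * (2 * m : ℝ) ^ m * M * N := by
        rw [Real.mul_self_sqrt (by linarith)]; gcongr
  rw [hsplit]
  calc _ ≤ _ := norm_add_le _ _
    _ ≤ _ := add_le_add hfirst hsec
    _ = _ := by ring

lemma vt_SW (K : ℕ) : ∃ C : ℝ, 0 < C ∧ ∀ (q : ℕ) [NeZero q] (χ : DirichletCharacter ℂ q), χ ≠ 1 →
    ∀ N : ℕ, 3 ≤ N → ‖∑ n ∈ Finset.Icc 1 N, vtC χ n‖ ≤ C * q * N / (Real.log N) ^ K := by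
  obtain ⟨C, hC, h⟩ := vt_tauber (K + 1) (by omega)
  obtain ⟨D, hD, hDb⟩ := vt_P4_chi (2 * (K + 1) - 1)
  refine ⟨C * (D + 1), by positivity, fun q _ χ hχ N hN => ?_⟩
  have hq : (1 : ℝ) ≤ q := by exact_mod_cast NeZero.one_le
  have := h (vtC χ) ((D + 1) * q) (by nlinarith) (fun n hn => by
    have hn1 : (1 : ℝ) ≤ n := by exact_mod_cast hn
    rw [vtC, norm_mul, Complex.norm_real, Real.norm_of_nonneg ArithmeticFunction.vonMangoldt_nonneg]
    have h1 := χ.norm_le_one n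
    have h2 := ArithmeticFunction.vonMangoldt_le_log (n := n)
    have h3 := ArithmeticFunction.vonMangoldt_nonneg (n := n)
    nlinarith) (fun s hs => vtC_summable χ hs) (fun s hs hs2 => by
      refine (hDb q χ hχ s hs hs2).trans ?_
      gcongr
      · linarith
      · calc (q : ℝ) ^ (1 / 2 : ℝ) ≤ (q : ℝ) ^ (1 : ℝ) := Real.rpow_le_rpow_of_exponent_le hq (by norm_num)
          _ = q := Real.rpow_one _) N hN
  rw [Nat.add_sub_cancel] at this
  calc _ ≤ _ := this
    _ = _ := by ring

lemma vt_PNT (K : ℕ) : ∃ C : ℝ, 0 < C ∧ 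
    ∀ N : ℕ, 3 ≤ N → ‖∑ n ∈ Finset.Icc 1 N, vtD n‖ ≤ C * N / (Real.log N) ^ K := by
  obtain ⟨C, hC, h⟩ := vt_tauber (K + 1) (by omega)
  obtain ⟨D, hD, hDb⟩ := vt_P4_zeta (2 * (K + 1) - 1)
  refine ⟨C * (D + 1), by positivity, fun N hN => ?_⟩
  have := h vtD (D + 1) (by linarith) (fun n hn => by
    have hn1 : (1 : ℝ) ≤ n := by exact_mod_cast hn
    refine (norm_sub_le _ _).trans ?_
    rw [Complex.norm_real, Real.norm_of_nonneg ArithmeticFunction.vonMangoldt_nonneg, norm_one]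
    linarith [ArithmeticFunction.vonMangoldt_le_log (n := n)]) (fun s hs => vtD_summable hs) (fun s hs hs2 => by
      refine (hDb s hs hs2).trans ?_
      gcongr
      linarith) N hN
  rwa [Nat.add_sub_cancel] at this
end P5b


section P6a
open Complex

/-- additive character -/
noncomputable def vtE (x : ℝ) : ℂ := Complex.exp (2 * Real.pi * x * I)

/-- distance to the nearest integer -/
noncomputable def vtN (x : ℝ) : ℝ := |x - round x|

lemma vtE_add (x y : ℝ) : vtE (x + y) = vtE x * vtE y := by
  unfold vtE; rw [← Complex.exp_add]; congr 1; push_cast; ring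

lemma vtE_zero : vtE 0 = 1 := by simp [vtE]

lemma vtE_int (n : ℤ) : vtE n = 1 := by
  unfold vtE
  rw [Complex.exp_eq_one_iff]; exact ⟨n, by push_cast; ring⟩

lemma vtE_nat (n : ℕ) : vtE n = 1 := by exact_mod_cast vtE_int n

lemma vtE_norm (x : ℝ) : ‖vtE x‖ = 1 := by
  unfold vtE
  have : (2 * Real.pi * x * I : ℂ) = ((2 * Real.pi * x : ℝ) : ℂ) * I := by push_cast; ring
  rw [this, Complex.norm_exp_ofReal_mul_I]

lemma vtE_ne (x : ℝ) : vtE x ≠ 0 := Complex.exp_ne_zero _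

lemma vtE_neg (x : ℝ) : vtE (-x) = (vtE x)⁻¹ := by
  unfold vtE; rw [← Complex.exp_neg]; congr 1; push_cast; ring

lemma vtE_conj (x : ℝ) : (starRingEnd ℂ) (vtE x) = vtE (-x) := by
  unfold vtE; rw [← Complex.exp_conj]; congr 1; simp [Complex.conj_ofNat]

lemma vtE_nat_mul (n : ℕ) (x : ℝ) : vtE (n * x) = vtE x ^ n := by
  unfold vtE; rw [← Complex.exp_nat_mul]; congr 1; push_cast; ring

lemma vtE_sub_one (x : ℝ) : ‖vtE x - 1‖ = 2 * |Real.sin (Real.pi * x)| := by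
  unfold vtE
  have : (2 * Real.pi * x * I : ℂ) = I * ((2 * Real.pi * x : ℝ) : ℂ) := by push_cast; ring
  rw [this, Complex.norm_exp_I_mul_ofReal_sub_one, Real.norm_eq_abs, abs_mul, abs_two]
  congr 3; ring

lemma vtE_sub_one_le (x : ℝ) : ‖vtE x - 1‖ ≤ 2 * Real.pi * |x| := by
  rw [vtE_sub_one]
  have := Real.abs_sin_le_abs (x := Real.pi * x)
  rw [abs_mul, abs_of_pos Real.pi_pos] at this
  linarith

lemma vtE_sub_one_ge (x : ℝ) : 4 * vtN x ≤ ‖vtE x - 1‖ := by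
  have e : vtE x = vtE (x - round x) := by
    have := vtE_add (x - round x) ((round x : ℤ) : ℝ)
    rw [vtE_int, mul_one] at this; rw [← this]; congr 1; ring
  rw [e, vtE_sub_one]
  have h := abs_sub_round x
  unfold vtN
  set y := x - round x
  have h1 : |Real.sin (Real.pi * y)| = Real.sin (Real.pi * |y|) := by
    rcases le_total 0 y with hy | hy
    · rw [abs_of_nonneg hy] at h ⊢
      rw [abs_of_nonneg]
      apply Real.sin_nonneg_of_nonneg_of_le_pi
      · positivity
      · nlinarith [Real.pi_pos]
    · rw [abs_of_nonpos hy] at h ⊢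
      rw [mul_neg, Real.sin_neg, abs_of_nonpos]
      apply Real.sin_nonpos_of_nonpos_of_neg_pi_le
      · nlinarith [Real.pi_pos]
      · nlinarith [Real.pi_pos]
  rw [h1]
  have h2 := Real.mul_le_sin (x := Real.pi * |y|) (by positivity) (by nlinarith [Real.pi_pos])
  have h3 : 2 / Real.pi * (Real.pi * |y|) = 2 * |y| := by field_simp
  linarith

lemma vtN_nonneg (x : ℝ) : 0 ≤ vtN x := abs_nonneg _
lemma vtN_le_half (x : ℝ) : vtN x ≤ 1 / 2 := abs_sub_round x
lemma vtN_le (x : ℝ) (z : ℤ) : vtN x ≤ |x - z| := round_le x z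
lemma vtN_le_abs (x : ℝ) : vtN x ≤ |x| := by simpa using vtN_le x 0

lemma vtN_add_le (x y : ℝ) : vtN (x + y) ≤ vtN x + |y| := by
  refine (vtN_le (x + y) (round x)).trans ?_
  unfold vtN
  have : x + y - round x = (x - round x) + y := by ring
  rw [this]; exact abs_add_le _ _

lemma vtN_neg (x : ℝ) : vtN (-x) = vtN x := by
  apply le_antisymm
  · refine (vtN_le (-x) (-round x)).trans ?_
    unfold vtN; push_cast; rw [← abs_neg]; apply le_of_eq; congr 1; ring
  · refine (vtN_le x (-round (-x))).trans ?_
    unfold vtN; push_cast; rw [← abs_neg]; apply le_of_eq; congr 1; ring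

lemma vtN_abs (x : ℝ) : vtN |x| = vtN x := by
  rcases abs_cases x with h | h
  · rw [h.1]
  · rw [h.1, vtN_neg]

lemma vtN_int_add (n : ℤ) (x : ℝ) : vtN (n + x) = vtN x := by
  unfold vtN; rw [round_intCast_add]; push_cast; congr 1; ring

lemma vtE_geom_le (β : ℝ) (a b : ℕ) :
    ‖∑ n ∈ Finset.Ico a b, vtE (n * β)‖ * vtN β ≤ 1 / 2 := by
  have h0 : (vtE β - 1) * ∑ n ∈ Finset.Ico a b, vtE (n * β) = if a ≤ b then vtE β ^ b - vtE β ^ a else 0 := by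
    split_ifs with hab
    · simp_rw [vtE_nat_mul]
      rw [mul_comm, geom_sum_Ico_mul _ hab]
    · rw [Finset.Ico_eq_empty (by omega)]; simp
  have h1 : ‖(vtE β - 1) * ∑ n ∈ Finset.Ico a b, vtE (n * β)‖ ≤ 2 := by
    rw [h0]; split_ifs
    · refine (norm_sub_le _ _).trans ?_
      rw [norm_pow, norm_pow, vtE_norm]; norm_num
    · simp
  rw [norm_mul] at h1
  have h2 := vtE_sub_one_ge β
  have h3 := norm_nonneg (∑ n ∈ Finset.Ico a b, vtE (n * β))
  nlinarith

lemma vtE_geom_trivial (β : ℝ) (a b : ℕ) :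
    ‖∑ n ∈ Finset.Ico a b, vtE (n * β)‖ ≤ ((b - a : ℕ) : ℝ) := by
  refine (norm_sum_le _ _).trans ?_
  simp [vtE_norm]

lemma vtE_int_mul_div (q : ℕ) (hq : q ≠ 0) (a b : ℤ) (m : ℤ) (h : (q : ℤ) ∣ a - b) :
    vtE (a * m / q) = vtE (b * m / q) := by
  obtain ⟨k, hk⟩ := h
  have : (a : ℝ) * m / q = b * m / q + ((k * m : ℤ) : ℝ) := by
    have : (a : ℝ) - b = q * k := by exact_mod_cast hk
    have hq' : (q : ℝ) ≠ 0 := by exact_mod_cast hq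
    push_cast; field_simp; linear_combination (m : ℝ) * this
  rw [this, vtE_add, vtE_int, mul_one]

/-- sum over complete residue system -/
lemma vtE_complete (q : ℕ) (hq : q ≠ 0) (m : ℤ) :
    ∑ b ∈ Finset.range q, vtE (b * m / q) = if (q : ℤ) ∣ m then (q : ℂ) else 0 := by
  have hq' : (q : ℝ) ≠ 0 := by exact_mod_cast hq
  split_ifs with h
  · obtain ⟨k, rfl⟩ := h
    have : ∀ b ∈ Finset.range q, vtE (b * ((q * k : ℤ) : ℝ) / q) = 1 := by
      intro b _
      have : (b : ℝ) * ((q * k : ℤ) : ℝ) / q = ((b * k : ℤ) : ℝ) := by push_cast; field_simp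
      rw [this, vtE_int]
    rw [Finset.sum_congr rfl this]; simp
  · have e : ∀ b : ℕ, vtE (b * m / q) = vtE (m / q) ^ b := by
      intro b; rw [← vtE_nat_mul]; congr 1; ring
    simp_rw [e]
    have hne : vtE (m / q) ≠ 1 := by
      unfold vtE
      rw [Ne, Complex.exp_eq_one_iff]
      rintro ⟨n, hn⟩
      apply h
      have hpi : (2 * Real.pi * I : ℂ) ≠ 0 := Complex.two_pi_I_ne_zero
      have h1 : ((m / q : ℝ) : ℂ) = n := by
        have : (2 * Real.pi * I : ℂ) * ((m / q : ℝ) : ℂ) = 2 * Real.pi * I * n := by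
          linear_combination hn
        exact mul_left_cancel₀ hpi this
      have h2 : (m / q : ℝ) = n := by exact_mod_cast h1
      refine ⟨n, ?_⟩
      have h3 : (m : ℝ) = q * n := by rw [← h2]; field_simp
      exact_mod_cast h3
    rw [geom_sum_eq hne, ← vtE_nat_mul]
    have : (q : ℝ) * (m / q) = (m : ℤ) := by field_simp
    rw [this, vtE_int]; simp

/-- Ramanujan sum -/
noncomputable def vtR (q : ℕ) (m : ℤ) : ℂ :=
  ∑ b ∈ (Finset.range q).filter (Nat.Coprime q), vtE (b * m / q)

lemma vtR_norm_le (q : ℕ) (m : ℤ) : ‖vtR q m‖ ≤ Nat.totient q := by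
  unfold vtR
  refine (norm_sum_le _ _).trans ?_
  simp [vtE_norm, Nat.totient]

lemma vtR_sum_divisors (q : ℕ) (hq : 0 < q) (m : ℤ) :
    ∑ d ∈ q.divisors, vtR d m = if (q : ℤ) ∣ m then (q : ℂ) else 0 := by
  rw [← vtE_complete q hq.ne' m]
  unfold vtR
  rw [Finset.sum_sigma']
  have key : ∀ d b : ℕ, d ∣ q → Nat.Coprime d b → Nat.gcd q (b * (q / d)) = q / d := by
    intro d b hd hc
    obtain ⟨k, rfl⟩ := hd
    have hd0 : 0 < d := Nat.pos_of_ne_zero (by rintro rfl; simp at hq)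
    rw [Nat.mul_div_cancel_left _ hd0, Nat.gcd_mul_right, hc, one_mul]
  refine Finset.sum_nbij (fun x => x.2 * (q / x.1)) ?_ ?_ ?_ ?_
  · rintro ⟨d, b⟩ h
    simp only [Finset.mem_sigma, Nat.mem_divisors, Finset.mem_filter, Finset.mem_range] at h ⊢
    obtain ⟨⟨hd, _⟩, hb, hc⟩ := h
    calc b * (q / d) < d * (q / d) :=
          Nat.mul_lt_mul_of_pos_right hb (Nat.div_pos (Nat.le_of_dvd hq hd) (by omega))
      _ = q := Nat.mul_div_cancel' hd
  · rintro ⟨d, b⟩ h ⟨d', b'⟩ h' heq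
    simp only [Finset.coe_sigma, Set.mem_sigma_iff, Finset.mem_coe, Nat.mem_divisors, Finset.mem_filter, Finset.mem_range] at h h' heq
    obtain ⟨⟨hd, _⟩, hb, hc⟩ := h
    obtain ⟨⟨hd', _⟩, hb', hc'⟩ := h'
    have h1 := key d b hd hc
    have h2 := key d' b' hd' hc'
    rw [heq, h2] at h1
    have h3 : d = d' := by
      have e1 := Nat.mul_div_cancel' hd
      have e2 := Nat.mul_div_cancel' hd'
      rw [h1] at e2; have e2 := e2.trans e1.symm
      have : 0 < q / d := Nat.div_pos (Nat.le_of_dvd hq hd) (by omega)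
      exact (Nat.eq_of_mul_eq_mul_right this e2).symm
    subst h3
    have : 0 < q / d := Nat.div_pos (Nat.le_of_dvd hq hd) (by omega)
    have := Nat.eq_of_mul_eq_mul_right this heq
    subst this; rfl
  · intro b hb
    simp only [Finset.coe_range, Set.mem_Iio] at hb
    have hg : 0 < Nat.gcd q b := Nat.gcd_pos_of_pos_left _ hq
    refine ⟨⟨q / Nat.gcd q b, b / Nat.gcd q b⟩, ?_, ?_⟩
    · simp only [Finset.coe_sigma, Set.mem_sigma_iff, Finset.mem_coe, Nat.mem_divisors, Finset.mem_filter, Finset.mem_range]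
      refine ⟨⟨Nat.div_dvd_of_dvd (Nat.gcd_dvd_left _ _), hq.ne'⟩, ?_, Nat.coprime_div_gcd_div_gcd hg⟩
      exact Nat.div_lt_div_of_lt_of_dvd (Nat.gcd_dvd_left _ _) hb
    · simp only
      rw [Nat.div_div_self (Nat.gcd_dvd_left _ _) hq.ne', Nat.div_mul_cancel (Nat.gcd_dvd_right _ _)]
  · rintro ⟨d, b⟩ h
    simp only [Finset.mem_sigma, Nat.mem_divisors, Finset.mem_filter, Finset.mem_range] at h ⊢
    obtain ⟨⟨hd, _⟩, hb, hc⟩ := h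
    congr 1
    obtain ⟨k, rfl⟩ := hd
    have hd0 : 0 < d := by omega
    have hk : 0 < k := Nat.pos_of_mul_pos_left hq
    rw [Nat.mul_div_cancel_left _ hd0]
    have : (k : ℝ) ≠ 0 := by positivity
    push_cast; field_simp

/-- the Ramanujan sum as arithmetic function in q -/
noncomputable def vtRd (m : ℤ) : ArithmeticFunction ℝ :=
  ⟨fun d => if (d : ℤ) ∣ m then (d : ℝ) else 0, by simp⟩

lemma vtRd_apply (m : ℤ) (d : ℕ) : vtRd m d = if (d : ℤ) ∣ m then (d : ℝ) else 0 := rfl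

/-- the Ramanujan sum as arithmetic function in q -/
noncomputable def vtRaf (m : ℤ) : ArithmeticFunction ℝ :=
  (ArithmeticFunction.moebius : ArithmeticFunction ℝ) * vtRd m

lemma vtR_eq (q : ℕ) (hq : 0 < q) (m : ℤ) : vtR q m = ((vtRaf m q : ℝ) : ℂ) := by
  have h := (ArithmeticFunction.sum_eq_iff_sum_mul_moebius_eq (R := ℂ) (f := fun d => vtR d m)
    (g := fun q => if (q : ℤ) ∣ m then (q : ℂ) else 0)).1 (fun n hn => vtR_sum_divisors n hn m) q hq
  rw [← h, vtRaf, ArithmeticFunction.mul_apply]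
  push_cast
  apply Finset.sum_congr rfl
  intro x hx
  simp only [ArithmeticFunction.intCoe_apply, vtRd_apply]
  split_ifs <;> simp

lemma vtRaf_mult (m : ℤ) : (vtRaf m).IsMultiplicative := by
  unfold vtRaf
  apply ArithmeticFunction.IsMultiplicative.mul
  · exact ArithmeticFunction.isMultiplicative_moebius.intCast
  · refine ⟨by simp [vtRd_apply], ?_⟩
    intro a b hab
    simp only [vtRd_apply]
    have : (((a * b : ℕ) : ℤ) ∣ m) ↔ ((a : ℤ) ∣ m ∧ (b : ℤ) ∣ m) := by
      push_cast
      constructor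
      · intro h; exact ⟨dvd_of_mul_right_dvd h, dvd_of_mul_left_dvd h⟩
      · rintro ⟨h1, h2⟩
        exact IsCoprime.mul_dvd (Nat.isCoprime_iff_coprime.2 hab) h1 h2
    simp only [this]
    by_cases h1 : (a : ℤ) ∣ m <;> by_cases h2 : (b : ℤ) ∣ m <;> simp [h1, h2]

lemma vtR_coprime (q : ℕ) (hq : 0 < q) (a : ℤ) (h : IsCoprime (q : ℤ) a) :
    vtR q a = (ArithmeticFunction.moebius q : ℂ) := by
  rw [vtR_eq q hq, vtRaf, ArithmeticFunction.mul_apply]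
  rw [Finset.sum_eq_single (q, 1)]
  · simp [vtRd_apply]
  · rintro ⟨x, y⟩ hxy hne
    rw [Nat.mem_divisorsAntidiagonal] at hxy
    simp only [vtRd_apply]
    rw [if_neg, mul_zero]
    intro hy
    have h1 : (y : ℤ) ∣ q := by exact_mod_cast Dvd.intro_left x hxy.1
    have h2 : IsUnit (y : ℤ) := h.isUnit_of_dvd' h1 hy
    have h3 : y = 1 := by
      have := Int.isUnit_iff_natAbs_eq.1 h2
      simpa using this
    subst h3
    apply hne; simp at hxy; simp [hxy.1]
  · intro h; simp [hq.ne'] at h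

lemma vtRaf_prime (p : ℕ) (hp : p.Prime) (m : ℤ) :
    vtRaf m p = if (p : ℤ) ∣ m then (p : ℝ) - 1 else -1 := by
  rw [vtRaf, ArithmeticFunction.mul_apply, Nat.sum_divisorsAntidiagonal (fun x y => (ArithmeticFunction.moebius : ArithmeticFunction ℝ) x * vtRd m y), Nat.Prime.sum_divisors hp, Nat.div_self hp.pos, Nat.div_one]
  simp [ArithmeticFunction.moebius_apply_prime hp, vtRd_apply]
  split_ifs <;> ring

/-- crude totient bound -/
lemma vt_prod_tele (S : Finset ℕ) (h : ∀ p ∈ S, 2 ≤ p) :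
    ∏ p ∈ S, ((p : ℝ) / (p - 1)) ≤ S.card + 1 := by
  induction S using Finset.induction_on_max with
  | empty => simp
  | insert a s hs ih =>
    have hna : a ∉ s := fun h => lt_irrefl _ (hs a h)
    rw [Finset.prod_insert hna, Finset.card_insert_of_notMem hna]
    have ih' := ih (fun p hp => h p (Finset.mem_insert_of_mem hp))
    have ha : 2 ≤ a := h a (Finset.mem_insert_self _ _)
    have hc : s.card + 2 ≤ a := by
      have : s ⊆ Finset.Ico 2 a := by
        intro x hx
        rw [Finset.mem_Ico]; exact ⟨h x (Finset.mem_insert_of_mem hx), hs x hx⟩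
      have := Finset.card_le_card this
      rw [Nat.card_Ico] at this; omega
    have hc' : (s.card : ℝ) + 2 ≤ a := by exact_mod_cast hc
    have ha1 : (0 : ℝ) < (a : ℝ) - 1 := by
      have := Nat.cast_nonneg (α := ℝ) s.card; linarith
    calc (a : ℝ) / (a - 1) * ∏ p ∈ s, ((p : ℝ) / (p - 1)) ≤ (a : ℝ) / (a - 1) * (s.card + 1) := by
          gcongr
      _ ≤ _ := by
          push_cast
          rw [div_mul_eq_mul_div, div_le_iff₀ ha1]; nlinarith

lemma vt_totient_lower (q : ℕ) (hq : 0 < q) : (q : ℝ) ≤ Nat.totient q * (Nat.log 2 q + 1) := by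
  have h0 := Nat.totient_eq_mul_prod_factors q
  have h1 : (Nat.totient q : ℝ) = q * ∏ p ∈ q.primeFactors, (1 - (p : ℝ)⁻¹) := by
    have := congrArg (fun x : ℚ => (x : ℝ)) h0
    push_cast at this; exact this
  have h2 := vt_prod_tele q.primeFactors (fun p hp => (Nat.prime_of_mem_primeFactors hp).two_le)
  have h3 : (∏ p ∈ q.primeFactors, (1 - (p : ℝ)⁻¹)) * ∏ p ∈ q.primeFactors, ((p : ℝ) / (p - 1)) = 1 := by
    rw [← Finset.prod_mul_distrib]
    apply Finset.prod_eq_one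
    intro p hp
    have : (2 : ℝ) ≤ p := by exact_mod_cast (Nat.prime_of_mem_primeFactors hp).two_le
    have h : (p : ℝ) - 1 ≠ 0 := by linarith
    have h' : (p : ℝ) ≠ 0 := by linarith
    field_simp
  have h4 : q.primeFactors.card ≤ Nat.log 2 q := by
    apply Nat.le_log_of_pow_le (by norm_num)
    calc 2 ^ q.primeFactors.card ≤ ∏ p ∈ q.primeFactors, p :=
          Finset.pow_card_le_prod _ _ _ (fun p hp => (Nat.prime_of_mem_primeFactors hp).two_le)
      _ ≤ q := Nat.le_of_dvd hq (Nat.prod_primeFactors_dvd q)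
  have h5 : ((q.primeFactors.card : ℕ) : ℝ) ≤ Nat.log 2 q := by exact_mod_cast h4
  calc (q : ℝ) = Nat.totient q * ∏ p ∈ q.primeFactors, ((p : ℝ) / (p - 1)) := by
        rw [h1, mul_assoc, h3, mul_one]
    _ ≤ _ := by gcongr; linarith

end P6a


section P6b
open Complex

lemma vt_noncop (q N : ℕ) (hq : 0 < q) (hN : 1 ≤ N) :
    ∑ n ∈ (Finset.Icc 1 N).filter (fun n => ¬ Nat.Coprime q n), ArithmeticFunction.vonMangoldt n
      ≤ (q + 1) * (Nat.log 2 N + 1) * Real.log N := by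
  set T := (Finset.range (q + 1) ×ˢ Finset.range (Nat.log 2 N + 1)).image (fun x => x.1 ^ x.2)
  have hT : (T.card : ℝ) ≤ (q + 1) * (Nat.log 2 N + 1) := by
    have := Finset.card_image_le (s := Finset.range (q + 1) ×ˢ Finset.range (Nat.log 2 N + 1))
      (f := fun x => x.1 ^ x.2)
    rw [Finset.card_product, Finset.card_range, Finset.card_range] at this
    exact_mod_cast this
  have h1 : ∑ n ∈ (Finset.Icc 1 N).filter (fun n => ¬ Nat.Coprime q n), ArithmeticFunction.vonMangoldt n
      = ∑ n ∈ ((Finset.Icc 1 N).filter (fun n => ¬ Nat.Coprime q n)).filter (fun n => n ∈ T), ArithmeticFunction.vonMangoldt n := by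
    symm
    apply Finset.sum_subset (Finset.filter_subset _ _)
    intro n hn hn'
    by_contra h
    apply hn'
    rw [Finset.mem_filter]
    refine ⟨hn, ?_⟩
    rw [← Ne, ArithmeticFunction.vonMangoldt_ne_zero_iff, isPrimePow_nat_iff] at h
    obtain ⟨p, k, hp, hk, rfl⟩ := h
    simp only [Finset.mem_filter, Finset.mem_Icc] at hn
    obtain ⟨⟨_, hn1⟩, hn2⟩ := hn
    rw [Nat.coprime_pow_right_iff hk, Nat.coprime_comm, Nat.Prime.coprime_iff_not_dvd hp, not_not] at hn2
    have hpq := Nat.le_of_dvd hq hn2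
    simp only [T, Finset.mem_image, Finset.mem_product, Finset.mem_range]
    refine ⟨(p, k), ⟨by simp; omega, ?_⟩, rfl⟩
    have : 2 ^ k ≤ N := (Nat.pow_le_pow_left hp.two_le k).trans hn1
    have := Nat.le_log_of_pow_le (by norm_num) this
    simp; omega
  rw [h1]
  have h2 : (((Finset.Icc 1 N).filter (fun n => ¬ Nat.Coprime q n)).filter (fun n => n ∈ T)).card ≤ T.card := by
    apply Finset.card_le_card
    intro n hn; exact (Finset.mem_filter.1 hn).2
  have hl : 0 ≤ Real.log N := Real.log_natCast_nonneg N
  calc _ ≤ ∑ n ∈ ((Finset.Icc 1 N).filter (fun n => ¬ Nat.Coprime q n)).filter (fun n => n ∈ T), Real.log N := by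
        apply Finset.sum_le_sum
        intro n hn
        simp only [Finset.mem_filter, Finset.mem_Icc] at hn
        refine ArithmeticFunction.vonMangoldt_le_log.trans ?_
        apply Real.log_le_log
        · exact_mod_cast hn.1.1.1
        · exact_mod_cast hn.1.1.2
    _ = (((Finset.Icc 1 N).filter (fun n => ¬ Nat.Coprime q n)).filter (fun n => n ∈ T)).card * Real.log N := by
        rw [Finset.sum_const, nsmul_eq_mul]
    _ ≤ T.card * Real.log N := by gcongr
    _ ≤ _ := by gcongr

lemma vt_char_exp (q : ℕ) [NeZero q] (a : ℤ) (n : ℕ) :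
    ∑ b ∈ (Finset.range q).filter (Nat.Coprime q), vtE (b * a / q) *
      ∑ χ : DirichletCharacter ℂ q, χ (b : ZMod q)⁻¹ * χ (n : ZMod q)
      = if Nat.Coprime q n then (Nat.totient q : ℂ) * vtE (n * a / q) else 0 := by
  have hq : 0 < q := Nat.pos_of_ne_zero (NeZero.ne q)
  have h1 : ∀ b ∈ (Finset.range q).filter (Nat.Coprime q), vtE (b * a / q) *
      ∑ χ : DirichletCharacter ℂ q, χ (b : ZMod q)⁻¹ * χ (n : ZMod q) =
      vtE (b * a / q) * if (b : ZMod q) = n then (Nat.totient q : ℂ) else 0 := by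
    intro b hb
    rw [DirichletCharacter.sum_char_inv_mul_char_eq]
    rw [ZMod.isUnit_iff_coprime]; exact (Finset.mem_filter.1 hb).2.symm
  rw [Finset.sum_congr rfl h1]
  split_ifs with h
  · rw [Finset.sum_eq_single (n % q)]
    · rw [if_pos (by simp), mul_comm]
      congr 1
      have := vtE_int_mul_div q hq.ne' ((n % q : ℕ) : ℤ) (n : ℤ) a
        (by push_cast; exact (Int.emod_emod_of_dvd (n : ℤ) (dvd_refl (q : ℤ))) |> Int.ModEq.symm |> Int.ModEq.dvd)
      simpa only [Int.cast_natCast] using this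
    · intro b hb hne
      rw [if_neg, mul_zero]
      rw [ZMod.natCast_eq_natCast_iff']
      intro h
      rw [Nat.mod_eq_of_lt (Finset.mem_range.1 (Finset.mem_filter.1 hb).1)] at h
      exact hne h
    · intro hn
      exfalso; apply hn
      rw [Finset.mem_filter, Finset.mem_range]
      refine ⟨Nat.mod_lt _ hq, ?_⟩
      rw [Nat.Coprime, Nat.gcd_comm, ← Nat.gcd_rec]; exact h
  · apply Finset.sum_eq_zero
    intro b hb
    rw [if_neg, mul_zero]
    intro hbn
    apply h
    have : IsUnit (b : ZMod q) := by
      rw [ZMod.isUnit_iff_coprime]; exact (Finset.mem_filter.1 hb).2.symm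
    rw [hbn, ZMod.isUnit_iff_coprime] at this; exact this.symm

lemma vt_log_ge_one {N : ℕ} (hN : 3 ≤ N) : 1 ≤ Real.log N := by
  rw [Real.le_log_iff_exp_le (by positivity)]
  have : (3 : ℝ) ≤ N := by exact_mod_cast hN
  linarith [Real.exp_one_lt_d9]

lemma vt_natlog_le {N : ℕ} (hN : 3 ≤ N) : (Nat.log 2 N : ℝ) + 1 ≤ 3 * Real.log N := by
  have h1 := Real.natLog_le_logb N 2
  have h2 := vt_log_ge_one hN
  rw [Real.logb] at h1
  have h3 := Real.log_two_gt_d9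
  have h4 : Real.log N / Real.log ((2 : ℕ) : ℝ) ≤ 2 * Real.log N := by
    rw [div_le_iff₀ (by push_cast; linarith)]
    push_cast; nlinarith
  linarith

lemma vt_logpow_le (K : ℕ) : ∃ C : ℝ, 0 < C ∧ ∀ x : ℝ, 3 ≤ x → Real.sqrt x ≤ C * x / (Real.log x) ^ K := by
  refine ⟨(2 * (K + 1 : ℕ) : ℝ) ^ (K + 1), by positivity, fun x hx => ?_⟩
  have h1 := vt_logpow_sqrt (K + 1) (by omega) (x := x) (by linarith)
  have hl : 1 ≤ Real.log x := by
    rw [Real.le_log_iff_exp_le (by linarith)]; linarith [Real.exp_one_lt_d9]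
  rw [le_div_iff₀ (by positivity)]
  have h2 : Real.log x ^ K ≤ Real.log x ^ (K + 1) := pow_le_pow_right₀ hl (by omega)
  have h3 : x = Real.sqrt x * Real.sqrt x := (Real.mul_self_sqrt (by linarith)).symm
  calc Real.sqrt x * Real.log x ^ K ≤ Real.sqrt x * ((2 * (K + 1 : ℕ) : ℝ) ^ (K + 1) * Real.sqrt x) := by
        gcongr; exact h2.trans h1
    _ = (2 * (K + 1 : ℕ) : ℝ) ^ (K + 1) * (Real.sqrt x * Real.sqrt x) := by ring
    _ = _ := by rw [← h3]

lemma vt_ap_exp (K : ℕ) : ∃ C : ℝ, 0 < C ∧ ∀ (q : ℕ), 0 < q → ∀ a : ℤ, IsCoprime (q : ℤ) a →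
    ∀ N : ℕ, 3 ≤ N → ‖∑ n ∈ Finset.Icc 1 N, ((ArithmeticFunction.vonMangoldt n : ℂ) * vtE (n * a / q)
      - (ArithmeticFunction.moebius q : ℂ) / Nat.totient q)‖ ≤ C * q ^ 2 * N / (Real.log N) ^ K := by
  obtain ⟨C1, hC1, h1⟩ := vt_SW K
  obtain ⟨C2, hC2, h2⟩ := vt_PNT K
  obtain ⟨C3, hC3, h3⟩ := vt_logpow_le K
  refine ⟨C1 + C2 + 2 * (2 * 3 * (4 * 4)) * C3, by positivity, fun q hq a ha N hN => ?_⟩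
  have : NeZero q := ⟨hq.ne'⟩
  have hl := vt_log_ge_one hN
  have hN3 : (3 : ℝ) ≤ N := by exact_mod_cast hN
  have hφ : 0 < Nat.totient q := Nat.totient_pos.2 hq
  have hφ' : (0 : ℝ) < Nat.totient q := by exact_mod_cast hφ
  have hq1 : (1 : ℝ) ≤ q := by exact_mod_cast hq
  set Z := ((q : ℝ) + 1) * (Nat.log 2 N + 1) * Real.log N with hZ
  set E := (N : ℝ) / (Real.log N) ^ K with hE
  have hE0 : 0 ≤ E := by positivity
  have hZE : Z ≤ 2 * 3 * (4 * 4) * C3 * (q ^ 2 * E) := by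
    have hs := h3 N hN3
    have h4 := vt_logpow_sqrt 2 (by norm_num) (x := N) (by linarith)
    have h5 := vt_natlog_le hN
    have hqq : (q : ℝ) + 1 ≤ 2 * q ^ 2 := by nlinarith
    calc Z ≤ (2 * q ^ 2) * (3 * Real.log N) * Real.log N := by rw [hZ]; gcongr
      _ = 2 * 3 * q ^ 2 * (Real.log N ^ 2) := by ring
      _ ≤ 2 * 3 * q ^ 2 * ((4 * 4) * (C3 * E)) := by
          gcongr
          rw [hE, ← mul_div_assoc]
          refine h4.trans ?_
          push_cast
          have : (2 * 2 : ℝ) ^ 2 = 4 * 4 := by norm_num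
          rw [this]; gcongr
      _ = _ := by ring
  set μ : ℂ := (ArithmeticFunction.moebius q : ℂ)
  have hμ : ‖μ‖ ≤ 1 := by
    have := ArithmeticFunction.abs_moebius_le_one (n := q)
    simp only [μ]; rw [Complex.norm_intCast]; exact_mod_cast this
  set S := ∑ n ∈ Finset.Icc 1 N, (ArithmeticFunction.vonMangoldt n : ℂ) * vtE (n * a / q) with hS
  set Sc := ∑ n ∈ Finset.Icc 1 N, if Nat.Coprime q n then (ArithmeticFunction.vonMangoldt n : ℂ) * vtE (n * a / q) else 0 with hSc
  set ψ := ∑ n ∈ Finset.Icc 1 N, (ArithmeticFunction.vonMangoldt n : ℂ) with hψ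
  set P : DirichletCharacter ℂ q → ℂ := fun χ => ∑ n ∈ Finset.Icc 1 N, vtC χ n with hP
  have hA : (Nat.totient q : ℂ) * Sc = ∑ b ∈ (Finset.range q).filter (Nat.Coprime q), vtE (b * a / q) *
      ∑ χ : DirichletCharacter ℂ q, χ (b : ZMod q)⁻¹ * P χ := by
    calc (Nat.totient q : ℂ) * Sc = ∑ n ∈ Finset.Icc 1 N, (ArithmeticFunction.vonMangoldt n : ℂ) *
          ∑ b ∈ (Finset.range q).filter (Nat.Coprime q), vtE (b * a / q) *
            ∑ χ : DirichletCharacter ℂ q, χ (b : ZMod q)⁻¹ * χ (n : ZMod q) := by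
          rw [hSc, Finset.mul_sum]
          apply Finset.sum_congr rfl
          intro n _
          rw [vt_char_exp]
          split_ifs <;> ring
      _ = _ := by
          simp_rw [Finset.mul_sum]
          rw [Finset.sum_comm]
          apply Finset.sum_congr rfl
          intro b _
          rw [Finset.sum_comm]
          apply Finset.sum_congr rfl
          intro χ _
          simp only [hP, vtC]
          rw [Finset.mul_sum, Finset.mul_sum]
          apply Finset.sum_congr rfl
          intro n _
          ring
  have hB : ‖(Nat.totient q : ℂ) * Sc - μ * P 1‖ ≤ Nat.totient q * (Nat.totient q * (C1 * q * E)) := by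
    have e : (Nat.totient q : ℂ) * Sc - μ * P 1 = ∑ b ∈ (Finset.range q).filter (Nat.Coprime q), vtE (b * a / q) *
      ∑ χ ∈ Finset.univ.erase (1 : DirichletCharacter ℂ q), χ (b : ZMod q)⁻¹ * P χ := by
      rw [hA, show μ = vtR q a from (vtR_coprime q hq a ha).symm, vtR, Finset.sum_mul, ← Finset.sum_sub_distrib]
      apply Finset.sum_congr rfl
      intro b hb
      rw [← Finset.add_sum_erase _ _ (Finset.mem_univ (1 : DirichletCharacter ℂ q))]
      have hu : IsUnit (b : ZMod q)⁻¹ := by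
        have hu0 : IsUnit (b : ZMod q) := by
          rw [ZMod.isUnit_iff_coprime]; exact (Finset.mem_filter.1 hb).2.symm
        exact IsUnit.of_mul_eq_one _ (ZMod.inv_mul_of_unit _ hu0)
      rw [MulChar.one_apply hu]; ring
    rw [e]
    have hcard : ((Finset.univ.erase (1 : DirichletCharacter ℂ q)).card : ℝ) ≤ Nat.totient q := by
      have := DirichletCharacter.card_eq_totient_of_hasEnoughRootsOfUnity ℂ q
      rw [← this, Nat.card_eq_fintype_card]
      exact_mod_cast Finset.card_le_univ _
    calc _ ≤ ∑ b ∈ (Finset.range q).filter (Nat.Coprime q), (Nat.totient q * (C1 * q * E)) := by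
          apply norm_sum_le_of_le
          intro b hb
          rw [norm_mul, vtE_norm, one_mul]
          calc _ ≤ ∑ χ ∈ Finset.univ.erase (1 : DirichletCharacter ℂ q), (C1 * q * E) := by
                apply norm_sum_le_of_le
                intro χ hχ
                rw [norm_mul]
                have hh := h1 q χ (Finset.ne_of_mem_erase hχ) N hN
                have hn := χ.norm_le_one ((b : ZMod q)⁻¹)
                rw [mul_div_assoc] at hh
                calc _ ≤ 1 * ‖P χ‖ := by gcongr
                  _ ≤ _ := by rw [one_mul]; exact hh
            _ ≤ _ := by
                rw [Finset.sum_const, nsmul_eq_mul]; gcongr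
      _ = _ := by rw [Finset.sum_const, nsmul_eq_mul]; rfl
  have hncop := vt_noncop q N hq (by omega)
  have hC : ‖S - Sc‖ ≤ Z := by
    rw [hS, hSc, ← Finset.sum_sub_distrib]
    refine le_trans ?_ hncop
    rw [Finset.sum_filter]
    apply norm_sum_le_of_le
    intro n _
    by_cases h : Nat.Coprime q n
    · rw [if_pos h, if_neg (not_not.2 h)]; simp
    · rw [if_neg h, if_pos h, sub_zero]
      rw [norm_mul, vtE_norm, mul_one, Complex.norm_real, Real.norm_of_nonneg ArithmeticFunction.vonMangoldt_nonneg]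
  have hD : ‖P 1 - ψ‖ ≤ Z := by
    simp only [hP]
    rw [hψ, ← Finset.sum_sub_distrib]
    refine le_trans ?_ hncop
    rw [Finset.sum_filter]
    apply norm_sum_le_of_le
    intro n _
    unfold vtC
    by_cases h : Nat.Coprime q n
    · have hu : IsUnit (n : ZMod q) := by
        rw [ZMod.isUnit_iff_coprime]; exact h.symm
      simp [h, MulChar.one_apply hu]
    · have hu : ¬ IsUnit (n : ZMod q) := by
        rw [ZMod.isUnit_iff_coprime]; exact fun hh => h hh.symm
      simp only [h, not_false_eq_true, if_true]
      rw [MulChar.map_nonunit _ hu, zero_mul, zero_sub, norm_neg, Complex.norm_real, Real.norm_of_nonneg ArithmeticFunction.vonMangoldt_nonneg]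
  have hF : ‖ψ - N‖ ≤ C2 * E := by
    have := h2 N hN
    unfold vtD at this
    rw [Finset.sum_sub_distrib, mul_div_assoc] at this
    simpa using this
  have e1 : ∑ n ∈ Finset.Icc 1 N, ((ArithmeticFunction.vonMangoldt n : ℂ) * vtE (n * a / q)
      - μ / Nat.totient q) = S - N * (μ / Nat.totient q) := by
    rw [Finset.sum_sub_distrib]; simp [hS]
  rw [e1]
  have hφc : (Nat.totient q : ℂ) ≠ 0 := by exact_mod_cast hφ.ne'
  have e2 : (Nat.totient q : ℂ) * (S - N * (μ / Nat.totient q)) = Nat.totient q * (S - Sc) +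
      (Nat.totient q * Sc - μ * P 1) + μ * ((P 1 - ψ) + (ψ - N)) := by
    field_simp; ring
  have h6 : (Nat.totient q : ℝ) * ‖S - N * (μ / Nat.totient q)‖ ≤ Nat.totient q * Z +
      Nat.totient q * (Nat.totient q * (C1 * q * E)) + 1 * (Z + C2 * E) := by
    have : ‖(Nat.totient q : ℂ) * (S - N * (μ / Nat.totient q))‖ = (Nat.totient q : ℝ) * ‖S - N * (μ / Nat.totient q)‖ := by
      rw [norm_mul, Complex.norm_natCast]
    rw [← this, e2]
    refine (norm_add_le _ _).trans (add_le_add ((norm_add_le _ _).trans (add_le_add ?_ hB)) ?_)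
    · rw [norm_mul, Complex.norm_natCast]; gcongr
    · rw [norm_mul]
      have := (norm_add_le (P 1 - ψ) (ψ - N)).trans (add_le_add hD hF)
      gcongr
  have hφ1 : (1 : ℝ) ≤ Nat.totient q := by exact_mod_cast hφ
  have hφq : (Nat.totient q : ℝ) ≤ q := by exact_mod_cast Nat.totient_le q
  have hZ0 : 0 ≤ Z := by rw [hZ]; positivity
  have h7 : ‖S - N * (μ / Nat.totient q)‖ ≤ 2 * Z + q * (C1 * q * E) + C2 * E := by
    have : (Nat.totient q : ℝ) * ‖S - N * (μ / Nat.totient q)‖ ≤ Nat.totient q * (2 * Z + q * (C1 * q * E) + C2 * E) := by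
      refine h6.trans ?_
      have a1 : Z + C2 * E ≤ Nat.totient q * (Z + C2 * E) := by
        apply le_mul_of_one_le_left _ hφ1
        positivity
      have a2 : Nat.totient q * (Nat.totient q * (C1 * q * E)) ≤ Nat.totient q * (q * (C1 * q * E)) := by gcongr
      linarith
    exact le_of_mul_le_mul_left this hφ'
  have h8 : (C1 + C2 + 2 * (2 * 3 * (4 * 4)) * C3) * (q : ℝ) ^ 2 * N / Real.log N ^ K =
     (C1 + C2 + 2 * (2 * 3 * (4 * 4)) * C3) * (q ^ 2 * E) := by rw [hE]; ring
  rw [h8]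
  refine h7.trans ?_
  have h9 : C2 * E ≤ C2 * (q ^ 2 * E) := by
    gcongr; apply le_mul_of_one_le_left hE0; nlinarith
  have : (q : ℝ) * (C1 * q * E) = C1 * (q ^ 2 * E) := by ring
  rw [this]; linarith

end P6b


section P6c
open Complex

lemma vt_ap_unif (K : ℕ) : ∃ C : ℝ, 0 < C ∧ ∀ (q : ℕ), 0 < q → ∀ a : ℤ, IsCoprime (q : ℤ) a →
    ∀ N : ℕ, 3 ≤ N → ∀ j ≤ N, ‖∑ n ∈ Finset.range j, ((ArithmeticFunction.vonMangoldt n : ℂ) * vtE (n * a / q)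
      - (ArithmeticFunction.moebius q : ℂ) / Nat.totient q)‖ ≤ C * q ^ 2 * N / (Real.log N) ^ K := by
  obtain ⟨C1, hC1, h1⟩ := vt_ap_exp K
  obtain ⟨C3, hC3, h3⟩ := vt_logpow_le K
  refine ⟨C1 * (2 ^ K + C3) + 10 * C3, by positivity, fun q hq a ha N hN j hj => ?_⟩
  have hl := vt_log_ge_one hN
  have hN3 : (3 : ℝ) ≤ N := by exact_mod_cast hN
  have hq1 : (1 : ℝ) ≤ q := by exact_mod_cast hq
  have hφ : 0 < Nat.totient q := Nat.totient_pos.2 hq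
  have hφ1 : (1 : ℝ) ≤ Nat.totient q := by exact_mod_cast hφ
  set D : ℕ → ℂ := fun n => ((ArithmeticFunction.vonMangoldt n : ℂ) * vtE (n * a / q)
      - (ArithmeticFunction.moebius q : ℂ) / Nat.totient q) with hD
  have hμφ : ‖(ArithmeticFunction.moebius q : ℂ) / Nat.totient q‖ ≤ 1 := by
    rw [norm_div, Complex.norm_natCast]
    have := ArithmeticFunction.abs_moebius_le_one (n := q)
    have h : ‖(ArithmeticFunction.moebius q : ℂ)‖ ≤ 1 := by
      rw [Complex.norm_intCast]; exact_mod_cast this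
    rw [div_le_one (by linarith)]; linarith
  have hD0 : ∀ n < 3, ‖D n‖ ≤ 2 := by
    intro n hn
    refine (norm_sub_le _ _).trans ?_
    rw [norm_mul, vtE_norm, mul_one, Complex.norm_real, Real.norm_of_nonneg ArithmeticFunction.vonMangoldt_nonneg]
    have : ArithmeticFunction.vonMangoldt n ≤ 1 := by
      refine ArithmeticFunction.vonMangoldt_le_log.trans ?_
      rcases Nat.eq_zero_or_pos n with rfl | h
      · simp
      · have h2 : (n : ℝ) ≤ 2 := by exact_mod_cast (by omega : n ≤ 2)
        have : Real.log n ≤ Real.log 2 := Real.log_le_log (by exact_mod_cast h) h2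
        linarith [Real.log_two_lt_d9]
    linarith
  set E := (N : ℝ) / (Real.log N) ^ K with hE
  have hs : Real.sqrt N ≤ C3 * E := by have := h3 N hN3; rwa [mul_div_assoc] at this
  have hs1 : 1 ≤ Real.sqrt N := by rw [Real.one_le_sqrt]; linarith
  have hE0 : 0 ≤ E := by positivity
  have hgoal : (C1 * (2 ^ K + C3) + 10 * C3) * (q : ℝ) ^ 2 * N / Real.log N ^ K = q ^ 2 * (C1 * (2 ^ K * E + C3 * E) + 10 * (C3 * E)) := by
    rw [hE]; ring
  rw [hgoal]
  have hq2 : (1 : ℝ) ≤ q ^ 2 := by nlinarith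
  have hqE : 10 * (C3 * E) ≤ q ^ 2 * (10 * (C3 * E)) := le_mul_of_one_le_left (by positivity) hq2
  have hqE1 : 0 ≤ q ^ 2 * (C1 * (2 ^ K * E + C3 * E)) := by positivity
  rcases Nat.lt_or_ge j 4 with h4 | h4
  · have : ‖∑ n ∈ Finset.range j, D n‖ ≤ 6 := by
      calc _ ≤ ∑ n ∈ Finset.range j, (2 : ℝ) := norm_sum_le_of_le _ (fun n hn => hD0 n (by have := Finset.mem_range.1 hn; omega))
        _ ≤ 6 := by
          rw [Finset.sum_const, nsmul_eq_mul, Finset.card_range]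
          have : (j : ℝ) ≤ 3 := by exact_mod_cast (by omega : j ≤ 3)
          linarith
    rw [mul_add]; linarith
  · obtain ⟨k, rfl⟩ : ∃ k, j = k + 1 := ⟨j - 1, by omega⟩
    have e : Finset.range (k + 1) = insert 0 (Finset.Icc 1 k) := by
      ext x; simp only [Finset.mem_range, Finset.mem_insert, Finset.mem_Icc]; omega
    change ‖∑ n ∈ Finset.range (k + 1), D n‖ ≤ _
    rw [e, Finset.sum_insert (by simp)]
    have hk := h1 q hq a ha k (by omega)
    have hk3 : (3 : ℝ) ≤ k := by exact_mod_cast (by omega : 3 ≤ k)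
    have hkl := vt_log_ge_one (N := k) (by omega)
    have hkN : (k : ℝ) ≤ N := by exact_mod_cast (by omega : k ≤ N)
    have hkE : (k : ℝ) / (Real.log k) ^ K ≤ 2 ^ K * E + C3 * E := by
      rcases le_total (Real.sqrt N) k with h | h
      · have : Real.log N / 2 ≤ Real.log k := by
          rw [← Real.log_sqrt (by linarith)]
          exact Real.log_le_log (by linarith) h
        have h5 : (Real.log N / 2) ^ K ≤ Real.log k ^ K := by gcongr
        have : (k : ℝ) / (Real.log k) ^ K ≤ 2 ^ K * E := by
          calc (k : ℝ) / (Real.log k) ^ K ≤ N / (Real.log N / 2) ^ K := by gcongr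
            _ = 2 ^ K * E := by rw [hE, div_pow]; field_simp
        have : 0 ≤ C3 * E := by positivity
        linarith
      · have : (k : ℝ) / (Real.log k) ^ K ≤ k := div_le_self (by linarith) (one_le_pow₀ hkl)
        have : 0 ≤ 2 ^ K * E := by positivity
        linarith
    refine (norm_add_le _ _).trans ?_
    have h0 := hD0 0 (by norm_num)
    have h6 : C1 * (q : ℝ) ^ 2 * k / Real.log k ^ K = q ^ 2 * (C1 * (k / Real.log k ^ K)) := by ring
    rw [h6] at hk
    have h7 : q ^ 2 * (C1 * (k / Real.log k ^ K)) ≤ q ^ 2 * (C1 * (2 ^ K * E + C3 * E)) := by gcongr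
    rw [mul_add]
    have h8 : ‖∑ n ∈ Finset.Icc 1 k, D n‖ ≤ q ^ 2 * (C1 * (k / Real.log k ^ K)) := hk
    linarith

lemma vt_major (K : ℕ) : ∃ C : ℝ, 0 < C ∧ ∀ (q : ℕ), 0 < q → ∀ a : ℤ, IsCoprime (q : ℤ) a →
    ∀ N : ℕ, 3 ≤ N → ∀ β : ℝ, ∀ a0 b0 : ℕ, b0 ≤ N →
    ‖∑ n ∈ Finset.Ico a0 b0, (ArithmeticFunction.vonMangoldt n : ℂ) * vtE (n * (a / q + β))
      - (ArithmeticFunction.moebius q : ℂ) / Nat.totient q * ∑ n ∈ Finset.Ico a0 b0, vtE (n * β)‖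
      ≤ C * q ^ 2 * (1 + N * |β|) * N / (Real.log N) ^ K := by
  obtain ⟨C1, hC1, h1⟩ := vt_ap_unif K
  refine ⟨2 * C1 * (2 * Real.pi), by positivity, fun q hq a ha N hN β a0 b0 hb => ?_⟩
  have hl := vt_log_ge_one hN
  set D : ℕ → ℂ := fun n => ((ArithmeticFunction.vonMangoldt n : ℂ) * vtE (n * a / q)
      - (ArithmeticFunction.moebius q : ℂ) / Nat.totient q) with hD
  have e : ∑ n ∈ Finset.Ico a0 b0, (ArithmeticFunction.vonMangoldt n : ℂ) * vtE (n * (a / q + β))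
      - (ArithmeticFunction.moebius q : ℂ) / Nat.totient q * ∑ n ∈ Finset.Ico a0 b0, vtE (n * β)
      = ∑ i ∈ Finset.range (b0 - a0), vtE ((a0 + i : ℕ) * β) * D (a0 + i) := by
    rw [Finset.mul_sum, ← Finset.sum_sub_distrib, Finset.sum_Ico_eq_sum_range]
    apply Finset.sum_congr rfl
    intro i _
    simp only [hD]
    have : ((a0 + i : ℕ) : ℝ) * (a / q + β) = ((a0 + i : ℕ) : ℝ) * a / q + ((a0 + i : ℕ) : ℝ) * β := by ring
    rw [this, vtE_add]; ring
  rw [e]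
  set M := C1 * q ^ 2 * N / (Real.log N) ^ K with hM
  have hM0 : 0 ≤ M := by positivity
  have h2 := vt_abel (fun i => vtE ((a0 + i : ℕ) * β)) (fun i => D (a0 + i)) (2 * M) (b0 - a0) (by
    intro j hj
    rcases Nat.eq_zero_or_pos j with rfl | hj0
    · simp; positivity
    have e2 : ∑ i ∈ Finset.range j, D (a0 + i) = ∑ i ∈ Finset.range (a0 + j), D i - ∑ i ∈ Finset.range a0, D i := by
      rw [Finset.sum_range_add]; ring
    rw [e2]
    refine (norm_sub_le _ _).trans ?_
    have p1 := h1 q hq a ha N hN (a0 + j) (by omega)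
    have p2 := h1 q hq a ha N hN a0 (by omega)
    linarith)
  refine h2.trans ?_
  have h3 : ∀ i ∈ Finset.range (b0 - a0), ‖vtE ((a0 + (i + 1) : ℕ) * β) - vtE ((a0 + i : ℕ) * β)‖ ≤ 2 * Real.pi * |β| := by
    intro i _
    have : ((a0 + (i + 1) : ℕ) : ℝ) * β = ((a0 + i : ℕ) : ℝ) * β + β := by push_cast; ring
    rw [this, vtE_add]
    have : vtE ((a0 + i : ℕ) * β) * vtE β - vtE ((a0 + i : ℕ) * β) = vtE ((a0 + i : ℕ) * β) * (vtE β - 1) := by ring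
    rw [this, norm_mul, vtE_norm, one_mul]; exact vtE_sub_one_le β
  have h4 : ∑ i ∈ Finset.range (b0 - a0), ‖vtE ((a0 + (i + 1) : ℕ) * β) - vtE ((a0 + i : ℕ) * β)‖ ≤ N * (2 * Real.pi * |β|) := by
    refine (Finset.sum_le_sum h3).trans ?_
    rw [Finset.sum_const, nsmul_eq_mul, Finset.card_range]
    have : ((b0 - a0 : ℕ) : ℝ) ≤ N := by exact_mod_cast (by omega : b0 - a0 ≤ N)
    gcongr
  have hpi : 1 ≤ 2 * Real.pi := by linarith [Real.pi_gt_three]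
  calc 2 * M * (‖vtE ((a0 + (b0 - a0) : ℕ) * β)‖ + ∑ i ∈ Finset.range (b0 - a0), ‖vtE ((a0 + (i + 1) : ℕ) * β) - vtE ((a0 + i : ℕ) * β)‖)
      ≤ 2 * M * (2 * Real.pi * 1 + N * (2 * Real.pi * |β|)) := by
        rw [vtE_norm]; gcongr; linarith
    _ = _ := by rw [hM]; ring

end P6c


section P7a
open Complex

/-- Diophantine separation -/
lemma vt_sep (α : ℝ) (q : ℕ) (a : ℤ) (hq : 0 < q) (ha : IsCoprime (q : ℤ) a)
    (h : |α - a / q| ≤ 1 / (q : ℝ) ^ 2) (k : ℤ) (hk : k ≠ 0) (hkq : 2 * |k| ≤ q) (hlt : |k| < q) :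
    1 / (2 * q : ℝ) ≤ vtN (k * α) := by
  have hq' : (0 : ℝ) < q := by exact_mod_cast hq
  have h1 : vtN (k * a / q) ≤ vtN (k * α) + |(k : ℝ)| * (1 / (q : ℝ) ^ 2) := by
    have e : (k * a / q : ℝ) = k * α + (-(k * (α - a / q))) := by ring
    rw [e]
    refine (vtN_add_le _ _).trans ?_
    rw [abs_neg, abs_mul]
    gcongr
  have h2 : 1 / (q : ℝ) ≤ vtN (k * a / q) := by
    unfold vtN
    set r := round (k * a / q : ℝ)
    have e : (k * a / q : ℝ) - r = ((k * a - q * r : ℤ) : ℝ) / q := by push_cast; field_simp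
    rw [e, abs_div, abs_of_pos hq']
    gcongr
    have : k * a - q * r ≠ 0 := by
      intro h0
      have hd : (q : ℤ) ∣ k * a := ⟨r, by linarith⟩
      have hd2 : (q : ℤ) ∣ k := ha.dvd_of_dvd_mul_right hd
      have := Int.le_of_dvd (abs_pos.2 hk) ((dvd_abs _ _).2 hd2)
      omega
    have h3 := Int.one_le_abs this
    exact_mod_cast h3
  have h3 : |(k : ℝ)| * (1 / (q : ℝ) ^ 2) ≤ 1 / (2 * q) := by
    have : 2 * |(k : ℝ)| ≤ q := by exact_mod_cast hkq
    rw [mul_one_div, div_le_div_iff₀ (by positivity) (by positivity)]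
    nlinarith
  have h4 : 1 / (q : ℝ) = 1 / (2 * q) + 1 / (2 * q) := by field_simp; norm_num
  linarith

lemma vtN_frac (x : ℝ) : vtN x = min (Int.fract x) (1 - Int.fract x) := by
  unfold vtN; rw [abs_sub_round_eq_min]

lemma vt_harm (n : ℕ) (hn : 1 ≤ n) : ∑ j ∈ Finset.range n, 1 / (j : ℝ) ≤ 1 + Real.log n := by
  have h1 := harmonic_le_one_add_log n
  rw [harmonic] at h1
  push_cast at h1
  refine le_trans ?_ h1
  obtain ⟨m, rfl⟩ : ∃ m, n = m + 1 := ⟨n - 1, by omega⟩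
  rw [Finset.sum_range_succ', Finset.sum_range_succ]
  simp
  positivity

lemma vt_block (α : ℝ) (q : ℕ) (a : ℤ) (hq : 2 ≤ q) (ha : IsCoprime (q : ℤ) a)
    (h : |α - a / q| ≤ 1 / (q : ℝ) ^ 2) (θ : ℝ) (M : ℝ) (hM : 0 ≤ M) (F : ℕ → ℝ)
    (hF1 : ∀ k, F k ≤ M) (hF2 : ∀ k : ℕ, F k * vtN (k * α + θ) ≤ 1 / 2) (k0 : ℕ) :
    ∑ k ∈ Finset.Ico k0 (k0 + q / 2), F k ≤ 2 * M + 2 * q * (1 + Real.log (2 * q)) := by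
  have hq' : (0 : ℝ) < q := by positivity
  set c : ℕ → ℕ := fun k => ⌊2 * q * Int.fract (k * α + θ)⌋₊ with hc
  set G : ℕ → ℝ := fun j => (if j = 0 then M else 0) + q * (1 / (j : ℝ)) with hG
  have hG0 : ∀ j, 0 ≤ G j := by intro j; simp only [hG]; split_ifs <;> positivity
  have hc_lt : ∀ k, c k < 2 * q := by
    intro k
    simp only [hc]
    rw [Nat.floor_lt (by have := Int.fract_nonneg (k * α + θ); positivity)]
    push_cast
    have := Int.fract_lt_one (k * α + θ)
    nlinarith
  have hinj : Set.InjOn c (Finset.Ico k0 (k0 + q / 2) : Finset ℕ) := by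
    intro k hk k' hk' hkk
    by_contra hne
    simp only [Finset.coe_Ico, Set.mem_Ico] at hk hk'
    have hd := vt_sep α q a (by omega) ha h ((k : ℤ) - k') (by omega) (by
      have : 2 * (q / 2) ≤ q := Nat.mul_div_le q 2
      have : |(k : ℤ) - k'| ≤ (q / 2 : ℕ) := by rw [abs_le]; constructor <;> omega
      omega) (by
      have : |(k : ℤ) - k'| ≤ (q / 2 : ℕ) := by rw [abs_le]; constructor <;> omega
      omega)
    set f := Int.fract (k * α + θ) with hf
    set f' := Int.fract (k' * α + θ) with hf'
    have hff : |2 * q * f - 2 * q * f'| < 1 := by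
      have a1 := Nat.floor_le (show 0 ≤ 2 * q * f by have := Int.fract_nonneg (k * α + θ); positivity)
      have a2 := Nat.lt_floor_add_one (2 * q * f)
      have a3 := Nat.floor_le (show 0 ≤ 2 * q * f' by have := Int.fract_nonneg (k' * α + θ); positivity)
      have a4 := Nat.lt_floor_add_one (2 * q * f')
      have e : ((⌊2 * q * f⌋₊ : ℕ) : ℝ) = (⌊2 * q * f'⌋₊ : ℕ) := congrArg (fun n : ℕ => (n : ℝ)) hkk
      rw [abs_lt]; constructor <;> linarith
    have h5 : vtN (((k : ℤ) - k' : ℤ) * α) ≤ |f - f'| := by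
      refine (vtN_le _ (⌊k * α + θ⌋ - ⌊k' * α + θ⌋)).trans ?_
      apply le_of_eq; congr 1
      rw [hf, hf', Int.fract, Int.fract]; push_cast; ring
    have h6 : 2 * q * |f - f'| < 1 := by
      have : 2 * q * f - 2 * q * f' = 2 * q * (f - f') := by ring
      rw [this, abs_mul, abs_of_pos (by positivity)] at hff; exact hff
    have h7 : 1 / (2 * q : ℝ) ≤ |f - f'| := hd.trans h5
    rw [div_le_iff₀ (by positivity)] at h7
    linarith
  have hbound : ∀ k, F k ≤ G (c k) + G (2 * q - 1 - c k) := by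
    intro k
    have hlt := hc_lt k
    by_cases h0 : c k = 0
    · have : M ≤ G (c k) := by simp only [hG, h0]; simp
      have := hG0 (2 * q - 1 - c k); have := hF1 k; linarith
    by_cases h1 : 2 * q - 1 - c k = 0
    · have : M ≤ G (2 * q - 1 - c k) := by simp only [hG, h1]; simp
      have := hG0 (c k); have := hF1 k; linarith
    have hGc : G (c k) = q * (1 / (c k : ℝ)) := by simp [hG, h0]
    have hGd : G (2 * q - 1 - c k) = q * (1 / ((2 * q - 1 - c k : ℕ) : ℝ)) := by
      simp only [hG, h1, if_false, zero_add]
    have hf0 := Int.fract_nonneg (k * α + θ)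
    have hf1 := Int.fract_lt_one (k * α + θ)
    set f := Int.fract (k * α + θ) with hf
    have a1 : (c k : ℝ) ≤ 2 * q * f := Nat.floor_le (by positivity)
    have a2 : 2 * q * f < c k + 1 := Nat.lt_floor_add_one (2 * q * f)
    have hck : (0 : ℝ) < c k := by exact_mod_cast Nat.pos_of_ne_zero h0
    have hdk : (0 : ℝ) < ((2 * q - 1 - c k : ℕ) : ℝ) := by exact_mod_cast Nat.pos_of_ne_zero h1
    have hdk' : ((2 * q - 1 - c k : ℕ) : ℝ) = 2 * q - 1 - c k := by
      have : 2 * q - 1 - c k + c k + 1 = 2 * q := by omega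
      have h := congrArg (fun n : ℕ => (n : ℝ)) this
      push_cast at h; linarith
    have hF := hF2 k
    rw [vtN_frac] at hF
    by_cases hFk : F k ≤ 0
    · exact hFk.trans (add_nonneg (hG0 _) (hG0 _))
    push Not at hFk
    rcases min_cases f (1 - f) with ⟨hm, _⟩ | ⟨hm, _⟩
    · rw [hm] at hF
      have : F k ≤ G (c k) := by
        rw [hGc, mul_one_div, le_div_iff₀ hck]
        have : F k * c k ≤ F k * (2 * q * f) := by gcongr
        nlinarith
      linarith [hG0 (2 * q - 1 - c k)]
    · rw [hm] at hF
      have : F k ≤ G (2 * q - 1 - c k) := by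
        rw [hGd, mul_one_div, le_div_iff₀ hdk]
        have : F k * ((2 * q - 1 - c k : ℕ) : ℝ) ≤ F k * (2 * q * (1 - f)) := by
          gcongr; rw [hdk']; linarith
        nlinarith
      linarith [hG0 (c k)]
  have hsumG : ∑ j ∈ Finset.range (2 * q), G j ≤ M + q * (1 + Real.log (2 * q)) := by
    simp only [hG]
    rw [Finset.sum_add_distrib, ← Finset.mul_sum]
    have := vt_harm (2 * q) (by omega)
    push_cast at this
    have h2 : ∑ i ∈ Finset.range (2 * q), (if i = 0 then M else 0) = M := by
      rw [Finset.sum_ite_eq' (Finset.range (2 * q)) 0 (fun _ => M), if_pos (by simp; omega)]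
    rw [h2]; gcongr
  calc ∑ k ∈ Finset.Ico k0 (k0 + q / 2), F k ≤ ∑ k ∈ Finset.Ico k0 (k0 + q / 2), (G (c k) + G (2 * q - 1 - c k)) :=
        Finset.sum_le_sum (fun k _ => hbound k)
    _ = ∑ j ∈ (Finset.Ico k0 (k0 + q / 2)).image c, (G j + G (2 * q - 1 - j)) := by
        rw [Finset.sum_image hinj]
    _ ≤ ∑ j ∈ Finset.range (2 * q), (G j + G (2 * q - 1 - j)) := by
        apply Finset.sum_le_sum_of_subset_of_nonneg
        · intro j hj
          obtain ⟨k, _, rfl⟩ := Finset.mem_image.1 hj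
          exact Finset.mem_range.2 (hc_lt k)
        · intro j _ _; exact add_nonneg (hG0 _) (hG0 _)
    _ = 2 * ∑ j ∈ Finset.range (2 * q), G j := by
        rw [Finset.sum_add_distrib, Finset.sum_range_reflect]; ring
    _ ≤ _ := by linarith

lemma vt_blocks (α : ℝ) (q : ℕ) (a : ℤ) (hq : 2 ≤ q) (ha : IsCoprime (q : ℤ) a)
    (h : |α - a / q| ≤ 1 / (q : ℝ) ^ 2) (θ : ℝ) (M : ℝ) (hM : 0 ≤ M) (F : ℕ → ℝ) (hF0 : ∀ k, 0 ≤ F k)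
    (hF1 : ∀ k, F k ≤ M) (hF2 : ∀ k : ℕ, F k * vtN (k * α + θ) ≤ 1 / 2) (L : ℕ) :
    ∑ k ∈ Finset.range L, F k ≤ (3 * L / q + 1) * (2 * M + 2 * q * (1 + Real.log (2 * q))) := by
  set B := q / 2 with hB
  have hB0 : 0 < B := by omega
  set W := 2 * M + 2 * q * (1 + Real.log (2 * q)) with hW
  have hW0 : 0 ≤ W := by
    have : (0 : ℝ) ≤ Real.log (2 * q) := by exact_mod_cast Real.log_natCast_nonneg (2 * q)
    positivity
  have h1 : ∀ n : ℕ, ∑ k ∈ Finset.range (n * B), F k ≤ n * W := by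
    intro n
    induction n with
    | zero => simp
    | succ n ih =>
      have e : (n + 1) * B = n * B + B := by ring
      rw [e, ← Finset.sum_range_add_sum_Ico _ (Nat.le_add_right (n * B) B)]
      have := vt_block α q a hq ha h θ M hM F hF1 hF2 (n * B)
      push_cast
      linarith
  have h2 : L ≤ (L / B + 1) * B := by
    have := Nat.lt_div_mul_add (a := L) hB0
    have e : (L / B + 1) * B = L / B * B + B := by ring
    omega
  calc ∑ k ∈ Finset.range L, F k ≤ ∑ k ∈ Finset.range ((L / B + 1) * B), F k := by
        apply Finset.sum_le_sum_of_subset_of_nonneg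
        · exact Finset.range_mono h2
        · intro i _ _; exact hF0 i
    _ ≤ ((L / B + 1 : ℕ) : ℝ) * W := h1 _
    _ ≤ _ := by
        gcongr
        push_cast
        gcongr
        have h3 : ((L / B : ℕ) : ℝ) ≤ (L : ℝ) / B := Nat.cast_div_le
        refine h3.trans ?_
        have hB0' : (0 : ℝ) < B := by exact_mod_cast hB0
        rw [div_le_div_iff₀ hB0' (by positivity)]
        have h4 : (q : ℝ) ≤ 3 * B := by exact_mod_cast (by omega : q ≤ 3 * B)
        nlinarith [Nat.cast_nonneg (α := ℝ) L]

end P7a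


section P7b
open Complex

lemma vt_filter_Ico (M N k1 k2 : ℕ) : ∃ t ≤ 2 * M + 1,
    (Finset.Ioc M (2 * M)).filter (fun m => m * k1 ≤ N ∧ m * k2 ≤ N) = Finset.Ico (M + 1) t := by
  refine ⟨min (2 * M + 1) (min (if k1 = 0 then 2 * M + 1 else N / k1 + 1) (if k2 = 0 then 2 * M + 1 else N / k2 + 1)),
    min_le_left _ _, ?_⟩
  ext m
  simp only [Finset.mem_filter, Finset.mem_Ioc, Finset.mem_Ico, lt_min_iff]
  have h : ∀ k : ℕ, 0 < k → (m * k ≤ N ↔ m < N / k + 1) := by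
    intro k hk; rw [Nat.lt_succ_iff, Nat.le_div_iff_mul_le hk]
  rcases Nat.eq_zero_or_pos k1 with h1 | h1 <;> rcases Nat.eq_zero_or_pos k2 with h2 | h2
  · subst h1; subst h2; simp
  · subst h1; rw [h k2 h2]; simp [h2.ne']; omega
  · subst h2; rw [h k1 h1]; simp [h1.ne']; omega
  · rw [h k1 h1, h k2 h2]; simp [h1.ne', h2.ne']; omega

lemma vt_bilin (α : ℝ) (q : ℕ) (a : ℤ) (hq : 2 ≤ q) (ha : IsCoprime (q : ℤ) a)
    (h : |α - a / q| ≤ 1 / (q : ℝ) ^ 2) (M L N : ℕ) (x y : ℕ → ℂ) (H : ℝ)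
    (hx : ∀ m, ‖x m‖ ≤ 1) (hy : ∀ l ∈ Finset.Ioc 0 L, ‖y l‖ ≤ H) :
    ‖∑ m ∈ Finset.Ioc M (2 * M), ∑ l ∈ Finset.Ioc 0 L,
      if m * l ≤ N then x m * y l * vtE (m * l * α) else 0‖ ^ 2 ≤
      M * (H ^ 2 * (L * ((3 * (L + 1) / q + 1) * (2 * M + 2 * q * (1 + Real.log (2 * q)))))) := by
  have hH : ∀ l ∈ Finset.Ioc 0 L, 0 ≤ H := fun l hl => (norm_nonneg _).trans (hy l hl)
  set Z : ℕ → ℂ := fun m => ∑ l ∈ Finset.Ioc 0 L, if m * l ≤ N then y l * vtE (m * l * α) else 0 with hZ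
  have e1 : ∀ m, ∑ l ∈ Finset.Ioc 0 L, (if m * l ≤ N then x m * y l * vtE (m * l * α) else 0) = x m * Z m := by
    intro m
    simp only [hZ]
    rw [Finset.mul_sum]
    apply Finset.sum_congr rfl
    intro l _
    split_ifs <;> ring
  simp_rw [e1]
  have e2 : ‖∑ m ∈ Finset.Ioc M (2 * M), x m * Z m‖ ^ 2 ≤ M * ∑ m ∈ Finset.Ioc M (2 * M), ‖Z m‖ ^ 2 := by
    have : ‖∑ m ∈ Finset.Ioc M (2 * M), x m * Z m‖ ≤ ∑ m ∈ Finset.Ioc M (2 * M), ‖Z m‖ := by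
      apply norm_sum_le_of_le
      intro m _
      rw [norm_mul]
      exact mul_le_of_le_one_left (norm_nonneg _) (hx m)
    calc _ ≤ (∑ m ∈ Finset.Ioc M (2 * M), ‖Z m‖) ^ 2 := by gcongr
      _ ≤ _ := by
        refine sq_sum_le_card_mul_sum_sq.trans ?_
        rw [Nat.card_Ioc]
        have : 2 * M - M = M := by omega
        rw [this]
  refine e2.trans ?_
  gcongr
  set F : ℕ → ℕ → ℝ := fun k1 k2 => ‖∑ m ∈ (Finset.Ioc M (2 * M)).filter (fun m => m * k1 ≤ N ∧ m * k2 ≤ N),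
    vtE (m * (k2 * α + -(k1 * α)))‖ with hF
  have e3 : ((∑ m ∈ Finset.Ioc M (2 * M), ‖Z m‖ ^ 2 : ℝ) : ℂ) = ∑ k1 ∈ Finset.Ioc 0 L, ∑ k2 ∈ Finset.Ioc 0 L,
      (starRingEnd ℂ (y k1) * y k2) * ∑ m ∈ (Finset.Ioc M (2 * M)).filter (fun m => m * k1 ≤ N ∧ m * k2 ≤ N),
    vtE (m * (k2 * α + -(k1 * α))) := by
    push_cast
    have : ∀ m ∈ Finset.Ioc M (2 * M), (‖Z m‖ : ℂ) ^ 2 = ∑ k1 ∈ Finset.Ioc 0 L, ∑ k2 ∈ Finset.Ioc 0 L,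
        if m * k1 ≤ N ∧ m * k2 ≤ N then (starRingEnd ℂ (y k1) * y k2) * vtE (m * (k2 * α + -(k1 * α))) else 0 := by
      intro m _
      rw [← Complex.conj_mul']
      simp only [hZ]
      rw [map_sum, Finset.sum_mul_sum]
      apply Finset.sum_congr rfl; intro k1 _
      apply Finset.sum_congr rfl; intro k2 _
      by_cases h1 : m * k1 ≤ N <;> by_cases h2 : m * k2 ≤ N
      · simp only [h1, h2, and_self, if_true, map_mul, vtE_conj]
        have : (m : ℝ) * (k2 * α + -(k1 * α)) = -(m * k1 * α) + m * k2 * α := by ring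
        rw [this, vtE_add]; ring
      · simp [h1, h2]
      · simp [h1, h2]
      · simp [h1, h2]
    rw [Finset.sum_congr rfl this, Finset.sum_comm]
    apply Finset.sum_congr rfl; intro k1 _
    rw [Finset.sum_comm]
    apply Finset.sum_congr rfl; intro k2 _
    rw [Finset.mul_sum, Finset.sum_filter]
  have e4 : ∑ m ∈ Finset.Ioc M (2 * M), ‖Z m‖ ^ 2 ≤ ∑ k1 ∈ Finset.Ioc 0 L, ∑ k2 ∈ Finset.Ioc 0 L, H ^ 2 * F k1 k2 := by
    have h0 : 0 ≤ ∑ m ∈ Finset.Ioc M (2 * M), ‖Z m‖ ^ 2 := by positivity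
    rw [← Real.norm_of_nonneg h0, ← Complex.norm_real, e3]
    apply norm_sum_le_of_le; intro k1 hk1
    apply norm_sum_le_of_le; intro k2 hk2
    rw [norm_mul, norm_mul, RCLike.norm_conj, sq]
    have := hy k1 hk1
    have := hy k2 hk2
    have := hH k1 hk1
    simp only [hF]
    gcongr
  refine e4.trans ?_
  set W := (3 * ((L : ℝ) + 1) / q + 1) * (2 * M + 2 * q * (1 + Real.log (2 * q))) with hW
  calc ∑ k1 ∈ Finset.Ioc 0 L, ∑ k2 ∈ Finset.Ioc 0 L, H ^ 2 * F k1 k2 ≤ ∑ k1 ∈ Finset.Ioc 0 L, H ^ 2 * W := by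
        apply Finset.sum_le_sum
        intro k1 _
        rw [← Finset.mul_sum]
        gcongr
        have hb := vt_blocks α q a hq ha h (-(k1 * α)) M (Nat.cast_nonneg M) (F k1) (fun k => norm_nonneg _) (by
          intro k
          simp only [hF]
          refine (norm_sum_le _ _).trans ?_
          simp only [vtE_norm, Finset.sum_const, nsmul_eq_mul, mul_one]
          have := Finset.card_filter_le (Finset.Ioc M (2 * M)) (fun m => m * k1 ≤ N ∧ m * k ≤ N)
          rw [Nat.card_Ioc] at this
          exact_mod_cast (by omega)) (by
          intro k
          simp only [hF]
          obtain ⟨t, _, ht⟩ := vt_filter_Ico M N k1 k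
          rw [ht]
          exact vtE_geom_le _ _ _) (L + 1)
        push_cast at hb
        refine le_trans ?_ hb
        apply Finset.sum_le_sum_of_subset_of_nonneg
        · intro k hk
          rw [Finset.mem_Ioc] at hk; rw [Finset.mem_range]; omega
        · intro k _ _; exact norm_nonneg _
    _ = H ^ 2 * (L * W) := by
        rw [Finset.sum_const, nsmul_eq_mul, Nat.card_Ioc]; simp; ring

lemma vt_conv_sum (f g : ArithmeticFunction ℝ) (w : ℕ → ℂ) (N : ℕ) :
    ∑ n ∈ Finset.Ioc 0 N, (((f * g) n : ℝ) : ℂ) * w n = ∑ m ∈ Finset.Ioc 0 N, ∑ l ∈ Finset.Ioc 0 N,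
      if m * l ≤ N then (f m : ℂ) * (g l : ℂ) * w (m * l) else 0 := by
  rw [← Finset.sum_product' (f := fun m l => if m * l ≤ N then (f m : ℂ) * (g l : ℂ) * w (m * l) else 0)]
  trans ∑ n ∈ Finset.Ioc 0 N, ∑ x ∈ (Finset.Ioc 0 N ×ˢ Finset.Ioc 0 N).filter (fun x => x.1 * x.2 = n),
    (f x.1 : ℂ) * (g x.2 : ℂ) * w (x.1 * x.2)
  · refine Finset.sum_congr rfl fun n hn ↦ ?_
    simp only [Finset.mem_Ioc] at hn
    rw [ArithmeticFunction.mul_apply, Nat.divisorsAntidiagonal_eq_prod_filter_of_le hn.1.ne' hn.2]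
    push_cast
    rw [Finset.sum_mul]
    apply Finset.sum_congr rfl
    intro x hx
    rw [(Finset.mem_filter.1 hx).2]
  · simp_rw [Finset.sum_filter]
    rw [Finset.sum_comm]
    apply Finset.sum_congr rfl
    intro x hx
    simp only [Finset.mem_product, Finset.mem_Ioc] at hx
    rw [Finset.sum_ite_eq]
    have : 0 < x.1 * x.2 := Nat.mul_pos hx.1.1 hx.2.1
    simp [Finset.mem_Ioc, this]

end P7b


section P7c
open Complex

noncomputable def vtCut (f : ArithmeticFunction ℝ) (V : ℕ) : ArithmeticFunction ℝ :=
  ⟨fun n => if n ≤ V then f n else 0, by simp⟩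

lemma vtCut_apply (f : ArithmeticFunction ℝ) (V n : ℕ) : vtCut f V n = if n ≤ V then f n else 0 := rfl

noncomputable def vtMu : ArithmeticFunction ℝ := (ArithmeticFunction.moebius : ArithmeticFunction ℝ)

lemma vtMu_apply (n : ℕ) : vtMu n = (ArithmeticFunction.moebius n : ℝ) := rfl

lemma vtMu_abs (n : ℕ) : |vtMu n| ≤ 1 := by
  rw [vtMu_apply]; exact_mod_cast ArithmeticFunction.abs_moebius_le_one

noncomputable def vtZe : ArithmeticFunction ℝ := (ArithmeticFunction.zeta : ArithmeticFunction ℝ)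

noncomputable def vtH (V : ℕ) : ArithmeticFunction ℝ := vtZe * (ArithmeticFunction.vonMangoldt - vtCut ArithmeticFunction.vonMangoldt V)

lemma vt_vaughan (V : ℕ) : ArithmeticFunction.vonMangoldt = vtCut ArithmeticFunction.vonMangoldt V
    + vtCut vtMu V * ArithmeticFunction.log - (vtCut vtMu V * vtCut ArithmeticFunction.vonMangoldt V) * vtZe
    + (vtMu - vtCut vtMu V) * vtH V := by
  have h1 : vtMu * vtZe = 1 := ArithmeticFunction.coe_moebius_mul_coe_zeta
  have h2 : ArithmeticFunction.log = ArithmeticFunction.vonMangoldt * vtZe := ArithmeticFunction.vonMangoldt_mul_zeta.symm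
  rw [h2, vtH]
  linear_combination (-(ArithmeticFunction.vonMangoldt - vtCut ArithmeticFunction.vonMangoldt V)) * h1

lemma vt_af_sub (f g : ArithmeticFunction ℝ) (n : ℕ) : (f - g) n = f n - g n := by
  have : (f - g + g) n = f n := by rw [sub_add_cancel]
  rw [ArithmeticFunction.add_apply] at this; linarith

lemma vt_lam2 (V n : ℕ) : (ArithmeticFunction.vonMangoldt - vtCut ArithmeticFunction.vonMangoldt V) n =
    if n ≤ V then 0 else ArithmeticFunction.vonMangoldt n := by
  rw [vt_af_sub, vtCut_apply]; split_ifs <;> simp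

lemma vtH_eq (V l : ℕ) : vtH V l = ∑ d ∈ l.divisors, if d ≤ V then 0 else ArithmeticFunction.vonMangoldt d := by
  rw [vtH, vtZe, ArithmeticFunction.coe_zeta_mul_apply]
  apply Finset.sum_congr rfl; intro d _; exact vt_lam2 V d

lemma vtH_abs (V l : ℕ) : |vtH V l| ≤ Real.log l := by
  rw [vtH_eq, ← ArithmeticFunction.vonMangoldt_sum]
  refine (Finset.abs_sum_le_sum_abs _ _).trans (Finset.sum_le_sum ?_)
  intro d _
  have := ArithmeticFunction.vonMangoldt_nonneg (n := d)
  split_ifs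
  · simp
  · rw [abs_of_nonneg this]

lemma vtH_zero (V l : ℕ) (hl : l ≤ V) : vtH V l = 0 := by
  rw [vtH_eq]
  apply Finset.sum_eq_zero
  intro d hd
  rw [if_pos ((Nat.divisor_le hd).trans hl)]

lemma vt_c_abs (V d : ℕ) : |(vtCut vtMu V * vtCut ArithmeticFunction.vonMangoldt V) d| ≤ Real.log d := by
  rw [ArithmeticFunction.mul_apply, ← ArithmeticFunction.vonMangoldt_sum]
  rw [← Nat.sum_divisorsAntidiagonal' (fun _ y => ArithmeticFunction.vonMangoldt y)]
  refine (Finset.abs_sum_le_sum_abs _ _).trans (Finset.sum_le_sum ?_)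
  intro x _
  rw [abs_mul, vtCut_apply, vtCut_apply]
  have h0 := ArithmeticFunction.vonMangoldt_nonneg (n := x.2)
  have h1 : |if x.1 ≤ V then vtMu x.1 else 0| ≤ 1 := by
    split_ifs
    · exact vtMu_abs _
    · simp
  have h2 : |if x.2 ≤ V then ArithmeticFunction.vonMangoldt x.2 else 0| ≤ ArithmeticFunction.vonMangoldt x.2 := by
    split_ifs
    · rw [abs_of_nonneg h0]
    · simp
  calc _ ≤ 1 * ArithmeticFunction.vonMangoldt x.2 := by gcongr
    _ = _ := one_mul _

lemma vt_c_zero (V d : ℕ) (hd : V ^ 2 < d) : (vtCut vtMu V * vtCut ArithmeticFunction.vonMangoldt V) d = 0 := by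
  rw [ArithmeticFunction.mul_apply]
  apply Finset.sum_eq_zero
  intro x hx
  rw [Nat.mem_divisorsAntidiagonal] at hx
  rw [vtCut_apply, vtCut_apply]
  by_cases h1 : x.1 ≤ V
  · by_cases h2 : x.2 ≤ V
    · exfalso
      have := Nat.mul_le_mul h1 h2
      rw [hx.1] at this; nlinarith
    · simp [h2]
  · simp [h1]

/-- inner sums of type I -/
lemma vt_inner (α : ℝ) (q : ℕ) (a : ℤ) (ha : IsCoprime (q : ℤ) a)
    (h : |α - a / q| ≤ 1 / (q : ℝ) ^ 2) (d : ℕ) (hd : 0 < d) (hdq : 2 * d ≤ q) (j : ℕ) :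
    ‖∑ i ∈ Finset.range j, vtE (d * (i + 1 : ℕ) * α)‖ ≤ q := by
  have hq' : (0 : ℝ) < q := by exact_mod_cast (by omega : 0 < q)
  have h1 := vt_sep α q a (by omega) ha h d (by omega) (by rw [abs_of_nonneg (by omega)]; omega) (by rw [abs_of_nonneg (by omega)]; omega)
  have h2 := vtE_geom_le (d * α) 1 (j + 1)
  have e : ∑ n ∈ Finset.Ico 1 (j + 1), vtE (n * (d * α)) = ∑ i ∈ Finset.range j, vtE (d * (i + 1 : ℕ) * α) := by
    rw [Finset.sum_Ico_eq_sum_range]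
    apply Finset.sum_congr (by simp)
    intro i _; congr 1; push_cast; ring
  rw [e] at h2
  push_cast at h1
  set S := ‖∑ i ∈ Finset.range j, vtE (d * (i + 1 : ℕ) * α)‖
  have h3 : S * (1 / (2 * q)) ≤ 1 / 2 := le_trans (by gcongr) h2
  rw [mul_one_div, div_le_iff₀ (by positivity)] at h3
  linarith

lemma vt_dyadic (G : ℕ → ℂ) (V I : ℕ) :
    ∑ m ∈ Finset.Ioc V (2 ^ I * V), G m = ∑ i ∈ Finset.range I, ∑ m ∈ Finset.Ioc (2 ^ i * V) (2 * (2 ^ i * V)), G m := by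
  induction I with
  | zero => simp
  | succ n ih =>
    rw [Finset.sum_range_succ, ← ih]
    have e : 2 ^ (n + 1) * V = 2 * (2 ^ n * V) := by ring
    rw [e, Finset.sum_Ioc_consecutive]
    · exact Nat.le_mul_of_pos_left _ (by positivity)
    · omega

lemma vt_restrict (N m : ℕ) (hm : 0 < m) (f : ℕ → ℂ) :
    ∑ l ∈ Finset.Ioc 0 N, (if m * l ≤ N then f l else 0) = ∑ i ∈ Finset.range (N / m), f (i + 1) := by
  have e : (Finset.Ioc 0 N).filter (fun l => m * l ≤ N) = Finset.Ico 1 (N / m + 1) := by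
    ext l
    simp only [Finset.mem_filter, Finset.mem_Ioc, Finset.mem_Ico]
    rw [Nat.lt_succ_iff, Nat.le_div_iff_mul_le hm, mul_comm l m]
    constructor
    · rintro ⟨⟨h1, _⟩, h3⟩; exact ⟨h1, h3⟩
    · rintro ⟨h1, h3⟩; exact ⟨⟨h1, (Nat.le_mul_of_pos_left l hm).trans h3⟩, h3⟩
  rw [← Finset.sum_filter, e, Finset.sum_Ico_eq_sum_range]
  apply Finset.sum_congr (by simp)
  intro i _; rw [add_comm]

end P7c


section P7d
open Complex

lemma vt_typeII_block (α : ℝ) (q : ℕ) (a : ℤ) (hq : 2 ≤ q) (ha : IsCoprime (q : ℤ) a)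
    (h : |α - a / q| ≤ 1 / (q : ℝ) ^ 2) (X N V : ℕ) (hX : 3 ≤ X) (hN : N ≤ X) (hV : 1 ≤ V)
    (hqV : V ≤ q) (hqX : q * V ≤ X) (h2q : 2 * q ≤ X)
    (M : ℕ) (hM : V ≤ M) :
    ‖∑ m ∈ Finset.Ioc M (2 * M), ∑ l ∈ Finset.Ioc 0 N,
      if m * l ≤ N then (((vtMu - vtCut vtMu V) m : ℝ) : ℂ) * ((vtH V l : ℝ) : ℂ) * vtE ((m * l : ℕ) * α) else 0‖
      ≤ 10 * (Real.log X) ^ 2 * X / Real.sqrt V := by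
  have hℓ := vt_log_ge_one hX
  set ℓ := Real.log X with hℓd
  have hXr : (3 : ℝ) ≤ X := by exact_mod_cast hX
  have hVr : (1 : ℝ) ≤ V := by exact_mod_cast hV
  have hM0 : 0 < M := by omega
  set L := N / M with hL
  have hLN : L ≤ N := Nat.div_le_self _ _
  -- restrict l
  have e1 : ∀ m ∈ Finset.Ioc M (2 * M), (∑ l ∈ Finset.Ioc 0 N,
      if m * l ≤ N then (((vtMu - vtCut vtMu V) m : ℝ) : ℂ) * ((vtH V l : ℝ) : ℂ) * vtE ((m * l : ℕ) * α) else 0)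
      = ∑ l ∈ Finset.Ioc 0 L, if m * l ≤ N then (((vtMu - vtCut vtMu V) m : ℝ) : ℂ) * ((vtH V l : ℝ) : ℂ) * vtE (m * l * α) else 0 := by
    intro m hm
    rw [Finset.mem_Ioc] at hm
    rw [← Finset.sum_subset (Finset.Ioc_subset_Ioc_right hLN)]
    · apply Finset.sum_congr rfl
      intro l _; push_cast; rfl
    · intro l _ hl
      rw [if_neg]
      intro hml
      apply hl
      rw [Finset.mem_Ioc] at *
      refine ⟨by omega, ?_⟩
      rw [hL, Nat.le_div_iff_mul_le hM0]
      calc l * M ≤ l * m := Nat.mul_le_mul_left _ hm.1.le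
        _ = m * l := mul_comm _ _
        _ ≤ N := hml
  rw [Finset.sum_congr rfl e1]
  -- trivial case
  by_cases hLV : L ≤ V
  · have : ∑ m ∈ Finset.Ioc M (2 * M), ∑ l ∈ Finset.Ioc 0 L, (if m * l ≤ N then (((vtMu - vtCut vtMu V) m : ℝ) : ℂ) * ((vtH V l : ℝ) : ℂ) * vtE (m * l * α) else 0) = 0 := by
      apply Finset.sum_eq_zero; intro m _
      apply Finset.sum_eq_zero; intro l hl
      rw [Finset.mem_Ioc] at hl
      rw [vtH_zero V l (by omega)]; simp
    rw [this, norm_zero]; positivity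
  push Not at hLV
  have hb := vt_bilin α q a hq ha h M L N (fun m => (((vtMu - vtCut vtMu V) m : ℝ) : ℂ)) (fun l => ((vtH V l : ℝ) : ℂ)) ℓ
    (by
      intro m
      simp only [Complex.norm_real, Real.norm_eq_abs]
      rw [vt_af_sub, vtCut_apply]
      split_ifs
      · simp
      · rw [sub_zero]; exact vtMu_abs m)
    (by
      intro l hl
      rw [Finset.mem_Ioc] at hl
      rw [Complex.norm_real, Real.norm_eq_abs]
      refine (vtH_abs V l).trans ?_
      apply Real.log_le_log
      · exact_mod_cast hl.1
      · exact_mod_cast (by omega : l ≤ X))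
  have hqr : (2 : ℝ) ≤ q := by exact_mod_cast hq
  have hML : (M : ℝ) * L ≤ X := by
    have : M * L ≤ N := Nat.mul_div_le N M
    exact_mod_cast this.trans hN
  have hLr : (V : ℝ) ≤ L := by exact_mod_cast hLV.le
  have hMr : (V : ℝ) ≤ M := by exact_mod_cast hM
  have hqVr : (V : ℝ) ≤ q := by exact_mod_cast hqV
  have hqXr : (q : ℝ) * V ≤ X := by exact_mod_cast hqX
  have hlq : 1 + Real.log (2 * q) ≤ 2 * ℓ := by
    have : Real.log (2 * q) ≤ ℓ := Real.log_le_log (by positivity) (by exact_mod_cast h2q)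
    linarith
  have hV0 : (0 : ℝ) < V := by linarith
  have hbound : (M : ℝ) * (ℓ ^ 2 * (L * ((3 * (L + 1) / q + 1) * (2 * M + 2 * q * (1 + Real.log (2 * q)))))) ≤ 96 * ℓ ^ 3 * (X * (X / V)) := by
    have s1 : 3 * ((L : ℝ) + 1) / q + 1 ≤ 6 * (L / q + 1) := by
      have hL1 : (1 : ℝ) ≤ L := by exact_mod_cast (by omega : 1 ≤ L)
      have : 3 * ((L : ℝ) + 1) / q ≤ 6 * L / q := div_le_div_of_nonneg_right (by linarith) (by linarith)
      have : 6 * (L : ℝ) / q = 6 * (L / q) := by ring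
      linarith
    have s2 : 2 * (M : ℝ) + 2 * q * (1 + Real.log (2 * q)) ≤ 4 * ℓ * (M + q) := by
      have : 2 * (q : ℝ) * (1 + Real.log (2 * q)) ≤ 2 * q * (2 * ℓ) := by gcongr
      nlinarith
    have s2' : 0 ≤ 2 * (M : ℝ) + 2 * q * (1 + Real.log (2 * q)) := by
      have : (0 : ℝ) ≤ Real.log (2 * q) := by exact_mod_cast Real.log_natCast_nonneg (2 * q)
      positivity
    have s3 : (L / q + 1 : ℝ) * (M + q) ≤ 4 * (X / V) := by
      have t1 : (L : ℝ) * M / q ≤ X / V := by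
        gcongr; linarith
      have t2 : (L : ℝ) ≤ X / V := by rw [le_div_iff₀ hV0]; nlinarith
      have t3 : (M : ℝ) ≤ X / V := by rw [le_div_iff₀ hV0]; nlinarith
      have t4 : (q : ℝ) ≤ X / V := by rw [le_div_iff₀ hV0]; exact hqXr
      have : (L / q + 1 : ℝ) * (M + q) = L * M / q + L + M + q := by field_simp; ring
      linarith
    calc _ ≤ (M : ℝ) * (ℓ ^ 2 * (L * ((6 * (L / q + 1)) * (4 * ℓ * (M + q))))) := by gcongr
      _ = 24 * ℓ ^ 3 * ((M * L) * ((L / q + 1) * (M + q))) := by ring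
      _ ≤ 24 * ℓ ^ 3 * (X * (4 * (X / V))) := by gcongr
      _ = _ := by ring
  have h3 : 96 * ℓ ^ 3 * (X * (X / V)) ≤ (10 * ℓ ^ 2 * X / Real.sqrt V) ^ 2 := by
    rw [div_pow, Real.sq_sqrt hV0.le]
    have : 96 * ℓ ^ 3 * (X * (X / V : ℝ)) = 96 * ℓ ^ 3 * X ^ 2 / V := by ring
    rw [this]
    gcongr
    have : ℓ ^ 3 ≤ ℓ ^ 4 := pow_le_pow_right₀ hℓ (by norm_num)
    nlinarith [sq_nonneg (X : ℝ), mul_le_mul_of_nonneg_right this (sq_nonneg (X : ℝ)), mul_nonneg (pow_nonneg (by linarith : 0 ≤ ℓ) 3) (sq_nonneg (X : ℝ))]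
  exact le_of_sq_le_sq (hb.trans (hbound.trans h3)) (by positivity)
where le_of_sq_le_sq {x y : ℝ} (h : x ^ 2 ≤ y ^ 2) (hy : 0 ≤ y) : x ≤ y := abs_le_of_sq_le_sq' h hy |>.2

lemma vt_typeII (α : ℝ) (q : ℕ) (a : ℤ) (hq : 2 ≤ q) (ha : IsCoprime (q : ℤ) a)
    (h : |α - a / q| ≤ 1 / (q : ℝ) ^ 2) (X N V : ℕ) (hX : 3 ≤ X) (hN : N ≤ X) (hV : 1 ≤ V)
    (hqV : V ≤ q) (hqX : q * V ≤ X) (h2q : 2 * q ≤ X) :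
    ‖∑ n ∈ Finset.Ioc 0 N, ((((vtMu - vtCut vtMu V) * vtH V) n : ℝ) : ℂ) * vtE (n * α)‖
      ≤ 30 * (Real.log X) ^ 3 * X / Real.sqrt V := by
  have hℓ := vt_log_ge_one hX
  rw [vt_conv_sum _ _ (fun n => vtE (n * α))]
  set G : ℕ → ℂ := fun m => ∑ l ∈ Finset.Ioc 0 N,
      if m * l ≤ N then (((vtMu - vtCut vtMu V) m : ℝ) : ℂ) * ((vtH V l : ℝ) : ℂ) * vtE ((m * l : ℕ) * α) else 0 with hG
  set I := Nat.log 2 X + 1 with hI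
  have hIX : X < 2 ^ I := Nat.lt_pow_succ_log_self (by norm_num) X
  have hG1 : ∀ m ≤ V, G m = 0 := by
    intro m hm
    simp only [hG]
    apply Finset.sum_eq_zero; intro l _
    rw [vt_af_sub, vtCut_apply, if_pos hm]; simp
  have hG2 : ∀ m, N < m → G m = 0 := by
    intro m hm
    simp only [hG]
    apply Finset.sum_eq_zero; intro l hl
    rw [Finset.mem_Ioc] at hl
    rw [if_neg]
    have : m ≤ m * l := Nat.le_mul_of_pos_right _ hl.1
    omega
  have hNI : N ≤ 2 ^ I * V := by
    have : 2 ^ I ≤ 2 ^ I * V := Nat.le_mul_of_pos_right _ hV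
    omega
  have e : ∑ m ∈ Finset.Ioc 0 N, G m = ∑ m ∈ Finset.Ioc V (2 ^ I * V), G m := by
    have h1 : ∑ m ∈ Finset.Ioc 0 N, G m = ∑ m ∈ Finset.Ioc 0 (2 ^ I * V), G m := by
      apply Finset.sum_subset (Finset.Ioc_subset_Ioc_right hNI)
      intro m hm hm'
      apply hG2
      rw [Finset.mem_Ioc] at hm hm'; omega
    rw [h1]; symm
    apply Finset.sum_subset (Finset.Ioc_subset_Ioc_left (Nat.zero_le _))
    intro m hm hm'
    apply hG1
    rw [Finset.mem_Ioc] at hm hm'; omega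
  change ‖∑ m ∈ Finset.Ioc 0 N, G m‖ ≤ _
  rw [e, vt_dyadic]
  calc _ ≤ ∑ i ∈ Finset.range I, 10 * (Real.log X) ^ 2 * X / Real.sqrt V := by
        apply norm_sum_le_of_le
        intro i _
        exact vt_typeII_block α q a hq ha h X N V hX hN hV hqV hqX h2q (2 ^ i * V) (Nat.le_mul_of_pos_left _ (by positivity))
    _ = (Nat.log 2 X + 1) * (10 * (Real.log X) ^ 2 * X / Real.sqrt V) := by
        rw [Finset.sum_const, nsmul_eq_mul, Finset.card_range, hI]; push_cast; rfl
    _ ≤ (3 * Real.log X) * (10 * (Real.log X) ^ 2 * X / Real.sqrt V) := by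
        gcongr; exact vt_natlog_le hX
    _ = _ := by ring

end P7d

section P7e
open Complex

lemma vt_typeI (f g : ArithmeticFunction ℝ) (α : ℝ) (D N : ℕ) (F G : ℝ) (hF : 0 ≤ F) (hG : 0 ≤ G)
    (hf : ∀ m ≤ D, |f m| ≤ F) (hf0 : ∀ m, D < m → f m = 0)
    (hg : ∀ m, 0 < m → m ≤ D → ∀ j ≤ N, ‖∑ i ∈ Finset.range j, (g (i + 1) : ℂ) * vtE (m * (i + 1 : ℕ) * α)‖ ≤ G) :
    ‖∑ n ∈ Finset.Ioc 0 N, (((f * g) n : ℝ) : ℂ) * vtE (n * α)‖ ≤ D * (F * G) := by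
  rw [vt_conv_sum _ _ (fun n => vtE (n * α))]
  have key : ∀ m ∈ Finset.Ioc 0 N, ‖∑ l ∈ Finset.Ioc 0 N,
      if m * l ≤ N then (f m : ℂ) * (g l : ℂ) * vtE ((m * l : ℕ) * α) else 0‖ ≤ if m ≤ D then F * G else 0 := by
    intro m hm
    rw [Finset.mem_Ioc] at hm
    rw [vt_restrict N m hm.1 (fun l => (f m : ℂ) * (g l : ℂ) * vtE ((m * l : ℕ) * α))]
    split_ifs with hmD
    · have : ∑ i ∈ Finset.range (N / m), (f m : ℂ) * (g (i + 1) : ℂ) * vtE ((m * (i + 1) : ℕ) * α)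
          = (f m : ℂ) * ∑ i ∈ Finset.range (N / m), (g (i + 1) : ℂ) * vtE (m * (i + 1 : ℕ) * α) := by
        rw [Finset.mul_sum]
        apply Finset.sum_congr rfl; intro i _
        rw [Nat.cast_mul]; ring
      rw [this, norm_mul, Complex.norm_real, Real.norm_eq_abs]
      exact mul_le_mul (hf m hmD) (hg m hm.1 hmD _ (Nat.div_le_self _ _)) (norm_nonneg _) hF
    · push Not at hmD
      rw [hf0 m hmD]; simp
  refine (norm_sum_le_of_le _ key).trans ?_
  rw [← Finset.sum_filter, Finset.sum_const, nsmul_eq_mul]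
  have : ((Finset.Ioc 0 N).filter (fun m => m ≤ D)).card ≤ D := by
    calc _ ≤ (Finset.Ioc 0 D).card := by
          apply Finset.card_le_card
          intro m; simp only [Finset.mem_filter, Finset.mem_Ioc]; omega
      _ = D := by simp
  gcongr

lemma vt_log_step_sum (j : ℕ) : ∑ i ∈ Finset.range j, ‖(((Real.log ((i + 1 + 1 : ℕ))) : ℝ) : ℂ) - ((Real.log ((i + 1 : ℕ)) : ℝ) : ℂ)‖ = Real.log (j + 1 : ℕ) := by
  have : ∀ i ∈ Finset.range j, ‖(((Real.log ((i + 1 + 1 : ℕ))) : ℝ) : ℂ) - ((Real.log ((i + 1 : ℕ)) : ℝ) : ℂ)‖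
      = Real.log ((i + 1 + 1 : ℕ)) - Real.log ((i + 1 : ℕ)) := by
    intro i _
    rw [← Complex.ofReal_sub, Complex.norm_real, Real.norm_eq_abs, abs_of_nonneg]
    rw [sub_nonneg]
    apply Real.log_le_log (by positivity)
    push_cast; linarith
  rw [Finset.sum_congr rfl this, Finset.sum_range_sub (fun i => Real.log ((i + 1 : ℕ)))]
  simp

lemma vt_minor (α : ℝ) (q : ℕ) (a : ℤ) (ha : IsCoprime (q : ℤ) a)
    (h : |α - a / q| ≤ 1 / (q : ℝ) ^ 2) (X N V : ℕ) (hX : 3 ≤ X) (hN : N ≤ X) (hV : 1 ≤ V)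
    (hqV : 2 * V ^ 2 ≤ q) (hqX : q * V ^ 3 ≤ X) (h2q : 2 * q ≤ X) :
    ‖∑ n ∈ Finset.Ioc 0 N, (ArithmeticFunction.vonMangoldt n : ℂ) * vtE (n * α)‖
      ≤ 36 * (Real.log X) ^ 3 * X / Real.sqrt V := by
  have hℓ := vt_log_ge_one hX
  set ℓ := Real.log X with hℓd
  have hVV : V ≤ V ^ 2 := by nlinarith
  have hVV3 : V ≤ V ^ 3 := by nlinarith
  have T3 := vt_typeII α q a (by omega) ha h X N V hX hN hV (by omega) ((Nat.mul_le_mul_left q hVV3).trans hqX) h2q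
  have T1 : ‖∑ n ∈ Finset.Ioc 0 N, (((vtCut vtMu V * ArithmeticFunction.log) n : ℝ) : ℂ) * vtE (n * α)‖ ≤ V * (1 * (q * (4 * ℓ))) := by
    apply vt_typeI _ _ _ _ _ _ _ (by norm_num) (by positivity)
    · intro m hm; rw [vtCut_apply, if_pos hm]; exact vtMu_abs m
    · intro m hm; rw [vtCut_apply, if_neg (by omega)]
    · intro m hm hmV j hj
      have hlog : Real.log (j + 1 : ℕ) ≤ 2 * ℓ := by
        calc Real.log (j + 1 : ℕ) ≤ Real.log ((X : ℝ) ^ 2) := by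
              apply Real.log_le_log (by positivity)
              exact_mod_cast (by nlinarith : j + 1 ≤ X ^ 2)
          _ = 2 * ℓ := by rw [Real.log_pow]; push_cast; rfl
      have := vt_abel (fun i => ((Real.log ((i + 1 : ℕ)) : ℝ) : ℂ)) (fun i => vtE (m * (i + 1 : ℕ) * α)) q j
        (fun k _ => vt_inner α q a ha h m hm (by omega) k)
      refine this.trans ?_
      rw [vt_log_step_sum, Complex.norm_real, Real.norm_eq_abs, abs_of_nonneg (Real.log_natCast_nonneg _)]
      gcongr; linarith
  have T2 : ‖∑ n ∈ Finset.Ioc 0 N, ((((vtCut vtMu V * vtCut ArithmeticFunction.vonMangoldt V) * vtZe) n : ℝ) : ℂ) * vtE (n * α)‖ ≤ (V ^ 2 : ℕ) * (ℓ * q) := by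
    apply vt_typeI _ _ _ _ _ _ _ (by linarith) (by positivity)
    · intro m hm
      refine (vt_c_abs V m).trans ?_
      rcases Nat.eq_zero_or_pos m with h0 | h0
      · subst h0; simp; linarith
      · apply Real.log_le_log (by exact_mod_cast h0)
        have : m ≤ X := by omega
        exact_mod_cast this
    · intro m hm; exact vt_c_zero V m hm
    · intro m hm hmV j hj
      have : ∀ i ∈ Finset.range j, ((vtZe (i + 1) : ℝ) : ℂ) * vtE (m * (i + 1 : ℕ) * α) = vtE (m * (i + 1 : ℕ) * α) := by
        intro i _
        have : vtZe (i + 1) = 1 := by simp [vtZe, ArithmeticFunction.natCoe_apply]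
        rw [this]; simp
      rw [Finset.sum_congr rfl this]
      exact vt_inner α q a ha h m hm (by omega) j
  have T0 : ‖∑ n ∈ Finset.Ioc 0 N, ((vtCut ArithmeticFunction.vonMangoldt V n : ℝ) : ℂ) * vtE (n * α)‖ ≤ V * ℓ := by
    have key : ∀ n ∈ Finset.Ioc 0 N, ‖((vtCut ArithmeticFunction.vonMangoldt V n : ℝ) : ℂ) * vtE (n * α)‖ ≤ if n ≤ V then ℓ else 0 := by
      intro n hn
      rw [Finset.mem_Ioc] at hn
      rw [norm_mul, vtE_norm, mul_one, Complex.norm_real, Real.norm_eq_abs, vtCut_apply]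
      split_ifs
      · rw [abs_of_nonneg ArithmeticFunction.vonMangoldt_nonneg]
        refine ArithmeticFunction.vonMangoldt_le_log.trans ?_
        apply Real.log_le_log (by exact_mod_cast hn.1)
        exact_mod_cast (by omega : n ≤ X)
      · simp
    refine (norm_sum_le_of_le _ key).trans ?_
    rw [← Finset.sum_filter, Finset.sum_const, nsmul_eq_mul]
    have : ((Finset.Ioc 0 N).filter (fun m => m ≤ V)).card ≤ V := by
      calc _ ≤ (Finset.Ioc 0 V).card := by
            apply Finset.card_le_card
            intro m; simp only [Finset.mem_filter, Finset.mem_Ioc]; omega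
        _ = V := by simp
    gcongr
  have hdec : ∑ n ∈ Finset.Ioc 0 N, (ArithmeticFunction.vonMangoldt n : ℂ) * vtE (n * α)
      = ∑ n ∈ Finset.Ioc 0 N, ((vtCut ArithmeticFunction.vonMangoldt V n : ℝ) : ℂ) * vtE (n * α)
       + ∑ n ∈ Finset.Ioc 0 N, (((vtCut vtMu V * ArithmeticFunction.log) n : ℝ) : ℂ) * vtE (n * α)
       - ∑ n ∈ Finset.Ioc 0 N, ((((vtCut vtMu V * vtCut ArithmeticFunction.vonMangoldt V) * vtZe) n : ℝ) : ℂ) * vtE (n * α)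
       + ∑ n ∈ Finset.Ioc 0 N, ((((vtMu - vtCut vtMu V) * vtH V) n : ℝ) : ℂ) * vtE (n * α) := by
    rw [← Finset.sum_add_distrib, ← Finset.sum_sub_distrib, ← Finset.sum_add_distrib]
    apply Finset.sum_congr rfl; intro n _
    conv_lhs => rw [vt_vaughan V]
    rw [ArithmeticFunction.add_apply, vt_af_sub, ArithmeticFunction.add_apply]
    push_cast; ring
  rw [hdec]
  refine (norm_add_le _ _).trans ?_
  refine (add_le_add_left (norm_sub_le _ _) _).trans ?_
  refine (add_le_add_left (add_le_add_left (norm_add_le _ _) _) _).trans ?_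
  have hVr : (1 : ℝ) ≤ V := by exact_mod_cast hV
  have hqXr : (q : ℝ) * V ^ 3 ≤ X := by exact_mod_cast hqX
  have hq1 : (1 : ℝ) ≤ q := by exact_mod_cast (by nlinarith : 1 ≤ q)
  have hsV : (1 : ℝ) ≤ Real.sqrt V := by rw [Real.one_le_sqrt]; exact hVr
  have hsV2 : Real.sqrt V ≤ V := by
    rw [Real.sqrt_le_left (by linarith)]; nlinarith
  have hq2 : (q : ℝ) * V ^ 2 ≤ X / Real.sqrt V := by
    rw [le_div_iff₀ (by linarith)]
    calc (q : ℝ) * V ^ 2 * Real.sqrt V ≤ (q : ℝ) * V ^ 2 * V := by gcongr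
      _ = (q : ℝ) * V ^ 3 := by ring
      _ ≤ (X : ℝ) := hqXr
  have b1 : (V : ℝ) * ℓ + V * (1 * (q * (4 * ℓ))) + (V ^ 2 : ℕ) * (ℓ * q) ≤ 6 * ℓ * (q * V ^ 2) := by
    push_cast
    have h1 : (V : ℝ) ≤ q * V ^ 2 := by nlinarith
    have h2 : (V : ℝ) * q ≤ q * V ^ 2 := by nlinarith
    nlinarith
  have b2 : 6 * ℓ * (q * V ^ 2) ≤ 6 * ℓ ^ 3 * (X / Real.sqrt V) := by
    have : ℓ ≤ ℓ ^ 3 := le_self_pow₀ hℓ (by norm_num)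
    gcongr
  have b3 : 36 * ℓ ^ 3 * X / Real.sqrt V = 30 * ℓ ^ 3 * X / Real.sqrt V + 6 * ℓ ^ 3 * (X / Real.sqrt V) := by ring
  linarith

end P7e

section P8a
open Complex

noncomputable def vtMod (Q n : ℕ) : ℂ :=
  ∑ r ∈ Finset.Ioc 0 Q, ((ArithmeticFunction.moebius r : ℂ) / (Nat.totient r : ℂ)) * vtR r n

noncomputable def vtS (c d : ℕ) (x : ℝ) : ℂ := ∑ n ∈ Finset.Ico c d, vtE (n * x)

lemma vtS_int_add (c d : ℕ) (k : ℤ) (x : ℝ) : vtS c d (k + x) = vtS c d x := by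
  unfold vtS
  apply Finset.sum_congr rfl; intro n _
  rw [mul_add, vtE_add]
  have : (n * k : ℝ) = ((n * k : ℤ) : ℝ) := by push_cast; ring
  rw [this, vtE_int, one_mul]

lemma vt_mu_phi_norm (r : ℕ) : ‖(ArithmeticFunction.moebius r : ℂ) / (Nat.totient r : ℂ)‖ ≤ 1 / Nat.totient r := by
  rw [norm_div, Complex.norm_natCast]
  gcongr
  rw [Complex.norm_intCast]
  exact_mod_cast ArithmeticFunction.abs_moebius_le_one

lemma vtMod_hat (Q c d : ℕ) (θ : ℝ) : ∑ n ∈ Finset.Ico c d, vtMod Q n * vtE (n * θ)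
    = ∑ r ∈ Finset.Ioc 0 Q, ((ArithmeticFunction.moebius r : ℂ) / (Nat.totient r : ℂ)) *
      ∑ b ∈ (Finset.range r).filter (Nat.Coprime r), vtS c d (b / r + θ) := by
  unfold vtMod vtS vtR
  simp_rw [Finset.sum_mul, Finset.mul_sum, Finset.sum_mul]
  rw [Finset.sum_comm]
  apply Finset.sum_congr rfl; intro r _
  rw [Finset.sum_comm]
  apply Finset.sum_congr rfl; intro b _
  apply Finset.sum_congr rfl; intro n _
  rw [mul_assoc, ← vtE_add]
  congr 2
  push_cast; ring

lemma vt_pair_sep (r q : ℕ) (hr : 0 < r) (hq : 0 < q) (b a : ℤ) (hb : IsCoprime (r : ℤ) b) (ha : IsCoprime (q : ℤ) a)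
    (h : ¬ (r = q ∧ (q : ℤ) ∣ a + b)) : 1 / ((r : ℝ) * q) ≤ vtN (b / r + a / q) := by
  have hr' : (0 : ℝ) < r := by exact_mod_cast hr
  have hq' : (0 : ℝ) < q := by exact_mod_cast hq
  unfold vtN
  set k := round ((b : ℝ) / r + a / q)
  have e : (b : ℝ) / r + a / q - k = ((b * q + a * r - k * (r * q) : ℤ) : ℝ) / (r * q) := by
    push_cast; field_simp
  rw [e, abs_div, abs_of_pos (by positivity : (0 : ℝ) < r * q)]
  gcongr
  have : b * q + a * r - k * (r * q) ≠ 0 := by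
    intro h0
    apply h
    have h1 : (q : ℤ) ∣ a * r := ⟨k * r - b, by linear_combination h0⟩
    have h2 : (r : ℤ) ∣ b * q := ⟨k * q - a, by linear_combination h0⟩
    have h3 : (q : ℤ) ∣ r := ha.dvd_of_dvd_mul_left h1
    have h4 : (r : ℤ) ∣ q := hb.dvd_of_dvd_mul_left h2
    have h5 : r = q := Nat.dvd_antisymm (Int.natCast_dvd_natCast.mp h4) (Int.natCast_dvd_natCast.mp h3)
    refine ⟨h5, ?_⟩
    subst h5
    refine ⟨k, ?_⟩
    have hrz : (r : ℤ) ≠ 0 := by exact_mod_cast hr.ne'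
    apply mul_left_cancel₀ hrz
    linear_combination h0
  have := Int.one_le_abs this
  exact_mod_cast this

lemma vt_ghat (Q q : ℕ) (hq : 0 < q) (a : ℤ) (ha : IsCoprime (q : ℤ) a) (β : ℝ) (hβ : |β| * (2 * Q * q) ≤ 1)
    (c d : ℕ) :
    ‖∑ n ∈ Finset.Ico c d, vtMod Q n * vtE (n * (a / q + β)) -
      (if q ≤ Q then (ArithmeticFunction.moebius q : ℂ) / (Nat.totient q : ℂ) * vtS c d β else 0)‖ ≤ (Q : ℝ) ^ 2 * q := by
  have hq' : (0 : ℝ) < q := by exact_mod_cast hq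
  have hmain : (if q ≤ Q then (ArithmeticFunction.moebius q : ℂ) / (Nat.totient q : ℂ) * vtS c d β else 0)
      = ∑ r ∈ Finset.Ioc 0 Q, ((ArithmeticFunction.moebius r : ℂ) / (Nat.totient r : ℂ)) *
      ∑ b ∈ (Finset.range r).filter (Nat.Coprime r), (if r = q ∧ (q : ℤ) ∣ a + b then vtS c d β else 0) := by
    split_ifs with hqQ
    · rw [Finset.sum_eq_single q]
      · congr 1
        have hqz : (q : ℤ) ≠ 0 := by exact_mod_cast hq.ne'
        have hb1 : ((((-a) % q).toNat : ℕ) : ℤ) = (-a) % q := Int.toNat_of_nonneg (Int.emod_nonneg _ hqz)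
        have hb2 : (-a) % q < q := Int.emod_lt_of_pos _ (by exact_mod_cast hq)
        rw [Finset.sum_eq_single ((-a) % q).toNat]
        · rw [if_pos]
          refine ⟨rfl, ?_⟩
          rw [hb1]
          have : a + -a % q = -(q * ((-a) / q)) := by have := Int.mul_ediv_add_emod (-a) q; linarith
          rw [this]; exact Dvd.dvd.neg_right (dvd_mul_right _ _)
        · intro b hb hne
          rw [if_neg]
          rintro ⟨_, h2⟩
          apply hne
          rw [Finset.mem_filter, Finset.mem_range] at hb
          have : (q : ℤ) ∣ b - (-a) := by convert h2 using 1; ring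
          have h3 := Int.emod_emod_of_dvd b (dvd_refl (q : ℤ))
          have h4 : (b : ℤ) % q = (-a) % q := Int.emod_eq_emod_iff_emod_sub_eq_zero.mpr (Int.emod_eq_zero_of_dvd this)
          rw [Int.emod_eq_of_lt (by omega) (by exact_mod_cast hb.1)] at h4
          omega
        · intro hn
          exfalso; apply hn
          rw [Finset.mem_filter, Finset.mem_range]
          refine ⟨by omega, ?_⟩
          rw [← Nat.isCoprime_iff_coprime, hb1]
          have : -a % q = -a + q * (-((-a) / q)) := by have := Int.mul_ediv_add_emod (-a) q; linarith
          rw [this]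
          exact (IsCoprime.neg_right ha).add_mul_left_right _
      · intro r _ hr
        rw [Finset.sum_eq_zero, mul_zero]
        intro b _; rw [if_neg]; tauto
      · intro hn; exfalso; apply hn; rw [Finset.mem_Ioc]; exact ⟨hq, hqQ⟩
    · symm
      apply Finset.sum_eq_zero
      intro r hr
      rw [Finset.mem_Ioc] at hr
      rw [Finset.sum_eq_zero, mul_zero]
      intro b _; rw [if_neg]; rintro ⟨h1, _⟩; omega
  rw [hmain, vtMod_hat, ← Finset.sum_sub_distrib]
  have key : ∀ r ∈ Finset.Ioc 0 Q, ‖((ArithmeticFunction.moebius r : ℂ) / (Nat.totient r : ℂ)) *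
      ∑ b ∈ (Finset.range r).filter (Nat.Coprime r), vtS c d (b / r + (a / q + β)) -
      ((ArithmeticFunction.moebius r : ℂ) / (Nat.totient r : ℂ)) *
      ∑ b ∈ (Finset.range r).filter (Nat.Coprime r), (if r = q ∧ (q : ℤ) ∣ a + b then vtS c d β else 0)‖ ≤ Q * q := by
    intro r hr
    rw [Finset.mem_Ioc] at hr
    have hr' : (0 : ℝ) < r := by exact_mod_cast hr.1
    have hrQ : (r : ℝ) ≤ Q := by exact_mod_cast hr.2
    rw [← mul_sub, ← Finset.sum_sub_distrib, norm_mul]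
    have hb : ∀ b ∈ (Finset.range r).filter (Nat.Coprime r), ‖vtS c d (b / r + (a / q + β)) -
        (if r = q ∧ (q : ℤ) ∣ a + b then vtS c d β else 0)‖ ≤ Q * q := by
      intro b hb
      rw [Finset.mem_filter] at hb
      split_ifs with hc
      · obtain ⟨h1, k, hk⟩ := hc
        subst h1
        have : (b : ℝ) / r + (a / r + β) = (k : ℤ) + β := by
          have : (a : ℝ) + b = r * k := by exact_mod_cast hk
          have : (k : ℝ) = (a + b) / r := by rw [this]; field_simp
          rw [this]; ring
        rw [this, vtS_int_add, sub_self, norm_zero]; positivity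
      · rw [sub_zero]
        have h1 := vt_pair_sep r q hr.1 hq b a (by rw [Nat.isCoprime_iff_coprime]; exact hb.2) ha hc
        have h2 := vtN_add_le ((b : ℝ) / r + (a / q + β)) (-β)
        have h3 := vtE_geom_le ((b : ℝ) / r + (a / q + β)) c d
        rw [show (b : ℝ) / r + (a / q + β) + -β = ((b : ℤ) : ℝ) / r + a / q by push_cast; ring, abs_neg] at h2
        change ‖vtS c d _‖ * _ ≤ _ at h3
        have h4 : 1 / ((Q : ℝ) * q) ≤ 1 / ((r : ℝ) * q) := by gcongr
        have hQ' : (0 : ℝ) < Q := by linarith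
        have h5 : |β| ≤ 1 / (2 * (Q * q)) := by rw [le_div_iff₀ (by positivity)]; linarith
        have h6 : 1 / (2 * ((Q : ℝ) * q)) ≤ vtN ((b : ℝ) / r + (a / q + β)) := by
          have : 1 / (2 * ((Q : ℝ) * q)) = 1 / (Q * q) - 1 / (2 * (Q * q)) := by field_simp; norm_num
          linarith
        have h7 := (mul_le_mul_of_nonneg_left h6 (norm_nonneg (vtS c d ((b : ℝ) / r + (a / q + β))))).trans h3
        rw [mul_one_div, div_le_iff₀ (by positivity)] at h7
        linarith
    calc _ ≤ (1 / Nat.totient r : ℝ) * ∑ b ∈ (Finset.range r).filter (Nat.Coprime r), (Q * q : ℝ) :=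
          mul_le_mul (vt_mu_phi_norm r) (norm_sum_le_of_le _ hb) (norm_nonneg _) (by positivity)
      _ = Q * q := by
          rw [Finset.sum_const, nsmul_eq_mul, ← Nat.totient]
          have : (0 : ℝ) < Nat.totient r := by exact_mod_cast Nat.totient_pos.mpr hr.1
          field_simp
  refine (norm_sum_le_of_le _ key).trans ?_
  rw [Finset.sum_const, nsmul_eq_mul, Nat.card_Ioc, Nat.sub_zero]
  apply le_of_eq; ring

lemma vtMod_norm_le (Q n : ℕ) : ‖vtMod Q n‖ ≤ Q := by
  unfold vtMod
  have : ∀ r ∈ Finset.Ioc 0 Q, ‖((ArithmeticFunction.moebius r : ℂ) / (Nat.totient r : ℂ)) * vtR r n‖ ≤ 1 := by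
    intro r hr
    rw [Finset.mem_Ioc] at hr
    have h0 : (0 : ℝ) < Nat.totient r := by exact_mod_cast Nat.totient_pos.mpr hr.1
    rw [norm_mul]
    calc _ ≤ (1 / Nat.totient r : ℝ) * Nat.totient r := mul_le_mul (vt_mu_phi_norm r) (vtR_norm_le r n) (norm_nonneg _) (by positivity)
      _ = 1 := by field_simp
  refine (norm_sum_le_of_le _ this).trans ?_
  simp

end P8a

section P8b
open Complex

lemma vt_pow_log_le (m : ℕ) : ∃ N0 : ℕ, 3 ≤ N0 ∧ ∀ N : ℕ, N0 ≤ N → 8 * (Real.log N) ^ m ≤ N := by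
  refine ⟨max 3 ((8 * (2 * (m + 1)) ^ (m + 1)) ^ 2), le_max_left _ _, ?_⟩
  intro N hN
  have h3 : 3 ≤ N := (le_max_left _ _).trans hN
  have hb : (8 * (2 * (m + 1)) ^ (m + 1)) ^ 2 ≤ N := (le_max_right _ _).trans hN
  have hl := vt_log_ge_one h3
  have h1 := vt_logpow_sqrt (m + 1) (by omega) (x := (N : ℝ)) (by exact_mod_cast (by omega : 1 ≤ N))
  have h2 : (8 * (2 * ((m + 1 : ℕ) : ℝ)) ^ (m + 1)) ≤ Real.sqrt N := by
    apply Real.le_sqrt_of_sq_le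
    exact_mod_cast hb
  have h4 : Real.sqrt N * Real.sqrt N = N := Real.mul_self_sqrt (by positivity)
  calc 8 * (Real.log N) ^ m ≤ 8 * (Real.log N) ^ (m + 1) := by
        gcongr
        omega
    _ ≤ 8 * ((2 * ((m + 1 : ℕ) : ℝ)) ^ (m + 1) * Real.sqrt N) := by gcongr
    _ = (8 * (2 * ((m + 1 : ℕ) : ℝ)) ^ (m + 1)) * Real.sqrt N := by ring
    _ ≤ Real.sqrt N * Real.sqrt N := by gcongr
    _ = N := h4

lemma vt_minor_Ico (α : ℝ) (q : ℕ) (a : ℤ) (ha : IsCoprime (q : ℤ) a)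
    (h : |α - a / q| ≤ 1 / (q : ℝ) ^ 2) (X V : ℕ) (hX : 3 ≤ X) (hV : 1 ≤ V)
    (hqV : 2 * V ^ 2 ≤ q) (hqX : q * V ^ 3 ≤ X) (h2q : 2 * q ≤ X) (c d : ℕ) (hcd : c ≤ d) (hd : d ≤ X) :
    ‖∑ n ∈ Finset.Ico c d, (ArithmeticFunction.vonMangoldt n : ℂ) * vtE (n * α)‖
      ≤ 72 * (Real.log X) ^ 3 * X / Real.sqrt V := by
  have key : ∀ k ≤ X, ‖∑ n ∈ Finset.range k, (ArithmeticFunction.vonMangoldt n : ℂ) * vtE (n * α)‖ ≤ 36 * (Real.log X) ^ 3 * X / Real.sqrt V := by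
    intro k hk
    have e : ∑ n ∈ Finset.range k, (ArithmeticFunction.vonMangoldt n : ℂ) * vtE (n * α)
        = ∑ n ∈ Finset.Ioc 0 (k - 1), (ArithmeticFunction.vonMangoldt n : ℂ) * vtE (n * α) := by
      by_cases hk0 : k = 0
      · subst hk0; simp
      symm
      apply Finset.sum_subset
      · intro n; rw [Finset.mem_Ioc, Finset.mem_range]; omega
      · intro n h1 h2
        rw [Finset.mem_range] at h1
        rw [Finset.mem_Ioc] at h2
        have : n = 0 := by omega
        subst this; simp
    rw [e]
    exact vt_minor α q a ha h X (k - 1) V hX (by omega) hV hqV hqX h2q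
  rw [Finset.sum_Ico_eq_sub _ hcd]
  refine (norm_sub_le _ _).trans ?_
  have h1 := key d hd
  have h2 := key c (hcd.trans hd)
  have : 72 * (Real.log X) ^ 3 * X / Real.sqrt V = 36 * (Real.log X) ^ 3 * X / Real.sqrt V + 36 * (Real.log X) ^ 3 * X / Real.sqrt V := by ring
  linarith

theorem vt_sup (B : ℕ) : ∃ C : ℝ, 0 < C ∧ ∃ N0 : ℕ, 3 ≤ N0 ∧ ∀ N : ℕ, N0 ≤ N → ∀ V : ℕ, 1 ≤ V → (V : ℝ) ≤ (Real.log N) ^ B →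
    ∀ c d : ℕ, c ≤ d → d ≤ N → ∀ θ : ℝ,
    ‖∑ n ∈ Finset.Ico c d, ((ArithmeticFunction.vonMangoldt n : ℂ) - vtMod (2 * V ^ 2) n) * vtE (n * θ)‖
      ≤ C * (Real.log N) ^ 3 * N / Real.sqrt V := by
  obtain ⟨C0, hC0, hmaj⟩ := vt_major (12 * B)
  obtain ⟨N0, hN03, hN0⟩ := vt_pow_log_le (8 * B)
  refine ⟨12 * C0 + 80, by positivity, N0, hN03, ?_⟩
  intro N hN V hV hVB c d hcd hd θ
  have hN3 : 3 ≤ N := hN03.trans hN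
  have hℓ := vt_log_ge_one hN3
  set ℓ := Real.log N
  have hVr : (1 : ℝ) ≤ V := by exact_mod_cast hV
  have hV8r : 8 * (V : ℝ) ^ 8 ≤ N := by
    refine le_trans ?_ (hN0 N hN)
    rw [mul_comm 8 B, pow_mul]
    gcongr
  have hV8 : 8 * V ^ 8 ≤ N := by exact_mod_cast hV8r
  have hVR : 0 < 2 * V ^ 6 := by positivity
  have hn : 4 * V ^ 2 ≤ N / (2 * V ^ 6) := by
    rw [Nat.le_div_iff_mul_le hVR]
    calc 4 * V ^ 2 * (2 * V ^ 6) = 8 * V ^ 8 := by ring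
      _ ≤ N := hV8
  set n := N / (2 * V ^ 6) with hnd
  have hn0 : 0 < n := by
    have : 0 < V ^ 2 := by positivity
    omega
  have hnN : n * (2 * V ^ 6) ≤ N := Nat.div_mul_le_self _ _
  have hnN2 : N ≤ (n + 1) * (2 * V ^ 6) := by
    rw [hnd, mul_comm]; exact (Nat.lt_mul_div_succ N hVR).le
  obtain ⟨x, hx1, hx2⟩ := Real.exists_rat_abs_sub_le_and_den_le θ hn0
  set q := x.den
  set a := x.num
  have hq : 0 < q := x.pos
  have hq' : (0 : ℝ) < q := by exact_mod_cast hq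
  have ha : IsCoprime (q : ℤ) a := by
    have := x.reduced
    rw [isCoprime_comm, Int.isCoprime_iff_gcd_eq_one]
    exact this
  have hxe : (x : ℝ) = a / q := by exact_mod_cast (Rat.num_div_den x).symm
  rw [hxe] at hx1
  set β := θ - a / q with hβ
  have hθ : θ = a / q + β := by rw [hβ]; ring
  have hnr : (4 * (V : ℝ) ^ 2) ≤ n + 1 := by
    have : 4 * V ^ 2 ≤ n + 1 := by omega
    exact_mod_cast this
  have hn1 : (0 : ℝ) < n + 1 := by positivity
  have hβ1 : |β| * ((n + 1) * q) ≤ 1 := by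
    rw [← le_div_iff₀ (by positivity)]; exact hx1
  have hβ2 : |β| * (2 * (2 * V ^ 2 : ℕ) * q) ≤ 1 := by
    refine le_trans ?_ hβ1
    have := abs_nonneg β
    gcongr
    push_cast; linarith
  have hβ3 : N * |β| ≤ 2 * V ^ 6 := by
    have h1 : (N : ℝ) ≤ (n + 1) * (2 * V ^ 6) := by exact_mod_cast hnN2
    have hq1 : (1 : ℝ) ≤ q := by exact_mod_cast hq
    have h2 : |β| * (n + 1) ≤ 1 := by
      refine le_trans ?_ hβ1
      have := abs_nonneg β
      nlinarith [mul_nonneg this hn1.le]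
    calc (N : ℝ) * |β| ≤ (n + 1) * (2 * V ^ 6) * |β| := by gcongr
      _ = (|β| * (n + 1)) * (2 * V ^ 6) := by ring
      _ ≤ 1 * (2 * V ^ 6) := by gcongr
      _ = _ := one_mul _
  have hG := vt_ghat (2 * V ^ 2) q hq a ha β hβ2 c d
  rw [← hθ] at hG
  have hsV : (1 : ℝ) ≤ Real.sqrt V := by rw [Real.one_le_sqrt]; exact hVr
  have hsV2 : Real.sqrt V ≤ V := by
    rw [Real.sqrt_le_left (by linarith)]; nlinarith
  have hℓ3 : 1 ≤ ℓ ^ 3 := one_le_pow₀ hℓ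
  have hcmp : (N : ℝ) / V ^ 2 ≤ ℓ ^ 3 * N / Real.sqrt V := by
    have : Real.sqrt V ≤ V ^ 2 := by nlinarith
    calc (N : ℝ) / V ^ 2 ≤ N / Real.sqrt V := by gcongr
      _ ≤ ℓ ^ 3 * N / Real.sqrt V := by
        gcongr
        nlinarith [(by positivity : (0 : ℝ) ≤ N)]
  have hsplit : ∑ n ∈ Finset.Ico c d, ((ArithmeticFunction.vonMangoldt n : ℂ) - vtMod (2 * V ^ 2) n) * vtE (n * θ)
      = ∑ n ∈ Finset.Ico c d, (ArithmeticFunction.vonMangoldt n : ℂ) * vtE (n * θ) - ∑ n ∈ Finset.Ico c d, vtMod (2 * V ^ 2) n * vtE (n * θ) := by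
    rw [← Finset.sum_sub_distrib]; apply Finset.sum_congr rfl; intro n _; ring
  rw [hsplit]
  by_cases hqQ : q ≤ 2 * V ^ 2
  · rw [if_pos hqQ] at hG
    have hM := hmaj q hq a ha N hN3 β c d hd
    rw [← hθ] at hM
    change ‖_ - _ * vtS c d β‖ ≤ _ at hM
    have hqr : (q : ℝ) ≤ 2 * V ^ 2 := by exact_mod_cast hqQ
    have e1 : C0 * q ^ 2 * (1 + N * |β|) * N / ℓ ^ (12 * B) ≤ 12 * C0 * (N / V ^ 2) := by
      calc C0 * q ^ 2 * (1 + N * |β|) * N / ℓ ^ (12 * B) ≤ C0 * (2 * V ^ 2) ^ 2 * (V ^ 6 + 2 * V ^ 6) * N / V ^ 12 := by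
            gcongr
            · exact one_le_pow₀ hVr
            · rw [mul_comm 12 B, pow_mul]; gcongr
        _ = 12 * C0 * (N / V ^ 2) := by field_simp; norm_num
    have e2 : ((2 * V ^ 2 : ℕ) : ℝ) ^ 2 * q ≤ N / V ^ 2 := by
      rw [le_div_iff₀ (by positivity)]
      calc ((2 * V ^ 2 : ℕ) : ℝ) ^ 2 * q * (V : ℝ) ^ 2 ≤ ((2 * V ^ 2 : ℕ) : ℝ) ^ 2 * (2 * (V : ℝ) ^ 2) * (V : ℝ) ^ 2 := by gcongr
        _ = 8 * (V : ℝ) ^ 8 := by push_cast; ring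
        _ ≤ (N : ℝ) := hV8r
    set F := ∑ n ∈ Finset.Ico c d, (ArithmeticFunction.vonMangoldt n : ℂ) * vtE (n * θ)
    set G := ∑ n ∈ Finset.Ico c d, vtMod (2 * V ^ 2) n * vtE (n * θ)
    set M := (ArithmeticFunction.moebius q : ℂ) / (Nat.totient q : ℂ) * vtS c d β
    have : F - G = (F - M) - (G - M) := by ring
    rw [this]
    refine (norm_sub_le _ _).trans ?_
    have : (12 * C0 + 80) * ℓ ^ 3 * N / Real.sqrt V = (12 * C0 + 80) * (ℓ ^ 3 * N / Real.sqrt V) := by ring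
    rw [this]
    nlinarith [(by positivity : 0 ≤ ℓ ^ 3 * N / Real.sqrt V)]
  · rw [if_neg hqQ, sub_zero] at hG
    push Not at hqQ
    have hqn : q * (2 * V ^ 6) ≤ N := (Nat.mul_le_mul_right _ hx2).trans hnN
    have hq1 : (1 : ℝ) ≤ q := by exact_mod_cast hq
    have hV36 : V ^ 3 ≤ 2 * V ^ 6 := by
      have : V ^ 3 ≤ V ^ 6 := Nat.pow_le_pow_right hV (by norm_num)
      omega
    have hV6 : 2 ≤ 2 * V ^ 6 := by have : 0 < V ^ 6 := by positivity
                                   omega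
    have hm := vt_minor_Ico θ q a ha (by
      rw [← hβ, le_div_iff₀ (by positivity)]
      refine le_trans ?_ hβ1
      have : (q : ℝ) ≤ n + 1 := by exact_mod_cast (by omega : q ≤ n + 1)
      rw [sq]
      have := abs_nonneg β
      gcongr) N V hN3 hV hqQ.le ((Nat.mul_le_mul_left q hV36).trans hqn)
      (by calc 2 * q = q * 2 := mul_comm _ _
            _ ≤ q * (2 * V ^ 6) := Nat.mul_le_mul_left q hV6
            _ ≤ N := hqn) c d hcd hd
    have e2 : ((2 * V ^ 2 : ℕ) : ℝ) ^ 2 * q ≤ 2 * (N / V ^ 2) := by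
      rw [← mul_div_assoc, le_div_iff₀ (by positivity)]
      have : (q : ℝ) * (2 * V ^ 6) ≤ N := by exact_mod_cast hqn
      calc ((2 * V ^ 2 : ℕ) : ℝ) ^ 2 * q * (V : ℝ) ^ 2 = 2 * ((q : ℝ) * (2 * (V : ℝ) ^ 6)) := by push_cast; ring
        _ ≤ 2 * (N : ℝ) := by gcongr
    refine (norm_sub_le _ _).trans ?_
    have : (12 * C0 + 80) * ℓ ^ 3 * N / Real.sqrt V = 12 * C0 * (ℓ ^ 3 * N / Real.sqrt V) + 8 * (ℓ ^ 3 * N / Real.sqrt V)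
      + 72 * ℓ ^ 3 * N / Real.sqrt V := by ring
    rw [this]
    have : 0 ≤ 12 * C0 * (ℓ ^ 3 * N / Real.sqrt V) := by positivity
    have : 0 ≤ ℓ ^ 3 * N / Real.sqrt V := by positivity
    linarith

end P8b

section P8c
open Complex

lemma vt_orth (M : ℕ) (hM : M ≠ 0) (t : ℤ) (ht : |t| < M) :
    ∑ k ∈ Finset.range M, vtE (k * t / M) = if t = 0 then (M : ℂ) else 0 := by
  rw [vtE_complete M hM]
  congr 1
  rw [eq_iff_iff]
  constructor
  · intro h; exact Int.eq_zero_of_abs_lt_dvd h ht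
  · rintro rfl; exact dvd_zero _

lemma vt_parseval (W : Finset ℕ) (y : ℕ → ℂ) (M : ℕ) (hW : ∀ n ∈ W, n < M) :
    ∑ k ∈ Finset.range M, ‖∑ n ∈ W, y n * vtE (n * (k / M))‖ ^ 2 = M * ∑ n ∈ W, ‖y n‖ ^ 2 := by
  by_cases hM : M = 0
  · subst hM; simp
  have h : ((∑ k ∈ Finset.range M, ‖∑ n ∈ W, y n * vtE (n * (k / M))‖ ^ 2 : ℝ) : ℂ) = ((M * ∑ n ∈ W, ‖y n‖ ^ 2 : ℝ) : ℂ) := by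
    push_cast
    simp_rw [← Complex.mul_conj']
    simp_rw [map_sum, map_mul, vtE_conj, Finset.sum_mul_sum]
    rw [Finset.sum_comm, Finset.mul_sum]
    apply Finset.sum_congr rfl
    intro n hn
    rw [Finset.sum_comm]
    have : ∀ n' ∈ W, ∑ k ∈ Finset.range M, y n * vtE (n * (k / M)) * ((starRingEnd ℂ) (y n') * vtE (-(n' * (k / M))))
        = if n' = n then (M : ℂ) * (y n * (starRingEnd ℂ) (y n)) else 0 := by
      intro n' hn'
      have e : ∀ k ∈ Finset.range M, y n * vtE (n * (k / M)) * ((starRingEnd ℂ) (y n') * vtE (-(n' * (k / M))))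
         = (y n * (starRingEnd ℂ) (y n')) * vtE (k * ((n - n' : ℤ) : ℝ) / M) := by
        intro k _
        have : (k * ((n - n' : ℤ) : ℝ) / M : ℝ) = n * (k / M) + -(n' * (k / M)) := by push_cast; ring
        rw [this, vtE_add]; ring
      rw [Finset.sum_congr rfl e, ← Finset.mul_sum, vt_orth M hM]
      · by_cases h : n' = n
        · rw [if_pos h, if_pos (by omega), h]; ring
        · rw [if_neg h, if_neg (by omega), mul_zero]
      · have := hW n hn
        have := hW n' hn'
        rw [abs_lt]; omega
    rw [Finset.sum_congr rfl this, Finset.sum_ite_eq', if_pos hn]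
  exact_mod_cast h

noncomputable def vtT (W : Finset ℕ) (m : ℕ) (x y z : ℕ → ℂ) : ℂ :=
  ∑ n₁ ∈ W, ∑ n₂ ∈ W, ∑ n₃ ∈ W, if n₁ + n₂ + n₃ = m then x n₁ * y n₂ * z n₃ else 0

lemma vt_trilin (W : Finset ℕ) (m : ℕ) (x y z : ℕ → ℂ) (S : ℝ) (hS : ∀ θ : ℝ, ‖∑ n ∈ W, x n * vtE (n * θ)‖ ≤ S) :
    ‖vtT W m x y z‖ ≤ S * (Real.sqrt (∑ n ∈ W, ‖y n‖ ^ 2) * Real.sqrt (∑ n ∈ W, ‖z n‖ ^ 2)) := by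
  obtain ⟨B, hB⟩ : ∃ B : ℕ, ∀ n ∈ W, n < B := ⟨W.sup id + 1, fun n hn => Nat.lt_succ_of_le (Finset.le_sup (f := id) hn)⟩
  set M := 3 * B + m + 1 with hM
  have hM0 : M ≠ 0 := by omega
  have hMr : (0 : ℝ) < M := by exact_mod_cast (by omega : 0 < M)
  have hWM : ∀ n ∈ W, n < M := fun n hn => by have := hB n hn; omega
  set X : ℕ → ℂ := fun k => ∑ n ∈ W, x n * vtE (n * (k / M)) with hX
  set Y : ℕ → ℂ := fun k => ∑ n ∈ W, y n * vtE (n * (k / M)) with hY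
  set Z : ℕ → ℂ := fun k => ∑ n ∈ W, z n * vtE (n * (k / M)) with hZ
  have key : (M : ℂ) * vtT W m x y z = ∑ k ∈ Finset.range M, X k * Y k * Z k * vtE (-(m * (k / M))) := by
    have e1 : ∀ k ∈ Finset.range M, X k * Y k * Z k * vtE (-(m * (k / M))) = ∑ n₁ ∈ W, ∑ n₂ ∈ W, ∑ n₃ ∈ W,
        (x n₁ * y n₂ * z n₃) * vtE (k * ((n₁ + n₂ + n₃ - m : ℤ) : ℝ) / M) := by
      intro k _
      simp only [hX, hY, hZ]
      rw [Finset.sum_mul_sum, Finset.sum_mul, Finset.sum_mul]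
      apply Finset.sum_congr rfl; intro n₁ _
      rw [Finset.sum_mul, Finset.sum_mul]
      apply Finset.sum_congr rfl; intro n₂ _
      rw [Finset.mul_sum, Finset.sum_mul]
      apply Finset.sum_congr rfl; intro n₃ _
      have : (k * ((n₁ + n₂ + n₃ - m : ℤ) : ℝ) / M : ℝ) = n₁ * (k / M) + n₂ * (k / M) + n₃ * (k / M) + -(m * (k / M)) := by push_cast; ring
      rw [this, vtE_add, vtE_add, vtE_add]; ring
    rw [Finset.sum_congr rfl e1, Finset.sum_comm, vtT, Finset.mul_sum]
    apply Finset.sum_congr rfl; intro n₁ h₁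
    rw [Finset.mul_sum]
    conv_rhs => rw [Finset.sum_comm]
    apply Finset.sum_congr rfl; intro n₂ h₂
    rw [Finset.mul_sum]
    conv_rhs => rw [Finset.sum_comm]
    apply Finset.sum_congr rfl; intro n₃ h₃
    rw [← Finset.mul_sum, vt_orth M hM0]
    · by_cases h : n₁ + n₂ + n₃ = m
      · rw [if_pos h, if_pos (by omega)]; ring
      · rw [if_neg h, if_neg (by omega)]; ring
    · have := hB n₁ h₁
      have := hB n₂ h₂
      have := hB n₃ h₃
      rw [abs_lt]; omega
  have hS0 : 0 ≤ S := (norm_nonneg _).trans (hS 0)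
  have h1 : (M : ℝ) * ‖vtT W m x y z‖ ≤ S * ∑ k ∈ Finset.range M, ‖Y k‖ * ‖Z k‖ := by
    have : (M : ℝ) * ‖vtT W m x y z‖ = ‖(M : ℂ) * vtT W m x y z‖ := by rw [norm_mul, Complex.norm_natCast]
    rw [this, key, Finset.mul_sum]
    apply norm_sum_le_of_le
    intro k _
    rw [norm_mul, norm_mul, norm_mul, vtE_norm, mul_one, mul_assoc]
    gcongr
    exact hS _
  have h2 := Real.sum_mul_le_sqrt_mul_sqrt (Finset.range M) (fun k => ‖Y k‖) (fun k => ‖Z k‖)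
  rw [vt_parseval W y M hWM, vt_parseval W z M hWM, Real.sqrt_mul hMr.le, Real.sqrt_mul hMr.le] at h2
  have h3 : Real.sqrt M * Real.sqrt M = M := Real.mul_self_sqrt hMr.le
  have h4 : (M : ℝ) * ‖vtT W m x y z‖ ≤ M * (S * (Real.sqrt (∑ n ∈ W, ‖y n‖ ^ 2) * Real.sqrt (∑ n ∈ W, ‖z n‖ ^ 2))) := by
    refine h1.trans ?_
    calc _ ≤ S * (Real.sqrt M * Real.sqrt (∑ n ∈ W, ‖y n‖ ^ 2) * (Real.sqrt M * Real.sqrt (∑ n ∈ W, ‖z n‖ ^ 2))) := by gcongr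
      _ = (Real.sqrt M * Real.sqrt M) * (S * (Real.sqrt (∑ n ∈ W, ‖y n‖ ^ 2) * Real.sqrt (∑ n ∈ W, ‖z n‖ ^ 2))) := by ring
      _ = _ := by rw [h3]
  exact le_of_mul_le_mul_left h4 hMr

lemma vtT_swap12 (W : Finset ℕ) (m : ℕ) (x y z : ℕ → ℂ) : vtT W m x y z = vtT W m y x z := by
  unfold vtT
  rw [Finset.sum_comm]
  apply Finset.sum_congr rfl; intro n₁ _
  apply Finset.sum_congr rfl; intro n₂ _
  apply Finset.sum_congr rfl; intro n₃ _
  rw [add_comm n₂ n₁, mul_comm (x n₂)]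

lemma vtT_swap13 (W : Finset ℕ) (m : ℕ) (x y z : ℕ → ℂ) : vtT W m x y z = vtT W m z y x := by
  unfold vtT
  have : ∀ n₁ ∈ W, ∑ n₂ ∈ W, ∑ n₃ ∈ W, (if n₁ + n₂ + n₃ = m then x n₁ * y n₂ * z n₃ else 0)
      = ∑ n₃ ∈ W, ∑ n₂ ∈ W, (if n₁ + n₂ + n₃ = m then x n₁ * y n₂ * z n₃ else 0) := fun n₁ _ => Finset.sum_comm
  rw [Finset.sum_congr rfl this, Finset.sum_comm]
  apply Finset.sum_congr rfl; intro n₁ _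
  rw [Finset.sum_comm]
  apply Finset.sum_congr rfl; intro n₂ _
  apply Finset.sum_congr rfl; intro n₃ _
  rw [show n₃ + n₂ + n₁ = n₁ + n₂ + n₃ by ring]
  split_ifs
  · ring
  · rfl

lemma vtT_sub (W : Finset ℕ) (m : ℕ) (x x' y z : ℕ → ℂ) : vtT W m (fun n => x n - x' n) y z = vtT W m x y z - vtT W m x' y z := by
  unfold vtT
  simp_rw [← Finset.sum_sub_distrib]
  apply Finset.sum_congr rfl; intro n₁ _
  apply Finset.sum_congr rfl; intro n₂ _
  apply Finset.sum_congr rfl; intro n₃ _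
  split_ifs <;> ring

lemma vt_trilin_diff (W : Finset ℕ) (m : ℕ) (f g : ℕ → ℂ) (S E : ℝ) (hE : 0 ≤ E)
    (hS : ∀ θ : ℝ, ‖∑ n ∈ W, (f n - g n) * vtE (n * θ)‖ ≤ S)
    (hf : ∑ n ∈ W, ‖f n‖ ^ 2 ≤ E) (hg : ∑ n ∈ W, ‖g n‖ ^ 2 ≤ E) :
    ‖vtT W m f f f - vtT W m g g g‖ ≤ 3 * S * E := by
  have hS0 : 0 ≤ S := (norm_nonneg _).trans (hS 0)
  have hsf := Real.sqrt_le_sqrt hf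
  have hsg := Real.sqrt_le_sqrt hg
  have hEE : Real.sqrt E * Real.sqrt E = E := Real.mul_self_sqrt hE
  have key : ∀ y z : ℕ → ℂ, Real.sqrt (∑ n ∈ W, ‖y n‖ ^ 2) ≤ Real.sqrt E → Real.sqrt (∑ n ∈ W, ‖z n‖ ^ 2) ≤ Real.sqrt E →
      ‖vtT W m (fun n => f n - g n) y z‖ ≤ S * E := by
    intro y z hy hz
    refine (vt_trilin W m _ y z S hS).trans ?_
    rw [← hEE]
    gcongr
  have h1 := key f f hsf hsf
  have h2 := key g f hsg hsf
  have h3 := key g g hsg hsg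
  rw [vtT_sub] at h1 h2 h3
  have e : vtT W m f f f - vtT W m g g g = (vtT W m f f f - vtT W m g f f) + (vtT W m f g f - vtT W m g g f) + (vtT W m f g g - vtT W m g g g) := by
    rw [vtT_swap12 W m g f f, vtT_swap13 W m g g f]; ring
  rw [e]
  refine (norm_add₃_le).trans ?_
  linarith

lemma vtMod_hat_zero (Q r : ℕ) (hr : 0 < r) (hrQ : r ≤ Q) (b : ℤ) (hb : IsCoprime (r : ℤ) b) (c d : ℕ) :
    ‖∑ n ∈ Finset.Ico c d, vtMod Q n * vtE (n * (-b / r)) -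
      (ArithmeticFunction.moebius r : ℂ) / (Nat.totient r : ℂ) * ((d - c : ℕ) : ℂ)‖ ≤ (Q : ℝ) ^ 3 := by
  have h := vt_ghat Q r hr (-b) hb.neg_right 0 (by simp) c d
  rw [if_pos hrQ] at h
  have e : vtS c d 0 = ((d - c : ℕ) : ℂ) := by unfold vtS; simp [vtE_zero]
  rw [e] at h
  simp only [add_zero, Int.cast_neg] at h
  refine h.trans ?_
  have : (r : ℝ) ≤ Q := by exact_mod_cast hrQ
  rw [pow_succ (Q : ℝ) 2]
  gcongr

lemma vtMod_conj (Q n : ℕ) : (starRingEnd ℂ) (vtMod Q n) = ∑ r ∈ Finset.Ioc 0 Q, ((ArithmeticFunction.moebius r : ℂ) / (Nat.totient r : ℂ)) *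
    ∑ b ∈ (Finset.range r).filter (Nat.Coprime r), vtE (n * (-(b : ℤ) / r)) := by
  unfold vtMod vtR
  rw [map_sum]
  apply Finset.sum_congr rfl; intro r _
  rw [map_mul, map_sum]
  congr 1
  · simp
  · apply Finset.sum_congr rfl; intro b _
    rw [vtE_conj]; congr 1; push_cast; ring

lemma vtMod_l2 (Q c d : ℕ) : ∑ n ∈ Finset.Ico c d, ‖vtMod Q n‖ ^ 2 ≤
    (d - c : ℕ) * ∑ r ∈ Finset.Ioc 0 Q, 1 / (Nat.totient r : ℝ) + (Q : ℝ) ^ 4 := by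
  have e : ((∑ n ∈ Finset.Ico c d, ‖vtMod Q n‖ ^ 2 : ℝ) : ℂ) = ∑ r ∈ Finset.Ioc 0 Q, ((ArithmeticFunction.moebius r : ℂ) / (Nat.totient r : ℂ)) *
    ∑ b ∈ (Finset.range r).filter (Nat.Coprime r), ∑ n ∈ Finset.Ico c d, vtMod Q n * vtE (n * (-(b : ℤ) / r)) := by
    push_cast
    simp_rw [← Complex.mul_conj', vtMod_conj, Finset.mul_sum]
    rw [Finset.sum_comm]
    apply Finset.sum_congr rfl; intro r _
    rw [Finset.sum_comm]
    apply Finset.sum_congr rfl; intro b _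
    apply Finset.sum_congr rfl; intro n _
    push_cast; ring
  have h0 : ∑ n ∈ Finset.Ico c d, ‖vtMod Q n‖ ^ 2 = ‖((∑ n ∈ Finset.Ico c d, ‖vtMod Q n‖ ^ 2 : ℝ) : ℂ)‖ := by
    rw [Complex.norm_real, Real.norm_of_nonneg (Finset.sum_nonneg fun _ _ => by positivity)]
  rw [h0, e]
  have key : ∀ r ∈ Finset.Ioc 0 Q, ‖((ArithmeticFunction.moebius r : ℂ) / (Nat.totient r : ℂ)) *
    ∑ b ∈ (Finset.range r).filter (Nat.Coprime r), ∑ n ∈ Finset.Ico c d, vtMod Q n * vtE (n * (-(b : ℤ) / r))‖ ≤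
      (d - c : ℕ) * (1 / (Nat.totient r : ℝ)) + (Q : ℝ) ^ 3 := by
    intro r hr
    rw [Finset.mem_Ioc] at hr
    have hφ : (0 : ℝ) < Nat.totient r := by exact_mod_cast Nat.totient_pos.mpr hr.1
    have hb : ∀ b ∈ (Finset.range r).filter (Nat.Coprime r), ‖∑ n ∈ Finset.Ico c d, vtMod Q n * vtE (n * (-(b : ℤ) / r))‖
        ≤ (d - c : ℕ) * (1 / (Nat.totient r : ℝ)) + (Q : ℝ) ^ 3 := by
      intro b hb
      rw [Finset.mem_filter] at hb
      have h1 := vtMod_hat_zero Q r hr.1 hr.2 b (by rw [Nat.isCoprime_iff_coprime]; exact hb.2) c d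
      have h2 : ‖(ArithmeticFunction.moebius r : ℂ) / (Nat.totient r : ℂ) * ((d - c : ℕ) : ℂ)‖ ≤ (d - c : ℕ) * (1 / (Nat.totient r : ℝ)) := by
        rw [norm_mul, Complex.norm_natCast, mul_comm]
        gcongr
        exact vt_mu_phi_norm r
      have h3 := norm_le_norm_add_norm_sub' (∑ n ∈ Finset.Ico c d, vtMod Q n * vtE (n * (-(b : ℤ) / r))) ((ArithmeticFunction.moebius r : ℂ) / (Nat.totient r : ℂ) * ((d - c : ℕ) : ℂ))
      linarith
    rw [norm_mul]
    calc _ ≤ (1 / Nat.totient r : ℝ) * ∑ b ∈ (Finset.range r).filter (Nat.Coprime r), ((d - c : ℕ) * (1 / (Nat.totient r : ℝ)) + (Q : ℝ) ^ 3) :=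
          mul_le_mul (vt_mu_phi_norm r) (norm_sum_le_of_le _ hb) (norm_nonneg _) (by positivity)
      _ = _ := by
          rw [Finset.sum_const, nsmul_eq_mul, ← Nat.totient]
          field_simp
  refine (norm_sum_le_of_le _ key).trans ?_
  rw [Finset.sum_add_distrib, ← Finset.mul_sum, Finset.sum_const, nsmul_eq_mul, Nat.card_Ioc, Nat.sub_zero]
  apply le_of_eq; ring

lemma vt_sum_inv_phi (Q : ℕ) : ∑ r ∈ Finset.Ioc 0 Q, 1 / (Nat.totient r : ℝ) ≤ (Nat.log 2 Q + 1) * (1 + Real.log Q) := by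
  have h1 : ∀ r ∈ Finset.Ioc 0 Q, 1 / (Nat.totient r : ℝ) ≤ (Nat.log 2 Q + 1) * (r : ℝ)⁻¹ := by
    intro r hr
    rw [Finset.mem_Ioc] at hr
    have hr0 : (0 : ℝ) < r := by exact_mod_cast hr.1
    have hφ : (0 : ℝ) < Nat.totient r := by exact_mod_cast Nat.totient_pos.mpr hr.1
    rw [← div_eq_mul_inv, div_le_div_iff₀ hφ hr0, one_mul, mul_comm]
    refine (vt_totient_lower r hr.1).trans ?_
    have : Nat.log 2 r ≤ Nat.log 2 Q := Nat.log_mono_right hr.2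
    gcongr
  refine (Finset.sum_le_sum h1).trans ?_
  rw [← Finset.mul_sum]
  gcongr
  have h2 := harmonic_le_one_add_log Q
  rw [harmonic_eq_sum_Icc] at h2
  push_cast at h2
  exact h2

end P8c

section P9a
open Complex

def vtL (a0 b0 m n : ℕ) : ℕ := min b0 (m + 1 - a0 - n) - max a0 (m + 1 - b0 - n)

lemma vt_filter_Ico3 (a0 b0 m n : ℕ) : (Finset.Ico a0 b0).filter (fun k => a0 + n + k ≤ m ∧ m < b0 + n + k)
    = Finset.Ico (max a0 (m + 1 - b0 - n)) (min b0 (m + 1 - a0 - n)) := by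
  ext k
  simp only [Finset.mem_filter, Finset.mem_Ico]
  omega

lemma vtT_eq (a0 b0 m : ℕ) (x y z : ℕ → ℂ) : vtT (Finset.Ico a0 b0) m x y z =
    ∑ n₁ ∈ Finset.Ico a0 b0, ∑ n₂ ∈ Finset.Ico a0 b0, if (a0 + n₁ + n₂ ≤ m ∧ m < b0 + n₁ + n₂) then
      x n₁ * y n₂ * z (m - n₁ - n₂) else 0 := by
  unfold vtT
  apply Finset.sum_congr rfl; intro n₁ _
  apply Finset.sum_congr rfl; intro n₂ _
  split_ifs with h
  · rw [Finset.sum_eq_single (m - n₁ - n₂)]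
    · rw [if_pos (by omega)]
    · intro k _ hk; rw [if_neg (by omega)]
    · intro hn; exfalso; apply hn; rw [Finset.mem_Ico]; omega
  · apply Finset.sum_eq_zero; intro k hk
    rw [Finset.mem_Ico] at hk
    rw [if_neg (by omega)]

lemma vt_A (Q a0 b0 m r : ℕ) (hr : 0 < r) (hrQ : r ≤ Q) (b : ℤ) (hb : IsCoprime (r : ℤ) b) :
    ‖∑ n₁ ∈ Finset.Ico a0 b0, ∑ n₂ ∈ Finset.Ico a0 b0, (if (a0 + n₁ + n₂ ≤ m ∧ m < b0 + n₁ + n₂) then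
      vtMod Q n₁ * vtE (n₁ * (-b / r)) * (vtMod Q n₂ * vtE (n₂ * (-b / r))) else 0) -
     ((ArithmeticFunction.moebius r : ℂ) / (Nat.totient r : ℂ)) ^ 2 * ((∑ n ∈ Finset.Ico a0 b0, vtL a0 b0 m n : ℕ) : ℂ)‖
     ≤ 2 * (b0 - a0 : ℕ) * (Q : ℝ) ^ 4 := by
  set w := (ArithmeticFunction.moebius r : ℂ) / (Nat.totient r : ℂ) with hw
  set F : ℕ → ℂ := fun n => vtMod Q n * vtE (n * (-b / r)) with hF
  set W := Finset.Ico a0 b0 with hW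
  have hQ1 : (1 : ℝ) ≤ Q := by exact_mod_cast (by omega : 1 ≤ Q)
  have hwn : ‖w‖ ≤ 1 := by
    refine (vt_mu_phi_norm r).trans ?_
    have hφ : (1 : ℝ) ≤ Nat.totient r := by exact_mod_cast Nat.totient_pos.mpr hr
    rw [div_le_one (by linarith)]; exact hφ
  have hFn : ∀ n, ‖F n‖ ≤ Q := by
    intro n; simp only [hF]; rw [norm_mul, vtE_norm, mul_one]; exact vtMod_norm_le Q n
  set H : ℕ → ℂ := fun n => ∑ k ∈ W, if (a0 + n + k ≤ m ∧ m < b0 + n + k) then F k else 0 with hH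
  have hHn : ∀ n, ‖H n - w * (vtL a0 b0 m n : ℂ)‖ ≤ (Q : ℝ) ^ 3 := by
    intro n
    simp only [hH]
    rw [← Finset.sum_filter, hW, vt_filter_Ico3]
    exact vtMod_hat_zero Q r hr hrQ b hb _ _
  have hcard : ∀ C : ℝ, ∑ _n ∈ W, C = (b0 - a0 : ℕ) * C := by
    intro C; rw [Finset.sum_const, nsmul_eq_mul, hW, Nat.card_Ico]
  have hL : ∀ n, (vtL a0 b0 m n : ℂ) = ∑ k ∈ W, if (a0 + n + k ≤ m ∧ m < b0 + n + k) then (1 : ℂ) else 0 := by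
    intro n
    rw [← Finset.sum_filter, hW, vt_filter_Ico3]; simp [vtL]
  have e1 : ∑ n₁ ∈ W, ∑ n₂ ∈ W, (if (a0 + n₁ + n₂ ≤ m ∧ m < b0 + n₁ + n₂) then F n₁ * F n₂ else 0) = ∑ n₁ ∈ W, F n₁ * H n₁ := by
    apply Finset.sum_congr rfl; intro n₁ _
    simp only [hH]
    rw [Finset.mul_sum]
    apply Finset.sum_congr rfl; intro n₂ _
    split_ifs <;> simp
  have e2 : ∑ n₁ ∈ W, F n₁ * (vtL a0 b0 m n₁ : ℂ) = ∑ n ∈ W, H n := by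
    simp_rw [hL, Finset.mul_sum]
    rw [Finset.sum_comm]
    apply Finset.sum_congr rfl; intro n₁ _
    simp only [hH]
    apply Finset.sum_congr rfl; intro n₂ _
    rw [show a0 + n₂ + n₁ = a0 + n₁ + n₂ by ring, show b0 + n₂ + n₁ = b0 + n₁ + n₂ by ring]
    split_ifs <;> simp
  have h1 : ‖∑ n₁ ∈ W, F n₁ * (H n₁ - w * (vtL a0 b0 m n₁ : ℂ))‖ ≤ (b0 - a0 : ℕ) * (Q : ℝ) ^ 4 := by
    rw [← hcard]
    apply norm_sum_le_of_le
    intro n _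
    rw [norm_mul]
    calc _ ≤ (Q : ℝ) * Q ^ 3 := mul_le_mul (hFn n) (hHn n) (norm_nonneg _) (by positivity)
      _ = _ := by ring
  have h2 : ‖∑ n ∈ W, (H n - w * (vtL a0 b0 m n : ℂ))‖ ≤ (b0 - a0 : ℕ) * (Q : ℝ) ^ 4 := by
    rw [← hcard]
    apply norm_sum_le_of_le
    intro n _
    refine (hHn n).trans ?_
    exact pow_le_pow_right₀ hQ1 (by norm_num)
  have h3 : ‖w * ∑ n ∈ W, (H n - w * (vtL a0 b0 m n : ℂ))‖ ≤ (b0 - a0 : ℕ) * (Q : ℝ) ^ 4 := by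
    rw [norm_mul]
    exact (mul_le_of_le_one_left (norm_nonneg _) hwn).trans h2
  have e3 : ∑ n₁ ∈ W, F n₁ * H n₁ - w ^ 2 * ((∑ n ∈ W, vtL a0 b0 m n : ℕ) : ℂ)
      = ∑ n₁ ∈ W, F n₁ * (H n₁ - w * (vtL a0 b0 m n₁ : ℂ)) + w * ∑ n ∈ W, (H n - w * (vtL a0 b0 m n : ℂ)) := by
    have : ∑ n₁ ∈ W, F n₁ * (H n₁ - w * (vtL a0 b0 m n₁ : ℂ)) = ∑ n₁ ∈ W, F n₁ * H n₁ - w * ∑ n₁ ∈ W, F n₁ * (vtL a0 b0 m n₁ : ℂ) := by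
      rw [Finset.mul_sum, ← Finset.sum_sub_distrib]
      apply Finset.sum_congr rfl; intro n _; ring
    rw [this, e2, Finset.sum_sub_distrib, ← Finset.mul_sum]
    push_cast; ring
  rw [e1, e3]
  refine (norm_add_le _ _).trans ?_
  linarith

theorem vt_ggg (Q a0 b0 m : ℕ) :
    ‖vtT (Finset.Ico a0 b0) m (vtMod Q) (vtMod Q) (vtMod Q) -
      (∑ r ∈ Finset.Ioc 0 Q, ((ArithmeticFunction.moebius r : ℂ) / (Nat.totient r : ℂ)) ^ 3 * vtR r m) *
        ((∑ n ∈ Finset.Ico a0 b0, vtL a0 b0 m n : ℕ) : ℂ)‖ ≤ 2 * (b0 - a0 : ℕ) * (Q : ℝ) ^ 5 := by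
  set J : ℂ := ((∑ n ∈ Finset.Ico a0 b0, vtL a0 b0 m n : ℕ) : ℂ)
  set A : ℕ → ℕ → ℂ := fun r b => ∑ n₁ ∈ Finset.Ico a0 b0, ∑ n₂ ∈ Finset.Ico a0 b0, (if (a0 + n₁ + n₂ ≤ m ∧ m < b0 + n₁ + n₂) then
      vtMod Q n₁ * vtE (n₁ * (-(b : ℤ) / r)) * (vtMod Q n₂ * vtE (n₂ * (-(b : ℤ) / r))) else 0) with hA
  have e1 : vtT (Finset.Ico a0 b0) m (vtMod Q) (vtMod Q) (vtMod Q) = ∑ r ∈ Finset.Ioc 0 Q,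
      ((ArithmeticFunction.moebius r : ℂ) / (Nat.totient r : ℂ)) * ∑ b ∈ (Finset.range r).filter (Nat.Coprime r), vtE (b * m / r) * A r b := by
    rw [vtT_eq]
    have : ∀ n₁ ∈ Finset.Ico a0 b0, ∀ n₂ ∈ Finset.Ico a0 b0, (if (a0 + n₁ + n₂ ≤ m ∧ m < b0 + n₁ + n₂) then
      vtMod Q n₁ * vtMod Q n₂ * vtMod Q (m - n₁ - n₂) else 0) = ∑ r ∈ Finset.Ioc 0 Q,
      ∑ b ∈ (Finset.range r).filter (Nat.Coprime r), ((ArithmeticFunction.moebius r : ℂ) / (Nat.totient r : ℂ)) * (vtE (b * m / r) *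
       (if (a0 + n₁ + n₂ ≤ m ∧ m < b0 + n₁ + n₂) then
      vtMod Q n₁ * vtE (n₁ * (-(b : ℤ) / r)) * (vtMod Q n₂ * vtE (n₂ * (-(b : ℤ) / r))) else 0)) := by
      intro n₁ _ n₂ _
      split_ifs with h
      · conv_lhs => rw [vtMod.eq_def Q (m - n₁ - n₂)]
        rw [Finset.mul_sum]
        apply Finset.sum_congr rfl; intro r _
        unfold vtR
        rw [Finset.mul_sum, Finset.mul_sum]
        apply Finset.sum_congr rfl; intro b _
        have : (b * (((m - n₁ - n₂ : ℕ) : ℤ) : ℝ) / r : ℝ) = b * m / r + n₁ * (-(b : ℤ) / r) + n₂ * (-(b : ℤ) / r) := by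
          have : (((m - n₁ - n₂ : ℕ) : ℤ) : ℝ) = m - n₁ - n₂ := by
            rw [Int.cast_natCast, Nat.cast_sub (by omega), Nat.cast_sub (by omega)]
          rw [this]; push_cast; ring
        rw [this, vtE_add, vtE_add]; ring
      · simp
    rw [Finset.sum_congr rfl fun n₁ h₁ => Finset.sum_congr rfl fun n₂ h₂ => this n₁ h₁ n₂ h₂]
    simp only [hA, Finset.mul_sum]
    rw [Finset.sum_congr rfl fun n₁ h₁ => Finset.sum_comm]
    rw [Finset.sum_comm]
    apply Finset.sum_congr rfl; intro r _
    rw [Finset.sum_congr rfl fun n₁ h₁ => Finset.sum_comm]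
    rw [Finset.sum_comm]
  have e2 : (∑ r ∈ Finset.Ioc 0 Q, ((ArithmeticFunction.moebius r : ℂ) / (Nat.totient r : ℂ)) ^ 3 * vtR r m) * J
     = ∑ r ∈ Finset.Ioc 0 Q,
      ((ArithmeticFunction.moebius r : ℂ) / (Nat.totient r : ℂ)) * ∑ b ∈ (Finset.range r).filter (Nat.Coprime r), vtE (b * m / r) *
        (((ArithmeticFunction.moebius r : ℂ) / (Nat.totient r : ℂ)) ^ 2 * J) := by
    rw [Finset.sum_mul]
    apply Finset.sum_congr rfl; intro r _
    rw [← Finset.sum_mul]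
    unfold vtR
    simp only [Int.cast_natCast]
    ring
  rw [e1, e2, ← Finset.sum_sub_distrib]
  have key : ∀ r ∈ Finset.Ioc 0 Q, ‖((ArithmeticFunction.moebius r : ℂ) / (Nat.totient r : ℂ)) * ∑ b ∈ (Finset.range r).filter (Nat.Coprime r), vtE (b * m / r) * A r b
     - ((ArithmeticFunction.moebius r : ℂ) / (Nat.totient r : ℂ)) * ∑ b ∈ (Finset.range r).filter (Nat.Coprime r), vtE (b * m / r) *
        (((ArithmeticFunction.moebius r : ℂ) / (Nat.totient r : ℂ)) ^ 2 * J)‖ ≤ 2 * (b0 - a0 : ℕ) * (Q : ℝ) ^ 4 := by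
    intro r hr
    rw [Finset.mem_Ioc] at hr
    have hφ : (0 : ℝ) < Nat.totient r := by exact_mod_cast Nat.totient_pos.mpr hr.1
    rw [← mul_sub, ← Finset.sum_sub_distrib, norm_mul]
    have hb : ∀ b ∈ (Finset.range r).filter (Nat.Coprime r), ‖vtE (b * m / r) * A r b - vtE (b * m / r) *
        (((ArithmeticFunction.moebius r : ℂ) / (Nat.totient r : ℂ)) ^ 2 * J)‖ ≤ 2 * (b0 - a0 : ℕ) * (Q : ℝ) ^ 4 := by
      intro b hb
      rw [Finset.mem_filter] at hb
      rw [← mul_sub, norm_mul, vtE_norm, one_mul]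
      exact vt_A Q a0 b0 m r hr.1 hr.2 b (by rw [Nat.isCoprime_iff_coprime]; exact hb.2)
    calc _ ≤ (1 / Nat.totient r : ℝ) * ∑ b ∈ (Finset.range r).filter (Nat.Coprime r), (2 * (b0 - a0 : ℕ) * (Q : ℝ) ^ 4) :=
          mul_le_mul (vt_mu_phi_norm r) (norm_sum_le_of_le _ hb) (norm_nonneg _) (by positivity)
      _ = _ := by
          rw [Finset.sum_const, nsmul_eq_mul, ← Nat.totient]
          field_simp
  refine (norm_sum_le_of_le _ key).trans ?_
  rw [Finset.sum_const, nsmul_eq_mul, Nat.card_Ioc, Nat.sub_zero]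
  apply le_of_eq; ring

lemma vtJ_lower (u : ℝ) (hu : 12 ≤ u) (m : ℕ) (h4 : 4 * u ≤ m) (h5 : m ≤ 5 * u) :
    u ^ 2 / 144 ≤ ((∑ n ∈ Finset.Ico ⌈u⌉₊ (⌊2 * u⌋₊ + 1), vtL ⌈u⌉₊ (⌊2 * u⌋₊ + 1) m n : ℕ) : ℝ) := by
  set a0 := ⌈u⌉₊ with ha0
  set b0 := ⌊2 * u⌋₊ + 1 with hb0
  set t := m / 3 with ht
  set k := ⌊u / 12⌋₊ with hk
  have hk1 : (k : ℝ) ≤ u / 12 := Nat.floor_le (by positivity)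
  have hk2 : u / 12 < k + 1 := Nat.lt_floor_add_one _
  have ha1 : ∀ n : ℕ, u ≤ n → a0 ≤ n := fun n hn => Nat.ceil_le.mpr hn
  have hb1 : ∀ n : ℕ, (n : ℝ) ≤ 2 * u → n < b0 := fun n hn => Nat.lt_succ_of_le (Nat.le_floor hn)
  have ht1 : (3 * t : ℝ) ≤ m := by exact_mod_cast (by omega : 3 * t ≤ m)
  have ht2 : (m : ℝ) ≤ 3 * t + 2 := by exact_mod_cast (by omega : m ≤ 3 * t + 2)
  have hmem : ∀ n ∈ Finset.Icc t (t + k), n ∈ Finset.Ico a0 b0 := by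
    intro n hn
    rw [Finset.mem_Icc] at hn
    have h1 : (t : ℝ) ≤ n := by exact_mod_cast hn.1
    have h2 : (n : ℝ) ≤ t + k := by exact_mod_cast hn.2
    rw [Finset.mem_Ico]
    exact ⟨ha1 n (by linarith), hb1 n (by linarith)⟩
  have hLk : ∀ n ∈ Finset.Icc t (t + k), k + 1 ≤ vtL a0 b0 m n := by
    intro n hn
    have : vtL a0 b0 m n = ((Finset.Ico a0 b0).filter (fun k => a0 + n + k ≤ m ∧ m < b0 + n + k)).card := by
      rw [vt_filter_Ico3, Nat.card_Ico]; rfl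
    rw [this]
    calc k + 1 = (Finset.Icc t (t + k)).card := by rw [Nat.card_Icc]; omega
      _ ≤ _ := by
        apply Finset.card_le_card
        intro l hl
        rw [Finset.mem_filter]
        refine ⟨hmem l hl, ?_⟩
        rw [Finset.mem_Icc] at hn hl
        have h1 : (t : ℝ) ≤ n := by exact_mod_cast hn.1
        have h2 : (n : ℝ) ≤ t + k := by exact_mod_cast hn.2
        have h3 : (t : ℝ) ≤ l := by exact_mod_cast hl.1
        have h4 : (l : ℝ) ≤ t + k := by exact_mod_cast hl.2
        have hnl : n + l ≤ m := by
          have : (n : ℝ) + l ≤ m := by linarith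
          exact_mod_cast this
        have hc : ((m - n - l : ℕ) : ℝ) = m - n - l := by
          rw [Nat.cast_sub (by omega), Nat.cast_sub (by omega)]
        have h5 := ha1 (m - n - l) (by rw [hc]; linarith)
        have h6 := hb1 (m - n - l) (by rw [hc]; linarith)
        omega
  have h1 : (k + 1) * (k + 1) ≤ ∑ n ∈ Finset.Ico a0 b0, vtL a0 b0 m n := by
    calc (k + 1) * (k + 1) = ∑ n ∈ Finset.Icc t (t + k), (k + 1) := by
          rw [Finset.sum_const, Nat.card_Icc, smul_eq_mul]; congr 1; omega
      _ ≤ ∑ n ∈ Finset.Icc t (t + k), vtL a0 b0 m n := Finset.sum_le_sum hLk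
      _ ≤ _ := Finset.sum_le_sum_of_subset hmem
  have h2 : ((k : ℝ) + 1) * (k + 1) ≤ ((∑ n ∈ Finset.Ico a0 b0, vtL a0 b0 m n : ℕ) : ℝ) := by exact_mod_cast h1
  nlinarith

end P9a

section P9b
open Complex

noncomputable def vtSg (m : ℤ) (r : ℕ) : ℝ := ((ArithmeticFunction.moebius r : ℝ) / (Nat.totient r : ℝ)) ^ 3 * vtRaf m r

lemma vtSg_zero (m : ℤ) : vtSg m 0 = 0 := by simp [vtSg]

lemma vtSg_one (m : ℤ) : vtSg m 1 = 1 := by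
  simp [vtSg, (vtRaf_mult m).map_one]

lemma vtSg_mul (m : ℤ) {r s : ℕ} (h : Nat.Coprime r s) : vtSg m (r * s) = vtSg m r * vtSg m s := by
  unfold vtSg
  rw [ArithmeticFunction.isMultiplicative_moebius.map_mul_of_coprime h, (vtRaf_mult m).map_mul_of_coprime h, Nat.totient_mul h]
  push_cast
  rw [mul_div_mul_comm]; ring

lemma vtSg_abs (m : ℤ) (r : ℕ) : ‖vtSg m r‖ ≤ 1 / (Nat.totient r : ℝ) ^ 2 := by
  rcases Nat.eq_zero_or_pos r with h | h
  · subst h; simp [vtSg_zero]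
  have hφ : (0 : ℝ) < Nat.totient r := by exact_mod_cast Nat.totient_pos.mpr h
  unfold vtSg
  rw [norm_mul, norm_pow, norm_div, Real.norm_natCast]
  have h1 : ‖vtRaf m r‖ ≤ Nat.totient r := by
    have := vtR_norm_le r m
    rw [vtR_eq r h, Complex.norm_real] at this; exact this
  have h2 : ‖(ArithmeticFunction.moebius r : ℝ)‖ ≤ 1 := by
    rw [Real.norm_eq_abs]; exact_mod_cast ArithmeticFunction.abs_moebius_le_one
  calc _ ≤ (1 / (Nat.totient r : ℝ)) ^ 3 * Nat.totient r := by gcongr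
    _ = _ := by field_simp

lemma vt_phi_summable : Summable (fun r : ℕ => 1 / (Nat.totient r : ℝ) ^ 2) := by
  have hs : Summable (fun r : ℕ => 144 * (1 / (r : ℝ) ^ (3 / 2 : ℝ))) :=
    (Real.summable_one_div_nat_rpow.mpr (by norm_num)).mul_left 144
  apply Summable.of_norm_bounded_eventually_nat hs
  filter_upwards [Filter.eventually_ge_atTop 3] with r hr
  have hr0 : (0 : ℝ) < r := by positivity
  have hφ : (0 : ℝ) < Nat.totient r := by exact_mod_cast Nat.totient_pos.mpr (by omega)
  rw [Real.norm_of_nonneg (by positivity)]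
  have h1 := vt_totient_lower r (by omega)
  have h2 := vt_natlog_le hr
  have h3 := vt_logpow_sqrt 2 (by norm_num) (x := (r : ℝ)) (by exact_mod_cast (by omega : 1 ≤ r))
  have h4 : (r : ℝ) ≤ Nat.totient r * (3 * Real.log r) := h1.trans (by gcongr)
  have h5 : (r : ℝ) ^ 2 ≤ (Nat.totient r : ℝ) ^ 2 * (144 * Real.sqrt r) := by
    calc (r : ℝ) ^ 2 ≤ (Nat.totient r * (3 * Real.log r)) ^ 2 := by gcongr
      _ = (Nat.totient r : ℝ) ^ 2 * (9 * (Real.log r) ^ 2) := by ring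
      _ ≤ (Nat.totient r : ℝ) ^ 2 * (9 * ((2 * ((2 : ℕ) : ℝ)) ^ 2 * Real.sqrt r)) := by gcongr
      _ = _ := by push_cast; ring
  have h6 : (r : ℝ) ^ (3 / 2 : ℝ) * Real.sqrt r = r ^ 2 := by
    rw [Real.sqrt_eq_rpow, ← Real.rpow_add hr0, ← Real.rpow_natCast]; norm_num
  have h7 : (0 : ℝ) < (r : ℝ) ^ (3 / 2 : ℝ) := Real.rpow_pos_of_pos hr0 _
  have h8 : 0 < Real.sqrt r := Real.sqrt_pos.mpr hr0
  rw [mul_one_div, div_le_div_iff₀ (by positivity) h7, one_mul]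
  rw [← h6] at h5
  have : (r : ℝ) ^ (3 / 2 : ℝ) * Real.sqrt r ≤ (144 * (Nat.totient r : ℝ) ^ 2) * Real.sqrt r := by linarith
  exact le_of_mul_le_mul_right this h8

lemma vtSg_summable (m : ℤ) : Summable (fun r => ‖vtSg m r‖) :=
  Summable.of_nonneg_of_le (fun _ => norm_nonneg _) (vtSg_abs m) vt_phi_summable

lemma vtSg_factor (m : ℤ) (p : ℕ) (hp : p.Prime) : ∑' e : ℕ, vtSg m (p ^ e) = 1 + vtSg m p := by
  rw [tsum_eq_sum (s := Finset.range 2)]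
  · rw [Finset.sum_range_succ, Finset.sum_range_one, pow_zero, pow_one, vtSg_one]
  · intro e he
    rw [Finset.mem_range] at he
    unfold vtSg
    rw [ArithmeticFunction.moebius_apply_prime_pow hp (by omega), if_neg (by omega)]
    simp

lemma vtSg_prime (m : ℤ) (p : ℕ) (hp : p.Prime) : vtSg m p = -(1 / ((p : ℝ) - 1) ^ 3) * (if (p : ℤ) ∣ m then (p : ℝ) - 1 else -1) := by
  unfold vtSg
  rw [ArithmeticFunction.moebius_apply_prime hp, vtRaf_prime p hp, Nat.totient_prime hp, Nat.cast_sub hp.one_le]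
  push_cast
  congr 1
  rw [div_pow]
  norm_num [neg_div]

lemma vtSg_two (m : ℤ) (hm : Odd m) : vtSg m 2 = 1 := by
  rw [vtSg_prime m 2 Nat.prime_two, if_neg]
  · norm_num
  · intro h
    have : (2 : ℤ) ∣ m := by exact_mod_cast h
    rw [← Int.not_even_iff_odd] at hm
    exact hm (even_iff_two_dvd.mpr this)

lemma vtSg_ge (m : ℤ) (p : ℕ) (hp : p.Prime) (h3 : 3 ≤ p) : 1 - 1 / ((p : ℝ) - 1) ^ 2 ≤ 1 + vtSg m p := by
  have h : (3 : ℝ) ≤ p := by exact_mod_cast h3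
  have h0 : (0 : ℝ) < (p : ℝ) - 1 := by linarith
  rw [vtSg_prime m p hp]
  split_ifs
  · have : -(1 / ((p : ℝ) - 1) ^ 3) * ((p : ℝ) - 1) = - (1 / ((p : ℝ) - 1) ^ 2) := by field_simp
    rw [this]; linarith
  · have : 0 ≤ 1 / ((p : ℝ) - 1) ^ 3 := by positivity
    have : 0 ≤ 1 / ((p : ℝ) - 1) ^ 2 := by positivity
    linarith

lemma vtSg_prod (m : ℤ) (hm : Odd m) (k : ℕ) :
    ((k : ℝ) + 2) / (2 * (k + 1)) ≤ ∏ p ∈ (k + 3).primesBelow, ∑' e : ℕ, vtSg m (p ^ e) := by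
  induction k with
  | zero =>
    have : Nat.primesBelow (0 + 3) = {2} := by decide
    rw [this, Finset.prod_singleton, vtSg_factor m 2 Nat.prime_two, vtSg_two m hm]; norm_num
  | succ k ih =>
    have hk : (0 : ℝ) ≤ k := by positivity
    rw [show k + 1 + 3 = (k + 3) + 1 by ring, Nat.primesBelow_succ]
    split_ifs with hp
    · rw [Finset.prod_insert (Nat.notMem_primesBelow _), vtSg_factor m _ hp]
      have h1 := vtSg_ge m _ hp (by omega)
      have e : ((k + 1 : ℕ) + 2 : ℝ) / (2 * ((k + 1 : ℕ) + 1)) = (1 - 1 / (((k + 3 : ℕ) : ℝ) - 1) ^ 2) * (((k : ℝ) + 2) / (2 * (k + 1))) := by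
        push_cast
        have : (k : ℝ) + 3 - 1 = k + 2 := by ring
        rw [this]
        field_simp
        ring
      rw [e]
      apply mul_le_mul h1 ih (by positivity)
      refine le_trans ?_ h1
      push_cast
      rw [show (k : ℝ) + 3 - 1 = k + 2 by ring]
      rw [sub_nonneg, div_le_one (by positivity)]
      nlinarith
    · refine le_trans ?_ ih
      push_cast
      rw [div_le_div_iff₀ (by positivity) (by positivity)]
      nlinarith

lemma vtSg_tsum (m : ℤ) (hm : Odd m) : (1 / 2 : ℝ) ≤ ∑' r, vtSg m r := by
  have h := EulerProduct.eulerProduct (vtSg_one m) (vtSg_mul m) (vtSg_summable m) (vtSg_zero m)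
  have h2 := h.comp (Filter.tendsto_add_atTop_nat 3)
  apply ge_of_tendsto' h2
  intro k
  refine le_trans ?_ (vtSg_prod m hm k)
  rw [div_le_div_iff₀ (by norm_num) (by positivity)]
  linarith

theorem vt_singular : ∃ Q0 : ℕ, ∀ Q : ℕ, Q0 ≤ Q → ∀ m : ℤ, Odd m →
    (1 / 4 : ℝ) ≤ ∑ r ∈ Finset.Ioc 0 Q, vtSg m r := by
  have ht := tendsto_sum_nat_add (fun r : ℕ => 1 / (Nat.totient r : ℝ) ^ 2)
  have := ht.eventually (gt_mem_nhds (show (0 : ℝ) < 1 / 4 by norm_num))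
  obtain ⟨Q0, hQ0⟩ := Filter.eventually_atTop.mp this
  refine ⟨Q0, fun Q hQ m hm => ?_⟩
  have h1 := hQ0 (Q + 1) (by omega)
  have hsum := (vtSg_summable m).of_norm
  have h2 := hsum.sum_add_tsum_nat_add (Q + 1)
  have h3 : ∑' i, vtSg m (i + (Q + 1)) ≤ ∑' i : ℕ, 1 / (Nat.totient (i + (Q + 1)) : ℝ) ^ 2 := by
    have a1 := hsum.comp_injective (add_left_injective (Q + 1))
    have a2 := vt_phi_summable.comp_injective (add_left_injective (Q + 1))
    exact Summable.tsum_le_tsum (fun i => (Real.le_norm_self _).trans (vtSg_abs m _)) a1 a2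
  have h4 := vtSg_tsum m hm
  have e : ∑ r ∈ Finset.Ioc 0 Q, vtSg m r = ∑ r ∈ Finset.range (Q + 1), vtSg m r := by
    apply Finset.sum_subset
    · intro n; rw [Finset.mem_Ioc, Finset.mem_range]; omega
    · intro n h1 h2
      rw [Finset.mem_range] at h1
      rw [Finset.mem_Ioc] at h2
      have : n = 0 := by omega
      subst this; exact vtSg_zero m
  rw [e]
  linarith

lemma vtSg_sum_eq (Q : ℕ) (m : ℕ) : ∑ r ∈ Finset.Ioc 0 Q, ((ArithmeticFunction.moebius r : ℂ) / (Nat.totient r : ℂ)) ^ 3 * vtR r m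
    = ((∑ r ∈ Finset.Ioc 0 Q, vtSg m r : ℝ) : ℂ) := by
  push_cast
  apply Finset.sum_congr rfl
  intro r hr
  rw [Finset.mem_Ioc] at hr
  rw [vtR_eq r hr.1]
  unfold vtSg
  push_cast; rfl

end P9b

section P9c
open Complex

lemma vt_lam_le {n N : ℕ} (h : n < N) : ArithmeticFunction.vonMangoldt n ≤ Real.log N := by
  rcases Nat.eq_zero_or_pos n with h0 | h0
  · subst h0; simp; exact Real.log_natCast_nonneg _
  · refine ArithmeticFunction.vonMangoldt_le_log.trans ?_
    exact Real.log_le_log (by exact_mod_cast h0) (by exact_mod_cast h.le)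

lemma vt_lam_l2 (c N : ℕ) : ∑ n ∈ Finset.Ico c N, ‖(ArithmeticFunction.vonMangoldt n : ℂ)‖ ^ 2 ≤ N * (Real.log N) ^ 2 := by
  have h : ∀ n ∈ Finset.Ico c N, ‖(ArithmeticFunction.vonMangoldt n : ℂ)‖ ^ 2 ≤ (Real.log N) ^ 2 := by
    intro n hn
    rw [Finset.mem_Ico] at hn
    rw [Complex.norm_real, Real.norm_of_nonneg ArithmeticFunction.vonMangoldt_nonneg]
    have := vt_lam_le hn.2
    have := ArithmeticFunction.vonMangoldt_nonneg (n := n)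
    gcongr
  refine (Finset.sum_le_card_nsmul _ _ _ h).trans ?_
  rw [nsmul_eq_mul, Nat.card_Ico]
  gcongr
  exact_mod_cast Nat.sub_le _ _

lemma vt_log_large (L : ℝ) : ∃ N0 : ℕ, 3 ≤ N0 ∧ ∀ N : ℕ, N0 ≤ N → L ≤ Real.log N := by
  refine ⟨max 3 ⌈Real.exp L⌉₊, le_max_left _ _, fun N hN => ?_⟩
  have h3 : 3 ≤ N := (le_max_left _ _).trans hN
  rw [Real.le_log_iff_exp_le (by exact_mod_cast (by omega : 0 < N))]
  exact (Nat.le_ceil _).trans (by exact_mod_cast (le_max_right _ _).trans hN)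

set_option maxHeartbeats 1000000 in
theorem vt_lam3 : ∃ u0 : ℝ, 12 ≤ u0 ∧ ∀ u : ℝ, u0 ≤ u → ∀ m : ℕ, Odd m → 4 * u ≤ m → m ≤ 5 * u →
    u ^ 2 / 1152 ≤ (vtT (Finset.Ico ⌈u⌉₊ (⌊2 * u⌋₊ + 1)) m (fun n => (ArithmeticFunction.vonMangoldt n : ℂ))
      (fun n => (ArithmeticFunction.vonMangoldt n : ℂ)) (fun n => (ArithmeticFunction.vonMangoldt n : ℂ))).re := by
  obtain ⟨C, hC, N1, hN1, hsup⟩ := vt_sup 12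
  obtain ⟨Q0, hQ0⟩ := vt_singular
  obtain ⟨N2, hN2, hpow⟩ := vt_pow_log_le 121
  obtain ⟨N3, hN3, hlog⟩ := vt_log_large (42 * 9 * 2304 * C + 192 * 2304 + 2 * Q0 + 2)
  refine ⟨N1 + N2 + N3 + 12, by linarith [(by positivity : (0 : ℝ) ≤ N1 + N2 + N3)], ?_⟩
  intro u hu m hm h4 h5
  have hu12 : 12 ≤ u := by linarith [(by positivity : (0 : ℝ) ≤ N1 + N2 + N3)]
  set a0 := ⌈u⌉₊ with ha0
  set N := ⌊2 * u⌋₊ + 1 with hN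
  have hNu : 2 * u ≤ (N : ℝ) := by push_cast [hN]; exact (Nat.lt_floor_add_one _).le
  have hNu2 : (N : ℝ) ≤ 3 * u := by
    push_cast [hN]; linarith [Nat.floor_le (show 0 ≤ 2 * u by linarith)]
  have hNs : N1 + N2 + N3 ≤ N := by
    have : ((N1 + N2 + N3 : ℕ) : ℝ) ≤ N := by push_cast; linarith
    exact_mod_cast this
  have hpow := hpow N (by omega)
  have hlog := hlog N (by omega)
  have hsup := hsup N (by omega)
  have hN3 : 3 ≤ N := by omega
  have haN : a0 ≤ N := by
    rw [ha0, Nat.ceil_le]; linarith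
  have hNpos : (0 : ℝ) < N := by linarith
  set ℓ := Real.log N with hℓdef
  have hQ00 : (0 : ℝ) ≤ Q0 := by positivity
  have hℓ2 : 2 ≤ ℓ := by nlinarith
  have hℓ : 1 ≤ ℓ := by linarith
  have hℓ0 : 0 < ℓ := by linarith
  set V := ⌊ℓ ^ 12⌋₊ with hVdef
  have hV1 : (V : ℝ) ≤ ℓ ^ 12 := Nat.floor_le (by positivity)
  have hℓ12 : ℓ ≤ ℓ ^ 12 := le_self_pow₀ hℓ (by norm_num)
  have hV2 : ℓ ^ 12 / 2 ≤ V := by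
    have := Nat.lt_floor_add_one (ℓ ^ 12)
    linarith
  have hV1' : 1 ≤ V := by
    rw [hVdef]; apply Nat.le_floor; push_cast; linarith
  have hVr : (1 : ℝ) ≤ V := by exact_mod_cast hV1'
  have hsV : ℓ ^ 6 / 2 ≤ Real.sqrt V := by
    apply Real.le_sqrt_of_sq_le
    have : 0 < ℓ ^ 12 := by positivity
    calc (ℓ ^ 6 / 2) ^ 2 = ℓ ^ 12 / 4 := by ring
      _ ≤ (V : ℝ) := by linarith
  set Q := 2 * V ^ 2 with hQdef
  have hQr : (Q : ℝ) ≤ 2 * ℓ ^ 24 := by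
    push_cast [hQdef]
    calc 2 * (V : ℝ) ^ 2 ≤ 2 * (ℓ ^ 12) ^ 2 := by gcongr
      _ = _ := by ring
  have hQ1 : (1 : ℝ) ≤ Q := by push_cast [hQdef]; nlinarith
  have hQQ0 : Q0 ≤ Q := by
    have : (Q0 : ℝ) ≤ Q := by
      have : (V : ℝ) ≤ Q := by push_cast [hQdef]; nlinarith
      have : ℓ / 2 ≤ V := by linarith
      have : 2 * (Q0 : ℝ) ≤ ℓ := by nlinarith
      linarith
    exact_mod_cast this
  have hQ5 : (Q : ℝ) ^ 5 ≤ 32 * ℓ ^ 120 := by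
    calc (Q : ℝ) ^ 5 ≤ (2 * ℓ ^ 24) ^ 5 := by gcongr
      _ = _ := by ring
  have hQ5N : (Q : ℝ) ^ 5 * ℓ ≤ 4 * N := by
    calc (Q : ℝ) ^ 5 * ℓ ≤ 32 * ℓ ^ 120 * ℓ := by gcongr
      _ = 4 * (8 * ℓ ^ 121) := by ring
      _ ≤ 4 * N := by gcongr
  have hbig : 192 * 2304 ≤ ℓ := by nlinarith
  have hbigC : 42 * 9 * 2304 * C ≤ ℓ := by linarith
  have hQ5N' : (Q : ℝ) ^ 5 ≤ N := by nlinarith [pow_pos (by linarith : (0 : ℝ) < Q) 5]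
  have hQN : (Q : ℝ) ≤ N := (le_self_pow₀ hQ1 (by norm_num)).trans hQ5N'
  have hQ4 : (Q : ℝ) ^ 4 ≤ N := (pow_le_pow_right₀ hQ1 (by norm_num)).trans hQ5N'
  have hQNn : Q ≤ N := by exact_mod_cast hQN
  -- energy
  have hbaN : ((N - a0 : ℕ) : ℝ) ≤ N := by exact_mod_cast Nat.sub_le _ _
  have hg : ∑ n ∈ Finset.Ico a0 N, ‖vtMod Q n‖ ^ 2 ≤ 7 * ℓ ^ 2 * N := by
    refine (vtMod_l2 Q a0 N).trans ?_
    have h1 : ∑ r ∈ Finset.Ioc 0 Q, 1 / (Nat.totient r : ℝ) ≤ 6 * ℓ ^ 2 := by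
      refine (vt_sum_inv_phi Q).trans ?_
      have e1 : (Nat.log 2 Q : ℝ) + 1 ≤ 3 * ℓ := by
        refine le_trans ?_ (vt_natlog_le hN3)
        have : Nat.log 2 Q ≤ Nat.log 2 N := Nat.log_mono_right hQNn
        have : (Nat.log 2 Q : ℝ) ≤ Nat.log 2 N := by exact_mod_cast this
        linarith
      have e2 : Real.log Q ≤ ℓ := Real.log_le_log (by linarith) hQN
      have e3 : 0 ≤ Real.log Q := Real.log_nonneg hQ1
      calc _ ≤ (3 * ℓ) * (ℓ + ℓ) := by gcongr
        _ = _ := by ring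
    calc _ ≤ (N : ℝ) * (6 * ℓ ^ 2) + N := by gcongr
      _ ≤ _ := by
        have e1 : (1 : ℝ) ≤ ℓ ^ 2 := one_le_pow₀ hℓ
        have e2 : (N : ℝ) * 1 ≤ N * ℓ ^ 2 := by gcongr
        linarith
  have hf : ∑ n ∈ Finset.Ico a0 N, ‖(ArithmeticFunction.vonMangoldt n : ℂ)‖ ^ 2 ≤ 7 * ℓ ^ 2 * N := by
    refine (vt_lam_l2 a0 N).trans ?_
    have : 0 ≤ N * ℓ ^ 2 := by positivity
    linarith
  have hS : ∀ θ : ℝ, ‖∑ n ∈ Finset.Ico a0 N, ((ArithmeticFunction.vonMangoldt n : ℂ) - vtMod Q n) * vtE (n * θ)‖ ≤ 2 * C * N / ℓ ^ 3 := by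
    intro θ
    refine (hsup V hV1' hV1 a0 N haN le_rfl θ).trans ?_
    rw [div_le_div_iff₀ (by positivity) (by positivity)]
    calc C * ℓ ^ 3 * N * ℓ ^ 3 = 2 * C * N * (ℓ ^ 6 / 2) := by ring
      _ ≤ _ := by gcongr
  have hd1 := vt_trilin_diff (Finset.Ico a0 N) m (fun n => (ArithmeticFunction.vonMangoldt n : ℂ)) (vtMod Q) _ _ (by positivity) hS hf hg
  have hd1' : 3 * (2 * C * N / ℓ ^ 3) * (7 * ℓ ^ 2 * N) ≤ u ^ 2 / 2304 := by
    have e : 3 * (2 * C * N / ℓ ^ 3) * (7 * ℓ ^ 2 * N) = 42 * C * (N : ℝ) ^ 2 / ℓ := by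
      field_simp; ring
    rw [e, div_le_div_iff₀ hℓ0 (by norm_num)]
    calc 42 * C * (N : ℝ) ^ 2 * 2304 ≤ 42 * C * (3 * u) ^ 2 * 2304 := by gcongr
      _ = u ^ 2 * (42 * 9 * 2304 * C) := by ring
      _ ≤ _ := by gcongr
  have hd2 := vt_ggg Q a0 N m
  have hd2' : 2 * ((N - a0 : ℕ) : ℝ) * (Q : ℝ) ^ 5 ≤ u ^ 2 / 2304 := by
    have h1 : (Q : ℝ) ^ 5 * (192 * 2304) ≤ 12 * u := by
      calc (Q : ℝ) ^ 5 * (192 * 2304) ≤ (Q : ℝ) ^ 5 * ℓ := by gcongr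
        _ ≤ _ := by linarith
    have h2 : (Q : ℝ) ^ 5 ≤ u / (16 * 2304) := by
      rw [le_div_iff₀ (by norm_num)]; linarith
    calc 2 * ((N - a0 : ℕ) : ℝ) * (Q : ℝ) ^ 5 ≤ 2 * (3 * u) * (u / (16 * 2304)) := by
          gcongr; linarith
      _ ≤ _ := by nlinarith
  rw [vtSg_sum_eq] at hd2
  have hJ := vtJ_lower u hu12 m h4 h5
  rw [← ha0, ← hN] at hJ
  have hsing := hQ0 Q hQQ0 m (by exact_mod_cast hm)
  set J : ℕ := ∑ n ∈ Finset.Ico a0 N, vtL a0 N m n with hJdef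
  set G : ℝ := ∑ r ∈ Finset.Ioc 0 Q, vtSg m r with hGdef
  set T1 := vtT (Finset.Ico a0 N) m (fun n => (ArithmeticFunction.vonMangoldt n : ℂ))
      (fun n => (ArithmeticFunction.vonMangoldt n : ℂ)) (fun n => (ArithmeticFunction.vonMangoldt n : ℂ))
  set T2 := vtT (Finset.Ico a0 N) m (vtMod Q) (vtMod Q) (vtMod Q)
  have hGJ : u ^ 2 / 576 ≤ G * J := by
    calc u ^ 2 / 576 = 1 / 4 * (u ^ 2 / 144) := by ring
      _ ≤ G * J := by gcongr
  have r1 := (Complex.abs_re_le_norm (T1 - T2)).trans (hd1.trans hd1')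
  have r2 := (Complex.abs_re_le_norm (T2 - (G : ℂ) * (J : ℂ))).trans (hd2.trans hd2')
  have r3 : ((G : ℂ) * (J : ℂ)).re = G * J := by simp
  rw [Complex.sub_re] at r1 r2
  rw [r3] at r2
  have := (abs_le.mp r1).1
  have := (abs_le.mp r2).1
  linarith

end P9c

section P9d

/-- Triples of elements of `X` with sum `m`. -/
def vtTr (X : Finset ℕ) (m : ℕ) : Finset (ℕ × ℕ × ℕ) :=
  (X ×ˢ X ×ˢ X).filter (fun t => t.1 + t.2.1 + t.2.2 = m)

lemma vtTr_mem {X : Finset ℕ} {m : ℕ} {t : ℕ × ℕ × ℕ} :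
    t ∈ vtTr X m ↔ (t.1 ∈ X ∧ t.2.1 ∈ X ∧ t.2.2 ∈ X) ∧ t.1 + t.2.1 + t.2.2 = m := by
  simp [vtTr, Finset.mem_product]

lemma vtTr_card1 (X : Finset ℕ) (m a : ℕ) : ((vtTr X m).filter (fun t => t.1 = a)).card ≤ X.card := by
  apply Finset.card_le_card_of_injOn (fun t => t.2.1)
  · intro t ht
    have ht := Finset.mem_filter.mp ht
    exact (vtTr_mem.mp ht.1).1.2.1
  · rintro ⟨x, y, z⟩ ht ⟨x', y', z'⟩ ht' e
    have ht := Finset.mem_filter.mp ht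
    have ht' := Finset.mem_filter.mp ht'
    have h1 := (vtTr_mem.mp ht.1).2
    have h2 := (vtTr_mem.mp ht'.1).2
    simp only [Prod.mk.injEq] at *
    omega

lemma vtTr_card2 (X : Finset ℕ) (m a : ℕ) : ((vtTr X m).filter (fun t => t.2.1 = a)).card ≤ X.card := by
  apply Finset.card_le_card_of_injOn (fun t => t.1)
  · intro t ht
    have ht := Finset.mem_filter.mp ht
    exact (vtTr_mem.mp ht.1).1.1
  · rintro ⟨x, y, z⟩ ht ⟨x', y', z'⟩ ht' e
    have ht := Finset.mem_filter.mp ht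
    have ht' := Finset.mem_filter.mp ht'
    have h1 := (vtTr_mem.mp ht.1).2
    have h2 := (vtTr_mem.mp ht'.1).2
    simp only [Prod.mk.injEq] at *
    omega

lemma vtTr_card3 (X : Finset ℕ) (m a : ℕ) : ((vtTr X m).filter (fun t => t.2.2 = a)).card ≤ X.card := by
  apply Finset.card_le_card_of_injOn (fun t => t.1)
  · intro t ht
    have ht := Finset.mem_filter.mp ht
    exact (vtTr_mem.mp ht.1).1.1
  · rintro ⟨x, y, z⟩ ht ⟨x', y', z'⟩ ht' e
    have ht := Finset.mem_filter.mp ht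
    have ht' := Finset.mem_filter.mp ht'
    have h1 := (vtTr_mem.mp ht.1).2
    have h2 := (vtTr_mem.mp ht'.1).2
    simp only [Prod.mk.injEq] at *
    omega

lemma vtTr_sum_coord (X : Finset ℕ) (m : ℕ) (π : ℕ × ℕ × ℕ → ℕ) (hπ : ∀ t ∈ vtTr X m, π t ∈ X)
    (hc : ∀ a, ((vtTr X m).filter (fun t => π t = a)).card ≤ X.card) (F : ℕ → ℝ) (hF : ∀ n, 0 ≤ F n) :
    ∑ t ∈ vtTr X m, F (π t) ≤ X.card * ∑ n ∈ X, F n := by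
  rw [← Finset.sum_fiberwise_of_maps_to hπ, Finset.mul_sum]
  apply Finset.sum_le_sum
  intro a _
  have : ∑ t ∈ (vtTr X m).filter (fun t => π t = a), F (π t) = ∑ t ∈ (vtTr X m).filter (fun t => π t = a), F a := by
    apply Finset.sum_congr rfl
    intro t ht
    rw [(Finset.mem_filter.mp ht).2]
  rw [this, Finset.sum_const, nsmul_eq_mul]
  exact mul_le_mul_of_nonneg_right (by exact_mod_cast hc a) (hF a)

lemma vtT_re (W : Finset ℕ) (m : ℕ) (f : ℕ → ℝ) :
    (vtT W m (fun n => (f n : ℂ)) (fun n => (f n : ℂ)) (fun n => (f n : ℂ))).re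
      = ∑ t ∈ vtTr W m, f t.1 * f t.2.1 * f t.2.2 := by
  unfold vtT vtTr
  rw [Finset.sum_filter, Finset.sum_product]
  simp_rw [Finset.sum_product]
  rw [Complex.re_sum]
  refine Finset.sum_congr rfl fun x _ => ?_
  rw [Complex.re_sum]
  refine Finset.sum_congr rfl fun y _ => ?_
  rw [Complex.re_sum]
  refine Finset.sum_congr rfl fun z _ => ?_
  split_ifs
  · rw [← Complex.ofReal_mul, ← Complex.ofReal_mul, Complex.ofReal_re]
  · simp

lemma vt_prime_split (a0 N m : ℕ) (hN : 3 ≤ N) :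
    ∑ t ∈ vtTr (Finset.Ico a0 N) m, ArithmeticFunction.vonMangoldt t.1 * ArithmeticFunction.vonMangoldt t.2.1 * ArithmeticFunction.vonMangoldt t.2.2
      ≤ (Real.log N) ^ 3 * ((vtTr ((Finset.Ico a0 N).filter Nat.Prime) m).card : ℝ) + 6 * (Real.log N) ^ 3 * N * Real.sqrt N := by
  set W := Finset.Ico a0 N with hW
  set ℓ := Real.log N with hℓ
  have hℓ0 : 0 ≤ ℓ := by have := vt_log_ge_one hN; linarith
  set z : ℕ → ℝ := fun n => if n.Prime then 0 else ArithmeticFunction.vonMangoldt n with hz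
  have hz0 : ∀ n, 0 ≤ z n := by
    intro n; rw [hz]; dsimp only; split_ifs
    · exact le_rfl
    · exact ArithmeticFunction.vonMangoldt_nonneg
  have hzs : ∑ n ∈ W, z n ≤ 2 * Real.sqrt N * ℓ := by
    have h := Chebyshev.psi_sub_theta_le (x := (N : ℝ)) (by exact_mod_cast (by omega : 1 ≤ N))
    rw [Chebyshev.psi_sub_theta_eq_sum_not_prime, Nat.floor_natCast, Finset.sum_filter] at h
    refine le_trans ?_ h
    have e : ∀ n, z n = if ¬ n.Prime then ArithmeticFunction.vonMangoldt n else 0 := by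
      intro n; rw [hz]; dsimp only; split_ifs <;> rfl
    simp_rw [← e]
    have h2 : ∑ n ∈ W, z n = ∑ n ∈ W.filter (fun n => n ≠ 0), z n := by
      symm; apply Finset.sum_filter_of_ne
      intro n _ hn h0
      subst h0; apply hn; rw [hz]; simp
    rw [h2]
    apply Finset.sum_le_sum_of_subset_of_nonneg
    · intro n hn
      rw [Finset.mem_filter, hW, Finset.mem_Ico] at hn
      rw [Finset.mem_Ioc]; omega
    · intro n _ _; exact hz0 n
  have hcard : (W.card : ℝ) ≤ N := by
    rw [hW, Nat.card_Ico]; exact_mod_cast Nat.sub_le _ _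
  have hpt : ∀ t ∈ vtTr W m, ArithmeticFunction.vonMangoldt t.1 * ArithmeticFunction.vonMangoldt t.2.1 * ArithmeticFunction.vonMangoldt t.2.2
      ≤ (if t.1.Prime ∧ t.2.1.Prime ∧ t.2.2.Prime then ℓ ^ 3 else 0) + ℓ ^ 2 * (z t.1 + z t.2.1 + z t.2.2) := by
    intro t ht
    obtain ⟨⟨m1, m2, m3⟩, -⟩ := vtTr_mem.mp ht
    have l1 := vt_lam_le (Finset.mem_Ico.mp m1).2
    have l2 := vt_lam_le (Finset.mem_Ico.mp m2).2
    have l3 := vt_lam_le (Finset.mem_Ico.mp m3).2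
    rw [← hℓ] at l1 l2 l3
    have p1 := ArithmeticFunction.vonMangoldt_nonneg (n := t.1)
    have p2 := ArithmeticFunction.vonMangoldt_nonneg (n := t.2.1)
    have p3 := ArithmeticFunction.vonMangoldt_nonneg (n := t.2.2)
    have z1 := hz0 t.1
    have z2 := hz0 t.2.1
    have z3 := hz0 t.2.2
    have q : 0 ≤ ℓ ^ 2 := by positivity
    by_cases h1 : t.1.Prime
    · by_cases h2 : t.2.1.Prime
      · by_cases h3 : t.2.2.Prime
        · rw [if_pos ⟨h1, h2, h3⟩]
          calc _ ≤ ℓ * ℓ * ℓ := by gcongr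
            _ = ℓ ^ 3 := by ring
            _ ≤ _ := by
              have : 0 ≤ ℓ ^ 2 * (z t.1 + z t.2.1 + z t.2.2) := by positivity
              linarith
        · rw [if_neg (by tauto), zero_add]
          have e : z t.2.2 = ArithmeticFunction.vonMangoldt t.2.2 := by rw [hz]; simp [h3]
          calc _ ≤ ℓ * ℓ * ArithmeticFunction.vonMangoldt t.2.2 := by gcongr
            _ = ℓ ^ 2 * z t.2.2 := by rw [e]; ring
            _ ≤ _ := by gcongr; linarith
      · rw [if_neg (by tauto), zero_add]
        have e : z t.2.1 = ArithmeticFunction.vonMangoldt t.2.1 := by rw [hz]; simp [h2]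
        calc _ ≤ ℓ * ArithmeticFunction.vonMangoldt t.2.1 * ℓ := by gcongr
          _ = ℓ ^ 2 * z t.2.1 := by rw [e]; ring
          _ ≤ _ := by gcongr; linarith
    · rw [if_neg (by tauto), zero_add]
      have e : z t.1 = ArithmeticFunction.vonMangoldt t.1 := by rw [hz]; simp [h1]
      calc _ ≤ ArithmeticFunction.vonMangoldt t.1 * ℓ * ℓ := by gcongr
        _ = ℓ ^ 2 * z t.1 := by rw [e]; ring
        _ ≤ _ := by gcongr; linarith
  refine (Finset.sum_le_sum hpt).trans ?_
  rw [Finset.sum_add_distrib]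
  have hA : ∑ t ∈ vtTr W m, (if t.1.Prime ∧ t.2.1.Prime ∧ t.2.2.Prime then ℓ ^ 3 else 0) =
      ℓ ^ 3 * ((vtTr (W.filter Nat.Prime) m).card : ℝ) := by
    rw [← Finset.sum_filter, Finset.sum_const, nsmul_eq_mul, mul_comm]
    congr 3
    ext t
    rw [Finset.mem_filter, vtTr_mem, vtTr_mem, Finset.mem_filter, Finset.mem_filter, Finset.mem_filter]
    tauto
  rw [hA, ← Finset.mul_sum, Finset.sum_add_distrib, Finset.sum_add_distrib]
  have c1 := vtTr_sum_coord W m (fun t => t.1) (fun t ht => (vtTr_mem.mp ht).1.1) (vtTr_card1 W m) z hz0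
  have c2 := vtTr_sum_coord W m (fun t => t.2.1) (fun t ht => (vtTr_mem.mp ht).1.2.1) (vtTr_card2 W m) z hz0
  have c3 := vtTr_sum_coord W m (fun t => t.2.2) (fun t ht => (vtTr_mem.mp ht).1.2.2) (vtTr_card3 W m) z hz0
  have hz1 : 0 ≤ ∑ n ∈ W, z n := Finset.sum_nonneg fun n _ => hz0 n
  have c4 : (W.card : ℝ) * ∑ n ∈ W, z n ≤ N * (2 * Real.sqrt N * ℓ) := by gcongr
  have c5 : ℓ ^ 2 * (∑ t ∈ vtTr W m, z t.1 + ∑ t ∈ vtTr W m, z t.2.1 + ∑ t ∈ vtTr W m, z t.2.2) ≤ ℓ ^ 2 * (3 * (N * (2 * Real.sqrt N * ℓ))) := by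
    apply mul_le_mul_of_nonneg_left _ (by positivity)
    linarith
  calc _ ≤ ℓ ^ 3 * ((vtTr (W.filter Nat.Prime) m).card : ℝ) + ℓ ^ 2 * (3 * (N * (2 * Real.sqrt N * ℓ))) := by linarith
    _ = _ := by ring

theorem vt_triples : ∃ u0 : ℝ, 12 ≤ u0 ∧ ∀ u : ℝ, u0 ≤ u → ∀ m : ℕ, Odd m → 4 * u ≤ m → m ≤ 5 * u →
    u ^ 2 / (20000 * (Real.log u) ^ 3) ≤ ((vtTr ((Finset.Ico ⌈u⌉₊ (⌊2 * u⌋₊ + 1)).filter Nat.Prime) m).card : ℝ) := by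
  obtain ⟨u1, hu1, h⟩ := vt_lam3
  obtain ⟨N0, hN0, hpow⟩ := vt_pow_log_le 7
  obtain ⟨N2, hN2, hlog⟩ := vt_log_large 2000000000000
  refine ⟨u1 + N0 + N2, by linarith [(by positivity : (0 : ℝ) ≤ N0 + N2)], ?_⟩
  intro u hu m hm h4 h5
  have hu12 : 12 ≤ u := by linarith [(by positivity : (0 : ℝ) ≤ N0 + N2)]
  have h := h u (by linarith [(by positivity : (0 : ℝ) ≤ N0 + N2)]) m hm h4 h5
  rw [vtT_re] at h
  set N := ⌊2 * u⌋₊ + 1 with hN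
  have hNu : 2 * u ≤ (N : ℝ) := by push_cast [hN]; exact (Nat.lt_floor_add_one _).le
  have hNu2 : (N : ℝ) ≤ 3 * u := by
    push_cast [hN]; linarith [Nat.floor_le (show 0 ≤ 2 * u by linarith)]
  have hNs : N0 + N2 ≤ N := by
    have : ((N0 + N2 : ℕ) : ℝ) ≤ N := by push_cast; linarith
    exact_mod_cast this
  have hpow := hpow N (by omega)
  have hlog := hlog N (by omega)
  have hs := h.trans (vt_prime_split ⌈u⌉₊ N m (by omega))
  set ℓ := Real.log N with hℓ
  set T : ℝ := ((vtTr ((Finset.Ico ⌈u⌉₊ N).filter Nat.Prime) m).card : ℝ) with hT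
  have hT0 : 0 ≤ T := by positivity
  have hℓ0 : 0 < ℓ := by linarith
  have hN0 : (0 : ℝ) < N := by linarith
  have hℓu : ℓ ≤ 2 * Real.log u := by
    calc ℓ ≤ Real.log (u ^ 2) := Real.log_le_log hN0 (by nlinarith)
      _ = _ := by rw [Real.log_pow]; norm_num
  have herr : 6 * ℓ ^ 3 * N * Real.sqrt N ≤ u ^ 2 / 2304 := by
    have hs0 := Real.sqrt_nonneg (N : ℝ)
    have hss : Real.sqrt N * Real.sqrt N = N := Real.mul_self_sqrt hN0.le
    have a1 : (200000 * ℓ ^ 3) ≤ Real.sqrt N := by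
      apply Real.le_sqrt_of_sq_le
      calc (200000 * ℓ ^ 3) ^ 2 = 40000000000 * ℓ ^ 6 := by ring
        _ ≤ (8 * ℓ) * ℓ ^ 6 := by gcongr; linarith
        _ = 8 * ℓ ^ 7 := by ring
        _ ≤ (N : ℝ) := hpow
    have a2 : 6 * ℓ ^ 3 ≤ Real.sqrt N * (6 / 200000) := by linarith
    calc 6 * ℓ ^ 3 * N * Real.sqrt N ≤ Real.sqrt N * (6 / 200000) * N * Real.sqrt N := by gcongr
      _ = 6 / 200000 * (N : ℝ) * (Real.sqrt N * Real.sqrt N) := by ring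
      _ = 6 / 200000 * (N : ℝ) * N := by rw [hss]
      _ ≤ 6 / 200000 * (3 * u) * (3 * u) := by gcongr
      _ ≤ _ := by nlinarith
  have hfin : u ^ 2 / 2304 ≤ ℓ ^ 3 * T := by linarith
  have hlu : 0 < Real.log u := by linarith
  have h3 : ℓ ^ 3 * T ≤ (2 * Real.log u) ^ 3 * T := by gcongr
  rw [div_le_iff₀ (by positivity)]
  have e : (2 * Real.log u) ^ 3 * T = 8 * (T * Real.log u ^ 3) := by ring
  have e2 : 0 ≤ T * Real.log u ^ 3 := by positivity
  have e3 : T * (20000 * Real.log u ^ 3) = 20000 * (T * Real.log u ^ 3) := by ring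
  rw [e3]
  linarith

end P9d

section P10

/-- Indicator that the colouring `χ` vanishes on `U`. -/
noncomputable def vtInd {α : Type*} {K : ℕ} (U : Finset α) (χ : α → Fin (K + 1)) : ℝ :=
  open Classical in if ∀ a ∈ U, χ a = 0 then 1 else 0

lemma vtInd_mul {α : Type*} [DecidableEq α] {K : ℕ} (U U' : Finset α) (χ : α → Fin (K + 1)) :
    vtInd U χ * vtInd U' χ = vtInd (U ∪ U') χ := by
  unfold vtInd
  by_cases h : ∀ a ∈ U, χ a = 0
  · by_cases h' : ∀ a ∈ U', χ a = 0
    · rw [if_pos h, if_pos h', if_pos, one_mul]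
      intro a ha
      rcases Finset.mem_union.mp ha with ha | ha
      · exact h a ha
      · exact h' a ha
    · rw [if_neg h', mul_zero, if_neg]
      intro hh; exact h' fun a ha => hh a (Finset.mem_union_right _ ha)
  · rw [if_neg h, zero_mul, if_neg]
    intro hh; exact h fun a ha => hh a (Finset.mem_union_left _ ha)

lemma vtInd_sum {α : Type*} [Fintype α] [DecidableEq α] {K : ℕ} (U : Finset α) :
    ∑ χ : α → Fin (K + 1), vtInd U χ = ((K : ℝ) + 1) ^ (Fintype.card α) * (1 / ((K : ℝ) + 1)) ^ U.card := by
  classical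
  have h1 : ∑ χ : α → Fin (K + 1), vtInd U χ =
      ((Fintype.piFinset (fun a : α => if a ∈ U then ({0} : Finset (Fin (K + 1))) else Finset.univ)).card : ℝ) := by
    have hm : ∀ χ : α → Fin (K + 1), vtInd U χ = if χ ∈ Fintype.piFinset (fun a : α => if a ∈ U then ({0} : Finset (Fin (K + 1))) else Finset.univ) then (1 : ℝ) else 0 := by
      intro χ
      have hiff : (∀ a ∈ U, χ a = 0) ↔ χ ∈ Fintype.piFinset (fun a : α => if a ∈ U then ({0} : Finset (Fin (K + 1))) else Finset.univ) := by
        rw [Fintype.mem_piFinset]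
        constructor
        · intro h a
          split_ifs with ha
          · simp [h a ha]
          · simp
        · intro h a ha
          have := h a
          rw [if_pos ha] at this
          simpa using this
      unfold vtInd
      by_cases h : ∀ a ∈ U, χ a = 0
      · rw [if_pos h, if_pos (hiff.mp h)]
      · rw [if_neg h, if_neg (fun hh => h (hiff.mpr hh))]
    simp_rw [hm]
    rw [Finset.sum_ite_mem, Finset.univ_inter, Finset.sum_const, nsmul_eq_mul, mul_one]
  rw [h1, Fintype.card_piFinset]
  have h2 : ∀ a : α, (if a ∈ U then ({0} : Finset (Fin (K + 1))) else Finset.univ).card = if a ∈ U then 1 else (K + 1) := by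
    intro a; split_ifs <;> simp
  simp_rw [h2]
  push_cast
  have hk : (0 : ℝ) < (K : ℝ) + 1 := by positivity
  have h3 : (∏ a : α, (if a ∈ U then (1 : ℝ) else (K + 1))) * ((K : ℝ) + 1) ^ U.card = ((K : ℝ) + 1) ^ (Fintype.card α) := by
    have : ((K : ℝ) + 1) ^ U.card = ∏ a : α, (if a ∈ U then ((K : ℝ) + 1) else 1) := by
      rw [← Finset.prod_filter, Finset.prod_const]
      congr 2
      ext a; simp
    rw [this, ← Finset.prod_mul_distrib]
    rw [← Finset.card_univ, ← Finset.prod_const]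
    apply Finset.prod_congr rfl
    intro a _
    split_ifs <;> ring
  rw [← h3]
  rw [one_div, inv_pow, mul_assoc, mul_inv_cancel₀ (by positivity), mul_one]

lemma vt_thin_bad {α ι : Type*} [Fintype α] [DecidableEq α] {K : ℕ} (T : Finset ι) (U : ι → Finset α) (D : ℝ)
    (hT : T.Nonempty) (hU : ∀ t ∈ T, (U t).card ≤ 3)
    (hD : ∀ t ∈ T, ∑ t' ∈ T, (if Disjoint (U t) (U t') then (0 : ℝ) else 1) ≤ D)
    (Bad : Finset (α → Fin (K + 1))) (hB : ∀ χ ∈ Bad, ∀ t ∈ T, vtInd (U t) χ = 0) :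
    (Bad.card : ℝ) ≤ ((K : ℝ) + 1) ^ (Fintype.card α) * (D * ((K : ℝ) + 1) ^ 6 / T.card) := by
  set k : ℝ := (K : ℝ) + 1 with hk
  have hk1 : 1 ≤ k := by rw [hk]; linarith [(by positivity : (0 : ℝ) ≤ K)]
  set n := Fintype.card α
  set μ : ℝ := ∑ t ∈ T, (1 / k) ^ (U t).card with hμ
  have hT0 : (0 : ℝ) < T.card := by exact_mod_cast hT.card_pos
  have hμ1 : (T.card : ℝ) * (1 / k) ^ 3 ≤ μ := by
    rw [hμ, ← nsmul_eq_mul]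
    apply Finset.card_nsmul_le_sum
    intro t ht
    exact pow_le_pow_of_le_one (by positivity) (by rw [div_le_one (by positivity)]; exact hk1) (hU t ht)
  have e1 : ∑ χ : α → Fin (K + 1), ∑ t ∈ T, vtInd (U t) χ = k ^ n * μ := by
    rw [Finset.sum_comm, hμ, Finset.mul_sum]
    exact Finset.sum_congr rfl fun t _ => vtInd_sum (U t)
  have e2 : ∑ χ : α → Fin (K + 1), (∑ t ∈ T, vtInd (U t) χ) ^ 2 = k ^ n * ∑ t ∈ T, ∑ t' ∈ T, (1 / k) ^ (U t ∪ U t').card := by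
    simp_rw [sq, Finset.sum_mul_sum, vtInd_mul]
    rw [Finset.sum_comm, Finset.mul_sum]
    refine Finset.sum_congr rfl fun t _ => ?_
    rw [Finset.sum_comm, Finset.mul_sum]
    exact Finset.sum_congr rfl fun t' _ => vtInd_sum _
  have e3 : ∑ χ : α → Fin (K + 1), (∑ t ∈ T, vtInd (U t) χ - μ) ^ 2 = k ^ n * (∑ t ∈ T, ∑ t' ∈ T, (1 / k) ^ (U t ∪ U t').card - μ ^ 2) := by
    have : ∀ χ : α → Fin (K + 1), (∑ t ∈ T, vtInd (U t) χ - μ) ^ 2 = (∑ t ∈ T, vtInd (U t) χ) ^ 2 - 2 * μ * (∑ t ∈ T, vtInd (U t) χ) + μ ^ 2 := fun χ => by ring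
    simp_rw [this]
    rw [Finset.sum_add_distrib, Finset.sum_sub_distrib, ← Finset.mul_sum, e1, e2, Finset.sum_const, Finset.card_univ, Fintype.card_fun, Fintype.card_fin, nsmul_eq_mul]
    push_cast
    rw [← hk]; ring
  have e4 : ∑ t ∈ T, ∑ t' ∈ T, (1 / k) ^ (U t ∪ U t').card - μ ^ 2 ≤ T.card * D := by
    rw [hμ, sq, Finset.sum_mul_sum, ← Finset.sum_sub_distrib, ← nsmul_eq_mul]
    apply Finset.sum_le_card_nsmul
    intro t ht
    refine le_trans ?_ (hD t ht)
    rw [← Finset.sum_sub_distrib]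
    apply Finset.sum_le_sum
    intro t' _
    split_ifs with hd
    · rw [Finset.card_union_of_disjoint hd, pow_add, sub_self]
    · have a1 : (1 / k) ^ (U t ∪ U t').card ≤ 1 := pow_le_one₀ (by positivity) (by rw [div_le_one (by positivity)]; exact hk1)
      have a2 : 0 ≤ (1 / k) ^ (U t).card * (1 / k) ^ (U t').card := by positivity
      linarith
  have e5 : (Bad.card : ℝ) * μ ^ 2 ≤ ∑ χ : α → Fin (K + 1), (∑ t ∈ T, vtInd (U t) χ - μ) ^ 2 := by
    calc (Bad.card : ℝ) * μ ^ 2 = ∑ χ ∈ Bad, (∑ t ∈ T, vtInd (U t) χ - μ) ^ 2 := by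
          rw [← nsmul_eq_mul, ← Finset.sum_const]
          refine Finset.sum_congr rfl fun χ hχ => ?_
          rw [Finset.sum_eq_zero (hB χ hχ)]; ring
      _ ≤ _ := Finset.sum_le_sum_of_subset_of_nonneg (Finset.subset_univ _) (fun _ _ _ => sq_nonneg _)
  have e6 : (Bad.card : ℝ) * ((T.card : ℝ) * (1 / k) ^ 3) ^ 2 ≤ k ^ n * (T.card * D) := by
    calc _ ≤ (Bad.card : ℝ) * μ ^ 2 := by gcongr
      _ ≤ _ := e5
      _ ≤ _ := by rw [e3]; gcongr
  have hk0 : 0 < k := by linarith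
  have e7 : (Bad.card : ℝ) * ((T.card : ℝ) * (1 / k) ^ 3) ^ 2 = (Bad.card * T.card) * (T.card / k ^ 6) := by
    field_simp
  have e8 : k ^ n * (T.card * D) = (k ^ n * (D * k ^ 6)) * (T.card / k ^ 6) := by
    field_simp
  rw [e7, e8] at e6
  have e9 := le_of_mul_le_mul_right e6 (by positivity)
  rw [← mul_div_assoc, le_div_iff₀ hT0]
  exact e9

/-- The elements of a triple, inside the subtype. -/
def vtU (X : Finset ℕ) (t : ℕ × ℕ × ℕ) : Finset X := ({t.1, t.2.1, t.2.2} : Finset ℕ).subtype (· ∈ X)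

lemma vtU_card (X : Finset ℕ) (t : ℕ × ℕ × ℕ) : (vtU X t).card ≤ 3 := by
  unfold vtU
  rw [Finset.card_subtype]
  exact (Finset.card_filter_le _ _).trans Finset.card_le_three

lemma vtU_mem {X : Finset ℕ} {t : ℕ × ℕ × ℕ} {a : X} : a ∈ vtU X t ↔ (a : ℕ) = t.1 ∨ (a : ℕ) = t.2.1 ∨ (a : ℕ) = t.2.2 := by
  unfold vtU
  rw [Finset.mem_subtype]; simp

lemma vtU_disj (X : Finset ℕ) (m : ℕ) (t : ℕ × ℕ × ℕ) :
    ∑ t' ∈ vtTr X m, (if Disjoint (vtU X t) (vtU X t') then (0 : ℝ) else 1) ≤ 9 * X.card := by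
  have key : ∀ a : ℕ, ∑ t' ∈ vtTr X m, ((if t'.1 = a then (1 : ℝ) else 0) + (if t'.2.1 = a then 1 else 0) + (if t'.2.2 = a then 1 else 0)) ≤ 3 * X.card := by
    intro a
    rw [Finset.sum_add_distrib, Finset.sum_add_distrib, ← Finset.sum_filter, ← Finset.sum_filter, ← Finset.sum_filter]
    simp only [Finset.sum_const, nsmul_eq_mul, mul_one]
    have h1 : (((vtTr X m).filter (fun t => t.1 = a)).card : ℝ) ≤ X.card := by exact_mod_cast vtTr_card1 X m a
    have h2 : (((vtTr X m).filter (fun t => t.2.1 = a)).card : ℝ) ≤ X.card := by exact_mod_cast vtTr_card2 X m a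
    have h3 : (((vtTr X m).filter (fun t => t.2.2 = a)).card : ℝ) ≤ X.card := by exact_mod_cast vtTr_card3 X m a
    linarith
  set F : ℕ → ℕ × ℕ × ℕ → ℝ := fun a t' => (if t'.1 = a then (1 : ℝ) else 0) + (if t'.2.1 = a then 1 else 0) + (if t'.2.2 = a then 1 else 0) with hF
  have hF0 : ∀ a t', 0 ≤ F a t' := by intro a t'; rw [hF]; positivity
  have hF1 : ∀ a t', (t'.1 = a ∨ t'.2.1 = a ∨ t'.2.2 = a) → 1 ≤ F a t' := by
    intro a t' h
    have p1 : (0 : ℝ) ≤ if t'.1 = a then (1 : ℝ) else 0 := by positivity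
    have p2 : (0 : ℝ) ≤ if t'.2.1 = a then (1 : ℝ) else 0 := by positivity
    have p3 : (0 : ℝ) ≤ if t'.2.2 = a then (1 : ℝ) else 0 := by positivity
    rw [hF]; dsimp only
    rcases h with h | h | h
    · rw [if_pos h]; linarith
    · rw [if_pos h]; linarith
    · rw [if_pos h]; linarith
  have hpt : ∀ t' ∈ vtTr X m, (if Disjoint (vtU X t) (vtU X t') then (0 : ℝ) else 1) ≤ F t.1 t' + F t.2.1 t' + F t.2.2 t' := by
    intro t' _
    have q1 := hF0 t.1 t'
    have q2 := hF0 t.2.1 t'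
    have q3 := hF0 t.2.2 t'
    split_ifs with hd
    · linarith
    · rw [Finset.not_disjoint_iff] at hd
      obtain ⟨a, h1, h2⟩ := hd
      rw [vtU_mem] at h1 h2
      rcases h1 with h1 | h1 | h1
      · have := hF1 t.1 t' (by rw [← h1]; tauto)
        linarith
      · have := hF1 t.2.1 t' (by rw [← h1]; tauto)
        linarith
      · have := hF1 t.2.2 t' (by rw [← h1]; tauto)
        linarith
  refine (Finset.sum_le_sum hpt).trans ?_
  rw [Finset.sum_add_distrib, Finset.sum_add_distrib]
  have := key t.1
  have := key t.2.1
  have := key t.2.2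
  linarith

theorem vt_thin (X M : Finset ℕ) (K : ℕ) (τ : ℝ) (hτ : 0 < τ) (hM : ∀ m ∈ M, τ ≤ ((vtTr X m).card : ℝ)) :
    ∃ P : Finset ℕ, P ⊆ X ∧ (P.card : ℝ) ≤ X.card / ((K : ℝ) + 1) + 3 * (M.card * (9 * X.card * ((K : ℝ) + 1) ^ 6 / τ)) ∧
      ∀ m ∈ M, ∃ p₁ ∈ P, ∃ p₂ ∈ P, ∃ p₃ ∈ P, m = p₁ + p₂ + p₃ := by
  classical
  have hne : ∀ m ∈ M, (vtTr X m).Nonempty := by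
    intro m hm
    rw [← Finset.card_pos]
    have := hτ.trans_le (hM m hm)
    exact_mod_cast this
  set k : ℝ := (K : ℝ) + 1 with hk
  have hk0 : 0 < k := by positivity
  set n := Fintype.card X
  set good : (X → Fin (K + 1)) → ℕ → Prop := fun χ m => ∃ t ∈ vtTr X m, ∀ a ∈ vtU X t, χ a = 0 with hgood
  set δ : ℝ := 9 * X.card * k ^ 6 / τ with hδ
  have hbad : ∀ m ∈ M, ∑ χ : X → Fin (K + 1), (if good χ m then (0 : ℝ) else 1) ≤ k ^ n * δ := by
    intro m hm
    have h := vt_thin_bad (K := K) (vtTr X m) (vtU X) (9 * X.card) (hne m hm) (fun t _ => vtU_card X t)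
      (fun t _ => vtU_disj X m t) (Finset.univ.filter (fun χ => ¬ good χ m)) (by
        intro χ hχ t ht
        have hχ := (Finset.mem_filter.mp hχ).2
        unfold vtInd
        rw [if_neg]
        intro hh; exact hχ ⟨t, ht, hh⟩)
    rw [Finset.sum_ite, Finset.sum_const_zero, zero_add, Finset.sum_const, nsmul_eq_mul, mul_one]
    refine h.trans ?_
    rw [← hk, hδ]
    have := hM m hm
    gcongr
  set S : (X → Fin (K + 1)) → ℝ := fun χ => ∑ a : X, vtInd {a} χ + 3 * ∑ m ∈ M, (if good χ m then (0 : ℝ) else 1) with hS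
  have hsum : ∑ χ, S χ ≤ ∑ _χ : X → Fin (K + 1), (X.card / k + 3 * (M.card * δ)) := by
    rw [Finset.sum_const, Finset.card_univ, Fintype.card_fun, Fintype.card_fin, nsmul_eq_mul]
    push_cast
    rw [← hk, hS, Finset.sum_add_distrib, ← Finset.mul_sum, Finset.sum_comm, Finset.sum_comm (t := M)]
    have s1 : ∑ a : X, ∑ χ : X → Fin (K + 1), vtInd {a} χ = k ^ n * (X.card / k) := by
      simp_rw [vtInd_sum, Finset.card_singleton]
      rw [Finset.sum_const, Finset.card_univ, nsmul_eq_mul, Fintype.card_coe]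
      have hn : n = X.card := Fintype.card_coe X
      rw [← hk, hn]; ring
    have s2 : ∑ m ∈ M, ∑ χ : X → Fin (K + 1), (if good χ m then (0 : ℝ) else 1) ≤ M.card * (k ^ n * δ) := by
      rw [← nsmul_eq_mul]
      exact Finset.sum_le_card_nsmul _ _ _ hbad
    rw [s1]
    calc _ ≤ k ^ n * (X.card / k) + 3 * (M.card * (k ^ n * δ)) := by linarith
      _ = _ := by ring
  obtain ⟨χ, -, hχ⟩ := Finset.exists_le_of_sum_le Finset.univ_nonempty hsum
  have hch : ∀ m : ℕ, ∃ t : ℕ × ℕ × ℕ, m ∈ M → t ∈ vtTr X m := by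
    intro m
    by_cases hm : m ∈ M
    · obtain ⟨t, ht⟩ := hne m hm
      exact ⟨t, fun _ => ht⟩
    · exact ⟨0, fun h => absurd h hm⟩
  choose tt htt using hch
  set P0 : Finset ℕ := ((Finset.univ : Finset X).filter (fun a => χ a = 0)).map (Function.Embedding.subtype _) with hP0
  set Mb := M.filter (fun m => ¬ good χ m) with hMb
  set P1 : Finset ℕ := Mb.biUnion (fun m => {(tt m).1, (tt m).2.1, (tt m).2.2}) with hP1
  refine ⟨P0 ∪ P1, ?_, ?_, ?_⟩
  · apply Finset.union_subset
    · intro p hp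
      rw [hP0, Finset.mem_map] at hp
      obtain ⟨a, -, rfl⟩ := hp
      exact a.2
    · intro p hp
      rw [hP1, Finset.mem_biUnion] at hp
      obtain ⟨m, hm, hp⟩ := hp
      have h := (vtTr_mem.mp (htt m (Finset.mem_filter.mp hm).1)).1
      simp only [Finset.mem_insert, Finset.mem_singleton] at hp
      rcases hp with hp | hp | hp
      · rw [hp]; exact h.1
      · rw [hp]; exact h.2.1
      · rw [hp]; exact h.2.2
  · refine le_trans ?_ hχ
    have c0 : (P0.card : ℝ) = ∑ a : X, vtInd {a} χ := by
      rw [hP0, Finset.card_map, Finset.card_filter]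
      push_cast
      refine Finset.sum_congr rfl fun a _ => ?_
      unfold vtInd
      simp
    have c1 : (P1.card : ℝ) ≤ 3 * ∑ m ∈ M, (if good χ m then (0 : ℝ) else 1) := by
      rw [Finset.sum_ite, Finset.sum_const_zero, zero_add, Finset.sum_const, nsmul_eq_mul, mul_one]
      have : P1.card ≤ Mb.card * 3 := Finset.card_biUnion_le_card_mul _ _ _ (fun m _ => Finset.card_le_three)
      have : (P1.card : ℝ) ≤ Mb.card * 3 := by exact_mod_cast this
      linarith
    have c2 : ((P0 ∪ P1).card : ℝ) ≤ P0.card + P1.card := by exact_mod_cast Finset.card_union_le _ _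
    rw [hS]; dsimp only
    linarith
  · intro m hm
    by_cases hg : good χ m
    · obtain ⟨t, ht, h⟩ := hg
      obtain ⟨⟨h1, h2, h3⟩, hs⟩ := vtTr_mem.mp ht
      have mem : ∀ p (hp : p ∈ X), (p = t.1 ∨ p = t.2.1 ∨ p = t.2.2) → p ∈ P0 ∪ P1 := by
        intro p hp hh
        apply Finset.mem_union_left
        rw [hP0, Finset.mem_map]
        exact ⟨⟨p, hp⟩, Finset.mem_filter.mpr ⟨Finset.mem_univ _, h _ (vtU_mem.mpr hh)⟩, rfl⟩
      exact ⟨_, mem _ h1 (by tauto), _, mem _ h2 (by tauto), _, mem _ h3 (by tauto), hs.symm⟩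
    · have hmb : m ∈ Mb := Finset.mem_filter.mpr ⟨hm, hg⟩
      have hs := (vtTr_mem.mp (htt m hm)).2
      have mem : ∀ p, p ∈ ({(tt m).1, (tt m).2.1, (tt m).2.2} : Finset ℕ) → p ∈ P0 ∪ P1 := by
        intro p hp
        apply Finset.mem_union_right
        rw [hP1, Finset.mem_biUnion]
        exact ⟨m, hmb, hp⟩
      exact ⟨_, mem _ (by simp), _, mem _ (by simp), _, mem _ (by simp), hs.symm⟩

end P10


theorem main_lemma (A : ℕ) (hA : 0 < A) :
    ∃ uA : ℝ, 0 < uA ∧ ∀ u : ℝ, uA ≤ u →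
      ∃ Pu : Finset ℕ,
        (∀ p ∈ Pu, Nat.Prime p ∧ u ≤ (p : ℝ) ∧ (p : ℝ) ≤ 2 * u) ∧
        (Pu.card : ℝ) ≤ u / (Real.log u) ^ A ∧
        (∀ m : ℕ, Odd m → 4 * u ≤ (m : ℝ) → (m : ℝ) ≤ 5 * u →
          ∃ p₁ ∈ Pu, ∃ p₂ ∈ Pu, ∃ p₃ ∈ Pu, m = p₁ + p₂ + p₃) := by
  classical
  obtain ⟨u0, hu0, htri⟩ := vt_triples
  have hlim := (Real.isLittleO_pow_log_id_atTop (n := 7 * A + 3)).bound (show (0 : ℝ) < 1 / (2 * 2160000 * 5 ^ 6) by norm_num)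
  have hlog := Real.tendsto_log_atTop.eventually_ge_atTop 1
  obtain ⟨u1, hu1⟩ := Filter.eventually_atTop.mp (hlim.and hlog)
  refine ⟨max u0 u1, by have := le_max_left u0 u1; linarith, ?_⟩
  intro u hu
  have hu00 : u0 ≤ u := (le_max_left _ _).trans hu
  have hu12 : 12 ≤ u := hu0.trans hu00
  have hu_pos : 0 < u := by linarith
  obtain ⟨hb, hL⟩ := hu1 u ((le_max_right _ _).trans hu)
  set L := Real.log u with hLdef
  have hL0 : 0 < L := by linarith
  rw [id, Real.norm_of_nonneg (by positivity), Real.norm_of_nonneg hu_pos.le] at hb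
  set X := (Finset.Ico ⌈u⌉₊ (⌊2 * u⌋₊ + 1)).filter Nat.Prime with hX
  set M := (Finset.Icc ⌈4 * u⌉₊ ⌊5 * u⌋₊).filter (fun m => Odd m) with hM
  have hMmem : ∀ m : ℕ, m ∈ M ↔ (4 * u ≤ m ∧ (m : ℝ) ≤ 5 * u) ∧ Odd m := by
    intro m
    rw [hM, Finset.mem_filter, Finset.mem_Icc, Nat.ceil_le, Nat.le_floor_iff (by positivity)]
  have hXc : (X.card : ℝ) ≤ 2 * u := by
    have h1 : X.card ≤ ⌊2 * u⌋₊ + 1 - ⌈u⌉₊ := by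
      rw [← Nat.card_Ico]; exact Finset.card_filter_le _ _
    have h2 : ⌈u⌉₊ ≤ ⌊2 * u⌋₊ + 1 := by
      rw [Nat.ceil_le]; push_cast; linarith [Nat.lt_floor_add_one (2 * u)]
    have h3 : (X.card : ℝ) ≤ ((⌊2 * u⌋₊ + 1 - ⌈u⌉₊ : ℕ) : ℝ) := by exact_mod_cast h1
    rw [Nat.cast_sub h2] at h3
    push_cast at h3
    linarith [Nat.le_ceil u, Nat.floor_le (show 0 ≤ 2 * u by linarith)]
  have hMc : (M.card : ℝ) ≤ 2 * u := by
    have h1 : M.card ≤ ⌊5 * u⌋₊ + 1 - ⌈4 * u⌉₊ := by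
      rw [← Nat.card_Icc]; exact Finset.card_filter_le _ _
    have h2 : ⌈4 * u⌉₊ ≤ ⌊5 * u⌋₊ + 1 := by
      rw [Nat.ceil_le]; push_cast; linarith [Nat.lt_floor_add_one (5 * u)]
    have h3 : (M.card : ℝ) ≤ ((⌊5 * u⌋₊ + 1 - ⌈4 * u⌉₊ : ℕ) : ℝ) := by exact_mod_cast h1
    rw [Nat.cast_sub h2] at h3
    push_cast at h3
    linarith [Nat.le_ceil (4 * u), Nat.floor_le (show 0 ≤ 5 * u by linarith)]
  set K := ⌊4 * L ^ A⌋₊ with hK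
  set k : ℝ := (K : ℝ) + 1 with hk
  have hLA : 1 ≤ L ^ A := one_le_pow₀ hL
  have hk1 : 4 * L ^ A ≤ k := (Nat.lt_floor_add_one _).le
  have hk2 : k ≤ 5 * L ^ A := by
    have := Nat.floor_le (show 0 ≤ 4 * L ^ A by positivity)
    rw [hk, hK]; linarith
  have hk0 : 0 < k := by positivity
  obtain ⟨P, hPX, hPc, hPm⟩ := vt_thin X M K (u ^ 2 / (20000 * L ^ 3)) (by positivity)
    (fun m hm => htri u hu00 m ((hMmem m).mp hm).2 ((hMmem m).mp hm).1.1 ((hMmem m).mp hm).1.2)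
  refine ⟨P, ?_, ?_, ?_⟩
  · intro p hp
    have h := hPX hp
    rw [hX, Finset.mem_filter, Finset.mem_Ico, Nat.ceil_le] at h
    refine ⟨h.2, h.1.1, ?_⟩
    rw [← Nat.le_floor_iff (by positivity)]; omega
  · refine hPc.trans ?_
    rw [← hk]
    have a1 : (X.card : ℝ) / k ≤ u / (2 * L ^ A) := by
      rw [div_le_div_iff₀ hk0 (by positivity)]
      calc (X.card : ℝ) * (2 * L ^ A) ≤ 2 * u * (2 * L ^ A) := by gcongr
        _ = u * (4 * L ^ A) := by ring
        _ ≤ _ := by gcongr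
    have a2 : 3 * ((M.card : ℝ) * (9 * X.card * k ^ 6 / (u ^ 2 / (20000 * L ^ 3)))) ≤ u / (2 * L ^ A) := by
      calc 3 * ((M.card : ℝ) * (9 * X.card * k ^ 6 / (u ^ 2 / (20000 * L ^ 3))))
          ≤ 3 * (2 * u * (9 * (2 * u) * (5 * L ^ A) ^ 6 / (u ^ 2 / (20000 * L ^ 3)))) := by gcongr
        _ = 2160000 * 5 ^ 6 * (L ^ A) ^ 6 * L ^ 3 := by field_simp; ring
        _ ≤ _ := by
          rw [le_div_iff₀ (by positivity)]
          have e : L ^ (7 * A + 3) = (L ^ A) ^ 7 * L ^ 3 := by rw [pow_add, mul_comm 7 A, pow_mul]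
          rw [e, one_div, inv_mul_eq_div, le_div_iff₀ (by norm_num)] at hb
          calc _ = (L ^ A) ^ 7 * L ^ 3 * (2 * 2160000 * 5 ^ 6) := by ring
            _ ≤ u := hb
    have a3 : u / (2 * L ^ A) + u / (2 * L ^ A) = u / L ^ A := by field_simp; ring
    linarith
  · intro m hm h4 h5
    exact hPm m ((hMmem m).mpr ⟨⟨h4, h5⟩, hm⟩)
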